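/- There exist absolute constants c > 0 and C > 0 such that for every nonzero integer a and every real R ≥ 3, both of the following hold: | Σ_{r ≤ R, gcd(r,a)=1} μ(r)²/(r·φ(r)) − (|a|/φ(|a|))·C_1(a) + (φ(|a|)/|a|)·(1/R) | ≤ C · Π_{p | a}(1 + p^{−1/3}) / ( R^{3/2} · exp( c (log R)^{3/5} (log log R)^{−1/5} ) ), and | Σ_{r ≤ R, gcd(r,a)=1} μ(r)²·(log r)/(r·φ(r)) − (|a|/φ(|a|))·C_1(a)·Σ_{p ∤ a} (log p)/(p²−p+1) + (φ(|a|)/|a|)·(log R + 1)/R | ≤ C · Π_{p | a}(1 + p^{−1/3}) / ( R^{3/2} · exp( c (log R)^{3/5} (log log R)^{−1/5} ) ), where r runs over positive integers coprime to a, Σ_{p ∤ a} is over primes p not dividing a, and Π_{p | a} is over primes p dividing a. -/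

import Mathlib

open Finset Real

/-- `C_1(a) = (ζ(2)ζ(3)/ζ(6)) (φ(|a|)/|a|) ∏_{p ∣ a} (1 - 1/(p²-p+1))`. -/
noncomputable def C1 (a : ℤ) : ℝ :=
  (riemannZeta 2 * riemannZeta 3 / riemannZeta 6).re *
    ((Nat.totient a.natAbs : ℝ) / (a.natAbs : ℝ)) *
    ∏ p ∈ a.natAbs.primeFactors, (1 - 1 / ((p : ℝ) ^ 2 - (p : ℝ) + 1))

namespace VK

/-- The vector of power sums of degrees `1, …, k` of a finite family of integers. -/
def powerSums (k : ℕ) {ι : Type*} [Fintype ι] (x : ι → ℤ) : Fin k → ℤ :=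
  fun j => ∑ i, x i ^ ((j : ℕ) + 1)

/-- The number of pairs in `T × T'` with equal power sums of degrees `1, …, k`. -/
def coincidences (k : ℕ) {ι : Type*} [Fintype ι] (T T' : Finset (ι → ℤ)) : ℕ :=
  #{z ∈ T ×ˢ T' | powerSums k z.1 = powerSums k z.2}

/-- Tuples with all entries in `X`. -/
def tuples (ι : Type*) [Fintype ι] [DecidableEq ι] (X : Finset ℤ) : Finset (ι → ℤ) :=
  Fintype.piFinset fun _ => X

/-- Vinogradov's count of solutions, for variables in an arbitrary finite set of integers. -/
def vino (k n : ℕ) (X : Finset ℤ) : ℕ :=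
  coincidences k (tuples (Fin n) X) (tuples (Fin n) X)

/-- A finite set of unitary characters of `ℤ^k` that detects zero among the vectors in `F`. -/
structure CharSystem (k : ℕ) (F : Finset (Fin k → ℤ)) where
  idx : Type
  [fin : Fintype idx]
  [ne : Nonempty idx]
  χ : idx → (Fin k → ℤ) → ℂ
  norm_eq : ∀ i v, ‖χ i v‖ = 1
  map_add : ∀ i u v, χ i (u + v) = χ i u * χ i v
  map_zero : ∀ i, χ i 0 = 1
  map_neg : ∀ i v, χ i (-v) = starRingEnd ℂ (χ i v)
  orth : ∀ v ∈ F, ∑ i, χ i v = if v = 0 then (Fintype.card idx : ℂ) else 0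

attribute [instance] CharSystem.fin CharSystem.ne

lemma exists_characters (k : ℕ) (F : Finset (Fin k → ℤ)) : Nonempty (CharSystem k F) := by
  classical
  obtain ⟨Q, hQ⟩ : ∃ Q : ℕ, ∀ v ∈ F, ∀ j, (v j).natAbs < Q := by
    refine ⟨(F.sup fun v => univ.sup fun j => (v j).natAbs) + 1, fun v hv j => ?_⟩
    refine Nat.lt_succ_of_le ?_
    exact (Finset.le_sup (f := fun j => (v j).natAbs) (mem_univ j)).trans
      (Finset.le_sup (f := fun v : Fin k → ℤ => univ.sup fun j => (v j).natAbs) hv)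
  have : NeZero (Q + 1) := ⟨by omega⟩
  let red : (Fin k → ℤ) →+ (Fin k → ZMod (Q + 1)) :=
    (Int.castAddHom (ZMod (Q + 1))).compLeft (Fin k)
  have hcard : (Fintype.card (AddChar (Fin k → ZMod (Q + 1)) ℂ)) =
      Fintype.card (Fin k → ZMod (Q + 1)) := AddChar.card_eq
  refine ⟨⟨AddChar (Fin k → ZMod (Q + 1)) ℂ, 
    fun ψ v => ψ (red v), fun ψ v => ?_, fun ψ u v => ?_, fun ψ => ?_, fun ψ v => ?_, fun v hv => ?_⟩⟩
  · exact AddChar.norm_apply ψ _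
  · simp only [map_add, AddChar.map_add_eq_mul]
  · simp only [map_zero, AddChar.map_zero_eq_one]
  · simp only [map_neg, AddChar.map_neg_eq_conj]
  · rw [AddChar.sum_apply_eq_ite, hcard]
    have : red v = 0 ↔ v = 0 := by
      refine ⟨fun h => ?_, fun h => by rw [h, map_zero]⟩
      funext j
      have h1 : ((v j : ℤ) : ZMod (Q + 1)) = 0 := congrFun h j
      rw [ZMod.intCast_zmod_eq_zero_iff_dvd] at h1
      have h2 := hQ v hv j
      by_contra h3
      have := Int.natAbs_dvd_natAbs.mpr h1
      have := Nat.le_of_dvd (Int.natAbs_pos.mpr h3) this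
      simp at this
      omega
    simp only [this]

/-- A fixed difference of values of `g` is attained at most as often as the difference zero. -/
lemma card_offset_le {α G : Type*} [AddCommGroup G] [DecidableEq G] (T : Finset α) (g : α → G)
    (h : G) :
    #{z ∈ T ×ˢ T | g z.1 = g z.2 + h} ≤ #{z ∈ T ×ˢ T | g z.1 = g z.2} := by
  classical
  set r : G → ℕ := fun l => #{x ∈ T | g x = l} with hr
  have key : ∀ h : G, #{z ∈ T ×ˢ T | g z.1 = g z.2 + h} = ∑ l ∈ T.image g, r l * r (l + h) := by
    intro h
    rw [Finset.card_filter, Finset.sum_product_right]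
    have : ∀ y ∈ T, (∑ x ∈ T, if g x = g y + h then 1 else 0) = r (g y + h) := by
      intro y _
      simp only [hr, Finset.card_filter]
    rw [Finset.sum_congr rfl this, ← Finset.sum_fiberwise_of_maps_to (g := g) (t := T.image g)
      (fun x hx => Finset.mem_image_of_mem g hx)]
    refine Finset.sum_congr rfl fun l _ => ?_
    rw [Finset.sum_congr rfl (g := fun _ => r (l + h))
      (fun x hx => by rw [(Finset.mem_filter.mp hx).2])]
    simp [hr]
  have h0 := key 0
  simp only [add_zero] at h0
  rw [key h, h0]
  have hsq : ∀ a b : ℕ, 2 * (a * b) ≤ a * a + b * b := fun a b => by nlinarith [sq_nonneg ((a:ℤ) - b)]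
  have h1 : 2 * ∑ l ∈ T.image g, r l * r (l + h) ≤
      ∑ l ∈ T.image g, r l * r l + ∑ l ∈ T.image g, r (l + h) * r (l + h) := by
    rw [← Finset.sum_add_distrib, Finset.mul_sum]
    exact Finset.sum_le_sum fun l _ => hsq _ _
  have h2 : ∑ l ∈ T.image g, r (l + h) * r (l + h) ≤ ∑ l ∈ T.image g, r l * r l := by
    rw [← Finset.sum_image (s := T.image g) (g := fun l => l + h) (f := fun l => r l * r l)
      (by intro a _ b _ hab; simpa using hab)]
    refine Finset.sum_le_sum_of_ne_zero fun l _ hl => ?_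
    have : r l ≠ 0 := fun h => hl (by simp [h])
    obtain ⟨x, hx⟩ := Finset.card_ne_zero.mp this
    rw [Finset.mem_filter] at hx
    exact Finset.mem_image.mpr ⟨x, hx.1, hx.2⟩
  omega

/-- The vector `(x, x², …, x^k)`. -/
def powers (k : ℕ) (x : ℤ) : Fin k → ℤ := fun j => x ^ ((j : ℕ) + 1)

lemma powerSums_eq_sum (k : ℕ) {ι : Type*} [Fintype ι] (x : ι → ℤ) :
    powerSums k x = ∑ i, powers k (x i) := by
  funext j; simp [powerSums, powers, Finset.sum_apply]

namespace CharSystem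

variable {k : ℕ} {F : Finset (Fin k → ℤ)} (S : CharSystem k F)

lemma map_sum {ι : Type*} (s : Finset ι) (c : S.idx) (v : ι → Fin k → ℤ) :
    S.χ c (∑ i ∈ s, v i) = ∏ i ∈ s, S.χ c (v i) := by
  classical
  induction s using Finset.induction_on with
  | empty => simp [S.map_zero]
  | insert a s ha ih => rw [Finset.sum_insert ha, Finset.prod_insert ha, S.map_add, ih]

/-- The exponential sum attached to a set of tuples. -/
noncomputable def expSum {ι : Type*} [Fintype ι] (c : S.idx) (T : Finset (ι → ℤ)) : ℂ :=
  ∑ x ∈ T, S.χ c (powerSums k x)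

/-- The exponential sum attached to a set of integers. -/
noncomputable def weyl (c : S.idx) (X : Finset ℤ) : ℂ := ∑ x ∈ X, S.χ c (powers k x)

lemma expSum_piFinset {ι : Type*} [Fintype ι] [DecidableEq ι] (c : S.idx) (X : ι → Finset ℤ) :
    S.expSum c (Fintype.piFinset X) = ∏ i, S.weyl c (X i) := by
  unfold expSum weyl
  rw [Finset.prod_univ_sum]
  exact Finset.sum_congr rfl fun x _ => by rw [powerSums_eq_sum, S.map_sum]

lemma coincidences_eq {ι : Type*} [Fintype ι] {T T' : Finset (ι → ℤ)}
    (h : ∀ x ∈ T, ∀ y ∈ T', powerSums k x - powerSums k y ∈ F) :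
    (coincidences k T T' : ℂ) * Fintype.card S.idx =
      ∑ c, S.expSum c T * starRingEnd ℂ (S.expSum c T') := by
  have : ∀ c, S.expSum c T * starRingEnd ℂ (S.expSum c T') =
      ∑ z ∈ T ×ˢ T', S.χ c (powerSums k z.1 - powerSums k z.2) := by
    intro c
    unfold expSum
    rw [_root_.map_sum, Finset.sum_mul_sum, Finset.sum_product]
    refine Finset.sum_congr rfl fun x _ => Finset.sum_congr rfl fun y _ => ?_
    rw [sub_eq_add_neg, S.map_add, S.map_neg]
  rw [Finset.sum_congr rfl fun c _ => this c, Finset.sum_comm, coincidences, Finset.card_filter]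
  push_cast
  rw [Finset.sum_mul]
  refine Finset.sum_congr rfl fun z hz => ?_
  rw [Finset.mem_product] at hz
  rw [S.orth _ (h _ hz.1 _ hz.2)]
  simp only [sub_eq_zero]
  split_ifs <;> simp

lemma coincidences_le {ι : Type*} [Fintype ι] {T T' : Finset (ι → ℤ)}
    (h : ∀ x ∈ T, ∀ y ∈ T', powerSums k x - powerSums k y ∈ F) :
    (coincidences k T T' : ℝ) * Fintype.card S.idx ≤
      ∑ c, ‖S.expSum c T‖ * ‖S.expSum c T'‖ := by
  have h1 := congrArg norm (S.coincidences_eq h)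
  rw [norm_mul, Complex.norm_natCast, Complex.norm_natCast] at h1
  rw [h1]
  refine (norm_sum_le _ _).trans (Finset.sum_le_sum fun c _ => ?_)
  rw [norm_mul, RCLike.norm_conj]

lemma coincidences_self {ι : Type*} [Fintype ι] {T : Finset (ι → ℤ)}
    (h : ∀ x ∈ T, ∀ y ∈ T, powerSums k x - powerSums k y ∈ F) :
    (coincidences k T T : ℝ) * Fintype.card S.idx = ∑ c, ‖S.expSum c T‖ ^ 2 := by
  have h1 := S.coincidences_eq h
  have h2 : ∀ c, S.expSum c T * starRingEnd ℂ (S.expSum c T) = ((‖S.expSum c T‖ ^ 2 : ℝ) : ℂ) := by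
    intro c
    rw [Complex.mul_conj, Complex.normSq_eq_norm_sq]
  rw [Finset.sum_congr rfl fun c _ => h2 c] at h1
  exact_mod_cast h1

end CharSystem

/-- The differences of power sums of tuples from `X`. -/
def differences (k : ℕ) (ι : Type*) [Fintype ι] [DecidableEq ι] (X : Finset ℤ) :
    Finset (Fin k → ℤ) :=
  (tuples ι X ×ˢ tuples ι X).image fun z => powerSums k z.1 - powerSums k z.2

lemma mem_differences {k : ℕ} {ι : Type*} [Fintype ι] [DecidableEq ι] {X : Finset ℤ}
    {T T' : Finset (ι → ℤ)} (hT : T ⊆ tuples ι X) (hT' : T' ⊆ tuples ι X) :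
    ∀ x ∈ T, ∀ y ∈ T', powerSums k x - powerSums k y ∈ differences k ι X := fun x hx y hy =>
  Finset.mem_image.mpr ⟨(x, y), Finset.mem_product.mpr ⟨hT hx, hT' hy⟩, rfl⟩

lemma coincidences_cover {k : ℕ} {ι α : Type*} [Fintype ι] [DecidableEq ι] (I : Finset α)
    (U : α → Finset (ι → ℤ)) (A : ℕ) (h : ∀ i ∈ I, ∀ i' ∈ I, coincidences k (U i) (U i') ≤ A)
    (T : Finset (ι → ℤ)) (hT : ∀ x ∈ T, ∃ i ∈ I, x ∈ U i) :
    coincidences k T T ≤ #I ^ 2 * A := by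
  classical
  have hsub : ({z ∈ T ×ˢ T | powerSums k z.1 = powerSums k z.2} : Finset _) ⊆
      (I ×ˢ I).biUnion fun i => {z ∈ U i.1 ×ˢ U i.2 | powerSums k z.1 = powerSums k z.2} := by
    intro z hz
    simp only [Finset.mem_filter, Finset.mem_product, Finset.mem_biUnion] at hz ⊢
    obtain ⟨i, hi, hi'⟩ := hT _ hz.1.1
    obtain ⟨j, hj, hj'⟩ := hT _ hz.1.2
    exact ⟨(i, j), ⟨hi, hj⟩, ⟨hi', hj'⟩, hz.2⟩
  refine (Finset.card_le_card hsub).trans (Finset.card_biUnion_le.trans ?_)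
  refine (Finset.sum_le_card_nsmul _ _ A fun i hi => ?_).trans ?_
  · rw [Finset.mem_product] at hi
    exact h _ hi.1 _ hi.2
  · rw [Finset.card_product, smul_eq_mul, sq]

lemma coincidences_equiv {k : ℕ} {ι κ : Type*} [Fintype ι] [Fintype κ] [DecidableEq ι]
    [DecidableEq κ] (e : ι ≃ κ) (X : Finset ℤ) :
    coincidences k (tuples ι X) (tuples ι X) = coincidences k (tuples κ X) (tuples κ X) := by
  have hp : ∀ x : ι → ℤ, powerSums k (x ∘ e.symm) = powerSums k x := by
    intro x; funext j
    exact Equiv.sum_comp e.symm fun i => x i ^ ((j : ℕ) + 1)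
  have hp' : ∀ x : κ → ℤ, powerSums k (x ∘ e) = powerSums k x := by
    intro x; funext j
    exact Equiv.sum_comp e fun i => x i ^ ((j : ℕ) + 1)
  refine Finset.card_bij' (fun z _ => (z.1 ∘ e.symm, z.2 ∘ e.symm)) (fun z _ => (z.1 ∘ e, z.2 ∘ e))
    ?_ ?_ ?_ ?_
  · intro z hz
    simp only [Finset.mem_filter, Finset.mem_product, tuples, Fintype.mem_piFinset, hp] at hz ⊢
    exact ⟨⟨fun a => hz.1.1 _, fun a => hz.1.2 _⟩, hz.2⟩
  · intro z hz
    simp only [Finset.mem_filter, Finset.mem_product, tuples, Fintype.mem_piFinset, hp'] at hz ⊢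
    exact ⟨⟨fun a => hz.1.1 _, fun a => hz.1.2 _⟩, hz.2⟩
  · intro z _; ext <;> simp
  · intro z _; ext <;> simp

lemma sum_add_pow_eq {k : ℕ} {ι : Type*} [Fintype ι] {x y : ι → ℤ}
    (h : powerSums k x = powerSums k y) (b : ℤ) :
    powerSums k (fun i => x i + b) = powerSums k (fun i => y i + b) := by
  have h' : ∀ m ≤ k, ∑ i, x i ^ m = ∑ i, y i ^ m := by
    intro m hm
    rcases m with _ | m
    · simp
    · exact congrFun h ⟨m, hm⟩
  funext j
  simp only [powerSums, add_pow]
  rw [Finset.sum_comm, Finset.sum_comm (γ := ι)]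
  refine Finset.sum_congr rfl fun m hm => ?_
  rw [Finset.mem_range] at hm
  rw [← Finset.sum_mul, ← Finset.sum_mul, ← Finset.sum_mul, ← Finset.sum_mul, h' m (by omega)]

/-- The elements of `X` congruent to `b` modulo `p`. -/
def residueClass (X : Finset ℤ) (p : ℕ) (b : ℤ) : Finset ℤ := {x ∈ X | x % p = b}

lemma vino_residueClass_le {k n P Q p : ℕ} (hp : 0 < p) (hPQ : P ≤ p * Q) (b : ℤ) :
    vino k n (residueClass (Finset.Ico 0 (P : ℤ)) p b) ≤ vino k n (Finset.Ico 0 (Q : ℤ)) := by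
  have hp' : (0 : ℤ) < p := by exact_mod_cast hp
  have hdec : ∀ x ∈ residueClass (Finset.Ico 0 (P : ℤ)) p b, x = p * (x / p) + b := by
    intro x hx
    rw [residueClass, Finset.mem_filter] at hx
    rw [← hx.2, Int.mul_ediv_add_emod]
  have hmem : ∀ x ∈ residueClass (Finset.Ico 0 (P : ℤ)) p b, x / p ∈ Finset.Ico 0 (Q : ℤ) := by
    intro x hx
    rw [residueClass, Finset.mem_filter, Finset.mem_Ico] at hx
    rw [Finset.mem_Ico]
    refine ⟨Int.ediv_nonneg hx.1.1 hp'.le, Int.ediv_lt_of_lt_mul hp' ?_⟩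
    have : (P : ℤ) ≤ p * Q := by exact_mod_cast hPQ
    nlinarith [hx.1.2]
  refine Finset.card_le_card_of_injOn (fun z => (fun i => z.1 i / p, fun i => z.2 i / p)) ?_ ?_
  · intro z hz
    simp only [Finset.coe_filter, Finset.mem_product, tuples, Fintype.mem_piFinset,
      Set.mem_ofPred_eq] at hz ⊢
    refine ⟨⟨fun i => hmem _ (hz.1.1 i), fun i => hmem _ (hz.1.2 i)⟩, ?_⟩
    have h1 := sum_add_pow_eq hz.2 (-b)
    funext j
    have h2 := congrFun h1 j
    simp only [powerSums] at h2 ⊢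
    have e1 : ∀ w : Fin n → ℤ, (∀ i, w i ∈ residueClass (Finset.Ico 0 (P : ℤ)) p b) →
        ∑ i, (w i + -b) ^ ((j : ℕ) + 1) = (p : ℤ) ^ ((j : ℕ) + 1) * ∑ i, (w i / p) ^ ((j : ℕ) + 1) := by
      intro w hw
      rw [Finset.mul_sum]
      refine Finset.sum_congr rfl fun i _ => ?_
      rw [← mul_pow]
      congr 1
      have := hdec _ (hw i)
      linarith
    rw [e1 _ hz.1.1, e1 _ hz.1.2] at h2
    exact mul_left_cancel₀ (pow_ne_zero _ hp'.ne') h2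
  · intro z hz w hw hzw
    simp only [Finset.coe_filter, Finset.mem_product, tuples, Fintype.mem_piFinset,
      Set.mem_ofPred_eq, Prod.mk.injEq] at hz hw hzw
    refine Prod.ext (funext fun i => ?_) (funext fun i => ?_)
    · rw [hdec _ (hz.1.1 i), hdec _ (hw.1.1 i), congrFun hzw.1 i]
    · rw [hdec _ (hz.1.2 i), hdec _ (hw.1.2 i), congrFun hzw.2 i]

lemma residueClass_subset (X : Finset ℤ) (p : ℕ) (b : ℤ) : residueClass X p b ⊆ X :=
  Finset.filter_subset _ _

lemma coincidences_mixed {k : ℕ} {κ : Type*} [Fintype κ] [DecidableEq κ] (X : Finset ℤ) (p : ℕ)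
    (B : Finset ℤ) (hB : B.Nonempty) (g g' : κ → ℤ) (hg : ∀ i, g i ∈ B) (hg' : ∀ i, g' i ∈ B) :
    coincidences k (Fintype.piFinset fun i => residueClass X p (g i))
      (Fintype.piFinset fun i => residueClass X p (g' i)) ≤
    ∑ b ∈ B, coincidences k (tuples κ (residueClass X p b)) (tuples κ (residueClass X p b)) := by
  obtain ⟨S⟩ := exists_characters k (differences k κ X)
  have hsub : ∀ h : κ → ℤ, Fintype.piFinset (fun i => residueClass X p (h i)) ⊆ tuples κ X :=
    fun h => Fintype.piFinset_subset _ _ fun i => residueClass_subset _ _ _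
  have h1 := S.coincidences_le (mem_differences (hsub g) (hsub g'))
  have h2 : ∀ b, (coincidences k (tuples κ (residueClass X p b)) (tuples κ (residueClass X p b)) : ℝ)
      * Fintype.card S.idx = ∑ c, ‖S.weyl c (residueClass X p b)‖ ^ (2 * Fintype.card κ) := by
    intro b
    have hb : tuples κ (residueClass X p b) ⊆ tuples κ X := hsub fun _ => b
    rw [S.coincidences_self (mem_differences hb hb)]
    refine Finset.sum_congr rfl fun c _ => ?_
    rw [tuples, S.expSum_piFinset, Finset.prod_const, norm_pow, ← pow_mul, mul_comm]
    rfl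
  have hc : (0 : ℝ) < Fintype.card S.idx := by exact_mod_cast Fintype.card_pos
  have h3 : (coincidences k (Fintype.piFinset fun i => residueClass X p (g i))
      (Fintype.piFinset fun i => residueClass X p (g' i)) : ℝ) * Fintype.card S.idx ≤
      (∑ b ∈ B, (coincidences k (tuples κ (residueClass X p b))
        (tuples κ (residueClass X p b)) : ℝ)) * Fintype.card S.idx := by
    refine h1.trans ?_
    rw [Finset.sum_mul, Finset.sum_congr rfl fun b _ => h2 b, Finset.sum_comm]
    refine Finset.sum_le_sum fun c _ => ?_
    rw [S.expSum_piFinset, S.expSum_piFinset, norm_prod, norm_prod]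
    obtain ⟨m, hm, hmax⟩ := B.exists_max_image (fun b => ‖S.weyl c (residueClass X p b)‖) hB
    have hprod : ∀ h : κ → ℤ, (∀ i, h i ∈ B) → ∏ i, ‖S.weyl c (residueClass X p (h i))‖ ≤
        ‖S.weyl c (residueClass X p m)‖ ^ Fintype.card κ := by
      intro h hh
      calc _ ≤ ∏ i : κ, ‖S.weyl c (residueClass X p m)‖ :=
            Finset.prod_le_prod (fun _ _ => norm_nonneg _) fun i _ => hmax _ (hh i)
        _ = _ := by rw [Finset.prod_const]; rfl
    calc _ ≤ ‖S.weyl c (residueClass X p m)‖ ^ Fintype.card κ *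
            ‖S.weyl c (residueClass X p m)‖ ^ Fintype.card κ :=
          mul_le_mul (hprod g hg) (hprod g' hg') (Finset.prod_nonneg fun _ _ => norm_nonneg _)
            (by positivity)
      _ = ‖S.weyl c (residueClass X p m)‖ ^ (2 * Fintype.card κ) := by rw [← pow_add]; ring_nf
      _ ≤ _ := Finset.single_le_sum (f := fun b =>
            ‖S.weyl c (residueClass X p b)‖ ^ (2 * Fintype.card κ))
            (fun _ _ => by positivity) hm
  have h4 := le_of_mul_le_mul_right h3 hc
  exact_mod_cast h4

/-- Tuples meeting fewer than `k` residue classes contribute little. -/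
lemma coincidences_degenerate {k P Q p : ℕ} {κ : Type*} [Fintype κ] [DecidableEq κ] [Nonempty κ]
    (hp : 0 < p) (hPQ : P ≤ p * Q) (D : Finset (κ → ℤ))
    (hD : ∀ x ∈ D, x ∈ tuples κ (Finset.Ico 0 (P : ℤ)) ∧
      #(univ.image fun i => x i % (p : ℤ)) < k) :
    coincidences k D D ≤
      ((k - 1) ^ Fintype.card κ * p ^ (k - 1)) ^ 2 *
        (p * vino k (Fintype.card κ) (Finset.Ico 0 (Q : ℤ))) := by
  classical
  have hp' : (0 : ℤ) < p := by exact_mod_cast hp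
  have hBne : (Finset.Ico 0 (p : ℤ)).Nonempty := ⟨0, by simp [hp]⟩
  have := coincidences_cover (k := k) (ι := κ)
    ((univ : Finset (κ → Fin (k - 1))) ×ˢ Fintype.piFinset fun _ : Fin (k - 1) =>
      Finset.Ico 0 (p : ℤ))
    (fun q => Fintype.piFinset fun i => residueClass (Finset.Ico 0 (P : ℤ)) p (q.2 (q.1 i)))
    (p * vino k (Fintype.card κ) (Finset.Ico 0 (Q : ℤ))) ?_ D ?_
  · refine this.trans_eq ?_
    simp
  · intro i hi j hj
    simp only [Finset.mem_product, Fintype.mem_piFinset] at hi hj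
    refine (coincidences_mixed _ p (Finset.Ico 0 (p : ℤ)) hBne _ _ (fun a => hi.2 _)
      (fun a => hj.2 _)).trans ?_
    refine (Finset.sum_le_card_nsmul _ _ (vino k (Fintype.card κ) (Finset.Ico 0 (Q : ℤ)))
      fun b _ => ?_).trans ?_
    · rw [coincidences_equiv (Fintype.equivFin κ)]
      exact vino_residueClass_le hp hPQ b
    · simp
  · intro x hx
    obtain ⟨hx1, hx2⟩ := hD x hx
    set I := univ.image fun i => x i % (p : ℤ) with hI
    have hxI : ∀ i, x i % (p : ℤ) ∈ I := fun i => Finset.mem_image_of_mem _ (mem_univ i)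
    have hIB : ∀ b ∈ I, b ∈ Finset.Ico 0 (p : ℤ) := by
      intro b hb
      obtain ⟨i, -, rfl⟩ := Finset.mem_image.mp hb
      exact Finset.mem_Ico.mpr ⟨Int.emod_nonneg _ hp'.ne', Int.emod_lt_of_pos _ hp'⟩
    obtain ⟨e⟩ : Nonempty (I ↪ Fin (k - 1)) :=
      Function.Embedding.nonempty_of_card_le (by simp; omega)
    let i0 : κ := Classical.arbitrary κ
    have : Nonempty I := ⟨⟨_, hxI i0⟩⟩
    refine ⟨(fun i => e ⟨_, hxI i⟩, fun a => (Function.invFun e a : I)), ?_, ?_⟩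
    · simp only [Finset.mem_product, mem_univ, true_and, Fintype.mem_piFinset]
      exact fun a => hIB _ (Function.invFun e a : I).2
    · simp only [Fintype.mem_piFinset]
      intro i
      rw [Function.leftInverse_invFun e.injective, residueClass, Finset.mem_filter]
      exact ⟨Fintype.mem_piFinset.mp hx1 i, rfl⟩

lemma esymm_eq_of_psum_eq {R : Type*} [CommRing R] {k : ℕ} {σ : Type*} [Fintype σ]
    (hk : ∀ m, 1 ≤ m → m ≤ k → IsUnit (m : R)) {f g : σ → R}
    (h : ∀ m, 1 ≤ m → m ≤ k → ∑ i, f i ^ m = ∑ i, g i ^ m) :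
    ∀ m ≤ k, (univ.val.map f).esymm m = (univ.val.map g).esymm m := by
  intro m
  induction m using Nat.strong_induction_on with
  | _ m ih =>
    intro hm
    rcases Nat.eq_zero_or_pos m with rfl | hm0
    · simp [Multiset.esymm]
    have key : ∀ f : σ → R, (m : R) * (univ.val.map f).esymm m =
        (-1) ^ (m + 1) * ∑ a ∈ (antidiagonal m).filter (fun a => a.1 < m),
          (-1) ^ a.1 * (univ.val.map f).esymm a.1 * ∑ i, f i ^ a.2 := by
      intro f
      have := congrArg (MvPolynomial.aeval f) (MvPolynomial.mul_esymm_eq_sum σ R m)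
      simp only [map_mul, map_sum, map_pow, map_neg, map_one, map_natCast,
        MvPolynomial.aeval_esymm_eq_multiset_esymm, MvPolynomial.psum, MvPolynomial.aeval_X] at this
      exact this
    refine (hk m hm0 hm).mul_left_cancel ?_
    rw [key f, key g]
    congr 1
    refine Finset.sum_congr rfl fun a ha => ?_
    rw [Finset.mem_filter, Finset.HasAntidiagonal.mem_antidiagonal] at ha
    rw [ih a.1 ha.2 (by omega), h a.2 (by omega) (by omega)]

lemma prod_sub_eq_zero {p k : ℕ} (hp : p.Prime) (hkp : k < p) (u v : Fin k → ℤ)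
    (h : ∀ m, 1 ≤ m → m ≤ k → (p : ℤ) ^ k ∣ ∑ i, u i ^ m - ∑ i, v i ^ m) (j : Fin k) :
    (p : ℤ) ^ k ∣ ∏ i, (v j - u i) := by
  have hcast : ∀ z : ℤ, ((z : ℤ) : ZMod (p ^ k)) = 0 ↔ (p : ℤ) ^ k ∣ z := by
    intro z
    rw [ZMod.intCast_zmod_eq_zero_iff_dvd]
    push_cast
    rfl
  have hes := esymm_eq_of_psum_eq (R := ZMod (p ^ k)) (k := k) (f := fun i => (u i : ZMod (p ^ k)))
    (g := fun i => (v i : ZMod (p ^ k))) (fun m h1 h2 => by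
      rw [ZMod.isUnit_iff_coprime]
      exact Nat.Coprime.pow_right k (Nat.coprime_of_lt_prime (by omega) (by omega) hp).symm)
    (fun m h1 h2 => by
      have := (hcast _).mpr (h m h1 h2)
      simp only [Int.cast_sub, Int.cast_sum, Int.cast_pow] at this
      exact sub_eq_zero.mp this)
  rw [← hcast]
  simp only [Int.cast_prod, Int.cast_sub]
  have hpoly : ∀ w : Fin k → ZMod (p ^ k), ∏ i, ((v j : ZMod (p ^ k)) - w i) = ∑ m ∈ range (k + 1),
      (-1) ^ m * ((univ.val.map w).esymm m * (v j : ZMod (p ^ k)) ^ (k - m)) := by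
    intro w
    have := congrArg (Polynomial.eval (v j : ZMod (p ^ k)))
      (Multiset.prod_X_sub_X_eq_sum_esymm (univ.val.map w))
    rw [Multiset.map_map, Polynomial.eval_multiset_prod, Multiset.map_map] at this
    simp only [Polynomial.eval_finsetSum, Polynomial.eval_mul, Polynomial.eval_pow,
      Polynomial.eval_neg, Polynomial.eval_one, Polynomial.eval_C, Polynomial.eval_X,
      Multiset.card_map, Finset.card_val, Finset.card_univ, Fintype.card_fin] at this
    rw [← this, Finset.prod]
    congr 1
    refine Multiset.map_congr rfl fun i _ => ?_
    simp
  rw [hpoly, Finset.sum_congr rfl (g := fun m => (-1) ^ m *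
    ((univ.val.map fun i => (v i : ZMod (p ^ k))).esymm m * (v j : ZMod (p ^ k)) ^ (k - m))) (fun m hm => by
      rw [hes m (by have := Finset.mem_range.mp hm; omega)]), ← hpoly]
  exact Finset.prod_eq_zero (mem_univ j) (sub_self _)

lemma exists_congr_of_dvd_prod {p k : ℕ} (hp : p.Prime) (hk : k ≠ 0) (u : Fin k → ℤ)
    (hu : Function.Injective fun i => u i % (p : ℤ)) (z : ℤ)
    (h : (p : ℤ) ^ k ∣ ∏ i, (z - u i)) : ∃ i, (p : ℤ) ^ k ∣ z - u i := by
  have hp' : Prime (p : ℤ) := Nat.prime_iff_prime_int.mp hp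
  obtain ⟨i, -, hi⟩ := (Prime.dvd_finsetProd_iff hp' _).mp ((dvd_pow_self _ hk).trans h)
  refine ⟨i, ?_⟩
  rw [← Finset.mul_prod_erase _ _ (mem_univ i)] at h
  refine IsCoprime.dvd_of_dvd_mul_right (IsCoprime.pow_left (IsCoprime.prod_right fun l hl => ?_)) h
  rw [hp'.coprime_iff_not_dvd]
  intro hl'
  have : (p : ℤ) ∣ u l - u i := by
    have := dvd_sub hi hl'
    simpa using this
  refine (Finset.ne_of_mem_erase hl) (hu ?_)
  exact Int.emod_eq_emod_iff_emod_sub_eq_zero.mpr (Int.emod_eq_zero_of_dvd this)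

/-- Linnik's lemma. -/
lemma linnik_fibre {p k P : ℕ} (hp : p.Prime) (hk : k ≠ 0) (hkp : k < p) (hP : P ≤ p ^ k)
    (b : ℤ) (U : Finset (Fin k → ℤ))
    (hU : ∀ u ∈ U, u ∈ tuples (Fin k) (Finset.Ico 0 (P : ℤ)) ∧
      Function.Injective fun i => u i % (p : ℤ))
    (hc : ∀ u ∈ U, ∀ v ∈ U, ∀ m, 1 ≤ m → m ≤ k →
      (p : ℤ) ^ k ∣ ∑ i, (u i - b) ^ m - ∑ i, (v i - b) ^ m) : #U ≤ k ^ k := by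
  classical
  rcases U.eq_empty_or_nonempty with rfl | ⟨u, hu⟩
  · simp
  have key : ∀ v ∈ U, ∀ j, ∃ i, (p : ℤ) ^ k ∣ v j - u i := by
    intro v hv j
    have h1 := prod_sub_eq_zero hp hkp (fun i => u i - b) (fun i => v i - b) (hc u hu v hv) j
    refine exists_congr_of_dvd_prod hp hk u (hU u hu).2 _ ?_
    simpa using h1
  choose! τ hτ using key
  have hcard : #(univ : Finset (Fin k → Fin k)) = k ^ k := by simp
  rw [← hcard]
  refine Finset.card_le_card_of_injOn τ (fun _ _ => mem_univ _) ?_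
  intro v hv w hw hvw
  funext j
  have h1 := hτ v hv j
  have h2 := hτ w hw j
  rw [hvw] at h1
  have h3 : (p : ℤ) ^ k ∣ v j - w j := by
    have := dvd_sub h1 h2
    simpa using this
  have hv' := Finset.mem_Ico.mp ((Fintype.mem_piFinset.mp (hU v hv).1) j)
  have hw' := Finset.mem_Ico.mp ((Fintype.mem_piFinset.mp (hU w hw).1) j)
  have hP' : (P : ℤ) ≤ (p : ℤ) ^ k := by exact_mod_cast hP
  have := Int.eq_zero_of_abs_lt_dvd h3 (by rw [abs_lt]; constructor <;> linarith)
  linarith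

lemma card_residues_le {p k j : ℕ} (hp : 0 < p) (hj : j < k) (h : ℤ) :
    #{y ∈ Finset.Ico 0 ((p : ℤ) ^ k) | y % (p : ℤ) ^ (j + 1) = h} ≤ p ^ (k - 1 - j) := by
  have hp' : (0 : ℤ) < p := by exact_mod_cast hp
  have hc : #(Finset.Ico 0 ((p : ℤ) ^ (k - 1 - j))) = p ^ (k - 1 - j) := by
    rw [Int.card_Ico, sub_zero]; exact_mod_cast Int.toNat_natCast (p ^ (k - 1 - j))
  rw [← hc]
  refine Finset.card_le_card_of_injOn (fun y => y / (p : ℤ) ^ (j + 1)) ?_ ?_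
  · intro y hy
    have hy := (Finset.mem_filter.mp (Finset.mem_coe.mp hy)).1
    rw [Finset.mem_Ico] at hy
    rw [Finset.mem_coe, Finset.mem_Ico]
    refine ⟨Int.ediv_nonneg hy.1 (by positivity), ?_⟩
    rw [Int.ediv_lt_iff_lt_mul (by positivity), ← pow_add]
    rw [show k - 1 - j + (j + 1) = k by omega]
    exact hy.2
  · intro y hy z hz hyz
    have hy := (Finset.mem_filter.mp (Finset.mem_coe.mp hy)).2
    have hz := (Finset.mem_filter.mp (Finset.mem_coe.mp hz)).2
    have h1 := Int.mul_ediv_add_emod y ((p : ℤ) ^ (j + 1))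
    have h2 := Int.mul_ediv_add_emod z ((p : ℤ) ^ (j + 1))
    simp only at hyz
    rw [hyz, hy] at h1
    rw [hz] at h2
    linarith

lemma sum_fin_rev (k : ℕ) : ∑ j : Fin k, (k - 1 - (j : ℕ)) = k * (k - 1) / 2 := by
  rw [Fin.sum_univ_eq_sum_range (fun j => k - 1 - j) k, Finset.sum_range_reflect (fun j => j),
    Finset.sum_range_id]

lemma linnik_count {p k P : ℕ} (hp : p.Prime) (hk : k ≠ 0) (hkp : k < p) (hP : P ≤ p ^ k)
    (b : ℤ) (h : Fin k → ℤ) (U : Finset (Fin k → ℤ))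
    (hU : ∀ u ∈ U, u ∈ tuples (Fin k) (Finset.Ico 0 (P : ℤ)) ∧
      Function.Injective fun i => u i % (p : ℤ))
    (hc : ∀ u ∈ U, ∀ j : Fin k,
      (p : ℤ) ^ ((j : ℕ) + 1) ∣ ∑ i, (u i - b) ^ ((j : ℕ) + 1) - h j) :
    #U ≤ k ^ k * p ^ (k * (k - 1) / 2) := by
  classical
  have hp0 : (0 : ℤ) < p := by exact_mod_cast hp.pos
  let Y : Finset (Fin k → ℤ) := Fintype.piFinset fun j : Fin k =>
    {y ∈ Finset.Ico 0 ((p : ℤ) ^ k) | y % (p : ℤ) ^ ((j : ℕ) + 1) = h j % (p : ℤ) ^ ((j : ℕ) + 1)}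
  let F : (Fin k → ℤ) → (Fin k → ℤ) := fun u j => (∑ i, (u i - b) ^ ((j : ℕ) + 1)) % (p : ℤ) ^ k
  have hY : #Y ≤ p ^ (k * (k - 1) / 2) := by
    rw [Fintype.card_piFinset, ← sum_fin_rev, ← Finset.prod_pow_eq_pow_sum]
    exact Finset.prod_le_prod' fun j _ => card_residues_le hp.pos j.2 _
  have hF : ∀ u ∈ U, F u ∈ Y := by
    intro u hu
    rw [Fintype.mem_piFinset]
    intro j
    rw [Finset.mem_filter, Finset.mem_Ico]
    refine ⟨⟨Int.emod_nonneg _ (by positivity), Int.emod_lt_of_pos _ (by positivity)⟩, ?_⟩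
    rw [Int.emod_emod_of_dvd _ (pow_dvd_pow _ j.2)]
    exact Int.emod_eq_emod_iff_emod_sub_eq_zero.mpr (Int.emod_eq_zero_of_dvd (hc u hu j))
  calc #U ≤ k ^ k * #(U.image F) := by
        refine Finset.card_le_mul_card_image U (k ^ k) fun y _ => ?_
        refine linnik_fibre hp hk hkp hP b _ (fun u hu => hU u (Finset.mem_filter.mp hu).1) ?_
        intro u hu v hv m h1 h2
        have := congrFun ((Finset.mem_filter.mp hu).2.trans (Finset.mem_filter.mp hv).2.symm)
          ⟨m - 1, by omega⟩
        simp only [F, Nat.sub_add_cancel h1] at this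
        exact Int.dvd_of_emod_eq_zero (Int.emod_eq_emod_iff_emod_sub_eq_zero.mp this)
    _ ≤ _ := Nat.mul_le_mul_left _ ((Finset.card_le_card
        (Finset.image_subset_iff.mpr hF)).trans hY)

lemma powerSums_sumElim (k : ℕ) {ι κ : Type*} [Fintype ι] [Fintype κ] (u : ι → ℤ) (v : κ → ℤ) :
    powerSums k (Sum.elim u v) = powerSums k u + powerSums k v := by
  funext j; simp [powerSums, Fintype.sum_sum_type]

/-- Tuples assembled from a tuple in `A` and a tuple in `B`. -/
def joined {ι κ : Type*} [DecidableEq ι] [DecidableEq κ] [Fintype ι] [Fintype κ]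
    (A : Finset (ι → ℤ)) (B : Finset (κ → ℤ)) : Finset (ι ⊕ κ → ℤ) :=
  (A ×ˢ B).map (Equiv.sumArrowEquivProdArrow ι κ ℤ).symm.toEmbedding

section
variable {ι κ : Type*} [DecidableEq ι] [DecidableEq κ] [Fintype ι] [Fintype κ]

lemma mem_joined {A : Finset (ι → ℤ)} {B : Finset (κ → ℤ)} {x : ι ⊕ κ → ℤ} :
    x ∈ joined A B ↔ x ∘ Sum.inl ∈ A ∧ x ∘ Sum.inr ∈ B := by
  rw [joined, Finset.mem_map_equiv, Finset.mem_product]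
  rfl

lemma sum_joined {M : Type*} [AddCommMonoid M] (A : Finset (ι → ℤ)) (B : Finset (κ → ℤ))
    (f : (ι ⊕ κ → ℤ) → M) :
    ∑ x ∈ joined A B, f x = ∑ u ∈ A, ∑ v ∈ B, f (Sum.elim u v) := by
  rw [joined, Finset.sum_map, Finset.sum_product]
  rfl

lemma CharSystem.expSum_joined {k : ℕ} {F : Finset (Fin k → ℤ)} (S : CharSystem k F) (c : S.idx)
    (A : Finset (ι → ℤ)) (B : Finset (κ → ℤ)) :
    S.expSum c (joined A B) = S.expSum c A * S.expSum c B := by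
  unfold CharSystem.expSum
  rw [sum_joined, Finset.sum_mul_sum]
  refine Finset.sum_congr rfl fun u _ => Finset.sum_congr rfl fun v _ => ?_
  rw [powerSums_sumElim, S.map_add]

lemma joined_subset_tuples {A : Finset (ι → ℤ)} {B : Finset (κ → ℤ)} {X : Finset ℤ}
    (hA : A ⊆ tuples ι X) (hB : B ⊆ tuples κ X) : joined A B ⊆ tuples (ι ⊕ κ) X := by
  intro x hx
  obtain ⟨h1, h2⟩ := mem_joined.mp hx
  refine Fintype.mem_piFinset.mpr fun i => ?_
  rcases i with i | i
  · exact Fintype.mem_piFinset.mp (hA h1) i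
  · exact Fintype.mem_piFinset.mp (hB h2) i

end

lemma coincidences_split {k s p : ℕ} {ι : Type*} [Fintype ι] [DecidableEq ι] (hp : 0 < p)
    (hs : s ≠ 0) (X : Finset ℤ) (A : Finset (ι → ℤ)) (hA : A ⊆ tuples ι X) :
    coincidences k (joined A (tuples (Fin s) X)) (joined A (tuples (Fin s) X)) ≤
      p ^ (2 * s - 1) * ∑ b ∈ Finset.Ico 0 (p : ℤ),
        coincidences k (joined A (tuples (Fin s) (residueClass X p b)))
          (joined A (tuples (Fin s) (residueClass X p b))) := by
  have hp' : (0 : ℤ) < p := by exact_mod_cast hp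
  obtain ⟨S⟩ := exists_characters k (differences k (ι ⊕ Fin s) X)
  have hsub : ∀ b, joined A (tuples (Fin s) (residueClass X p b)) ⊆ tuples (ι ⊕ Fin s) X :=
    fun b => joined_subset_tuples hA
      (Fintype.piFinset_subset _ _ fun i => residueClass_subset _ _ _)
  have hsub0 : joined A (tuples (Fin s) X) ⊆ tuples (ι ⊕ Fin s) X :=
    joined_subset_tuples hA subset_rfl
  have h0 := S.coincidences_self (mem_differences hsub0 hsub0)
  have hb := fun b => S.coincidences_self (mem_differences (hsub b) (hsub b))
  have hcard : (0 : ℝ) < Fintype.card S.idx := by exact_mod_cast Fintype.card_pos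
  have hw : ∀ c, S.weyl c X = ∑ b ∈ Finset.Ico 0 (p : ℤ), S.weyl c (residueClass X p b) := by
    intro c
    unfold CharSystem.weyl residueClass
    exact (Finset.sum_fiberwise_of_maps_to (fun x _ => Finset.mem_Ico.mpr
      ⟨Int.emod_nonneg _ hp'.ne', Int.emod_lt_of_pos _ hp'⟩) _).symm
  have hpt : ∀ c (Y : Finset ℤ), ‖S.expSum c (joined A (tuples (Fin s) Y))‖ ^ 2 =
      ‖S.expSum c A‖ ^ 2 * ‖S.weyl c Y‖ ^ (2 * s) := by
    intro c Y
    rw [S.expSum_joined, tuples, S.expSum_piFinset, Finset.prod_const, norm_mul, norm_pow, mul_pow,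
      ← pow_mul, Finset.card_univ, Fintype.card_fin, mul_comm s]
  have hmain : ∀ c, ‖S.weyl c X‖ ^ (2 * s) ≤
      (p : ℝ) ^ (2 * s - 1) * ∑ b ∈ Finset.Ico 0 (p : ℤ), ‖S.weyl c (residueClass X p b)‖ ^ (2 * s) := by
    intro c
    have h1 : ‖S.weyl c X‖ ≤ ∑ b ∈ Finset.Ico 0 (p : ℤ), ‖S.weyl c (residueClass X p b)‖ := by
      rw [hw c]; exact norm_sum_le _ _
    have h2 := pow_sum_div_card_le_sum_pow (s := Finset.Ico 0 (p : ℤ))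
      (f := fun b => ‖S.weyl c (residueClass X p b)‖) (fun b _ => norm_nonneg _) (2 * s - 1)
    rw [show 2 * s - 1 + 1 = 2 * s by omega, Int.card_Ico, sub_zero, Int.toNat_natCast,
      div_le_iff₀ (by positivity)] at h2
    calc _ ≤ _ := pow_le_pow_left₀ (norm_nonneg _) h1 _
      _ ≤ _ := h2
      _ = _ := mul_comm _ _
  have : ((coincidences k (joined A (tuples (Fin s) X)) (joined A (tuples (Fin s) X)) : ℕ) : ℝ) *
      Fintype.card S.idx ≤ ((p ^ (2 * s - 1) * ∑ b ∈ Finset.Ico 0 (p : ℤ),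
        coincidences k (joined A (tuples (Fin s) (residueClass X p b)))
          (joined A (tuples (Fin s) (residueClass X p b))) : ℕ) : ℝ) * Fintype.card S.idx := by
    push_cast
    rw [h0, mul_assoc, Finset.sum_mul, Finset.sum_congr rfl fun b _ => hb b, Finset.sum_comm,
      Finset.mul_sum]
    refine Finset.sum_le_sum fun c _ => ?_
    rw [hpt c X, Finset.sum_congr rfl fun b _ => hpt c _, ← Finset.mul_sum]
    calc _ ≤ ‖S.expSum c A‖ ^ 2 * _ := mul_le_mul_of_nonneg_left (hmain c) (by positivity)
      _ = _ := by ring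
  exact_mod_cast le_of_mul_le_mul_right this hcard

lemma coincidences_joined_class {k s p P : ℕ} (hp : p.Prime) (hk : k ≠ 0) (hkp : k < p)
    (hP : P ≤ p ^ k) (b : ℤ) (U : Finset (Fin k → ℤ))
    (hU : ∀ u ∈ U, u ∈ tuples (Fin k) (Finset.Ico 0 (P : ℤ)) ∧
      Function.Injective fun i => u i % (p : ℤ)) (Y : Finset ℤ) (hY : ∀ y ∈ Y, y % p = b) :
    coincidences k (joined U (tuples (Fin s) Y)) (joined U (tuples (Fin s) Y)) ≤
      (k ^ k * p ^ (k * (k - 1) / 2)) * P ^ k * vino k s Y := by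
  classical
  set V := tuples (Fin s) Y with hV
  have h1 : coincidences k (joined U V) (joined U V) = ∑ u' ∈ U, ∑ u ∈ U,
      #{z ∈ V ×ˢ V | powerSums k z.1 = powerSums k z.2 + (powerSums k u' - powerSums k u)} := by
    rw [coincidences, Finset.card_filter, Finset.sum_product_right, sum_joined]
    simp only [sum_joined]
    refine Finset.sum_congr rfl fun u' _ => ?_
    rw [Finset.sum_comm]
    refine Finset.sum_congr rfl fun u _ => ?_
    rw [Finset.card_filter, Finset.sum_product_right]
    refine Finset.sum_congr rfl fun v' _ => Finset.sum_congr rfl fun v _ => ?_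
    rw [powerSums_sumElim, powerSums_sumElim]
    refine if_congr ?_ rfl rfl
    constructor <;> intro h
    · rw [← add_left_cancel_iff (a := powerSums k u), h]; abel
    · rw [h]; abel
  have h2 : ∀ u' ∈ U, ∑ u ∈ U,
      #{z ∈ V ×ˢ V | powerSums k z.1 = powerSums k z.2 + (powerSums k u' - powerSums k u)} ≤
      (k ^ k * p ^ (k * (k - 1) / 2)) * vino k s Y := by
    intro u' hu'
    let U' : Finset (Fin k → ℤ) := {u ∈ U |
      ({z ∈ V ×ˢ V | powerSums k z.1 = powerSums k z.2 + (powerSums k u' - powerSums k u)} :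
        Finset _).Nonempty}
    have hU' : #U' ≤ k ^ k * p ^ (k * (k - 1) / 2) := by
      refine linnik_count hp hk hkp hP b (fun j => ∑ i, (u' i - b) ^ ((j : ℕ) + 1)) U'
        (fun u hu => hU u (Finset.mem_filter.mp hu).1) fun u hu j => ?_
      obtain ⟨z, hz⟩ := (Finset.mem_filter.mp hu).2
      rw [Finset.mem_filter, Finset.mem_product] at hz
      have he : powerSums k (Sum.elim u z.1) = powerSums k (Sum.elim u' z.2) := by
        rw [powerSums_sumElim, powerSums_sumElim, hz.2]; abel
      have he' := congrFun (sum_add_pow_eq he (-b)) j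
      simp only [powerSums, Fintype.sum_sum_type, Sum.elim_inl, Sum.elim_inr,
        ← sub_eq_add_neg] at he'
      have hd : ∀ v ∈ V, (p : ℤ) ^ ((j : ℕ) + 1) ∣ ∑ i, (v i - b) ^ ((j : ℕ) + 1) := by
        intro v hv
        refine Finset.dvd_sum fun i _ => pow_dvd_pow_of_dvd ?_ _
        have := hY _ (Fintype.mem_piFinset.mp hv i)
        rw [← this]
        exact Int.dvd_self_sub_emod
      have := dvd_sub (hd _ hz.1.2) (hd _ hz.1.1)
      have he2 : ∑ i, (u i - b) ^ ((j : ℕ) + 1) - ∑ i, (u' i - b) ^ ((j : ℕ) + 1) =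
          ∑ i, (z.2 i - b) ^ ((j : ℕ) + 1) - ∑ i, (z.1 i - b) ^ ((j : ℕ) + 1) := by linarith
      rwa [he2]
    calc _ = ∑ u ∈ U', #{z ∈ V ×ˢ V |
          powerSums k z.1 = powerSums k z.2 + (powerSums k u' - powerSums k u)} := by
          refine (Finset.sum_subset (Finset.filter_subset _ _) fun u hu hu2 => ?_).symm
          rw [Finset.card_eq_zero, ← Finset.not_nonempty_iff_eq_empty]
          exact fun h => hu2 (Finset.mem_filter.mpr ⟨hu, h⟩)
      _ ≤ ∑ u ∈ U', vino k s Y := Finset.sum_le_sum fun u _ => card_offset_le _ _ _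
      _ ≤ _ := by rw [Finset.sum_const, smul_eq_mul]; exact Nat.mul_le_mul_right _ hU'
  have hUc : #U ≤ P ^ k := by
    calc #U ≤ #(tuples (Fin k) (Finset.Ico 0 (P : ℤ))) :=
          Finset.card_le_card fun u hu => (hU u hu).1
      _ = P ^ k := by simp [tuples, Fintype.card_piFinset]
  rw [h1]
  calc _ ≤ ∑ u' ∈ U, (k ^ k * p ^ (k * (k - 1) / 2)) * vino k s Y := Finset.sum_le_sum h2
    _ = #U * ((k ^ k * p ^ (k * (k - 1) / 2)) * vino k s Y) := by
        rw [Finset.sum_const, smul_eq_mul]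
    _ ≤ P ^ k * ((k ^ k * p ^ (k * (k - 1) / 2)) * vino k s Y) := Nat.mul_le_mul_right _ hUc
    _ = _ := by ring

lemma coincidences_nonsingular {k s p P Q : ℕ} (hp : p.Prime) (hk : k ≠ 0) (hkp : k < p)
    (hs : s ≠ 0) (hP : P ≤ p ^ k) (hPQ : P ≤ p * Q) (U : Finset (Fin k → ℤ))
    (hU : ∀ u ∈ U, u ∈ tuples (Fin k) (Finset.Ico 0 (P : ℤ)) ∧
      Function.Injective fun i => u i % (p : ℤ)) :
    coincidences k (joined U (tuples (Fin s) (Finset.Ico 0 (P : ℤ))))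
      (joined U (tuples (Fin s) (Finset.Ico 0 (P : ℤ)))) ≤
      k ^ k * p ^ (2 * s + k * (k - 1) / 2) * P ^ k * vino k s (Finset.Ico 0 (Q : ℤ)) := by
  refine (coincidences_split hp.pos hs _ U fun u hu => (hU u hu).1).trans ?_
  calc _ ≤ p ^ (2 * s - 1) * ∑ b ∈ Finset.Ico 0 (p : ℤ),
        (k ^ k * p ^ (k * (k - 1) / 2)) * P ^ k * vino k s (Finset.Ico 0 (Q : ℤ)) := by
        refine Nat.mul_le_mul_left _ (Finset.sum_le_sum fun b _ => ?_)
        refine (coincidences_joined_class hp hk hkp hP b U hU _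
          fun y hy => (Finset.mem_filter.mp hy).2).trans ?_
        exact Nat.mul_le_mul_left _ (vino_residueClass_le hp.pos hPQ b)
    _ = _ := by
        rw [Finset.sum_const, Int.card_Ico, sub_zero, Int.toNat_natCast, smul_eq_mul]
        have : p ^ (2 * s + k * (k - 1) / 2) = p ^ (2 * s - 1) * p * p ^ (k * (k - 1) / 2) := by
          rw [← pow_succ, ← pow_add]; congr 1; omega
        rw [this]; ring

lemma exists_perm_of_injective {α β : Type*} [Fintype β] [DecidableEq β] (i f : α → β)
    (hi : Function.Injective i) (hf : Function.Injective f) :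
    ∃ σ : Equiv.Perm β, ∀ a, σ (i a) = f a := by
  classical
  let e : {x // x ∈ Set.range i} ≃ {x // x ∈ Set.range f} :=
    (Equiv.ofInjective i hi).symm.trans (Equiv.ofInjective f hf)
  refine ⟨e.extendSubtype, fun a => ?_⟩
  rw [Equiv.extendSubtype_apply_of_mem e (i a) ⟨a, rfl⟩]
  have : (⟨i a, ⟨a, rfl⟩⟩ : {x // x ∈ Set.range i}) = Equiv.ofInjective i hi a := rfl
  rw [this]
  simp [e]

lemma exists_injective_of_card_image {k : ℕ} {β γ : Type*} [Fintype β] [DecidableEq γ]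
    (r : β → γ) (h : k ≤ #(univ.image r)) :
    ∃ f : Fin k → β, Function.Injective (r ∘ f) := by
  obtain ⟨g⟩ := Function.Embedding.nonempty_of_card_le (α := Fin k) (β := (univ.image r : Finset γ))
    (by simpa using h)
  have : ∀ i, ∃ b, r b = g i := fun i => by
    obtain ⟨b, -, hb⟩ := Finset.mem_image.mp (g i).2
    exact ⟨b, hb⟩
  choose f hf using this
  refine ⟨f, fun a b hab => g.injective (Subtype.ext ?_)⟩
  simpa [hf] using hab

lemma coincidences_covered_perm {k s p : ℕ} (X : Finset ℤ) (U : Finset (Fin k → ℤ))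
    (hU : ∀ u ∈ tuples (Fin k) X, Function.Injective (fun i => u i % (p : ℤ)) → u ∈ U)
    (E : Finset (Fin k ⊕ Fin s → ℤ)) (hE : ∀ x ∈ E, x ∈ tuples (Fin k ⊕ Fin s) X ∧
      k ≤ #(univ.image fun i => x i % (p : ℤ))) :
    coincidences k E E ≤ ((k + s).factorial) ^ 2 *
      coincidences k (joined U (tuples (Fin s) X)) (joined U (tuples (Fin s) X)) := by
  classical
  set T := joined U (tuples (Fin s) X) with hT
  let V : Equiv.Perm (Fin k ⊕ Fin s) → Finset (Fin k ⊕ Fin s → ℤ) := fun σ =>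
    {x ∈ E | x ∘ σ ∈ T}
  have hcard : #(univ : Finset (Equiv.Perm (Fin k ⊕ Fin s))) = (k + s).factorial := by
    rw [Finset.card_univ, Fintype.card_perm]; simp
  rw [← hcard]
  have hperm : ∀ (σ : Equiv.Perm (Fin k ⊕ Fin s)) x, powerSums k (x ∘ σ) = powerSums k x := by
    intro σ x; funext j
    exact Equiv.sum_comp σ fun i => x i ^ ((j : ℕ) + 1)
  refine coincidences_cover univ V _ (fun σ _ τ _ => ?_) E fun x hx => ?_
  · refine Finset.card_le_card_of_injOn (fun z => (z.1 ∘ σ, z.2 ∘ τ)) ?_ ?_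
    · intro z hz
      simp only [V, Finset.coe_filter, Finset.mem_product, Finset.mem_filter,
        Set.mem_ofPred_eq] at hz ⊢
      exact ⟨⟨hz.1.1.2, hz.1.2.2⟩, by rw [hperm, hperm, hz.2]⟩
    · intro z _ w _ h
      have h1 := congrArg Prod.fst h
      have h2 := congrArg Prod.snd h
      simp only at h1 h2
      exact Prod.ext (σ.surjective.injective_comp_right h1) (τ.surjective.injective_comp_right h2)
  · obtain ⟨hx1, hx2⟩ := hE x hx
    obtain ⟨f, hf⟩ := exists_injective_of_card_image _ hx2
    obtain ⟨σ, hσ⟩ := exists_perm_of_injective (Sum.inl : Fin k → Fin k ⊕ Fin s) f Sum.inl_injective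
      hf.of_comp
    have hx1' := Fintype.mem_piFinset.mp hx1
    refine ⟨σ, mem_univ _, Finset.mem_filter.mpr ⟨hx, mem_joined.mpr ⟨hU _ ?_ ?_, ?_⟩⟩⟩
    · exact Fintype.mem_piFinset.mpr fun i => hx1' _
    · intro a b hab
      simp only [Function.comp, hσ] at hab
      exact hf hab
    · exact Fintype.mem_piFinset.mpr fun i => hx1' _

lemma coincidences_union_le {k : ℕ} {κ : Type*} [Fintype κ] [DecidableEq κ] {X : Finset ℤ}
    (D E : Finset (κ → ℤ)) (hd : Disjoint D E) (hDE : D ∪ E = tuples κ X) :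
    coincidences k (tuples κ X) (tuples κ X) ≤ 2 * coincidences k E E + 2 * coincidences k D D := by
  obtain ⟨S⟩ := exists_characters k (differences k κ X)
  have hD : D ⊆ tuples κ X := hDE ▸ Finset.subset_union_left
  have hE : E ⊆ tuples κ X := hDE ▸ Finset.subset_union_right
  have hcard : (0 : ℝ) < Fintype.card S.idx := by exact_mod_cast Fintype.card_pos
  have h1 := S.coincidences_self (mem_differences hD hD)
  have h2 := S.coincidences_self (mem_differences hE hE)
  have h3 := S.coincidences_self (mem_differences (subset_refl (tuples κ X)) (subset_refl _))
  have : (coincidences k (tuples κ X) (tuples κ X) : ℝ) * Fintype.card S.idx ≤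
      ((2 * coincidences k E E + 2 * coincidences k D D : ℕ) : ℝ) * Fintype.card S.idx := by
    push_cast
    rw [add_mul, mul_assoc, mul_assoc, h1, h2, h3, Finset.mul_sum, Finset.mul_sum,
      ← Finset.sum_add_distrib]
    refine Finset.sum_le_sum fun c _ => ?_
    have : S.expSum c (tuples κ X) = S.expSum c D + S.expSum c E := by
      rw [← hDE]; exact Finset.sum_union hd
    rw [this]
    have hn := norm_add_le (S.expSum c D) (S.expSum c E)
    nlinarith [sq_nonneg (‖S.expSum c D‖ - ‖S.expSum c E‖), norm_nonneg (S.expSum c D + S.expSum c E)]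
  exact_mod_cast le_of_mul_le_mul_right this hcard

/-- The basic recursion for Vinogradov's mean value. -/
lemma vino_recursion {k s p P Q : ℕ} (hp : p.Prime) (hk : k ≠ 0) (hkp : k < p)
    (hs : s ≠ 0) (hP : P ≤ p ^ k) (hPQ : P ≤ p * Q) :
    vino k (k + s) (Finset.Ico 0 (P : ℤ)) ≤
      2 * (((k + s).factorial) ^ 2 * (k ^ k * p ^ (2 * s + k * (k - 1) / 2) * P ^ k *
        vino k s (Finset.Ico 0 (Q : ℤ)))) +
      2 * (((k - 1) ^ (k + s) * p ^ (k - 1)) ^ 2 *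
        (p * vino k (k + s) (Finset.Ico 0 (Q : ℤ)))) := by
  classical
  have : Nonempty (Fin k ⊕ Fin s) := ⟨Sum.inr ⟨0, by omega⟩⟩
  set X := Finset.Ico 0 (P : ℤ) with hX
  set T := tuples (Fin k ⊕ Fin s) X
  let D := {x ∈ T | #(univ.image fun i => x i % (p : ℤ)) < k}
  let E := {x ∈ T | ¬ #(univ.image fun i => x i % (p : ℤ)) < k}
  let U := {u ∈ tuples (Fin k) X | Function.Injective fun i => u i % (p : ℤ)}
  rw [vino, ← coincidences_equiv (finSumFinEquiv (m := k) (n := s)) X]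
  refine (coincidences_union_le D E (Finset.disjoint_filter_filter_not _ _ _)
    (Finset.filter_union_filter_not_eq _ _)).trans (Nat.add_le_add (Nat.mul_le_mul_left _ ?_)
    (Nat.mul_le_mul_left _ ?_))
  · refine (coincidences_covered_perm (p := p) X U (fun u h1 h2 => Finset.mem_filter.mpr ⟨h1, h2⟩) E
      fun x hx => ⟨(Finset.mem_filter.mp hx).1, not_lt.mp (Finset.mem_filter.mp hx).2⟩).trans ?_
    exact Nat.mul_le_mul_left _ (coincidences_nonsingular hp hk hkp hs hP hPQ U
      fun u hu => Finset.mem_filter.mp hu)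
  · have := coincidences_degenerate hp.pos hPQ D fun x hx => Finset.mem_filter.mp hx
    simpa using this

lemma vino_add_le (k s : ℕ) (X : Finset ℤ) : vino k (k + s) X ≤ (#X) ^ (2 * k) * vino k s X := by
  obtain ⟨S'⟩ := exists_characters k (differences k (Fin (k + s)) X ∪ differences k (Fin s) X)
  have h1 := S'.coincidences_self (ι := Fin (k + s)) (T := tuples _ X) fun x hx y hy =>
    Finset.mem_union_left _ (mem_differences subset_rfl subset_rfl x hx y hy)
  have h2 := S'.coincidences_self (ι := Fin s) (T := tuples _ X) fun x hx y hy =>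
    Finset.mem_union_right _ (mem_differences subset_rfl subset_rfl x hx y hy)
  have hcard : (0 : ℝ) < Fintype.card S'.idx := by exact_mod_cast Fintype.card_pos
  have : (vino k (k + s) X : ℝ) * Fintype.card S'.idx ≤
      (((#X) ^ (2 * k) * vino k s X : ℕ) : ℝ) * Fintype.card S'.idx := by
    push_cast
    rw [mul_assoc, vino, vino, h1, h2, Finset.mul_sum]
    refine Finset.sum_le_sum fun c _ => ?_
    have hle : ‖S'.weyl c X‖ ≤ #X := by
      refine (norm_sum_le _ _).trans ?_
      simp [S'.norm_eq]
    simp only [tuples, S'.expSum_piFinset, Finset.prod_const, Finset.card_univ, Fintype.card_fin,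
      norm_pow]
    calc _ = ‖S'.weyl c X‖ ^ (2 * k) * (‖S'.weyl c X‖ ^ s) ^ 2 := by ring
      _ ≤ _ := by gcongr
  exact_mod_cast le_of_mul_le_mul_right this hcard

lemma vino_trivial (k s P : ℕ) : vino k s (Finset.Ico 0 (P : ℤ)) ≤ P ^ (2 * s) := by
  refine (Finset.card_filter_le _ _).trans ?_
  rw [Finset.card_product]
  simp [tuples, Fintype.card_piFinset, ← pow_add, two_mul]

lemma cast_choose_half (k : ℕ) : ((k * (k - 1) / 2 : ℕ) : ℝ) = (k : ℝ) * (k - 1) / 2 := by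
  rw [Nat.cast_div (Nat.even_mul_pred_self k).two_dvd (by norm_num)]
  rcases k with _ | k
  · simp
  · push_cast; simp

lemma step_constant {k s : ℕ} (hk : 2 ≤ k) (hS : k + s ≤ 9 * k ^ 2) :
    2 * (((k + s).factorial : ℝ) ^ 2 * ((k : ℝ) ^ k * 4 ^ (k ^ 2) * 4 ^ s)) +
      2 * ((k : ℝ) ^ (2 * (k + s)) * 4 ^ (k + s)) ≤ (2 * k) ^ (85 * k ^ 2) := by
  have hk' : (2 : ℝ) ≤ k := by exact_mod_cast hk
  set b : ℝ := 2 * k with hb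
  have hb4 : 4 ≤ b := by linarith
  have hb1 : 1 ≤ b := by linarith
  have hk20 : (4 : ℝ) ≤ (k : ℝ) ^ 2 := by nlinarith
  have hf : ((k + s).factorial : ℝ) ≤ b ^ (36 * k ^ 2) := by
    have h1 : ((k + s).factorial : ℝ) ≤ ((9 * k ^ 2 : ℕ) : ℝ) ^ (9 * k ^ 2) := by
      exact_mod_cast (Nat.factorial_le hS).trans (Nat.factorial_le_pow _)
    refine h1.trans ?_
    rw [show b ^ (36 * k ^ 2) = (b ^ 4) ^ (9 * k ^ 2) by rw [← pow_mul]; ring_nf]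
    refine pow_le_pow_left₀ (Nat.cast_nonneg _) ?_ _
    push_cast
    rw [hb]
    nlinarith [mul_self_nonneg ((k : ℝ) ^ 2)]
  have h1 : (k : ℝ) ^ k ≤ b ^ (k ^ 2) := by
    calc (k : ℝ) ^ k ≤ b ^ k := by gcongr; rw [hb]; linarith
      _ ≤ _ := pow_le_pow_right₀ hb1 (by nlinarith)
  have h2 : (4 : ℝ) ^ (k ^ 2) ≤ b ^ (k ^ 2) := pow_le_pow_left₀ (by norm_num) hb4 _
  have h3 : (4 : ℝ) ^ s ≤ b ^ (9 * k ^ 2) :=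
    (pow_le_pow_left₀ (by norm_num) hb4 _).trans (pow_le_pow_right₀ hb1 (by omega))
  have h4 : (k : ℝ) ^ (2 * (k + s)) * 4 ^ (k + s) ≤ b ^ (18 * k ^ 2) := by
    calc (k : ℝ) ^ (2 * (k + s)) * 4 ^ (k + s) = b ^ (2 * (k + s)) := by
          rw [hb, mul_pow, pow_mul 2]; norm_num; ring
      _ ≤ _ := pow_le_pow_right₀ hb1 (by omega)
  have h5 : 2 * (b ^ (83 * k ^ 2)) + 2 * b ^ (18 * k ^ 2) ≤ b ^ (85 * k ^ 2) := by
    have : b ^ (18 * k ^ 2) ≤ b ^ (83 * k ^ 2) := pow_le_pow_right₀ hb1 (by omega)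
    have h6 : b ^ (83 * k ^ 2) * b ≤ b ^ (85 * k ^ 2) := by
      rw [← pow_succ]; exact pow_le_pow_right₀ hb1 (by nlinarith)
    nlinarith [pow_pos (show (0 : ℝ) < b by linarith) (83 * k ^ 2)]
  calc _ ≤ 2 * ((b ^ (36 * k ^ 2)) ^ 2 * (b ^ (k ^ 2) * b ^ (k ^ 2) * b ^ (9 * k ^ 2))) +
        2 * b ^ (18 * k ^ 2) := by gcongr
    _ = 2 * (b ^ (83 * k ^ 2)) + 2 * b ^ (18 * k ^ 2) := by
        rw [← pow_mul, ← pow_add, ← pow_add, ← pow_add]; ring_nf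
    _ ≤ _ := h5

lemma vino_step {k s : ℕ} (hk : 2 ≤ k) (hs : k ^ 2 ≤ s) (hS : k + s ≤ 9 * k ^ 2) {η D : ℝ}
    (hη0 : 0 ≤ η) (hη : η ≤ (k : ℝ) * (k + 1) / 2) (hD : (2 * k : ℝ) ^ (2 * k ^ 3) ≤ D)
    (h : ∀ Q : ℕ, 1 ≤ Q → (vino k s (Finset.Ico 0 (Q : ℤ)) : ℝ) ≤
      D * (Q : ℝ) ^ (2 * s - (k : ℝ) * (k + 1) / 2 + η)) (P : ℕ) (hP : 1 ≤ P) :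
    (vino k (k + s) (Finset.Ico 0 (P : ℤ)) : ℝ) ≤ D * (2 * k) ^ (85 * k ^ 2) *
      (P : ℝ) ^ (2 * ((k + s : ℕ) : ℝ) - (k : ℝ) * (k + 1) / 2 + (1 - 1 / k) * η) := by
  have hk' : (2 : ℝ) ≤ k := by exact_mod_cast hk
  have hk0 : (0 : ℝ) < k := by linarith
  have hs' : (k : ℝ) ^ 2 ≤ s := by exact_mod_cast hs
  have hP1 : (1 : ℝ) ≤ P := by exact_mod_cast hP
  have hP0 : (0 : ℝ) < P := by linarith
  have hb1 : (1 : ℝ) ≤ 2 * k := by linarith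
  have hDpos : 0 < D := lt_of_lt_of_le (by positivity) hD
  set κ : ℝ := (k : ℝ) * (k + 1) / 2 with hκ
  set e : ℝ := 2 * s - κ + η with he
  have hκk : κ ≤ (k : ℝ) ^ 2 := by rw [hκ]; nlinarith
  have he0 : 0 ≤ e := by rw [he]; nlinarith
  have heη : η ≤ e := by rw [he]; nlinarith
  have hes : e ≤ 2 * s := by rw [he]; linarith
  have hηk : 0 ≤ (1 - 1 / (k : ℝ)) * η := by
    refine mul_nonneg ?_ hη0
    rw [sub_nonneg, div_le_one hk0]; linarith
  have hstep1 : (1 : ℝ) ≤ (2 * k) ^ (85 * k ^ 2) := one_le_pow₀ hb1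
  set E : ℝ := 2 * ((k + s : ℕ) : ℝ) - κ + (1 - 1 / k) * η with hE
  have hEe : E = 2 * k + e - η / k := by
    rw [hE, he]; push_cast; field_simp; ring
  rcases lt_or_ge P ((4 * k) ^ k) with hsmall | hlarge
  · have h1 : (vino k (k + s) (Finset.Ico 0 (P : ℤ)) : ℝ) ≤ (P : ℝ) ^ (2 * (k + s)) := by
      exact_mod_cast vino_trivial k (k + s) P
    have h2 : (P : ℝ) ^ (2 * (k + s)) ≤ (P : ℝ) ^ (k ^ 2) * (P : ℝ) ^ E := by
      rw [← Real.rpow_natCast, ← Real.rpow_natCast, ← Real.rpow_add hP0]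
      refine Real.rpow_le_rpow_of_exponent_le hP1 ?_
      rw [hE]; push_cast; linarith
    have h3 : (P : ℝ) ^ (k ^ 2) ≤ D := by
      refine le_trans ?_ hD
      calc (P : ℝ) ^ (k ^ 2) ≤ (((4 * k : ℕ) : ℝ) ^ k) ^ (k ^ 2) := by
            gcongr; exact_mod_cast hsmall.le
        _ = ((4 * k : ℕ) : ℝ) ^ (k ^ 3) := by rw [← pow_mul]; ring_nf
        _ ≤ ((2 * k : ℝ) ^ 2) ^ (k ^ 3) := by
            gcongr; push_cast; nlinarith
        _ = _ := by rw [← pow_mul]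
    calc _ ≤ (P : ℝ) ^ (k ^ 2) * (P : ℝ) ^ E := h1.trans h2
      _ ≤ (D * (2 * k) ^ (85 * k ^ 2)) * (P : ℝ) ^ E := by
          gcongr
          exact h3.trans (le_mul_of_one_le_right hDpos.le hstep1)
  · set y : ℝ := (P : ℝ) ^ (1 / (k : ℝ)) with hy
    have hyk : y ^ k = P := by
      rw [hy, ← Real.rpow_natCast, ← Real.rpow_mul hP0.le]; field_simp; simp
    have hy0 : 0 < y := by positivity
    have hy4 : 4 * k ≤ y := by
      have : ((4 * k : ℝ)) ^ k ≤ y ^ k := by rw [hyk]; exact_mod_cast hlarge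
      exact le_of_pow_le_pow_left₀ (by omega) hy0.le this
    obtain ⟨p, hp, hp1, hp2⟩ := Nat.exists_prime_lt_and_le_two_mul ⌈y⌉₊
      (Nat.ceil_pos.mpr hy0).ne'
    have hpy : y ≤ p := (Nat.le_ceil y).trans (by exact_mod_cast hp1.le)
    have hpy4 : (p : ℝ) ≤ 4 * y := by
      have h1 : (p : ℝ) ≤ 2 * ⌈y⌉₊ := by exact_mod_cast hp2
      have h2 := Nat.ceil_lt_add_one hy0.le
      linarith
    have hp0 : (0 : ℝ) < p := by linarith
    have hkp : k < p := by
      have : (k : ℝ) < p := by linarith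
      exact_mod_cast this
    have hPp : P ≤ p ^ k := by
      have : (P : ℝ) ≤ (p : ℝ) ^ k := by rw [← hyk]; gcongr
      exact_mod_cast this
    have hpP : (p : ℝ) ≤ P := by
      rw [← hyk]
      calc (p : ℝ) ≤ 4 * y := hpy4
        _ ≤ y * y := by gcongr; linarith
        _ = y ^ 2 := by ring
        _ ≤ y ^ k := pow_le_pow_right₀ (by linarith) hk
    set Q : ℕ := ⌈(P : ℝ) / p⌉₊ with hQ
    have hQ1 : 1 ≤ Q := Nat.one_le_iff_ne_zero.mpr (Nat.ceil_pos.mpr (by positivity)).ne'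
    have hQP : (Q : ℝ) ≤ 2 * P / p := by
      have h1 := Nat.ceil_lt_add_one (show 0 ≤ (P : ℝ) / p by positivity)
      have h2 : 1 ≤ (P : ℝ) / p := by rw [le_div_iff₀ hp0]; linarith
      calc (Q : ℝ) ≤ P / p + 1 := h1.le
        _ ≤ P / p + P / p := by linarith
        _ = _ := by ring
    have hPQ : P ≤ p * Q := by
      have h1 := Nat.le_ceil ((P : ℝ) / p)
      rw [div_le_iff₀ hp0] at h1
      have : (P : ℝ) ≤ p * Q := by rw [mul_comm]; exact h1
      exact_mod_cast this
    have hrec := vino_recursion (k := k) (s := s) hp (by omega) hkp (by nlinarith) hPp hPQ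
    have hrec' : (vino k (k + s) (Finset.Ico 0 (P : ℤ)) : ℝ) ≤
        2 * (((k + s).factorial : ℝ) ^ 2 * ((k : ℝ) ^ k * (p : ℝ) ^ (2 * s + k * (k - 1) / 2) *
          (P : ℝ) ^ k * vino k s (Finset.Ico 0 (Q : ℤ)))) +
        2 * ((((k - 1 : ℕ) : ℝ) ^ (k + s) * (p : ℝ) ^ (k - 1)) ^ 2 *
          (p * vino k (k + s) (Finset.Ico 0 (Q : ℤ)))) := by exact_mod_cast hrec
    have hJ := h Q hQ1
    have hJ2 : (vino k (k + s) (Finset.Ico 0 (Q : ℤ)) : ℝ) ≤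
        (Q : ℝ) ^ (2 * k) * (D * (Q : ℝ) ^ e) := by
      have h1 : (vino k (k + s) (Finset.Ico 0 (Q : ℤ)) : ℝ) ≤
        (Q : ℝ) ^ (2 * k) * vino k s (Finset.Ico 0 (Q : ℤ)) := by
        have := vino_add_le k s (Finset.Ico 0 (Q : ℤ))
        rw [Int.card_Ico, sub_zero, Int.toNat_natCast] at this
        exact_mod_cast this
      exact h1.trans (mul_le_mul_of_nonneg_left hJ (by positivity))
    have hQe : (Q : ℝ) ^ e ≤ 4 ^ s * ((P : ℝ) ^ e * (p : ℝ) ^ (-e)) := by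
      calc (Q : ℝ) ^ e ≤ (2 * P / p) ^ e := Real.rpow_le_rpow (by positivity) hQP he0
        _ = 2 ^ e * ((P : ℝ) ^ e * (p : ℝ) ^ (-e)) := by
            rw [Real.div_rpow (by positivity) hp0.le, Real.mul_rpow (by norm_num) hP0.le,
              Real.rpow_neg hp0.le]; ring
        _ ≤ _ := by
            gcongr
            calc (2 : ℝ) ^ e ≤ 2 ^ (2 * s : ℝ) :=
                  Real.rpow_le_rpow_of_exponent_le (by norm_num) hes
              _ = 4 ^ s := by
                  rw [Real.rpow_mul (by norm_num), Real.rpow_natCast]; norm_num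
    have hT1 : (p : ℝ) ^ (2 * s + k * (k - 1) / 2) * (P : ℝ) ^ k * ((P : ℝ) ^ e * (p : ℝ) ^ (-e)) ≤
        4 ^ (k ^ 2) * (P : ℝ) ^ E := by
      have hpe : (p : ℝ) ^ (2 * s + k * (k - 1) / 2) * (p : ℝ) ^ (-e) = (p : ℝ) ^ ((k : ℝ) ^ 2 - η) := by
        rw [← Real.rpow_natCast, ← Real.rpow_add hp0]
        congr 1
        rw [Nat.cast_add, cast_choose_half, he, hκ]; push_cast; ring
      have hk2 : 0 ≤ (k : ℝ) ^ 2 - η := by linarith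
      have hpe2 : (p : ℝ) ^ ((k : ℝ) ^ 2 - η) ≤ 4 ^ (k ^ 2) * (P : ℝ) ^ (k - η / k : ℝ) := by
        calc (p : ℝ) ^ ((k : ℝ) ^ 2 - η) ≤ (4 * y) ^ ((k : ℝ) ^ 2 - η) :=
              Real.rpow_le_rpow hp0.le hpy4 hk2
          _ = 4 ^ ((k : ℝ) ^ 2 - η) * (P : ℝ) ^ (k - η / k : ℝ) := by
              rw [Real.mul_rpow (by norm_num) hy0.le, hy, ← Real.rpow_mul hP0.le]
              congr 2; field_simp
          _ ≤ _ := by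
              refine mul_le_mul_of_nonneg_right ?_ (by positivity)
              rw [← Real.rpow_natCast 4 (k ^ 2)]
              refine Real.rpow_le_rpow_of_exponent_le (by norm_num) ?_
              push_cast; linarith
      calc _ = ((p : ℝ) ^ (2 * s + k * (k - 1) / 2) * (p : ℝ) ^ (-e)) * ((P : ℝ) ^ k * (P : ℝ) ^ e) := by
            ring
        _ ≤ (4 ^ (k ^ 2) * (P : ℝ) ^ (k - η / k : ℝ)) * ((P : ℝ) ^ k * (P : ℝ) ^ e) := by
            rw [hpe]; gcongr
        _ = 4 ^ (k ^ 2) * (P : ℝ) ^ E := by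
            rw [mul_assoc, ← Real.rpow_natCast (P : ℝ), ← Real.rpow_add hP0, ← Real.rpow_add hP0, hEe]
            congr 2; ring
    have hT2 : ((p : ℝ) ^ (k - 1)) ^ 2 * p * (Q : ℝ) ^ (2 * k) * ((P : ℝ) ^ e * (p : ℝ) ^ (-e)) ≤
        4 ^ k * (P : ℝ) ^ E := by
      have h1 : ((p : ℝ) ^ (k - 1)) ^ 2 * p ≤ (p : ℝ) ^ (2 * k) := by
        rw [← pow_mul, ← pow_succ]
        refine pow_le_pow_right₀ (by linarith) (by omega)
      have h2 : (Q : ℝ) ^ (2 * k) ≤ 4 ^ k * ((P : ℝ) ^ (2 * k) / (p : ℝ) ^ (2 * k)) := by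
        calc (Q : ℝ) ^ (2 * k) ≤ (2 * P / p) ^ (2 * k) := by gcongr
          _ = _ := by rw [div_pow, mul_pow, pow_mul 2]; norm_num; ring
      have h3 : (p : ℝ) ^ (-e) ≤ (P : ℝ) ^ (-(η / k)) := by
        calc (p : ℝ) ^ (-e) ≤ y ^ (-e) := Real.rpow_le_rpow_of_nonpos hy0 hpy (by linarith)
          _ = (P : ℝ) ^ (-(e / k)) := by
              rw [hy, ← Real.rpow_mul hP0.le]; congr 1; ring
          _ ≤ _ := Real.rpow_le_rpow_of_exponent_le hP1 (by gcongr)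
      calc _ ≤ (p : ℝ) ^ (2 * k) * (4 ^ k * ((P : ℝ) ^ (2 * k) / (p : ℝ) ^ (2 * k))) *
            ((P : ℝ) ^ e * (P : ℝ) ^ (-(η / k))) := by gcongr
        _ = 4 ^ k * ((P : ℝ) ^ (2 * k) * ((P : ℝ) ^ e * (P : ℝ) ^ (-(η / k)))) := by
            field_simp
        _ = _ := by
            rw [← Real.rpow_natCast (P : ℝ), ← Real.rpow_add hP0, ← Real.rpow_add hP0, hEe]
            congr 2; push_cast; ring
    have hk1 : ((k - 1 : ℕ) : ℝ) ≤ k := by exact_mod_cast Nat.sub_le k 1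
    calc _ ≤ _ := hrec'
      _ ≤ 2 * (((k + s).factorial : ℝ) ^ 2 * ((k : ℝ) ^ k * (p : ℝ) ^ (2 * s + k * (k - 1) / 2) *
          (P : ℝ) ^ k * (D * (4 ^ s * ((P : ℝ) ^ e * (p : ℝ) ^ (-e)))))) +
        2 * (((k : ℝ) ^ (k + s) * (p : ℝ) ^ (k - 1)) ^ 2 *
          (p * ((Q : ℝ) ^ (2 * k) * (D * (4 ^ s * ((P : ℝ) ^ e * (p : ℝ) ^ (-e))))))) := by
          gcongr
          · exact hJ.trans (by gcongr)
          · exact hJ2.trans (by gcongr)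
      _ = D * (2 * (((k + s).factorial : ℝ) ^ 2 * ((k : ℝ) ^ k * 4 ^ s *
          ((p : ℝ) ^ (2 * s + k * (k - 1) / 2) * (P : ℝ) ^ k * ((P : ℝ) ^ e * (p : ℝ) ^ (-e))))) +
        2 * ((k : ℝ) ^ (2 * (k + s)) * 4 ^ s * (((p : ℝ) ^ (k - 1)) ^ 2 * p * (Q : ℝ) ^ (2 * k) *
          ((P : ℝ) ^ e * (p : ℝ) ^ (-e))))) := by
          rw [mul_comm 2 (k + s), pow_mul]; ring
      _ ≤ D * (2 * (((k + s).factorial : ℝ) ^ 2 * ((k : ℝ) ^ k * 4 ^ s *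
          (4 ^ (k ^ 2) * (P : ℝ) ^ E))) +
        2 * ((k : ℝ) ^ (2 * (k + s)) * 4 ^ s * (4 ^ k * (P : ℝ) ^ E))) := by gcongr
      _ = D * (2 * (((k + s).factorial : ℝ) ^ 2 * ((k : ℝ) ^ k * 4 ^ (k ^ 2) * 4 ^ s)) +
          2 * ((k : ℝ) ^ (2 * (k + s)) * 4 ^ (k + s))) * (P : ℝ) ^ E := by
          rw [pow_add 4 k s]; ring
      _ ≤ D * (2 * k) ^ (85 * k ^ 2) * (P : ℝ) ^ E := by
          gcongr
          exact step_constant hk hS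

lemma vino_iterate {k : ℕ} (hk : 2 ≤ k) (r : ℕ) (hr : r ≤ 8 * k) (P : ℕ) (hP : 1 ≤ P) :
    (vino k (k ^ 2 + r * k) (Finset.Ico 0 (P : ℤ)) : ℝ) ≤ (2 * k) ^ (2 * k ^ 3 + r * (85 * k ^ 2)) *
      (P : ℝ) ^ (2 * ((k ^ 2 + r * k : ℕ) : ℝ) - (k : ℝ) * (k + 1) / 2 +
        (1 - 1 / (k : ℝ)) ^ r * ((k : ℝ) * (k + 1) / 2)) := by
  have hk' : (2 : ℝ) ≤ k := by exact_mod_cast hk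
  have hb1 : (1 : ℝ) ≤ 2 * k := by linarith
  have hq0 : 0 ≤ 1 - 1 / (k : ℝ) := by
    rw [sub_nonneg, div_le_one (by linarith)]; linarith
  have hq1 : 1 - 1 / (k : ℝ) ≤ 1 := by
    have : 0 ≤ 1 / (k : ℝ) := by positivity
    linarith
  induction r generalizing P with
  | zero =>
    have h1 : (vino k (k ^ 2) (Finset.Ico 0 (P : ℤ)) : ℝ) ≤ (P : ℝ) ^ (2 * k ^ 2) := by
      exact_mod_cast vino_trivial k (k ^ 2) P
    simp only [zero_mul, add_zero, pow_zero, one_mul, sub_add_cancel]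
    refine h1.trans ?_
    rw [← Real.rpow_natCast]
    push_cast
    exact le_mul_of_one_le_left (by positivity) (one_le_pow₀ hb1)
  | succ r ih =>
    have := vino_step (s := k ^ 2 + r * k) hk (by omega) (by nlinarith) (η := (1 - 1 / (k : ℝ)) ^ r * ((k : ℝ) * (k + 1) / 2))
      (by positivity) (mul_le_of_le_one_left (by positivity) (pow_le_one₀ hq0 hq1))
      (pow_le_pow_right₀ hb1 (by omega)) (fun Q hQ => ih (by omega) Q hQ) P hP
    rw [show k ^ 2 + (r + 1) * k = k + (k ^ 2 + r * k) by ring,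
      show 2 * k ^ 3 + (r + 1) * (85 * k ^ 2) = 2 * k ^ 3 + r * (85 * k ^ 2) + 85 * k ^ 2 by ring,
      pow_add (2 * (k : ℝ)) _ (85 * k ^ 2), pow_succ' (1 - 1 / (k : ℝ)) r, mul_assoc (1 - 1 / (k : ℝ))]
    exact this

/-- Vinogradov's mean value theorem in a form with explicit uniformity. -/
theorem vino_mean_value {k : ℕ} (hk : 2 ≤ k) (P : ℕ) (hP : 1 ≤ P) :
    (vino k (9 * k ^ 2) (Finset.Ico 0 (P : ℤ)) : ℝ) ≤ (2 * k) ^ (682 * k ^ 3) *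
      (P : ℝ) ^ (2 * (9 * (k : ℝ) ^ 2) - (k : ℝ) * (k + 1) / 2 + k ^ 2 * Real.exp (-8)) := by
  have hk' : (2 : ℝ) ≤ k := by exact_mod_cast hk
  have hP1 : (1 : ℝ) ≤ P := by exact_mod_cast hP
  have h := vino_iterate hk (8 * k) le_rfl P hP
  rw [show k ^ 2 + 8 * k * k = 9 * k ^ 2 by ring,
    show 2 * k ^ 3 + 8 * k * (85 * k ^ 2) = 682 * k ^ 3 by ring] at h
  refine h.trans ?_
  gcongr ?_ * ?_
  refine Real.rpow_le_rpow_of_exponent_le hP1 ?_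
  push_cast
  have h1 : (1 - 1 / (k : ℝ)) ^ (8 * k) ≤ Real.exp (-8) := by
    have h2 : 1 - 1 / (k : ℝ) ≤ Real.exp (-(1 / k)) := by
      have := Real.add_one_le_exp (-(1 / (k : ℝ))); linarith
    have h3 : 0 ≤ 1 - 1 / (k : ℝ) := by
      rw [sub_nonneg, div_le_one (by linarith)]; linarith
    refine (pow_le_pow_left₀ h3 h2 _).trans ?_
    rw [← Real.exp_nat_mul]
    refine Real.exp_le_exp.mpr (le_of_eq ?_)
    push_cast; field_simp
  have h2 : (k : ℝ) * (k + 1) / 2 ≤ k ^ 2 := by nlinarith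
  have := mul_le_mul h1 h2 (by positivity) (Real.exp_pos _).le
  linarith

/-- The bilinear phase `∑ a_j u_j v_j`. -/
def phase {k : ℕ} (a : Fin k → ℝ) (u v : Fin k → ℤ) : ℝ := ∑ j, a j * u j * v j

lemma phase_comm {k : ℕ} (a : Fin k → ℝ) (u v : Fin k → ℤ) : phase a u v = phase a v u :=
  Finset.sum_congr rfl fun j _ => by ring

lemma phase_add {k : ℕ} (a : Fin k → ℝ) (u v w : Fin k → ℤ) :
    phase a u (v + w) = phase a u v + phase a u w := by
  simp [phase, mul_add, Finset.sum_add_distrib]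

lemma phase_sub {k : ℕ} (a : Fin k → ℝ) (u v w : Fin k → ℤ) :
    phase a u (v - w) = phase a u v - phase a u w := by
  simp [phase, mul_sub, Finset.sum_sub_distrib]

lemma phase_sum {k : ℕ} (a : Fin k → ℝ) (u : Fin k → ℤ) {ι : Type*} (s : Finset ι)
    (v : ι → Fin k → ℤ) : phase a u (∑ i ∈ s, v i) = ∑ i ∈ s, phase a u (v i) := by
  classical
  induction s using Finset.induction_on with
  | empty => simp [phase]
  | insert b s hb ih => rw [Finset.sum_insert hb, Finset.sum_insert hb, phase_add, ih]

/-- `exp (i v)`. -/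
noncomputable def ex (v : ℝ) : ℂ := Complex.exp (v * Complex.I)

lemma norm_ex (v : ℝ) : ‖ex v‖ = 1 := Complex.norm_exp_ofReal_mul_I v

lemma ex_add (u v : ℝ) : ex (u + v) = ex u * ex v := by
  rw [ex, ex, ex, ← Complex.exp_add]; push_cast; ring_nf

lemma ex_neg (v : ℝ) : ex (-v) = starRingEnd ℂ (ex v) := by
  rw [ex, ex, ← Complex.exp_conj]; simp

lemma ex_sum {ι : Type*} (s : Finset ι) (v : ι → ℝ) : ex (∑ i ∈ s, v i) = ∏ i ∈ s, ex (v i) := by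
  rw [ex, Complex.ofReal_sum, Finset.sum_mul, Complex.exp_sum]; rfl

/-- The linear form sum. -/
noncomputable def lin {k : ℕ} (a : Fin k → ℝ) (X : Finset ℤ) (u : Fin k → ℤ) : ℂ :=
  ∑ x ∈ X, ex (phase a u (powers k x))

lemma norm_lin_pow {k : ℕ} (a : Fin k → ℝ) (X : Finset ℤ) (u : Fin k → ℤ) (s : ℕ) :
    ((‖lin a X u‖ ^ (2 * s) : ℝ) : ℂ) = ∑ z ∈ tuples (Fin s) X ×ˢ tuples (Fin s) X,
      ex (phase a u (powerSums k z.1 - powerSums k z.2)) := by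
  have h1 : lin a X u ^ s = ∑ x ∈ tuples (Fin s) X, ex (phase a u (powerSums k x)) := by
    have : lin a X u ^ s = ∏ _i : Fin s, lin a X u := by simp
    rw [this]
    unfold lin tuples
    rw [Finset.prod_univ_sum]
    exact Finset.sum_congr rfl fun x _ => by rw [powerSums_eq_sum, phase_sum, ex_sum]
  have h2 : ((‖lin a X u‖ ^ (2 * s) : ℝ) : ℂ) = lin a X u ^ s * starRingEnd ℂ (lin a X u ^ s) := by
    rw [Complex.mul_conj, Complex.normSq_eq_norm_sq, norm_pow, ← pow_mul, mul_comm s]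
  rw [h2, h1, map_sum, Finset.sum_mul_sum, Finset.sum_product]
  refine Finset.sum_congr rfl fun x _ => Finset.sum_congr rfl fun y _ => ?_
  rw [phase_sub, sub_eq_add_neg, ex_add, ex_neg]

/-- A box containing all differences of power sums. -/
noncomputable def box (k s M : ℕ) : Finset (Fin k → ℤ) :=
  Fintype.piFinset fun j : Fin k =>
    Finset.Icc (-((s * M ^ ((j : ℕ) + 1) : ℕ) : ℤ)) ((s * M ^ ((j : ℕ) + 1) : ℕ) : ℤ)

lemma sub_mem_box {k s M : ℕ} {z : (Fin s → ℤ) × (Fin s → ℤ)}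
    (hz : z ∈ tuples (Fin s) (Finset.Ico 0 (M : ℤ)) ×ˢ tuples (Fin s) (Finset.Ico 0 (M : ℤ))) :
    powerSums k z.1 - powerSums k z.2 ∈ box k s M := by
  have key : ∀ x ∈ tuples (Fin s) (Finset.Ico 0 (M : ℤ)), ∀ j : Fin k,
      0 ≤ powerSums k x j ∧ powerSums k x j ≤ ((s * M ^ ((j : ℕ) + 1) : ℕ) : ℤ) := by
    intro x hx j
    have hx' := fun i => Finset.mem_Ico.mp (Fintype.mem_piFinset.mp hx i)
    refine ⟨Finset.sum_nonneg fun i _ => pow_nonneg (hx' i).1 _, ?_⟩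
    calc powerSums k x j ≤ ∑ _i : Fin s, (M : ℤ) ^ ((j : ℕ) + 1) :=
          Finset.sum_le_sum fun i _ => pow_le_pow_left₀ (hx' i).1 (hx' i).2.le _
      _ = _ := by simp
  rw [Finset.mem_product] at hz
  refine Fintype.mem_piFinset.mpr fun j => Finset.mem_Icc.mpr ?_
  have h1 := key _ hz.1 j
  have h2 := key _ hz.2 j
  rw [Pi.sub_apply]
  constructor <;> linarith

lemma sum_differences_le {k s M : ℕ} (g : (Fin k → ℤ) → ℝ) (hg : ∀ v, 0 ≤ g v) :
    ∑ z ∈ tuples (Fin s) (Finset.Ico 0 (M : ℤ)) ×ˢ tuples (Fin s) (Finset.Ico 0 (M : ℤ)),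
      g (powerSums k z.1 - powerSums k z.2) ≤
    vino k s (Finset.Ico 0 (M : ℤ)) * ∑ v ∈ box k s M, g v := by
  classical
  rw [← Finset.sum_fiberwise_of_maps_to (fun z hz => sub_mem_box hz), Finset.mul_sum]
  refine Finset.sum_le_sum fun v _ => ?_
  rw [Finset.sum_congr rfl (g := fun _ => g v) fun z hz => by rw [(Finset.mem_filter.mp hz).2],
    Finset.sum_const, nsmul_eq_mul]
  refine mul_le_mul_of_nonneg_right ?_ (hg v)
  have := card_offset_le (tuples (Fin s) (Finset.Ico 0 (M : ℤ))) (powerSums k) v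
  have h2 : #{z ∈ tuples (Fin s) (Finset.Ico 0 (M : ℤ)) ×ˢ tuples (Fin s) (Finset.Ico 0 (M : ℤ)) |
      powerSums k z.1 - powerSums k z.2 = v} = #{z ∈ tuples (Fin s) (Finset.Ico 0 (M : ℤ)) ×ˢ
        tuples (Fin s) (Finset.Ico 0 (M : ℤ)) | powerSums k z.1 = powerSums k z.2 + v} := by
    congr 1
    refine Finset.filter_congr fun z _ => ?_
    rw [sub_eq_iff_eq_add']
  exact_mod_cast h2 ▸ this

/-- The one-dimensional factor. -/
noncomputable def wsum (a : ℝ) (L : ℕ) : ℝ :=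
  ∑ m ∈ Finset.Icc (-(L : ℤ)) L, ‖∑ l ∈ Finset.Icc (-(L : ℤ)) L, ex (a * l * m)‖

/-- Vinogradov's estimate for bilinear Weyl sums. -/
lemma bilinear_bound {k s : ℕ} (hs : s ≠ 0) (a : Fin k → ℝ) (M : ℕ) :
    ‖∑ x ∈ Finset.Ico 0 (M : ℤ), ∑ y ∈ Finset.Ico 0 (M : ℤ),
      ex (phase a (powers k x) (powers k y))‖ ^ (2 * s * (2 * s)) ≤
    (M : ℝ) ^ ((2 * s - 1) * (2 * s)) * ((M : ℝ) ^ (2 * s)) ^ (2 * s - 1) *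
      (vino k s (Finset.Ico 0 (M : ℤ)) : ℝ) ^ 2 *
      ∏ j : Fin k, wsum (a j) (s * M ^ ((j : ℕ) + 1)) := by
  classical
  set X := Finset.Ico 0 (M : ℤ) with hX
  set T := tuples (Fin s) X with hT
  have hXc : #X = M := by simp [hX]
  have hTc : #(T ×ˢ T) = M ^ (2 * s) := by
    rw [Finset.card_product, hT, tuples, Fintype.card_piFinset]
    simp [hX, ← pow_add, two_mul]
  have h2s : 2 * s - 1 + 1 = 2 * s := by omega
  have step1 : ‖∑ x ∈ X, ∑ y ∈ X, ex (phase a (powers k x) (powers k y))‖ ^ (2 * s) ≤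
      (M : ℝ) ^ (2 * s - 1) * ∑ z ∈ T ×ˢ T, ‖lin a X (powerSums k z.1 - powerSums k z.2)‖ := by
    have h1 : ‖∑ x ∈ X, ∑ y ∈ X, ex (phase a (powers k x) (powers k y))‖ ≤
        ∑ x ∈ X, ‖lin a X (powers k x)‖ := norm_sum_le _ _
    have h2 := pow_sum_le_card_mul_sum_pow (s := X)
      (f := fun x => ‖lin a X (powers k x)‖) (fun b _ => norm_nonneg _) (2 * s - 1)
    rw [h2s, hXc] at h2
    refine (pow_le_pow_left₀ (norm_nonneg _) h1 _).trans (h2.trans ?_)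
    gcongr
    have h3 : ((∑ x ∈ X, ‖lin a X (powers k x)‖ ^ (2 * s) : ℝ) : ℂ) =
        ∑ z ∈ T ×ˢ T, lin a X (powerSums k z.1 - powerSums k z.2) := by
      rw [Complex.ofReal_sum, Finset.sum_congr rfl fun x _ => norm_lin_pow a X _ s,
        Finset.sum_comm]
      exact Finset.sum_congr rfl fun z _ => Finset.sum_congr rfl fun x _ => by rw [phase_comm]
    have h4 : ∑ x ∈ X, ‖lin a X (powers k x)‖ ^ (2 * s) =
        ‖∑ z ∈ T ×ˢ T, lin a X (powerSums k z.1 - powerSums k z.2)‖ := by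
      rw [← h3, Complex.norm_real, Real.norm_of_nonneg]
      positivity
    rw [h4]
    exact norm_sum_le _ _
  have step2 : (∑ z ∈ T ×ˢ T, ‖lin a X (powerSums k z.1 - powerSums k z.2)‖) ^ (2 * s) ≤
      ((M : ℝ) ^ (2 * s)) ^ (2 * s - 1) * (vino k s X * ∑ u ∈ box k s M, ‖lin a X u‖ ^ (2 * s)) := by
    have h2 := pow_sum_le_card_mul_sum_pow (s := T ×ˢ T)
      (f := fun z => ‖lin a X (powerSums k z.1 - powerSums k z.2)‖)
      (fun b _ => norm_nonneg _) (2 * s - 1)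
    rw [h2s, hTc] at h2
    push_cast at h2
    refine h2.trans ?_
    gcongr
    exact sum_differences_le (fun u => ‖lin a X u‖ ^ (2 * s)) fun v => by positivity
  have step3 : ∑ u ∈ box k s M, ‖lin a X u‖ ^ (2 * s) ≤
      vino k s X * ∏ j : Fin k, wsum (a j) (s * M ^ ((j : ℕ) + 1)) := by
    have h3 : ((∑ u ∈ box k s M, ‖lin a X u‖ ^ (2 * s) : ℝ) : ℂ) =
        ∑ z ∈ T ×ˢ T, ∑ u ∈ box k s M, ex (phase a u (powerSums k z.1 - powerSums k z.2)) := by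
      rw [Complex.ofReal_sum, Finset.sum_congr rfl fun x _ => norm_lin_pow a X _ s,
        Finset.sum_comm]
    have h4 : ∑ u ∈ box k s M, ‖lin a X u‖ ^ (2 * s) =
        ‖∑ z ∈ T ×ˢ T, ∑ u ∈ box k s M, ex (phase a u (powerSums k z.1 - powerSums k z.2))‖ := by
      rw [← h3, Complex.norm_real, Real.norm_of_nonneg]
      positivity
    rw [h4]
    refine (norm_sum_le _ _).trans ((sum_differences_le
      (fun v => ‖∑ u ∈ box k s M, ex (phase a u v)‖) fun v => norm_nonneg _).trans ?_)
    gcongr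
    have h5 : ∀ v : Fin k → ℤ, ‖∑ u ∈ box k s M, ex (phase a u v)‖ =
        ∏ j : Fin k, ‖∑ l ∈ Finset.Icc (-((s * M ^ ((j : ℕ) + 1) : ℕ) : ℤ))
          ((s * M ^ ((j : ℕ) + 1) : ℕ) : ℤ), ex (a j * l * v j)‖ := by
      intro v
      rw [← norm_prod, Finset.prod_univ_sum]
      congr 1
      refine Finset.sum_congr rfl fun u _ => ?_
      rw [phase, ex_sum]
    simp only [h5]
    unfold wsum
    rw [Finset.prod_univ_sum]
    exact le_rfl
  calc _ = (‖∑ x ∈ X, ∑ y ∈ X, ex (phase a (powers k x) (powers k y))‖ ^ (2 * s)) ^ (2 * s) := by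
        rw [← pow_mul]
    _ ≤ ((M : ℝ) ^ (2 * s - 1) * ∑ z ∈ T ×ˢ T,
          ‖lin a X (powerSums k z.1 - powerSums k z.2)‖) ^ (2 * s) := by gcongr
    _ ≤ (M : ℝ) ^ ((2 * s - 1) * (2 * s)) * (((M : ℝ) ^ (2 * s)) ^ (2 * s - 1) *
          (vino k s X * (vino k s X * ∏ j : Fin k, wsum (a j) (s * M ^ ((j : ℕ) + 1))))) := by
        rw [mul_pow, ← pow_mul]
        gcongr
        exact step2.trans (by gcongr)
    _ = _ := by ring

lemma norm_ex_sub_one (v : ℝ) : ‖ex v - 1‖ = 2 * |Real.sin (v / 2)| := by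
  rw [ex, mul_comm]
  simpa [Real.norm_eq_abs, abs_mul] using Complex.norm_exp_I_mul_ofReal_sub_one v

lemma norm_geom_le {v : ℝ} (hv0 : v ≠ 0) (hv : |v| ≤ 1) (L : ℕ) :
    ‖∑ l ∈ Finset.Icc (-(L : ℤ)) L, ex (v * l)‖ ≤ 4 / |v| := by
  have hpos : 0 < |v| := abs_pos.mpr hv0
  have hsin : |v| / π ≤ |Real.sin (v / 2)| := by
    have h := Real.mul_le_sin (x := |v| / 2) (by positivity) (by linarith [Real.pi_gt_three])
    have h2 : |Real.sin (v / 2)| = |Real.sin (|v| / 2)| := by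
      rcases abs_cases v with ⟨h, -⟩ | ⟨h, -⟩ <;> rw [h]
      rw [neg_div, Real.sin_neg, abs_neg]
    rw [h2]
    refine le_trans (le_of_eq ?_) (h.trans (le_abs_self _))
    ring
  have hne : 0 < ‖ex v - 1‖ := by
    rw [norm_ex_sub_one]
    have : 0 < |v| / π := by positivity
    linarith
  have h1 : (∑ l ∈ Finset.Icc (-(L : ℤ)) L, ex (v * l)) * (ex v - 1) =
      ex (v * (L + 1)) - ex (v * (-L)) := by
    have : ∀ n : ℕ, (∑ l ∈ Finset.Ico (-(L : ℤ)) (-L + n), ex (v * l)) * (ex v - 1) =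
        ex (v * (-L + n)) - ex (v * (-L)) := by
      intro n
      induction n with
      | zero => simp
      | succ n ih =>
        have hsplit : Finset.Ico (-(L : ℤ)) (-L + (n + 1 : ℕ)) =
            insert (-(L : ℤ) + n) (Finset.Ico (-(L : ℤ)) (-L + n)) := by
          ext x; simp only [Finset.mem_Ico, Finset.mem_insert]; push_cast; omega
        rw [hsplit, Finset.sum_insert (by simp), add_mul, ih, mul_sub, ← ex_add]
        push_cast
        ring_nf
    have h2 := this (2 * L + 1)
    have h3 : Finset.Ico (-(L : ℤ)) (-L + (2 * L + 1 : ℕ)) = Finset.Icc (-(L : ℤ)) L := by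
      ext x; simp only [Finset.mem_Ico, Finset.mem_Icc]; push_cast; omega
    rw [h3] at h2
    rw [h2]
    push_cast
    ring_nf
  have h2 : ‖∑ l ∈ Finset.Icc (-(L : ℤ)) L, ex (v * l)‖ * ‖ex v - 1‖ ≤ 2 := by
    rw [← norm_mul, h1]
    refine (norm_sub_le _ _).trans ?_
    rw [norm_ex, norm_ex]; norm_num
  rw [le_div_iff₀ hpos]
  have h3 : |v| ≤ 2 * ‖ex v - 1‖ := by
    rw [norm_ex_sub_one]
    rw [div_le_iff₀ Real.pi_pos] at hsin
    nlinarith [Real.pi_le_four, abs_nonneg (Real.sin (v / 2))]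
  nlinarith [norm_nonneg (∑ l ∈ Finset.Icc (-(L : ℤ)) L, ex (v * l))]

lemma norm_sum_ex_le (v : ℝ) (L : ℕ) :
    ‖∑ l ∈ Finset.Icc (-(L : ℤ)) L, ex (v * l)‖ ≤ 2 * L + 1 := by
  refine (norm_sum_le _ _).trans ?_
  simp only [norm_ex, Finset.sum_const, Int.card_Icc, nsmul_eq_mul, mul_one]
  have : ((L : ℤ) + 1 - -(L : ℤ)).toNat = 2 * L + 1 := by omega
  rw [this]; push_cast; exact le_rfl

lemma wsum_trivial (a : ℝ) (L : ℕ) : wsum a L ≤ (2 * L + 1 : ℝ) ^ 2 := by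
  have h : ∀ m ∈ Finset.Icc (-(L : ℤ)) L,
      ‖∑ l ∈ Finset.Icc (-(L : ℤ)) L, ex (a * l * m)‖ ≤ (2 * L + 1 : ℝ) := by
    intro m _
    have := norm_sum_ex_le (a * m) L
    simpa only [mul_right_comm] using this
  refine (Finset.sum_le_card_nsmul _ _ _ h).trans ?_
  have : ((L : ℤ) + 1 - -(L : ℤ)).toNat = 2 * L + 1 := by omega
  rw [Int.card_Icc, this, nsmul_eq_mul]
  push_cast; nlinarith

lemma sum_inv_sqrt_le (L : ℕ) : ∑ m ∈ Finset.Icc 1 L, 1 / √(m : ℝ) ≤ 2 * √L := by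
  induction L with
  | zero => simp
  | succ L ih =>
    rw [Finset.sum_Icc_succ_top (by omega)]
    have h1 : 0 < √((L + 1 : ℕ) : ℝ) := Real.sqrt_pos.mpr (by positivity)
    have h2 := Real.sq_sqrt (show (0 : ℝ) ≤ ((L + 1 : ℕ) : ℝ) by positivity)
    have h3 := Real.sq_sqrt (show (0 : ℝ) ≤ (L : ℝ) by positivity)
    have h4 := Real.sqrt_nonneg (L : ℝ)
    have h5 : 1 / √((L + 1 : ℕ) : ℝ) ≤ 2 * √((L + 1 : ℕ) : ℝ) - 2 * √(L : ℝ) := by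
      rw [div_le_iff₀ h1]
      push_cast at h2 ⊢
      push_cast at h1
      nlinarith [sq_nonneg (√((L : ℝ) + 1) - √(L : ℝ))]
    linarith

lemma sum_Icc_symm (f : ℤ → ℝ) (hf : ∀ m, f (-m) = f m) (L : ℕ) :
    ∑ m ∈ Finset.Icc (-(L : ℤ)) L, f m = f 0 + 2 * ∑ m ∈ Finset.Icc 1 L, f (m : ℤ) := by
  induction L with
  | zero => simp
  | succ L ih =>
    have : Finset.Icc (-((L + 1 : ℕ) : ℤ)) ((L + 1 : ℕ) : ℤ) =
        insert (-((L : ℤ) + 1)) (insert ((L : ℤ) + 1) (Finset.Icc (-(L : ℤ)) L)) := by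
      ext x; simp only [Finset.mem_Icc, Finset.mem_insert]; push_cast; omega
    rw [this, Finset.sum_insert (by simp; omega), Finset.sum_insert (by simp), ih, hf,
      Finset.sum_Icc_succ_top (by omega)]
    push_cast
    ring

lemma wsum_le {a : ℝ} {L : ℕ} (ha : a ≠ 0) (hL : 1 ≤ L) (haL : |a| * L ≤ 1) :
    wsum a L ≤ 9 * (2 * L + 1) / √|a| := by
  have hapos : 0 < |a| := abs_pos.mpr ha
  have hL' : (1 : ℝ) ≤ L := by exact_mod_cast hL
  have ha1 : |a| ≤ 1 := by nlinarith
  set G : ℝ := 2 * L + 1 with hG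
  have hG0 : 0 < G := by rw [hG]; positivity
  have hm : ∀ m ∈ Finset.Icc 1 L, ‖∑ l ∈ Finset.Icc (-(L : ℤ)) L, ex (a * l * ((m : ℕ) : ℤ))‖ ≤
      √(4 * G / |a|) * (1 / √(m : ℝ)) := by
    intro m hm
    obtain ⟨hm1, hm2⟩ := Finset.mem_Icc.mp hm
    have hm1' : (1 : ℝ) ≤ m := by exact_mod_cast hm1
    have hm2' : (m : ℝ) ≤ L := by exact_mod_cast hm2
    have habs : |a * m| = |a| * m := by rw [abs_mul, abs_of_nonneg (by positivity : (0:ℝ) ≤ m)]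
    have h1 := norm_sum_ex_le (a * m) L
    have h2 := norm_geom_le (v := a * m) (mul_ne_zero ha (by positivity))
      (by rw [habs]; nlinarith) L
    rw [habs] at h2
    have he : ∑ l ∈ Finset.Icc (-(L : ℤ)) L, ex (a * l * ((m : ℕ) : ℤ)) =
        ∑ l ∈ Finset.Icc (-(L : ℤ)) L, ex (a * m * l) :=
      Finset.sum_congr rfl fun l _ => by push_cast; ring_nf
    rw [he, mul_one_div, ← Real.sqrt_div' _ (by positivity)]
    refine Real.le_sqrt_of_sq_le ?_
    calc _ = ‖∑ l ∈ Finset.Icc (-(L : ℤ)) L, ex (a * m * l)‖ *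
          ‖∑ l ∈ Finset.Icc (-(L : ℤ)) L, ex (a * m * l)‖ := sq _
      _ ≤ G * (4 / (|a| * m)) := by gcongr
      _ = _ := by field_simp
  have h0 : ‖∑ l ∈ Finset.Icc (-(L : ℤ)) L, ex (a * l * ((0 : ℤ) : ℝ))‖ ≤ G := by
    have := norm_sum_ex_le 0 L
    simpa using this
  have hsym := sum_Icc_symm (fun m => ‖∑ l ∈ Finset.Icc (-(L : ℤ)) L, ex (a * l * m)‖) (by
    intro m
    have : ∑ l ∈ Finset.Icc (-(L : ℤ)) L, ex (a * l * ((-m : ℤ) : ℝ)) =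
        starRingEnd ℂ (∑ l ∈ Finset.Icc (-(L : ℤ)) L, ex (a * l * m)) := by
      rw [map_sum]
      refine Finset.sum_congr rfl fun l _ => ?_
      rw [← ex_neg]; push_cast; ring_nf
    rw [this, RCLike.norm_conj]) L
  have hs := Real.sqrt_pos.mpr hapos
  have hs1 : √|a| ≤ 1 := Real.sqrt_le_one.mpr ha1
  rw [wsum, hsym]
  have hsum : ∑ m ∈ Finset.Icc 1 L, ‖∑ l ∈ Finset.Icc (-(L : ℤ)) L, ex (a * l * ((m : ℕ) : ℤ))‖ ≤
      √(4 * G / |a|) * (2 * √L) := by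
    refine (Finset.sum_le_sum hm).trans ?_
    rw [← Finset.mul_sum]
    gcongr
    exact sum_inv_sqrt_le L
  have hGL : √(4 * G / |a|) * (2 * √L) ≤ 4 * G / √|a| := by
    rw [Real.sqrt_div (by positivity), Real.sqrt_mul (by norm_num), show √(4:ℝ) = 2 by
      rw [show (4:ℝ) = 2 ^ 2 by norm_num]; exact Real.sqrt_sq (by norm_num)]
    rw [div_mul_eq_mul_div]
    refine div_le_div_of_nonneg_right ?_ hs.le
    have : √(L : ℝ) ≤ √G := Real.sqrt_le_sqrt (by rw [hG]; linarith)
    nlinarith [Real.sq_sqrt hG0.le, Real.sqrt_nonneg G, Real.sqrt_nonneg (L : ℝ)]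
  have hG1 : G ≤ G / √|a| := by rw [le_div_iff₀ hs]; nlinarith
  calc _ ≤ G + 2 * (4 * G / √|a|) := by
        refine add_le_add h0 (mul_le_mul_of_nonneg_left (hsum.trans hGL) (by norm_num))
    _ ≤ G / √|a| + 2 * (4 * G / √|a|) := by linarith
    _ = _ := by ring

lemma wsum_save {a t X lam : ℝ} {j k M n : ℕ} (hj : 1 ≤ j) (hjk : j ≤ k) (hM : 1 ≤ M)
    (hX : 1 ≤ X) (hM1 : (M : ℝ) ≤ X ^ ((2 : ℝ) / 5)) (hM2 : X ^ ((2 : ℝ) / 5) ≤ 2 * M)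
    (hn1 : X ≤ n) (hn2 : n ≤ 2 * X) (ht : t = X ^ lam) (ha : |a| = t / (j * (n : ℝ) ^ j))
    (hj1 : 2 * lam ≤ j) (hj2 : j ≤ 4 * lam) (hs : (9 * k ^ 2 : ℝ) ≤ t ^ ((1 : ℝ) / 5)) :
    wsum a (9 * k ^ 2 * M ^ j) ≤ (3 * (9 * k ^ 2 * (M : ℝ) ^ j)) ^ 2 * (3 ^ k * X ^ (-lam / 10)) := by
  have hX0 : 0 < X := by linarith
  have ht0 : 0 < t := by rw [ht]; positivity
  have hn0 : (0 : ℝ) < n := by linarith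
  have hj' : (1 : ℝ) ≤ j := by exact_mod_cast hj
  have hjk' : (j : ℝ) ≤ k := by exact_mod_cast hjk
  have hk' : (1 : ℝ) ≤ k := hj'.trans hjk'
  have hMr : (1 : ℝ) ≤ M := by exact_mod_cast hM
  have hapos : 0 < |a| := by rw [ha]; positivity
  have hL : 1 ≤ 9 * k ^ 2 * M ^ j := by
    have h1 : 1 ≤ k := hj.trans hjk
    exact Nat.succ_le_of_lt (by positivity)
  have hcast : ((9 * k ^ 2 * M ^ j : ℕ) : ℝ) = 9 * k ^ 2 * (M : ℝ) ^ j := by push_cast; ring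
  set L : ℝ := 9 * k ^ 2 * (M : ℝ) ^ j with hLdef
  have hL1 : 1 ≤ L := by rw [← hcast]; exact_mod_cast hL
  have hMj : (M : ℝ) ^ j ≤ X ^ ((2 : ℝ) / 5 * j) := by
    rw [Real.rpow_mul hX0.le, Real.rpow_natCast]
    gcongr
  have hMj2 : X ^ ((2 : ℝ) / 5 * j) ≤ 2 ^ j * (M : ℝ) ^ j := by
    rw [Real.rpow_mul hX0.le, Real.rpow_natCast, ← mul_pow]
    gcongr
  have haL : |a| * ((9 * k ^ 2 * M ^ j : ℕ) : ℝ) ≤ 1 := by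
    rw [hcast, ha, div_mul_eq_mul_div, div_le_one (by positivity)]
    have h1 : t * L ≤ t * (t ^ ((1 : ℝ) / 5) * X ^ ((2 : ℝ) / 5 * j)) := by
      rw [hLdef]; gcongr
    have h2 : t * (t ^ ((1 : ℝ) / 5) * X ^ ((2 : ℝ) / 5 * j)) = X ^ (6 / 5 * lam + 2 / 5 * j) := by
      rw [ht, ← Real.rpow_mul hX0.le, ← Real.rpow_add hX0, ← Real.rpow_add hX0]
      congr 1; ring
    have h3 : X ^ (6 / 5 * lam + 2 / 5 * (j : ℝ)) ≤ X ^ (j : ℝ) :=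
      Real.rpow_le_rpow_of_exponent_le hX (by linarith)
    rw [Real.rpow_natCast] at h3
    have h4 : X ^ j ≤ (n : ℝ) ^ j := by gcongr
    have h5 : (0 : ℝ) ≤ (n : ℝ) ^ j := by positivity
    rw [h2] at h1
    nlinarith
  have ha0 : a ≠ 0 := abs_pos.mp hapos
  refine (wsum_le ha0 hL haL).trans ?_
  rw [hcast]
  have hsq : 0 < √|a| := Real.sqrt_pos.mpr hapos
  rw [div_le_iff₀ hsq]
  have hXm : X ^ (-lam / 10) * X ^ (lam / 10) = 1 := by
    rw [← Real.rpow_add hX0]; simp [neg_div]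
  have hX1 : 0 < X ^ (-lam / 10) := by positivity
  have hX2 : 0 < X ^ (lam / 10) := by positivity
  have key : 3 * X ^ (lam / 10) ≤ L * 3 ^ k * √|a| := by
    have e1 : L * 3 ^ k * √|a| = √((L * 3 ^ k) ^ 2 * |a|) := by
      rw [Real.sqrt_mul (by positivity), Real.sqrt_sq (by positivity)]
    rw [e1]
    refine Real.le_sqrt_of_sq_le ?_
    rw [ha, mul_div_assoc', le_div_iff₀ (by positivity)]
    have e2 : (3 * X ^ (lam / 10)) ^ 2 = 9 * X ^ (lam / 5) := by
      rw [mul_pow, ← Real.rpow_natCast (X ^ (lam / 10)), ← Real.rpow_mul hX0.le]; norm_num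
      congr 1; ring
    rw [e2]
    have h1 : (n : ℝ) ^ j ≤ 2 ^ j * X ^ j := by rw [← mul_pow]; gcongr
    have h2 : X ^ (lam / 5) * X ^ j ≤ t * X ^ ((4 : ℝ) / 5 * j) := by
      rw [ht, ← Real.rpow_natCast, ← Real.rpow_add hX0, ← Real.rpow_add hX0]
      exact Real.rpow_le_rpow_of_exponent_le hX (by linarith)
    have h3 : X ^ ((4 : ℝ) / 5 * j) ≤ 4 ^ j * ((M : ℝ) ^ j) ^ 2 := by
      have : X ^ ((4 : ℝ) / 5 * j) = (X ^ ((2 : ℝ) / 5 * j)) ^ 2 := by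
        rw [← Real.rpow_natCast (X ^ _), ← Real.rpow_mul hX0.le]; congr 1; push_cast; ring
      rw [this]
      calc _ ≤ (2 ^ j * (M : ℝ) ^ j) ^ 2 := by gcongr
        _ = _ := by rw [mul_pow, ← pow_mul, mul_comm j 2, pow_mul]; norm_num
    have h4 : (8 : ℝ) ^ j ≤ 9 ^ k :=
      (pow_le_pow_left₀ (by norm_num) (by norm_num) j).trans (pow_le_pow_right₀ (by norm_num) hjk)
    have h9 : ((3 : ℝ) ^ k) ^ 2 = 9 ^ k := by rw [← pow_mul, mul_comm, pow_mul]; norm_num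
    calc 9 * X ^ (lam / 5) * (j * (n : ℝ) ^ j) ≤ 9 * X ^ (lam / 5) * (k * (2 ^ j * X ^ j)) := by
          gcongr
      _ = 9 * k * 2 ^ j * (X ^ (lam / 5) * X ^ j) := by ring
      _ ≤ 9 * k * 2 ^ j * (t * (4 ^ j * ((M : ℝ) ^ j) ^ 2)) := by
          refine mul_le_mul_of_nonneg_left (h2.trans ?_) (by positivity)
          exact mul_le_mul_of_nonneg_left h3 ht0.le
      _ = 9 * k * ((M : ℝ) ^ j) ^ 2 * t * 8 ^ j := by
          rw [show (8 : ℝ) = 2 * 4 by norm_num, mul_pow]; ring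
      _ ≤ 9 * k * ((M : ℝ) ^ j) ^ 2 * t * 9 ^ k := by gcongr
      _ ≤ (9 * k ^ 2) ^ 2 * ((M : ℝ) ^ j) ^ 2 * t * 9 ^ k := by
          gcongr
          have : (k : ℝ) ≤ (k : ℝ) ^ 4 := by
            calc (k : ℝ) = k ^ 1 := (pow_one _).symm
              _ ≤ _ := pow_le_pow_right₀ hk' (by norm_num)
          nlinarith
      _ = (L * 3 ^ k) ^ 2 * t := by rw [hLdef, mul_pow, mul_pow, h9]; ring
  calc 9 * (2 * L + 1) ≤ 27 * L := by linarith
    _ = 9 * L * (3 * X ^ (lam / 10)) * X ^ (-lam / 10) := by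
        linear_combination (-27 * L) * hXm
    _ ≤ 9 * L * (L * 3 ^ k * √|a|) * X ^ (-lam / 10) := by gcongr
    _ = _ := by ring

lemma card_window {lam : ℝ} {k : ℕ} (hl : 1 / 2 ≤ lam) (hk : 4 * lam ≤ k) :
    lam ≤ ((Finset.univ.filter fun j : Fin k =>
      2 * lam ≤ ((j : ℕ) + 1 : ℕ) ∧ (((j : ℕ) + 1 : ℕ) : ℝ) ≤ 4 * lam).card : ℝ) := by
  have h1 : ((Finset.Icc ⌈2 * lam⌉₊ ⌊4 * lam⌋₊).card : ℕ) ≤ (Finset.univ.filter fun j : Fin k =>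
      2 * lam ≤ ((j : ℕ) + 1 : ℕ) ∧ (((j : ℕ) + 1 : ℕ) : ℝ) ≤ 4 * lam).card := by
    have hsub : Finset.Icc ⌈2 * lam⌉₊ ⌊4 * lam⌋₊ ⊆ (Finset.univ.filter fun j : Fin k =>
      2 * lam ≤ ((j : ℕ) + 1 : ℕ) ∧ (((j : ℕ) + 1 : ℕ) : ℝ) ≤ 4 * lam).image
        fun j : Fin k => (j : ℕ) + 1 := by
      intro i hi
      obtain ⟨hi1, hi2⟩ := Finset.mem_Icc.mp hi
      have hi1' : 2 * lam ≤ i := Nat.ceil_le.mp hi1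
      have hi2' : (i : ℝ) ≤ 4 * lam := (Nat.le_floor_iff (by linarith)).mp hi2
      have hi0 : 1 ≤ i := by
        have : (0 : ℝ) < i := by linarith
        exact_mod_cast this
      have hik : i ≤ k := by exact_mod_cast hi2'.trans hk
      refine Finset.mem_image.mpr ⟨⟨i - 1, by omega⟩, ?_, by simp; omega⟩
      simp only [Finset.mem_filter, Finset.mem_univ, true_and]
      rw [Nat.sub_add_cancel hi0]
      exact ⟨hi1', hi2'⟩
    exact (Finset.card_le_card hsub).trans Finset.card_image_le
  have h1' : ((Finset.Icc ⌈2 * lam⌉₊ ⌊4 * lam⌋₊).card : ℝ) ≤ _ := Nat.cast_le.mpr h1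
  refine le_trans ?_ h1'
  rw [Nat.card_Icc]
  rcases le_or_gt 1 lam with h | h
  · have h2 := Nat.ceil_lt_add_one (show (0:ℝ) ≤ 2 * lam by linarith)
    have h3 := Nat.lt_floor_add_one (4 * lam)
    have h4 : ((⌊4 * lam⌋₊ + 1 : ℕ) : ℝ) ≤ ((⌊4 * lam⌋₊ + 1 - ⌈2 * lam⌉₊ : ℕ) : ℝ) + (⌈2 * lam⌉₊ : ℕ) := by
      exact_mod_cast le_tsub_add
    push_cast at h4
    linarith
  · have h2 : ⌈2 * lam⌉₊ ≤ ⌊4 * lam⌋₊ := by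
      refine Nat.le_floor ?_
      rcases eq_or_lt_of_le hl with h' | h'
      · rw [← h']; norm_num
      · have : ⌈2 * lam⌉₊ ≤ 2 := Nat.ceil_le.mpr (by push_cast; linarith)
        have : ((⌈2 * lam⌉₊ : ℕ) : ℝ) ≤ 2 := by exact_mod_cast this
        linarith
    have h3 : 1 ≤ ⌊4 * lam⌋₊ + 1 - ⌈2 * lam⌉₊ := by omega
    have : (1 : ℝ) ≤ ((⌊4 * lam⌋₊ + 1 - ⌈2 * lam⌉₊ : ℕ) : ℝ) := by exact_mod_cast h3
    linarith

lemma prod_wsum_le {t X lam : ℝ} {k M n : ℕ} {a : Fin k → ℝ} (hM : 1 ≤ M) (hk0 : 1 ≤ k)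
    (hX : 1 ≤ X) (hM1 : (M : ℝ) ≤ X ^ ((2 : ℝ) / 5)) (hM2 : X ^ ((2 : ℝ) / 5) ≤ 2 * M)
    (hn1 : X ≤ n) (hn2 : n ≤ 2 * X) (ht : t = X ^ lam)
    (ha : ∀ j, |a j| = t / (((j : ℕ) + 1 : ℕ) * (n : ℝ) ^ ((j : ℕ) + 1)))
    (hl : 1 / 2 ≤ lam) (hk : 4 * lam ≤ k) (hs : (9 * k ^ 2 : ℝ) ≤ t ^ ((1 : ℝ) / 5)) :
    ∏ j : Fin k, wsum (a j) (9 * k ^ 2 * M ^ ((j : ℕ) + 1)) ≤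
      (27 * k ^ 2) ^ (2 * k) * (M : ℝ) ^ (k * (k + 1)) * (3 ^ k) ^ k * X ^ (-lam ^ 2 / 10) := by
  have hX0 : 0 < X := by linarith
  have hMr : (1 : ℝ) ≤ M := by exact_mod_cast hM
  have hkr : (1 : ℝ) ≤ k := by exact_mod_cast hk0
  set S := Finset.univ.filter fun j : Fin k =>
      2 * lam ≤ ((j : ℕ) + 1 : ℕ) ∧ (((j : ℕ) + 1 : ℕ) : ℝ) ≤ 4 * lam with hS
  have hw : ∀ j : Fin k, wsum (a j) (9 * k ^ 2 * M ^ ((j : ℕ) + 1)) ≤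
      ((3 * (9 * k ^ 2 * (M : ℝ) ^ ((j : ℕ) + 1))) ^ 2 * 3 ^ k) *
        (if j ∈ S then X ^ (-lam / 10) else 1) := by
    intro j
    split_ifs with hj
    · rw [hS, Finset.mem_filter] at hj
      have h := wsum_save (Nat.succ_pos (j : ℕ)) (Nat.succ_le_of_lt j.2) hM hX hM1 hM2 hn1 hn2 ht
        (ha j) hj.2.1 hj.2.2 hs
      exact h.trans_eq (mul_assoc _ _ _).symm
    · refine (wsum_trivial _ _).trans ?_
      rw [mul_one]
      have h1 : (1 : ℝ) ≤ 9 * k ^ 2 * (M : ℝ) ^ ((j : ℕ) + 1) := by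
        have h1 := one_le_pow₀ hMr (n := (j : ℕ) + 1)
        have h2 := one_le_pow₀ hkr (n := 2)
        nlinarith
      have h3 : (1 : ℝ) ≤ 3 ^ k := one_le_pow₀ (by norm_num)
      have h4 : ((9 * k ^ 2 * M ^ ((j : ℕ) + 1) : ℕ) : ℝ) = 9 * k ^ 2 * (M : ℝ) ^ ((j : ℕ) + 1) := by
        push_cast; ring
      rw [h4]
      generalize 9 * (k : ℝ) ^ 2 * (M : ℝ) ^ ((j : ℕ) + 1) = x at h1
      generalize (3 : ℝ) ^ k = y at h3
      have h5 : (2 * x + 1) ^ 2 ≤ (3 * x) ^ 2 := by nlinarith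
      nlinarith [sq_nonneg (3 * x)]
  have hnn : ∀ j ∈ (Finset.univ : Finset (Fin k)), 0 ≤ wsum (a j) (9 * k ^ 2 * M ^ ((j : ℕ) + 1)) :=
    fun j _ => Finset.sum_nonneg fun _ _ => norm_nonneg _
  refine (Finset.prod_le_prod hnn fun j _ => hw j).trans ?_
  rw [Finset.prod_mul_distrib, Finset.prod_mul_distrib, Finset.prod_ite_mem, Finset.univ_inter,
    Finset.prod_const, Finset.prod_const, Finset.card_univ, Fintype.card_fin]
  have h1 : ∏ j : Fin k, (3 * (9 * (k : ℝ) ^ 2 * (M : ℝ) ^ ((j : ℕ) + 1))) ^ 2 =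
      (27 * k ^ 2) ^ (2 * k) * (M : ℝ) ^ (k * (k + 1)) := by
    rw [Finset.prod_pow]
    have : ∀ j : Fin k, 3 * (9 * (k : ℝ) ^ 2 * (M : ℝ) ^ ((j : ℕ) + 1)) =
      (27 * k ^ 2) * (M : ℝ) ^ ((j : ℕ) + 1) := fun j => by ring
    rw [Finset.prod_congr rfl fun j _ => this j, Finset.prod_mul_distrib, Finset.prod_const,
      Finset.card_univ, Fintype.card_fin, Finset.prod_pow_eq_pow_sum, mul_pow, ← pow_mul, ← pow_mul,
      mul_comm k 2]
    congr 2
    rw [Fin.sum_univ_eq_sum_range (fun i => i + 1) k]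
    have h := Finset.sum_range_id_mul_two (k + 1)
    rw [Finset.sum_range_succ'] at h
    simp at h
    rw [h]; ring
  rw [h1]
  refine mul_le_mul_of_nonneg_left ?_ (by positivity)
  rw [← Real.rpow_natCast, ← Real.rpow_mul hX0.le]
  refine Real.rpow_le_rpow_of_exponent_le hX ?_
  have := card_window hl hk
  nlinarith

/-- The degree used in the approximation of `n ↦ n^{-it}` for `n` of size `N`. -/
noncomputable def deg (t : ℝ) (N : ℕ) : ℕ := ⌈5 * (Real.log t / Real.log N)⌉₊ + 1

/-- The length of the shifts. -/
noncomputable def shiftLen (N : ℕ) : ℕ := ⌊(N : ℝ) ^ ((2 : ℝ) / 5)⌋₊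

lemma deg_le {t : ℝ} {N : ℕ} (hl : 1 / 2 ≤ Real.log t / Real.log N) :
    (deg t N : ℝ) ≤ 9 * (Real.log t / Real.log N) := by
  have := Nat.ceil_lt_add_one (show (0 : ℝ) ≤ 5 * (Real.log t / Real.log N) by linarith)
  rw [deg]; push_cast; linarith

lemma le_deg {t : ℝ} {N : ℕ} : 5 * (Real.log t / Real.log N) + 1 ≤ (deg t N : ℝ) := by
  have := Nat.le_ceil (5 * (Real.log t / Real.log N))
  rw [deg]; push_cast; linarith

lemma deg_sq_le {t : ℝ} {N : ℕ} (hN : 2 ≤ N) (ht : 10 ^ 60 ≤ t)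
    (hl : 1 / 2 ≤ Real.log t / Real.log N) :
    (9 * (deg t N) ^ 2 : ℝ) ≤ t ^ ((1 : ℝ) / 5) := by
  have ht0 : 0 < t := lt_of_lt_of_le (by norm_num) ht
  have h1 : Real.log t ≤ t ^ ((1 : ℝ) / 20) / (1 / 20) := Real.log_le_rpow_div ht0.le (by norm_num)
  have h2 : Real.log 2 ≤ Real.log N := Real.log_le_log (by norm_num) (by exact_mod_cast hN)
  have h3 := Real.log_two_gt_d9
  have hlt : 0 < Real.log t := Real.log_pos (lt_of_lt_of_le (by norm_num) ht)
  have h4 : Real.log t / Real.log N ≤ 20 * t ^ ((1 : ℝ) / 20) / (69 / 100) := by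
    gcongr
    · linarith
    · linarith
  have h5 : (10 : ℝ) ^ 6 ≤ t ^ ((1 : ℝ) / 10) := by
    have : ((10 : ℝ) ^ 60) ^ ((1 : ℝ) / 10) ≤ t ^ ((1 : ℝ) / 10) :=
      Real.rpow_le_rpow (by norm_num) ht (by norm_num)
    refine le_trans (le_of_eq ?_) this
    rw [← Real.rpow_natCast, ← Real.rpow_natCast, ← Real.rpow_mul (by norm_num)]; norm_num
  have h6 : t ^ ((1 : ℝ) / 5) = t ^ ((1 : ℝ) / 10) * t ^ ((1 : ℝ) / 10) := by
    rw [← Real.rpow_add ht0]; norm_num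
  have h7 : t ^ ((1 : ℝ) / 10) = t ^ ((1 : ℝ) / 20) * t ^ ((1 : ℝ) / 20) := by
    rw [← Real.rpow_add ht0]; norm_num
  have h8 := deg_le hl
  have h9 : 0 < t ^ ((1 : ℝ) / 20) := by positivity
  have hd : (deg t N : ℝ) ≤ 262 * t ^ ((1 : ℝ) / 20) := by
    refine (h8.trans (mul_le_mul_of_nonneg_left h4 (by norm_num))).trans ?_
    rw [← mul_div_assoc, div_le_iff₀ (by norm_num)]
    nlinarith
  calc (9 * (deg t N) ^ 2 : ℝ) ≤ 9 * (262 * t ^ ((1 : ℝ) / 20)) ^ 2 := by gcongr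
    _ = 9 * 262 ^ 2 * t ^ ((1 : ℝ) / 10) := by rw [h7]; ring
    _ ≤ 10 ^ 6 * t ^ ((1 : ℝ) / 10) := by gcongr; norm_num
    _ ≤ _ := by rw [h6]; gcongr

lemma exp_eight : Real.exp (-8) ≤ 1 / 2800 := by
  rw [Real.exp_neg, ← one_div]
  apply one_div_le_one_div_of_le (by norm_num)
  have h := Real.exp_one_gt_d9
  have : Real.exp 8 = Real.exp 1 ^ 8 := by rw [← Real.exp_nat_mul]; norm_num
  rw [this]
  calc (2800 : ℝ) ≤ 2.7 ^ 8 := by norm_num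
    _ ≤ _ := by gcongr; linarith

lemma const_le (k : ℕ) (hk : 1 ≤ k) :
    (((2 * k : ℝ) ^ (682 * k ^ 3)) ^ 2 * (27 * k ^ 2) ^ (2 * k) * (3 ^ k) ^ k : ℝ) ≤
      Real.exp (2916 * k ^ 4) := by
  have hkr : (1 : ℝ) ≤ k := by exact_mod_cast hk
  have e : ∀ (x : ℝ) (n : ℕ), 0 ≤ x → x ^ n ≤ Real.exp (x * n) := by
    intro x n hx
    rw [mul_comm, Real.exp_nat_mul]
    exact pow_le_pow_left₀ hx (by linarith [Real.add_one_le_exp x]) n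
  have h1 := e (2 * k) (682 * k ^ 3 * 2) (by positivity)
  have h2 := e (27 * k ^ 2) (2 * k) (by positivity)
  have h3 := e 3 (k * k) (by norm_num)
  rw [pow_mul] at h1 h3
  refine (mul_le_mul (mul_le_mul h1 h2 (by positivity) (by positivity)) h3 (by positivity)
    (by positivity)).trans ?_
  rw [← Real.exp_add, ← Real.exp_add, Real.exp_le_exp]
  push_cast
  have h34 : (k : ℝ) ^ 3 ≤ k ^ 4 := pow_le_pow_right₀ hkr (by norm_num)
  have h24 : (k : ℝ) ^ 2 ≤ k ^ 4 := pow_le_pow_right₀ hkr (by norm_num)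
  nlinarith

lemma bilinear_numeric {t : ℝ} {N n k : ℕ} (hk : k = deg t N) (hN : 2 ≤ N) (ht : 10 ^ 60 ≤ t) (hNt : (N : ℝ) ≤ t ^ 2)
    (hn1 : N ≤ n) (hn2 : n ≤ 2 * N) (a : Fin k → ℝ)
    (ha : ∀ j, |a j| = t / (((j : ℕ) + 1 : ℕ) * (n : ℝ) ^ ((j : ℕ) + 1))) :
    ‖∑ x ∈ Finset.Ico 0 (shiftLen N : ℤ), ∑ y ∈ Finset.Ico 0 (shiftLen N : ℤ),
      ex (phase a (powers k x) (powers k y))‖ ≤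
      Real.exp 9 * (shiftLen N : ℝ) ^ 2 *
        Real.exp (-(1 / 42515280) * (Real.log N ^ 3 / Real.log t ^ 2)) := by
  have ht0 : 0 < t := lt_of_lt_of_le (by norm_num) ht
  have hlt : 0 < Real.log t := Real.log_pos (lt_of_lt_of_le (by norm_num) ht)
  have hNr : (2 : ℝ) ≤ N := by exact_mod_cast hN
  have hN0 : (0 : ℝ) < N := by linarith
  have hlN : 0 < Real.log N := Real.log_pos (by linarith)
  have hl : 1 / 2 ≤ Real.log t / Real.log N := by
    rw [div_le_div_iff₀ (by norm_num) hlN]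
    have := Real.log_le_log hN0 hNt
    rw [Real.log_pow] at this; push_cast at this; linarith
  have hk9 := deg_le hl
  have hk5 := @le_deg t N
  have hs := deg_sq_le hN ht hl
  set lam := Real.log t / Real.log N with hlam
  rw [← hk] at hk9 hk5 hs
  have htX : t = (N : ℝ) ^ lam := by
    rw [Real.rpow_def_of_pos hN0, hlam, mul_div_cancel₀ _ hlN.ne', Real.exp_log ht0]
  have hY : 1 ≤ (N : ℝ) ^ ((2 : ℝ) / 5) := Real.one_le_rpow (by linarith) (by norm_num)
  have hM1 : (shiftLen N : ℝ) ≤ (N : ℝ) ^ ((2 : ℝ) / 5) := Nat.floor_le (by positivity)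
  have hM0 : 1 ≤ shiftLen N := Nat.le_floor (by exact_mod_cast hY)
  have hM2 : (N : ℝ) ^ ((2 : ℝ) / 5) ≤ 2 * (shiftLen N : ℝ) := by
    have := Nat.lt_floor_add_one ((N : ℝ) ^ ((2 : ℝ) / 5))
    have h : (1 : ℝ) ≤ shiftLen N := by exact_mod_cast hM0
    rw [shiftLen] at h ⊢; linarith
  set M := shiftLen N with hM
  have hMr : (1 : ℝ) ≤ M := by exact_mod_cast hM0
  have hMpos : (0 : ℝ) < M := by linarith
  have hk2 : 2 ≤ k := by
    have : (2 : ℝ) ≤ k := by linarith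
    exact_mod_cast this
  have hprod := prod_wsum_le (a := a) hM0 (by omega) (by linarith) hM1 hM2
    (by exact_mod_cast hn1) (by exact_mod_cast hn2) htX ha hl (by linarith) hs
  have hvino := vino_mean_value hk2 M hM0
  have hbil := bilinear_bound (k := k) (s := 9 * k ^ 2) (by positivity) a M
  set B := ‖∑ x ∈ Finset.Ico 0 (M : ℤ), ∑ y ∈ Finset.Ico 0 (M : ℤ),
      ex (phase a (powers k x) (powers k y))‖ with hB
  set m := Real.log M with hm
  have hm0 : 0 ≤ m := Real.log_nonneg hMr
  have hm1 : m ≤ 2 / 5 * Real.log N := by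
    rw [← Real.log_rpow hN0]; exact Real.log_le_log hMpos hM1
  have hMe : ∀ x : ℝ, (M : ℝ) ^ x = Real.exp (m * x) := fun x => Real.rpow_def_of_pos hMpos x
  have hMn : ∀ x : ℕ, (M : ℝ) ^ x = Real.exp (m * x) := fun x => by
    rw [← Real.rpow_natCast, hMe]
  have hkr : (2 : ℝ) ≤ k := by exact_mod_cast hk2
  set r : ℕ := 2 * (9 * k ^ 2) with hr
  have hrr : (r : ℝ) = 18 * (k : ℝ) ^ 2 := by rw [hr]; push_cast; ring
  have hr1 : 1 ≤ r := by rw [hr]; nlinarith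
  have hrsub : ((r - 1 : ℕ) : ℝ) = 18 * (k : ℝ) ^ 2 - 1 := by
    rw [Nat.cast_sub hr1, hrr]; norm_num
  set V : ℝ := (vino k (9 * k ^ 2) (Finset.Ico 0 (M : ℤ)) : ℝ) with hV
  have hV0 : 0 ≤ V := Nat.cast_nonneg _
  have hpow : B ^ (r * r) ≤ (Real.exp 9 * (M : ℝ) ^ 2 *
        Real.exp (-(1 / 42515280) * (Real.log N ^ 3 / Real.log t ^ 2))) ^ (r * r) := by
    calc B ^ (r * r) ≤ (M : ℝ) ^ ((r - 1) * r) * ((M : ℝ) ^ r) ^ (r - 1) * V ^ 2 *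
          ∏ j : Fin k, wsum (a j) (9 * k ^ 2 * M ^ ((j : ℕ) + 1)) := hbil
      _ ≤ (M : ℝ) ^ ((r - 1) * r) * ((M : ℝ) ^ r) ^ (r - 1) *
          ((2 * k) ^ (682 * k ^ 3) *
            (M : ℝ) ^ (2 * (9 * (k : ℝ) ^ 2) - (k : ℝ) * (k + 1) / 2 + k ^ 2 * Real.exp (-8))) ^ 2 *
          ((27 * k ^ 2) ^ (2 * k) * (M : ℝ) ^ (k * (k + 1)) * (3 ^ k) ^ k *
            (N : ℝ) ^ (-lam ^ 2 / 10)) := by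
          refine mul_le_mul (mul_le_mul_of_nonneg_left (pow_le_pow_left₀ hV0 hvino 2)
            (by positivity)) hprod
            (Finset.prod_nonneg fun _ _ => Finset.sum_nonneg fun _ _ => norm_nonneg _)
            (by positivity)
      _ = (((2 * k : ℝ) ^ (682 * k ^ 3)) ^ 2 * (27 * k ^ 2) ^ (2 * k) * (3 ^ k) ^ k) *
          Real.exp (m * (2 * r * r + 2 * k ^ 2 * Real.exp (-8)) - Real.log N * (lam ^ 2 / 10)) := by
          rw [← pow_mul, hMn, hMn, hMn, hMe, mul_pow, ← Real.exp_nat_mul,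
            Real.rpow_def_of_pos hN0]
          have e : Real.exp (m * (2 * r * r + 2 * k ^ 2 * Real.exp (-8)) -
              Real.log N * (lam ^ 2 / 10)) =
              Real.exp (m * ((r - 1) * r : ℕ)) * Real.exp (m * (r * (r - 1) : ℕ)) *
              Real.exp ((2 : ℕ) * (m * (2 * (9 * (k : ℝ) ^ 2) - (k : ℝ) * (k + 1) / 2 +
                k ^ 2 * Real.exp (-8)))) * Real.exp (m * (k * (k + 1) : ℕ)) *
              Real.exp (Real.log N * (-lam ^ 2 / 10)) := by
            rw [← Real.exp_add, ← Real.exp_add, ← Real.exp_add, ← Real.exp_add]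
            congr 1
            push_cast [hrsub]
            rw [hrr]
            ring
          rw [e]; ring
      _ ≤ Real.exp (2916 * k ^ 4) *
          Real.exp (m * (2 * r * r + 2 * k ^ 2 * Real.exp (-8)) - Real.log N * (lam ^ 2 / 10)) :=
          mul_le_mul_of_nonneg_right (const_le k (by omega)) (Real.exp_pos _).le
      _ ≤ _ := by
          rw [hMn 2, ← Real.exp_add, ← Real.exp_add, ← Real.exp_add, ← Real.exp_nat_mul,
            Real.exp_le_exp]
          push_cast
          have e8 := exp_eight
          have hlam0 : 0 < lam := by linarith
          have hk4 : (k : ℝ) ^ 4 ≤ 6561 * lam ^ 4 := by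
            calc (k : ℝ) ^ 4 ≤ (9 * lam) ^ 4 := by gcongr
              _ = _ := by ring
          have hk22 : (k : ℝ) ^ 2 ≤ 81 * lam ^ 2 := by
            calc (k : ℝ) ^ 2 ≤ (9 * lam) ^ 2 := by gcongr
              _ = _ := by ring
          have h1 : m * (2 * k ^ 2 * Real.exp (-8)) ≤ Real.log N * (lam ^ 2 / 20) := by
            calc m * (2 * k ^ 2 * Real.exp (-8)) ≤
                  (2 / 5 * Real.log N) * (2 * (81 * lam ^ 2) * (1 / 2800)) := by gcongr
              _ ≤ _ := by nlinarith [mul_pos hlN (pow_pos hlam0 2)]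
          have h2 : Real.log N ^ 3 / Real.log t ^ 2 = Real.log N / lam ^ 2 := by
            rw [hlam]; field_simp
          have h3 : (1 / 42515280) * (324 * (k : ℝ) ^ 4 * (Real.log N / lam ^ 2)) ≤
              Real.log N * (lam ^ 2 / 20) := by
            have : (k : ℝ) ^ 4 * (Real.log N / lam ^ 2) ≤
                6561 * lam ^ 4 * (Real.log N / lam ^ 2) := by gcongr
            have e : 6561 * lam ^ 4 * (Real.log N / lam ^ 2) = 6561 * (lam ^ 2 * Real.log N) := by
              field_simp
            linear_combination (324 / 42515280) * this + (324 / 42515280) * e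
          rw [h2, hrr]
          linear_combination h1 + h3
  exact le_of_pow_le_pow_left₀ (by positivity) (by positivity) hpow

lemma norm_sum_shift_le (f : ℕ → ℂ) (hf : ∀ n, ‖f n‖ ≤ 1) {N N' : ℕ} (h : N ≤ N') (d : ℕ) :
    ‖∑ n ∈ Finset.Ioc N N', f n - ∑ n ∈ Finset.Ioc N N', f (n + d)‖ ≤ 2 * d := by
  induction d with
  | zero => simp
  | succ d ih =>
    have h1 : ‖∑ n ∈ Finset.Ioc N N', f (n + d) - ∑ n ∈ Finset.Ioc N N', f (n + (d + 1))‖ ≤ 2 := by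
      have e : ∑ n ∈ Finset.Ioc N N', f (n + d) - ∑ n ∈ Finset.Ioc N N', f (n + (d + 1)) =
          f (N + 1 + d) - f (N' + 1 + d) := by
        clear ih
        induction N', h using Nat.le_induction with
        | base => simp
        | succ m hm ihm =>
          rw [Finset.sum_Ioc_succ_top (by omega), Finset.sum_Ioc_succ_top (by omega)]
          have : f (m + 1 + (d + 1)) = f (m + 1 + 1 + d) := by congr 1; omega
          rw [this]
          linear_combination ihm
      rw [e]
      exact (norm_sub_le _ _).trans (by linarith [hf (N + 1 + d), hf (N' + 1 + d)])
    calc _ = ‖(∑ n ∈ Finset.Ioc N N', f n - ∑ n ∈ Finset.Ioc N N', f (n + d)) +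
          (∑ n ∈ Finset.Ioc N N', f (n + d) - ∑ n ∈ Finset.Ioc N N', f (n + (d + 1)))‖ := by
          congr 1; ring
      _ ≤ 2 * d + 2 := (norm_add_le _ _).trans (add_le_add ih h1)
      _ = _ := by push_cast; ring

lemma norm_ex_sub_ex (u v : ℝ) : ‖ex u - ex v‖ ≤ |u - v| := by
  have : ex u - ex v = ex v * (ex (u - v) - 1) := by
    rw [mul_sub, ← ex_add, mul_one]; congr 2; ring
  rw [this, norm_mul, norm_ex, one_mul, norm_ex_sub_one]
  have := Real.abs_sin_le_abs (x := (u - v) / 2)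
  rw [abs_div, abs_two] at this
  linarith

/-- The Taylor coefficients of `u ↦ -t log (1 + u / n)`. -/
noncomputable def taylorCoeff (t : ℝ) (n : ℕ) (k : ℕ) : Fin k → ℝ := fun j =>
  t * (-1) ^ ((j : ℕ) + 1) / (((j : ℕ) + 1 : ℕ) * (n : ℝ) ^ ((j : ℕ) + 1))

lemma phase_taylor (t : ℝ) {n : ℕ} (hn : 0 < n) (k x y : ℕ) (ht : 0 ≤ t)
    (h : (x : ℝ) * y / n ≤ 1 / 2) :
    ‖ex (-t * Real.log (n + x * y : ℕ)) -
      ex (-t * Real.log n) * ex (phase (taylorCoeff t n k) (powers k x) (powers k y))‖ ≤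
      2 * t * ((x : ℝ) * y / n) ^ (k + 1) := by
  have hn' : (0 : ℝ) < n := by exact_mod_cast hn
  set u : ℝ := (x : ℝ) * y / n with hu
  have hu0 : 0 ≤ u := by positivity
  rw [← ex_add]
  refine (norm_ex_sub_ex _ _).trans ?_
  have h1 := Real.abs_log_sub_add_sum_range_le (x := -u) (by rw [abs_neg, abs_of_nonneg hu0]; linarith) k
  rw [abs_neg, abs_of_nonneg hu0] at h1
  have e1 : Real.log (n + x * y : ℕ) = Real.log n + Real.log (1 - -u) := by
    rw [← Real.log_mul hn'.ne' (by linarith)]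
    congr 1; push_cast; rw [hu]; field_simp; ring
  have e2 : phase (taylorCoeff t n k) (powers k x) (powers k y) =
      t * ∑ i ∈ Finset.range k, (-u) ^ (i + 1) / (i + 1) := by
    rw [phase, Finset.mul_sum, ← Fin.sum_univ_eq_sum_range (fun i => t * ((-u) ^ (i + 1) / (i + 1))) k]
    refine Finset.sum_congr rfl fun j _ => ?_
    simp only [taylorCoeff, powers]
    push_cast
    rw [neg_pow u, hu, div_pow, mul_pow]
    field_simp
  rw [e1, e2]
  have e3 : -t * (Real.log n + Real.log (1 - -u)) - (-t * Real.log n +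
      t * ∑ i ∈ Finset.range k, (-u) ^ (i + 1) / (i + 1)) =
      -(t * ((∑ i ∈ Finset.range k, (-u) ^ (i + 1) / (i + 1)) + Real.log (1 - -u))) := by ring
  rw [e3, abs_neg, abs_mul, abs_of_nonneg ht]
  calc _ ≤ t * (u ^ (k + 1) / (1 - u)) := by gcongr
    _ ≤ t * (2 * u ^ (k + 1)) := by
        gcongr
        rw [div_le_iff₀ (by linarith)]
        nlinarith [pow_nonneg hu0 (k + 1)]
    _ = _ := by ring

lemma inner_sum_le {t : ℝ} {N n : ℕ} (hN : 32 ≤ N) (ht : 10 ^ 60 ≤ t) (hNt : (N : ℝ) ≤ t ^ 2)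
    (hn1 : N ≤ n) (hn2 : n ≤ 2 * N) :
    ‖∑ x ∈ Finset.range (shiftLen N), ∑ y ∈ Finset.range (shiftLen N),
      ex (-t * Real.log (n + x * y : ℕ))‖ ≤ (shiftLen N : ℝ) ^ 2 *
        (Real.exp 9 * Real.exp (-(1 / 42515280) * (Real.log N ^ 3 / Real.log t ^ 2)) +
          2 * (N : ℝ) ^ (-(2 : ℝ) / 5)) := by
  have ht0 : 0 < t := lt_of_lt_of_le (by norm_num) ht
  have hNr : (32 : ℝ) ≤ N := by exact_mod_cast hN
  have hN0 : (0 : ℝ) < N := by linarith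
  have hlN : 0 < Real.log N := Real.log_pos (by linarith)
  have hn : (N : ℝ) ≤ n := by exact_mod_cast hn1
  have hn0 : (0 : ℝ) < n := by linarith
  set M := shiftLen N with hM
  have hM1 : (M : ℝ) ≤ (N : ℝ) ^ ((2 : ℝ) / 5) := Nat.floor_le (by positivity)
  set k := deg t N with hk
  have hk5 := @le_deg t N
  set a := taylorCoeff t n k with ha
  have hbil := bilinear_numeric hk (by omega) ht hNt hn1 hn2 a (by
    intro j
    rw [ha, taylorCoeff, abs_div, abs_mul, abs_pow, abs_neg, abs_one, one_pow, mul_one,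
      abs_of_pos ht0, abs_of_nonneg (by positivity)])
  have hcast : ∑ x ∈ Finset.Ico 0 (M : ℤ), ∑ y ∈ Finset.Ico 0 (M : ℤ),
      ex (phase a (powers k x) (powers k y)) =
      ∑ x ∈ Finset.range M, ∑ y ∈ Finset.range M, ex (phase a (powers k x) (powers k y)) := by
    have : ∀ F : ℤ → ℂ, ∑ x ∈ Finset.Ico 0 (M : ℤ), F x = ∑ x ∈ Finset.range M, F x := by
      intro F
      refine Finset.sum_nbij' (fun i : ℤ => i.toNat) (fun i : ℕ => (i : ℤ)) ?_ ?_ ?_ ?_ ?_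
      · intro i hi; rw [Finset.mem_Ico] at hi; rw [Finset.mem_range]; omega
      · intro i hi; rw [Finset.mem_range] at hi; rw [Finset.mem_Ico]; omega
      · intro i hi; rw [Finset.mem_Ico] at hi; exact Int.toNat_of_nonneg hi.1
      · intro i _; exact Int.toNat_natCast i
      · intro i hi; rw [Finset.mem_Ico] at hi; rw [Int.toNat_of_nonneg hi.1]
    rw [this]
    exact Finset.sum_congr rfl fun x _ => this _
  have hterm : ∀ x ∈ Finset.range M, ∀ y ∈ Finset.range M,
      ‖ex (-t * Real.log (n + x * y : ℕ)) -
        ex (-t * Real.log n) * ex (phase a (powers k x) (powers k y))‖ ≤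
        2 * (N : ℝ) ^ (-(2 : ℝ) / 5) := by
    intro x hx y hy
    have hx' : (x : ℝ) ≤ (N : ℝ) ^ ((2 : ℝ) / 5) :=
      le_trans (by exact_mod_cast (Finset.mem_range.mp hx).le) hM1
    have hy' : (y : ℝ) ≤ (N : ℝ) ^ ((2 : ℝ) / 5) :=
      le_trans (by exact_mod_cast (Finset.mem_range.mp hy).le) hM1
    have hu : (x : ℝ) * y / n ≤ (N : ℝ) ^ (-(1 : ℝ) / 5) := by
      rw [div_le_iff₀ hn0]
      calc (x : ℝ) * y ≤ (N : ℝ) ^ ((2 : ℝ) / 5) * (N : ℝ) ^ ((2 : ℝ) / 5) := by gcongr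
        _ = (N : ℝ) ^ (-(1 : ℝ) / 5) * (N : ℝ) ^ (1 : ℝ) := by
            rw [← Real.rpow_add hN0, ← Real.rpow_add hN0]; norm_num
        _ ≤ _ := by rw [Real.rpow_one]; gcongr
    have hhalf : (N : ℝ) ^ (-(1 : ℝ) / 5) ≤ 1 / 2 := by
      calc (N : ℝ) ^ (-(1 : ℝ) / 5) ≤ (32 : ℝ) ^ (-(1 : ℝ) / 5) :=
            Real.rpow_le_rpow_of_nonpos (by norm_num) hNr (by norm_num)
        _ = 1 / 2 := by
            rw [show (32 : ℝ) = 2 ^ (5 : ℝ) by norm_num, ← Real.rpow_mul (by norm_num)]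
            norm_num [Real.rpow_neg_one]
    refine (phase_taylor t (by omega) k x y ht0.le (hu.trans hhalf)).trans ?_
    have h1 : ((x : ℝ) * y / n) ^ (k + 1) ≤ ((N : ℝ) ^ (-(1 : ℝ) / 5)) ^ (k + 1) := by gcongr
    have h2 : t * ((N : ℝ) ^ (-(1 : ℝ) / 5)) ^ (k + 1) ≤ (N : ℝ) ^ (-(2 : ℝ) / 5) := by
      rw [← Real.rpow_natCast, ← Real.rpow_mul hN0.le]
      have : t = (N : ℝ) ^ (Real.log t / Real.log N) := by
        rw [Real.rpow_def_of_pos hN0, mul_div_cancel₀ _ hlN.ne', Real.exp_log ht0]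
      calc _ = (N : ℝ) ^ (Real.log t / Real.log N) * (N : ℝ) ^ (-(1 : ℝ) / 5 * ((k + 1 : ℕ) : ℝ)) := by
            rw [← this]
        _ ≤ _ := by
          rw [← Real.rpow_add hN0]
          refine Real.rpow_le_rpow_of_exponent_le (by linarith) ?_
          push_cast; linarith
    calc _ = 2 * (t * ((x : ℝ) * y / n) ^ (k + 1)) := by ring
      _ ≤ 2 * (t * ((N : ℝ) ^ (-(1 : ℝ) / 5)) ^ (k + 1)) := by gcongr
      _ ≤ _ := by gcongr
  have hdiff : ‖∑ x ∈ Finset.range M, ∑ y ∈ Finset.range M, ex (-t * Real.log (n + x * y : ℕ)) -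
      ex (-t * Real.log n) * ∑ x ∈ Finset.range M, ∑ y ∈ Finset.range M,
        ex (phase a (powers k x) (powers k y))‖ ≤ (M : ℝ) ^ 2 * (2 * (N : ℝ) ^ (-(2 : ℝ) / 5)) := by
    simp only [Finset.mul_sum, ← Finset.sum_sub_distrib]
    refine (norm_sum_le_of_le _ fun x hx => norm_sum_le_of_le _ fun y hy => hterm x hx y hy).trans
      (le_of_eq ?_)
    simp; ring
  rw [hcast] at hbil
  calc _ = ‖(∑ x ∈ Finset.range M, ∑ y ∈ Finset.range M, ex (-t * Real.log (n + x * y : ℕ)) -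
      ex (-t * Real.log n) * ∑ x ∈ Finset.range M, ∑ y ∈ Finset.range M,
        ex (phase a (powers k x) (powers k y))) + ex (-t * Real.log n) *
        ∑ x ∈ Finset.range M, ∑ y ∈ Finset.range M, ex (phase a (powers k x) (powers k y))‖ := by
        congr 1; ring
    _ ≤ (M : ℝ) ^ 2 * (2 * (N : ℝ) ^ (-(2 : ℝ) / 5)) + 1 * (Real.exp 9 * (M : ℝ) ^ 2 *
        Real.exp (-(1 / 42515280) * (Real.log N ^ 3 / Real.log t ^ 2))) := by
        refine (norm_add_le _ _).trans (add_le_add hdiff ?_)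
        rw [norm_mul, norm_ex]
        gcongr
    _ = _ := by ring

/-- Vinogradov's bound for zeta sums. -/
lemma zeta_sum_le {t : ℝ} {N N' : ℕ} (hN : 1 ≤ N) (ht : 10 ^ 60 ≤ t) (hNt : (N : ℝ) ≤ t ^ 2)
    (h1 : N ≤ N') (h2 : N' ≤ 2 * N) :
    ‖∑ n ∈ Finset.Ioc N N', ex (-t * Real.log n)‖ ≤ (Real.exp 9 + 4) * N *
      Real.exp (-(1 / 42515280) * (Real.log N ^ 3 / Real.log t ^ 2)) := by
  have ht0 : 0 < t := lt_of_lt_of_le (by norm_num) ht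
  have hNr : (1 : ℝ) ≤ N := by exact_mod_cast hN
  have hN0 : (0 : ℝ) < N := by linarith
  have hlt : 1 ≤ Real.log t := by
    rw [Real.le_log_iff_exp_le ht0]
    have := Real.exp_one_lt_d9
    refine le_trans ?_ ht
    norm_num; linarith
  have hcard : ((Finset.Ioc N N').card : ℝ) ≤ N := by
    rw [Nat.card_Ioc]; exact_mod_cast (by omega : N' - N ≤ N)
  have hlN0 : 0 ≤ Real.log N := Real.log_nonneg hNr
  rcases lt_or_ge N 32 with hN32 | hN32
  · have hlog : Real.log N ≤ 4 := by
      rw [Real.log_le_iff_le_exp hN0]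
      have h3 : (2.7 : ℝ) ^ 4 ≤ Real.exp 4 := by
        have : Real.exp 4 = Real.exp 1 ^ 4 := by rw [← Real.exp_nat_mul]; norm_num
        rw [this]
        have := Real.exp_one_gt_d9
        gcongr; linarith
      have : (N : ℝ) ≤ 32 := by exact_mod_cast hN32.le
      refine this.trans (le_trans (by norm_num) h3)
    have hQ : Real.log N ^ 3 / Real.log t ^ 2 ≤ 64 := by
      rw [div_le_iff₀ (by positivity)]
      have h5 : Real.log N ^ 3 ≤ 4 ^ 3 := by gcongr
      nlinarith
    have hE : Real.exp (-1) ≤ Real.exp (-(1 / 42515280) * (Real.log N ^ 3 / Real.log t ^ 2)) := by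
      rw [Real.exp_le_exp]; linarith
    have h9 : 1 ≤ (Real.exp 9 + 4) * Real.exp (-1) := by
      rw [add_mul, ← Real.exp_add]
      have : 1 ≤ Real.exp (9 + -1) := Real.one_le_exp (by norm_num)
      linarith [Real.exp_pos (-1)]
    calc _ ≤ ∑ n ∈ Finset.Ioc N N', (1 : ℝ) := norm_sum_le_of_le _ fun n _ => (norm_ex _).le
      _ ≤ N * 1 := by simpa using hcard
      _ ≤ N * ((Real.exp 9 + 4) * Real.exp (-(1 / 42515280) * (Real.log N ^ 3 / Real.log t ^ 2))) := by
          gcongr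
          exact h9.trans (by gcongr)
      _ = _ := by ring
  · set E := Real.exp (-(1 / 42515280) * (Real.log N ^ 3 / Real.log t ^ 2)) with hE
    set M := shiftLen N with hM
    have hM1 : (M : ℝ) ≤ (N : ℝ) ^ ((2 : ℝ) / 5) := Nat.floor_le (by positivity)
    have hM0 : 1 ≤ M := Nat.le_floor (by exact_mod_cast Real.one_le_rpow hNr (by norm_num))
    have hMr : (1 : ℝ) ≤ M := by exact_mod_cast hM0
    set S := ∑ n ∈ Finset.Ioc N N', ex (-t * Real.log n) with hS
    have hsh : ∀ x ∈ Finset.range M, ∀ y ∈ Finset.range M,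
        ‖S - ∑ n ∈ Finset.Ioc N N', ex (-t * Real.log (n + x * y : ℕ))‖ ≤ 2 * (M : ℝ) ^ 2 := by
      intro x hx y hy
      refine (norm_sum_shift_le (fun n => ex (-t * Real.log n)) (fun n => (norm_ex _).le) h1
        (x * y)).trans ?_
      have hx' : (x : ℝ) ≤ M := by exact_mod_cast (Finset.mem_range.mp hx).le
      have hy' : (y : ℝ) ≤ M := by exact_mod_cast (Finset.mem_range.mp hy).le
      push_cast
      rw [sq]
      gcongr
    have hA : ‖(M : ℂ) ^ 2 * S - ∑ n ∈ Finset.Ioc N N', ∑ x ∈ Finset.range M,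
        ∑ y ∈ Finset.range M, ex (-t * Real.log (n + x * y : ℕ))‖ ≤
        (M : ℝ) ^ 2 * (2 * (M : ℝ) ^ 2) := by
      have e : (M : ℂ) ^ 2 * S - ∑ n ∈ Finset.Ioc N N', ∑ x ∈ Finset.range M,
        ∑ y ∈ Finset.range M, ex (-t * Real.log (n + x * y : ℕ)) =
        ∑ x ∈ Finset.range M, ∑ y ∈ Finset.range M,
          (S - ∑ n ∈ Finset.Ioc N N', ex (-t * Real.log (n + x * y : ℕ))) := by
        simp only [Finset.sum_sub_distrib]
        congr 1
        · simp; ring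
        · rw [Finset.sum_comm]
          exact Finset.sum_congr rfl fun x _ => Finset.sum_comm
      rw [e]
      refine (norm_sum_le_of_le _ fun x hx => norm_sum_le_of_le _ fun y hy => hsh x hx y hy).trans
        (le_of_eq ?_)
      simp; ring
    have hB : ‖∑ n ∈ Finset.Ioc N N', ∑ x ∈ Finset.range M,
        ∑ y ∈ Finset.range M, ex (-t * Real.log (n + x * y : ℕ))‖ ≤
        N * ((M : ℝ) ^ 2 * (Real.exp 9 * E + 2 * (N : ℝ) ^ (-(2 : ℝ) / 5))) := by
      refine (norm_sum_le_of_le (n := fun _ => (M : ℝ) ^ 2 * (Real.exp 9 * E +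
        2 * (N : ℝ) ^ (-(2 : ℝ) / 5))) _ fun n hn => ?_).trans ?_
      · obtain ⟨hn1, hn2⟩ := Finset.mem_Ioc.mp hn
        exact inner_sum_le hN32 ht hNt (by omega) (by omega)
      · rw [Finset.sum_const, nsmul_eq_mul]
        gcongr
    have hMM : (M : ℝ) ^ 2 ≤ (N : ℝ) * (N : ℝ) ^ (-(1 : ℝ) / 5) := by
      calc (M : ℝ) ^ 2 ≤ ((N : ℝ) ^ ((2 : ℝ) / 5)) ^ 2 := by gcongr
        _ = (N : ℝ) ^ (1 : ℝ) * (N : ℝ) ^ (-(1 : ℝ) / 5) := by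
            rw [← Real.rpow_natCast, ← Real.rpow_mul hN0.le, ← Real.rpow_add hN0]; norm_num
        _ = _ := by rw [Real.rpow_one]
    have hN25 : (N : ℝ) ^ (-(2 : ℝ) / 5) ≤ (N : ℝ) ^ (-(1 : ℝ) / 5) :=
      Real.rpow_le_rpow_of_exponent_le hNr (by norm_num)
    have hNE : (N : ℝ) ^ (-(1 : ℝ) / 5) ≤ E := by
      rw [hE, Real.rpow_def_of_pos hN0, Real.exp_le_exp]
      have h3 : Real.log N ≤ 2 * Real.log t := by
        have := Real.log_le_log hN0 hNt
        rwa [Real.log_pow] at this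
      have h4 : Real.log N ^ 3 / Real.log t ^ 2 ≤ 4 * Real.log N := by
        rw [div_le_iff₀ (by positivity)]
        have : Real.log N ^ 2 ≤ (2 * Real.log t) ^ 2 := by gcongr
        nlinarith
      linarith
    have hfin : (M : ℝ) ^ 2 * ‖S‖ ≤ (M : ℝ) ^ 2 * ((Real.exp 9 + 4) * N * E) := by
      have hn2 : ‖(M : ℂ) ^ 2 * S‖ = (M : ℝ) ^ 2 * ‖S‖ := by simp
      rw [← hn2]
      have := norm_le_norm_sub_add ((M : ℂ) ^ 2 * S) (∑ n ∈ Finset.Ioc N N', ∑ x ∈ Finset.range M,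
        ∑ y ∈ Finset.range M, ex (-t * Real.log (n + x * y : ℕ)))
      refine (this.trans (add_le_add hA hB)).trans ?_
      have h5 : 2 * (M : ℝ) ^ 2 ≤ 2 * (N * E) := by
        refine mul_le_mul_of_nonneg_left (hMM.trans ?_) (by norm_num)
        gcongr
      have h6 : (N : ℝ) * (2 * (N : ℝ) ^ (-(2 : ℝ) / 5)) ≤ N * (2 * E) := by
        gcongr; exact hN25.trans hNE
      calc _ = (M : ℝ) ^ 2 * (2 * (M : ℝ) ^ 2 + N * (Real.exp 9 * E) +
            (N : ℝ) * (2 * (N : ℝ) ^ (-(2 : ℝ) / 5))) := by ring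
        _ ≤ (M : ℝ) ^ 2 * (2 * (N * E) + N * (Real.exp 9 * E) + N * (2 * E)) := by
            gcongr
        _ = _ := by ring
    exact le_of_mul_le_mul_left hfin (by positivity)

/-- `(s - 1) ((n+1)^{-s} - ∫_n^{n+1} x^{-s} dx)` in closed form. -/
noncomputable def zterm (n : ℕ) (s : ℂ) : ℂ :=
  (s - 1) * ((n + 1 : ℕ) : ℂ) ^ (-s) + ((n + 1 : ℕ) : ℂ) ^ (1 - s) - (n : ℂ) ^ (1 - s)

lemma hasDerivAt_ofReal_cpow' {x : ℝ} (hx : 0 < x) (s : ℂ) :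
    HasDerivAt (fun y : ℝ => (y : ℂ) ^ s) (s * (x : ℂ) ^ (s - 1)) x := by
  by_cases hs : s = 0
  · subst hs
    simpa using hasDerivAt_const x (1 : ℂ)
  · exact hasDerivAt_ofReal_cpow_const hx.ne' hs

lemma norm_zterm_le {n : ℕ} (hn : 1 ≤ n) {s : ℂ} (hs : 1 / 2 ≤ s.re) :
    ‖zterm n s‖ ≤ ‖s - 1‖ * ‖s‖ * (n : ℝ) ^ (-(3 : ℝ) / 2) := by
  have hn' : (1 : ℝ) ≤ n := by exact_mod_cast hn
  have hn0 : (0 : ℝ) < n := by linarith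
  have hpow : ∀ x ∈ Set.Icc (n : ℝ) (n + 1), ‖(x : ℂ) ^ (-s - 1)‖ ≤ (n : ℝ) ^ (-(3 : ℝ) / 2) := by
    intro x hx
    have hx0 : 0 < x := hn0.trans_le hx.1
    rw [Complex.norm_cpow_eq_rpow_re_of_pos hx0]
    calc x ^ (-s - 1).re ≤ x ^ (-(3 : ℝ) / 2) :=
          Real.rpow_le_rpow_of_exponent_le (hn'.trans hx.1) (by simp; linarith)
      _ ≤ _ := Real.rpow_le_rpow_of_nonpos hn0 hx.1 (by norm_num)
  have h1 : ∀ x ∈ Set.Icc (n : ℝ) (n + 1), ‖(((n + 1 : ℕ) : ℝ) : ℂ) ^ (-s) - (x : ℂ) ^ (-s)‖ ≤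
      ‖s‖ * (n : ℝ) ^ (-(3 : ℝ) / 2) := by
    intro x hx
    have := (convex_Icc (n : ℝ) (n + 1)).norm_image_sub_le_of_norm_hasDerivWithin_le
      (f := fun y : ℝ => (y : ℂ) ^ (-s)) (f' := fun y : ℝ => -s * (y : ℂ) ^ (-s - 1))
      (C := ‖s‖ * (n : ℝ) ^ (-(3 : ℝ) / 2)) (x := x) (y := ((n + 1 : ℕ) : ℝ))
      (fun y hy => (hasDerivAt_ofReal_cpow' (hn0.trans_le hy.1) (-s)).hasDerivWithinAt)
      (fun y hy => by
        rw [norm_mul, norm_neg]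
        exact mul_le_mul_of_nonneg_left (hpow y hy) (norm_nonneg _)) hx
      (by push_cast; constructor <;> linarith)
    refine this.trans ?_
    rw [Real.norm_eq_abs]
    have : |((n + 1 : ℕ) : ℝ) - x| ≤ 1 := by
      push_cast; rw [abs_le]; constructor <;> linarith [hx.1, hx.2]
    exact mul_le_of_le_one_right (by positivity) this
  have h2 := (convex_Icc (n : ℝ) (n + 1)).norm_image_sub_le_of_norm_hasDerivWithin_le
      (f := fun y : ℝ => (s - 1) * (((n + 1 : ℕ) : ℝ) : ℂ) ^ (-s) * (y : ℂ) + (y : ℂ) ^ (1 - s))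
      (f' := fun y : ℝ => (s - 1) * (((n + 1 : ℕ) : ℝ) : ℂ) ^ (-s) * 1 +
        (1 - s) * (y : ℂ) ^ (1 - s - 1))
      (C := ‖s - 1‖ * ‖s‖ * (n : ℝ) ^ (-(3 : ℝ) / 2)) (x := (n : ℝ)) (y := ((n + 1 : ℕ) : ℝ))
      (fun y hy => ((((hasDerivAt_id y).ofReal_comp).const_mul _).add
        (hasDerivAt_ofReal_cpow' (hn0.trans_le hy.1) (1 - s))).hasDerivWithinAt)
      (fun y hy => by
        have : (s - 1) * (((n + 1 : ℕ) : ℝ) : ℂ) ^ (-s) * 1 + (1 - s) * (y : ℂ) ^ (1 - s - 1) =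
          (s - 1) * ((((n + 1 : ℕ) : ℝ) : ℂ) ^ (-s) - (y : ℂ) ^ (-s)) := by
          rw [show 1 - s - 1 = -s by ring]; ring
        rw [this, norm_mul, mul_assoc]
        exact mul_le_mul_of_nonneg_left (h1 y hy) (norm_nonneg _))
      (by constructor <;> linarith) (by push_cast; constructor <;> linarith)
  have e : (s - 1) * (((n + 1 : ℕ) : ℝ) : ℂ) ^ (-s) * (((n + 1 : ℕ) : ℝ) : ℂ) +
      (((n + 1 : ℕ) : ℝ) : ℂ) ^ (1 - s) - ((s - 1) * (((n + 1 : ℕ) : ℝ) : ℂ) ^ (-s) * ((n : ℝ) : ℂ)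
      + ((n : ℝ) : ℂ) ^ (1 - s)) = zterm n s := by
    rw [zterm]; push_cast; ring
  simp only [e] at h2
  refine h2.trans ?_
  rw [Real.norm_eq_abs]; push_cast; simp

lemma pow_three_halves_le {n : ℕ} (hn : 1 ≤ n) :
    (n : ℝ) ^ (-(3 : ℝ) / 2) ≤ 4 * (1 / √n - 1 / √(n + 1 : ℕ)) := by
  have hn' : (1 : ℝ) ≤ n := by exact_mod_cast hn
  have hn0 : (0 : ℝ) < n := by linarith
  have e : (n : ℝ) ^ (-(3 : ℝ) / 2) = 1 / (n * √n) := by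
    rw [neg_div, Real.rpow_neg hn0.le, Real.sqrt_eq_rpow, ← one_div]
    congr 1
    nth_rewrite 2 [← Real.rpow_one (n : ℝ)]
    rw [← Real.rpow_add hn0]; norm_num
  rw [e]
  set a := √(n : ℝ) with ha
  set b := √((n + 1 : ℕ) : ℝ) with hb
  have ha0 : 0 < a := Real.sqrt_pos.mpr hn0
  have hb0 : 0 < b := Real.sqrt_pos.mpr (by positivity)
  have ha2 : a ^ 2 = n := Real.sq_sqrt hn0.le
  have hb2 : b ^ 2 = n + 1 := by rw [hb, Real.sq_sqrt (by positivity)]; push_cast; ring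
  have hab : (b - a) * (b + a) = 1 := by linear_combination hb2 - ha2
  have hba : b ≤ 3 / 2 * a := by
    refine le_of_pow_le_pow_left₀ two_ne_zero (by positivity) ?_
    rw [mul_pow, hb2, ha2]; nlinarith
  have hs : 0 < b + a := by positivity
  have hd : b - a = 1 / (b + a) := by field_simp; linarith
  rw [div_sub_div _ _ ha0.ne' hb0.ne', ← ha2, one_mul, mul_one, hd, ← mul_div_assoc,
    mul_one_div, div_div, div_le_div_iff₀ (by positivity) (by positivity)]
  have : (b + a) * (a * b) ≤ (5 / 2 * a) * (a * (3 / 2 * a)) := by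
    gcongr; linarith
  nlinarith [pow_pos ha0 3]

lemma sum_three_halves {N : ℕ} (hN : 1 ≤ N) :
    Summable (fun n : ℕ => ((n + N : ℕ) : ℝ) ^ (-(3 : ℝ) / 2)) ∧
      ∑' n : ℕ, ((n + N : ℕ) : ℝ) ^ (-(3 : ℝ) / 2) ≤ 4 / √N := by
  have hb : ∀ K : ℕ, ∑ n ∈ Finset.range K, ((n + N : ℕ) : ℝ) ^ (-(3 : ℝ) / 2) ≤ 4 / √N := by
    intro K
    have : ∑ n ∈ Finset.range K, ((n + N : ℕ) : ℝ) ^ (-(3 : ℝ) / 2) ≤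
        4 * (1 / √N - 1 / √(K + N : ℕ)) := by
      induction K with
      | zero => simp
      | succ K ih =>
        rw [Finset.sum_range_succ]
        have h := pow_three_halves_le (show 1 ≤ K + N by omega)
        rw [show K + 1 + N = K + N + 1 by ring]
        linarith
    refine this.trans ?_
    have h0 : 0 ≤ 1 / √((K + N : ℕ) : ℝ) := by positivity
    rw [show 4 / √(N : ℝ) = 4 * (1 / √N) by ring]
    linarith
  have hs := summable_of_sum_range_le (fun n => by positivity) hb
  exact ⟨hs, hs.tsum_le_of_sum_range_le hb⟩

lemma sum_zterm (N K : ℕ) (s : ℂ) : ∑ n ∈ Finset.range K, zterm (n + N) s =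
    (s - 1) * ∑ n ∈ Finset.range K, ((n + N + 1 : ℕ) : ℂ) ^ (-s) +
      ((K + N : ℕ) : ℂ) ^ (1 - s) - (N : ℂ) ^ (1 - s) := by
  induction K with
  | zero => simp
  | succ K ih =>
    rw [Finset.sum_range_succ, ih, Finset.sum_range_succ, zterm, show K + 1 + N = K + N + 1 by ring]
    ring

lemma zeta_eq_of_one_lt {N : ℕ} {s : ℂ} (hs : 1 < s.re) (hN : 1 ≤ N) :
    riemannZeta₁ s = (s - 1) * ∑ n ∈ Finset.Ioc 0 N, (n : ℂ) ^ (-s) + (N : ℂ) ^ (1 - s) +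
      ∑' n, zterm (n + N) s := by
  have hs1 : s ≠ 1 := by rintro rfl; simp at hs
  have hsum : Summable fun n => zterm (n + N) s := by
    refine Summable.of_norm_bounded ((sum_three_halves hN).1.mul_left (‖s - 1‖ * ‖s‖)) fun n => ?_
    exact norm_zterm_le (by omega) (by linarith)
  have h1 := hsum.hasSum.tendsto_sum_nat
  have hz : HasSum (fun n : ℕ => ((n + 1 : ℕ) : ℂ) ^ (-s)) (riemannZeta s) := by
    rw [zeta_eq_tsum_one_div_nat_add_one_cpow hs]
    have : (fun n : ℕ => ((n + 1 : ℕ) : ℂ) ^ (-s)) = fun n : ℕ => 1 / ((n : ℂ) + 1) ^ s := by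
      ext n; rw [Complex.cpow_neg, one_div]; push_cast; rfl
    rw [this]
    refine Summable.hasSum ?_
    have h := (Complex.summable_one_div_nat_cpow (p := s)).mpr hs
    have h2 := (summable_nat_add_iff 1).mpr h
    simpa using h2
  have hz2 := (hasSum_nat_add_iff' N).mpr hz
  have h2 := hz2.tendsto_sum_nat
  have h3 : Filter.Tendsto (fun K : ℕ => ((K + N : ℕ) : ℂ) ^ (1 - s)) Filter.atTop (nhds 0) := by
    rw [tendsto_zero_iff_norm_tendsto_zero]
    have h4 : Filter.Tendsto (fun K : ℕ => ((K + N : ℕ) : ℝ) ^ (-(s.re - 1))) Filter.atTop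
        (nhds 0) :=
      (tendsto_rpow_neg_atTop (by linarith)).comp (tendsto_natCast_atTop_atTop.comp
        (Filter.tendsto_add_atTop_nat N))
    refine h4.congr fun K => ?_
    have : (0 : ℝ) < ((K + N : ℕ) : ℝ) := by exact_mod_cast (by omega)
    rw [← Complex.ofReal_natCast, Complex.norm_cpow_eq_rpow_re_of_pos this]
    simp
  have h4 : Filter.Tendsto (fun K => ∑ n ∈ Finset.range K, zterm (n + N) s) Filter.atTop
      (nhds ((s - 1) * (riemannZeta s - ∑ i ∈ Finset.range N, ((i + 1 : ℕ) : ℂ) ^ (-s)) + 0 -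
        (N : ℂ) ^ (1 - s))) := by
    simp only [sum_zterm]
    exact ((h2.const_mul _).add h3).sub_const _
  have h5 := tendsto_nhds_unique h1 h4
  have h6 : ∑ n ∈ Finset.Ioc 0 N, (n : ℂ) ^ (-s) = ∑ i ∈ Finset.range N, ((i + 1 : ℕ) : ℂ) ^ (-s) := by
    rw [Finset.range_eq_Ico, Finset.sum_Ico_add' (fun n : ℕ => (n : ℂ) ^ (-s)) 0 N 1]
    rfl
  rw [h5, h6]
  have h7 := riemannZeta_eq_inv_sub_mul hs1
  have h8 : s - 1 ≠ 0 := sub_ne_zero.mpr hs1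
  have h9 : riemannZeta₁ s = (s - 1) * riemannZeta s := by rw [h7]; field_simp
  rw [h9]; ring

lemma zeta_eq {N : ℕ} {s : ℂ} (hs : 1 / 2 < s.re) (hN : 1 ≤ N) :
    riemannZeta₁ s = (s - 1) * ∑ n ∈ Finset.Ioc 0 N, (n : ℂ) ^ (-s) + (N : ℂ) ^ (1 - s) +
      ∑' n, zterm (n + N) s := by
  set R : ℝ := ‖s‖ + 3 with hR
  set U : Set ℂ := {z | 1 / 2 < z.re} ∩ Metric.ball 0 R with hU
  have hUo : IsOpen U := (isOpen_lt continuous_const Complex.continuous_re).inter Metric.isOpen_ball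
  have hUc : IsPreconnected U :=
    ((convex_halfSpace_re_gt (1 / 2)).inter (convex_ball 0 R)).isPreconnected
  have hd : ∀ n : ℕ, 1 ≤ n → Differentiable ℂ (fun z : ℂ => (n : ℂ) ^ (-z)) := fun n hn =>
    Differentiable.const_cpow (by fun_prop) (Or.inl (by exact_mod_cast (by omega)))
  have hd' : ∀ n : ℕ, 1 ≤ n → Differentiable ℂ (fun z : ℂ => (n : ℂ) ^ (1 - z)) := fun n hn =>
    Differentiable.const_cpow (by fun_prop) (Or.inl (by exact_mod_cast (by omega)))
  have hzd : ∀ n : ℕ, 1 ≤ n → Differentiable ℂ (zterm n) := fun n hn => by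
    unfold zterm
    exact (((differentiable_id.sub_const 1).mul (hd _ (by omega))).add (hd' _ (by omega))).sub
      (hd' _ hn)
  have hts : DifferentiableOn ℂ (fun z => ∑' n, zterm (n + N) z) U := by
    refine Complex.differentiableOn_tsum_of_summable_norm
      ((sum_three_halves hN).1.mul_left ((R + 1) * R))
      (fun n => (hzd _ (by omega)).differentiableOn) hUo fun n z hz => ?_
    refine (norm_zterm_le (by omega) hz.1.le).trans ?_
    have h1 : ‖z‖ ≤ R := (mem_ball_zero_iff.mp hz.2).le
    have h2 : ‖z - 1‖ ≤ R + 1 := (norm_sub_le _ _).trans (by simpa using h1)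
    gcongr
  have hrd : DifferentiableOn ℂ (fun z => (z - 1) * ∑ n ∈ Finset.Ioc 0 N, (n : ℂ) ^ (-z) +
      (N : ℂ) ^ (1 - z) + ∑' n, zterm (n + N) z) U := by
    refine DifferentiableOn.add (Differentiable.differentiableOn ?_) hts
    refine ((differentiable_id.sub_const 1).mul ?_).add (hd' N hN)
    refine Differentiable.fun_sum fun n hn => hd n (Finset.mem_Ioc.mp hn).1
  have h2U : (2 : ℂ) ∈ U := by
    refine ⟨by norm_num, ?_⟩
    rw [mem_ball_zero_iff, hR]; norm_num; linarith [norm_nonneg s]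
  have heq := (differentiable_riemannZeta₁.differentiableOn.analyticOnNhd hUo
    ).eqOn_of_preconnected_of_eventuallyEq (hrd.analyticOnNhd hUo) hUc h2U (by
      have : ∀ᶠ z : ℂ in nhds 2, 1 < z.re :=
        (isOpen_lt continuous_const Complex.continuous_re).mem_nhds (by norm_num)
      filter_upwards [this] with z hz
      exact zeta_eq_of_one_lt hz hN)
  exact heq ⟨hs, by rw [mem_ball_zero_iff, hR]; linarith⟩

lemma norm_zeta_le {N : ℕ} {s : ℂ} (hs : 1 / 2 < s.re) (hs1 : s ≠ 1) (hN : 1 ≤ N) :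
    ‖riemannZeta s‖ ≤ ‖∑ n ∈ Finset.Ioc 0 N, (n : ℂ) ^ (-s)‖ + (N : ℝ) ^ (1 - s.re) / ‖s - 1‖ +
      4 * ‖s‖ / √N := by
  have h8 : s - 1 ≠ 0 := sub_ne_zero.mpr hs1
  have h9 : 0 < ‖s - 1‖ := norm_pos_iff.mpr h8
  rw [riemannZeta_eq_inv_sub_mul hs1, zeta_eq hs hN, norm_mul, norm_inv, inv_mul_le_iff₀ h9]
  have hts : ‖∑' n, zterm (n + N) s‖ ≤ ‖s - 1‖ * ‖s‖ * (4 / √N) := by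
    have h3 := sum_three_halves hN
    have hb : ∀ n, ‖zterm (n + N) s‖ ≤ ‖s - 1‖ * ‖s‖ * ((n + N : ℕ) : ℝ) ^ (-(3 : ℝ) / 2) :=
      fun n => norm_zterm_le (by omega) hs.le
    refine (tsum_of_norm_bounded ((h3.1.mul_left _).hasSum) hb).trans ?_
    rw [tsum_mul_left]
    gcongr
    exact h3.2
  have hN0 : (0 : ℝ) < N := by exact_mod_cast hN
  have hNn : ‖(N : ℂ) ^ (1 - s)‖ = (N : ℝ) ^ (1 - s.re) := by
    rw [← Complex.ofReal_natCast, Complex.norm_cpow_eq_rpow_re_of_pos hN0]; simp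
  calc _ ≤ ‖(s - 1) * ∑ n ∈ Finset.Ioc 0 N, (n : ℂ) ^ (-s)‖ + ‖(N : ℂ) ^ (1 - s)‖ +
        ‖∑' n, zterm (n + N) s‖ := norm_add₃_le
    _ ≤ ‖s - 1‖ * ‖∑ n ∈ Finset.Ioc 0 N, (n : ℂ) ^ (-s)‖ + (N : ℝ) ^ (1 - s.re) +
        ‖s - 1‖ * ‖s‖ * (4 / √N) := by
        rw [norm_mul, hNn]; gcongr
    _ = _ := by field_simp

lemma abel_bound (w : ℕ → ℝ) (b : ℕ → ℂ) {B : ℝ} {N N' : ℕ} (h : N ≤ N')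
    (hw : ∀ m, N ≤ m → w (m + 1) ≤ w m) (hw0 : ∀ m, N ≤ m → 0 ≤ w m)
    (hB : ∀ m, N ≤ m → m ≤ N' → ‖∑ n ∈ Finset.Ioc N m, b n‖ ≤ B) :
    ‖∑ n ∈ Finset.Ioc N N', (w n : ℂ) * b n‖ ≤ w N * B := by
  have key : ∀ m, N ≤ m → m ≤ N' → ‖∑ n ∈ Finset.Ioc N m, (w n : ℂ) * b n -
      w m * ∑ n ∈ Finset.Ioc N m, b n‖ ≤ (w N - w m) * B := by
    intro m hm
    induction m, hm using Nat.le_induction with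
    | base => simp
    | succ m hm ih =>
      intro hm'
      have h1 := ih (by omega)
      rw [Finset.sum_Ioc_succ_top (by omega), Finset.sum_Ioc_succ_top (by omega)]
      have e : ∑ n ∈ Finset.Ioc N m, (w n : ℂ) * b n + w (m + 1) * b (m + 1) -
          w (m + 1) * (∑ n ∈ Finset.Ioc N m, b n + b (m + 1)) =
          (∑ n ∈ Finset.Ioc N m, (w n : ℂ) * b n - w m * ∑ n ∈ Finset.Ioc N m, b n) +
          ((w m - w (m + 1) : ℝ) : ℂ) * ∑ n ∈ Finset.Ioc N m, b n := by push_cast; ring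
      rw [e]
      refine (norm_add_le _ _).trans ?_
      rw [norm_mul, Complex.norm_real, Real.norm_of_nonneg (by linarith [hw m hm])]
      have := mul_le_mul_of_nonneg_left (hB m hm (by omega)) (show 0 ≤ w m - w (m + 1) by
        linarith [hw m hm])
      linarith
  have h1 := key N' h le_rfl
  have h2 : ‖(w N' : ℂ) * ∑ n ∈ Finset.Ioc N N', b n‖ ≤ w N' * B := by
    rw [norm_mul, Complex.norm_real, Real.norm_of_nonneg (hw0 N' h)]
    exact mul_le_mul_of_nonneg_left (hB N' h le_rfl) (hw0 N' h)
  have h3 := norm_le_norm_sub_add (∑ n ∈ Finset.Ioc N N', (w n : ℂ) * b n)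
    ((w N' : ℂ) * ∑ n ∈ Finset.Ioc N N', b n)
  linarith

lemma natCast_cpow_neg {n : ℕ} (hn : 0 < n) (sig t : ℝ) :
    (n : ℂ) ^ (-((sig : ℂ) + t * Complex.I)) = (((n : ℝ) ^ (-sig) : ℝ) : ℂ) * ex (-t * Real.log n) := by
  have hn0 : (0 : ℝ) < n := by exact_mod_cast hn
  rw [Complex.cpow_def_of_ne_zero (by exact_mod_cast hn.ne'), Real.rpow_def_of_pos hn0, ex,
    Complex.ofReal_exp, ← Complex.exp_add, Complex.natCast_log.symm]
  congr 1; push_cast; ring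

lemma mul_sub_cube_div_sq_le {c del l tau q : ℝ} (hc : 0 < c) (hl : 0 ≤ l) (htau : 0 < tau)
    (hq : 0 ≤ q) (h : del ^ 3 * tau ^ 2 ≤ q ^ 2) :
    del * l - c * (l ^ 3 / tau ^ 2) ≤ q / √c := by
  have hsc : 0 < √c := Real.sqrt_pos.mpr hc
  rcases le_or_gt (del * tau ^ 2) (c * l ^ 2) with h1 | h1
  · have : del * l ≤ c * (l ^ 3 / tau ^ 2) := by
      rw [← mul_div_assoc, le_div_iff₀ (by positivity)]
      nlinarith
    have : 0 ≤ q / √c := by positivity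
    linarith
  · have h2 : 0 ≤ c * (l ^ 3 / tau ^ 2) := by positivity
    have h3 : del * l ≤ q / √c := by
      rw [le_div_iff₀ hsc]
      refine le_of_pow_le_pow_left₀ two_ne_zero hq ?_
      rw [mul_pow, Real.sq_sqrt hc.le]
      nlinarith [mul_le_mul_of_nonneg_left h1.le (sq_nonneg del)]
    linarith

lemma log_pos_of_large {t : ℝ} (ht : 10 ^ 60 ≤ t) : 10 ≤ Real.log t := by
  have ht0 : 0 < t := lt_of_lt_of_le (by norm_num) ht
  rw [Real.le_log_iff_exp_le ht0]
  have h := Real.exp_one_lt_d9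
  have : Real.exp 10 = Real.exp 1 ^ 10 := by rw [← Real.exp_nat_mul]; norm_num
  rw [this]
  calc Real.exp 1 ^ 10 ≤ 3 ^ 10 := by gcongr; linarith
    _ ≤ 10 ^ 60 := by norm_num
    _ ≤ t := ht

lemma block_le {t sig del : ℝ} {N N' : ℕ} (hN : 1 ≤ N) (ht : 10 ^ 60 ≤ t) (hNt : (N : ℝ) ≤ t ^ 2)
    (h1 : N ≤ N') (h2 : N' ≤ 2 * N) (hdel1 : del ≤ 1 / 4)
    (hd : del ^ 3 * Real.log t ^ 2 ≤ Real.log (Real.log t) ^ 2) (hsig : 1 - del ≤ sig) :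
    ‖∑ n ∈ Finset.Ioc N N', (n : ℂ) ^ (-((sig : ℂ) + t * Complex.I))‖ ≤
      (Real.exp 9 + 4) * Real.log t ^ (√42515280 : ℝ) := by
  have hNr : (1 : ℝ) ≤ N := by exact_mod_cast hN
  have hN0 : (0 : ℝ) < N := by linarith
  have hlt := log_pos_of_large ht
  have hlt0 : 0 < Real.log t := by linarith
  set E := (Real.exp 9 + 4) * N *
      Real.exp (-(1 / 42515280) * (Real.log N ^ 3 / Real.log t ^ 2)) with hE
  have hab := abel_bound (fun n => (n : ℝ) ^ (-sig)) (fun n => ex (-t * Real.log n)) h1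
    (B := E)
    (fun m hm => Real.rpow_le_rpow_of_nonpos (by exact_mod_cast (by omega : 0 < m))
      (by push_cast; linarith) (by linarith))
    (fun m hm => by positivity)
    (fun m hm hm' => zeta_sum_le hN ht hNt hm (by omega))
  have e : ∑ n ∈ Finset.Ioc N N', (n : ℂ) ^ (-((sig : ℂ) + t * Complex.I)) =
      ∑ n ∈ Finset.Ioc N N', (((n : ℝ) ^ (-sig) : ℝ) : ℂ) * ex (-t * Real.log n) :=
    Finset.sum_congr rfl fun n hn => natCast_cpow_neg (by
      have := (Finset.mem_Ioc.mp hn).1; omega) _ _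
  rw [e]
  refine hab.trans ?_
  have h3 : (N : ℝ) ^ (-sig) * N ≤ Real.exp (del * Real.log N) := by
    have : (N : ℝ) ^ (-sig) * N = (N : ℝ) ^ (1 - sig) := by
      nth_rewrite 2 [← Real.rpow_one (N : ℝ)]
      rw [← Real.rpow_add hN0]; ring_nf
    rw [this, mul_comm del, ← Real.rpow_def_of_pos hN0]
    exact Real.rpow_le_rpow_of_exponent_le hNr (by linarith)
  have hq : 0 ≤ Real.log (Real.log t) := Real.log_nonneg (by linarith)
  have h4 := mul_sub_cube_div_sq_le (c := 1 / 42515280) (by norm_num) (Real.log_nonneg hNr) hlt0 hq hd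
  calc (N : ℝ) ^ (-sig) * E = (Real.exp 9 + 4) * (((N : ℝ) ^ (-sig) * N) *
        Real.exp (-(1 / 42515280) * (Real.log N ^ 3 / Real.log t ^ 2))) := by rw [hE]; ring
    _ ≤ (Real.exp 9 + 4) * (Real.exp (del * Real.log N) *
        Real.exp (-(1 / 42515280) * (Real.log N ^ 3 / Real.log t ^ 2))) := by gcongr
    _ ≤ _ := by
        rw [← Real.exp_add, Real.rpow_def_of_pos hlt0]
        gcongr
        rw [one_div, Real.sqrt_inv, div_inv_eq_mul] at h4
        linarith

lemma dirichlet_sum_le {t sig del : ℝ} (ht : 10 ^ 60 ≤ t)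
    (hdel1 : del ≤ 1 / 4)
    (hd : del ^ 3 * Real.log t ^ 2 ≤ Real.log (Real.log t) ^ 2) (hsig : 1 - del ≤ sig) (K m : ℕ)
    (hm : m ≤ 2 ^ K) (hmt : (m : ℝ) ≤ t ^ 2) :
    ‖∑ n ∈ Finset.Ioc 0 m, (n : ℂ) ^ (-((sig : ℂ) + t * Complex.I))‖ ≤
      1 + K * ((Real.exp 9 + 4) * Real.log t ^ (√42515280 : ℝ)) := by
  have hlt := log_pos_of_large ht
  induction K generalizing m with
  | zero =>
    have : m = 0 ∨ m = 1 := by simp at hm; omega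
    rcases this with rfl | rfl <;> simp
  | succ K ih =>
    have hD : 0 ≤ (Real.exp 9 + 4) * Real.log t ^ (√42515280 : ℝ) := by positivity
    rcases le_or_gt m (2 ^ K) with h | h
    · refine (ih m h hmt).trans ?_
      push_cast; linarith
    · have hle : ((2 ^ K : ℕ) : ℝ) ≤ t ^ 2 := le_trans (by exact_mod_cast h.le) hmt
      rw [← Finset.sum_Ioc_consecutive _ (Nat.zero_le (2 ^ K)) h.le]
      refine (norm_add_le _ _).trans ?_
      have h1 := ih (2 ^ K) le_rfl hle
      have h2 := block_le (Nat.one_le_two_pow) ht hle h.le (by rw [pow_succ] at hm; omega)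
        hdel1 hd hsig
      push_cast
      linarith

/-- Richert-type bound for zeta near the line `re s = 1`. -/
lemma norm_zeta_le_log_pow {t sig del : ℝ} (ht : 10 ^ 60 ≤ t)
    (hdel1 : del ≤ 1 / 4)
    (hd : del ^ 3 * Real.log t ^ 2 ≤ Real.log (Real.log t) ^ 2) (hsig : 1 - del ≤ sig)
    (hsig3 : sig ≤ 3) :
    ‖riemannZeta ((sig : ℂ) + t * Complex.I)‖ ≤ Real.log t ^ (10000 : ℝ) := by
  have hlt := log_pos_of_large ht
  have ht0 : 0 < t := lt_of_lt_of_le (by norm_num) ht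
  have ht10 : 10 ≤ t := le_trans (by norm_num) ht
  set s : ℂ := (sig : ℂ) + t * Complex.I with hs
  have hre : s.re = sig := by simp [hs]
  have him : s.im = t := by simp [hs]
  have hs1 : s ≠ 1 := by
    intro h
    have := congrArg Complex.im h
    rw [him] at this; simp at this; linarith
  set N := ⌊t ^ 2⌋₊ with hN
  have hNle : (N : ℝ) ≤ t ^ 2 := Nat.floor_le (by positivity)
  have hNge : t ^ 2 / 4 ≤ N := by
    have := Nat.lt_floor_add_one (t ^ 2)
    rw [← hN] at this; nlinarith
  have hN1 : 1 ≤ N := by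
    have : (0 : ℝ) < N := by nlinarith
    exact_mod_cast this
  have hNr : (1 : ℝ) ≤ N := by exact_mod_cast hN1
  refine (norm_zeta_le (by rw [hre]; linarith) hs1 hN1).trans ?_
  have hK : N ≤ 2 ^ (Nat.log 2 N + 1) := (Nat.lt_pow_succ_log_self (by norm_num) N).le
  have h1 := dirichlet_sum_le ht hdel1 hd hsig (Nat.log 2 N + 1) N hK hNle
  have hlog : ((Nat.log 2 N + 1 : ℕ) : ℝ) ≤ 4 * Real.log t := by
    have h2 : (2 : ℝ) ^ Nat.log 2 N ≤ N := by exact_mod_cast Nat.pow_log_le_self 2 (by omega)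
    have h3 := Real.log_le_log (by positivity) (h2.trans hNle)
    rw [Real.log_pow, Real.log_pow] at h3
    have h4 := Real.log_two_gt_d9
    push_cast at h3 ⊢
    nlinarith [(Nat.cast_nonneg (Nat.log 2 N) : (0 : ℝ) ≤ _)]
  have hs1n : t ≤ ‖s - 1‖ := by
    have := Complex.abs_im_le_norm (s - 1)
    rw [Complex.sub_im, him, Complex.one_im, sub_zero, abs_of_pos ht0] at this
    exact this
  have hsn : ‖s‖ ≤ 2 * t := by
    refine (Complex.norm_le_abs_re_add_abs_im s).trans ?_
    rw [hre, him, abs_of_pos ht0, abs_of_nonneg (by linarith)]; linarith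
  have h5 : (N : ℝ) ^ (1 - s.re) / ‖s - 1‖ ≤ 1 := by
    rw [div_le_one (by linarith), hre]
    refine le_trans ?_ hs1n
    calc (N : ℝ) ^ (1 - sig) ≤ (N : ℝ) ^ ((1 : ℝ) / 2) :=
          Real.rpow_le_rpow_of_exponent_le hNr (by linarith)
      _ ≤ (t ^ 2) ^ ((1 : ℝ) / 2) := Real.rpow_le_rpow (by positivity) hNle (by norm_num)
      _ = t := by rw [← Real.sqrt_eq_rpow, Real.sqrt_sq ht0.le]
  have h6 : 4 * ‖s‖ / √N ≤ 16 := by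
    have : t / 2 ≤ √N := Real.le_sqrt_of_sq_le (by nlinarith)
    rw [div_le_iff₀ (by linarith)]; linarith
  set Q := Real.log t ^ (√42515280 : ℝ) with hQ
  have hsq : √(42515280 : ℝ) ≤ 6521 := by
    rw [Real.sqrt_le_left (by norm_num)]; norm_num
  have hQ1 : 1 ≤ Q := Real.one_le_rpow (by linarith) (Real.sqrt_nonneg _)
  have h9 : Real.exp 9 ≤ 10 ^ 5 := by
    have h := Real.exp_one_lt_d9
    have : Real.exp 9 = Real.exp 1 ^ 9 := by rw [← Real.exp_nat_mul]; norm_num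
    rw [this]
    calc Real.exp 1 ^ 9 ≤ 2.8 ^ 9 := by gcongr; linarith
      _ ≤ _ := by norm_num
  have h10 : ((Nat.log 2 N + 1 : ℕ) : ℝ) * ((Real.exp 9 + 4) * Q) ≤
      4 * Real.log t * ((10 ^ 5 + 4) * Q) := by gcongr
  have h11 : 18 + 4 * Real.log t * ((10 ^ 5 + 4) * Q) ≤ Real.log t ^ 7 * Q := by
    have h7 : (10 : ℝ) ^ 6 ≤ Real.log t ^ 6 := by gcongr
    have e7 : Real.log t ^ 7 = Real.log t * Real.log t ^ 6 := by ring
    have hlQ : 10 ≤ Real.log t * Q := by nlinarith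
    rw [e7]
    nlinarith [mul_le_mul_of_nonneg_left h7 (show 0 ≤ Real.log t * Q by positivity)]
  have h12 : Real.log t ^ 7 * Q ≤ Real.log t ^ (10000 : ℝ) := by
    rw [hQ, ← Real.rpow_natCast, ← Real.rpow_add (by linarith)]
    refine Real.rpow_le_rpow_of_exponent_le (by linarith) ?_
    push_cast; linarith
  linarith

open Metric in
lemma exists_log_of_ne_zero {g : ℂ → ℂ} {r : ℝ} (hr : 0 < r) (hg : DifferentiableOn ℂ g (ball 0 r))
    (h0 : ∀ z ∈ ball (0 : ℂ) r, g z ≠ 0) :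
    ∃ h : ℂ → ℂ, h 0 = 0 ∧ (∀ z ∈ ball (0 : ℂ) r, HasDerivAt h (deriv g z / g z) z) ∧
      ∀ z ∈ ball (0 : ℂ) r, g z = g 0 * Complex.exp (h z) := by
  have hd : DifferentiableOn ℂ (fun z => deriv g z / g z) (ball 0 r) :=
    (hg.deriv isOpen_ball).div hg h0
  obtain ⟨h, h00, hh⟩ := hd.isExactOn_ball.with_val_at 0 0
  refine ⟨h, h00, hh, fun z hz => ?_⟩
  have hgd : ∀ z ∈ ball (0 : ℂ) r, HasDerivAt g (deriv g z) z := fun z hz =>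
    (hg.differentiableAt (isOpen_ball.mem_nhds hz)).hasDerivAt
  have hq : ∀ z ∈ ball (0 : ℂ) r, HasDerivAt (fun z => g z * Complex.exp (-h z)) 0 z := by
    intro z hz
    have h1 := (hgd z hz).mul ((hh z hz).neg.cexp)
    have h2 : g z * (deriv g z / g z) = deriv g z := mul_div_cancel₀ _ (h0 z hz)
    refine HasDerivAt.congr_deriv h1 ?_
    show deriv g z * Complex.exp (-h z) +
      g z * (Complex.exp (-h z) * -(deriv g z / g z)) = (0 : ℂ)
    linear_combination (-Complex.exp (-h z)) * h2
  have hc := (convex_ball (0 : ℂ) r).is_const_of_fderivWithin_eq_zero (𝕜 := ℂ)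
    (fun z hz => (hq z hz).differentiableAt.differentiableWithinAt)
    (fun w hw => by
      rw [fderivWithin_of_isOpen isOpen_ball hw]
      have := (hq w hw).hasFDerivAt.fderiv
      rw [this]; ext; simp) hz (mem_ball_self hr)
  simp only [h00, neg_zero, Complex.exp_zero, mul_one] at hc
  rw [← hc, mul_assoc, ← Complex.exp_add]; simp

open Metric in
lemma norm_log_le {g h : ℂ → ℂ} {r M : ℝ} (hM : 0 < M) (hr : 0 < r)
    (hh0 : h 0 = 0) (hd : DifferentiableOn ℂ h (ball 0 r))
    (hg : ∀ z ∈ ball (0 : ℂ) r, g z = g 0 * Complex.exp (h z)) (hg0 : g 0 ≠ 0)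
    (hb : ∀ z ∈ ball (0 : ℂ) r, ‖g z‖ ≤ Real.exp M * ‖g 0‖) {z : ℂ} (hz : z ∈ ball (0 : ℂ) r) :
    ‖h z‖ ≤ 2 * M * ‖z‖ / (r - ‖z‖) := by
  refine Complex.borelCaratheodory_zero hM hd (fun w hw => ?_) hr hz hh0
  have h1 := hb w hw
  rw [hg w hw, norm_mul, Complex.norm_exp, mul_comm] at h1
  have h2 := le_of_mul_le_mul_right h1 (norm_pos_iff.2 hg0)
  simpa using h2

open Metric in
lemma norm_ge_of_ball {f : ℂ → ℂ} {c : ℂ} {r M : ℝ} (hM : 0 < M) (hr : 0 < r)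
    (hf : DifferentiableOn ℂ f (ball c r)) (h0 : ∀ z ∈ ball c r, f z ≠ 0)
    (hb : ∀ z ∈ ball c r, ‖f z‖ ≤ Real.exp M * ‖f c‖) {z : ℂ} (hz : ‖z - c‖ ≤ 3 / 4 * r) :
    ‖f c‖ * Real.exp (-(6 * M)) ≤ ‖f z‖ := by
  have hmem : ∀ w ∈ ball (0 : ℂ) r, c + w ∈ ball c r := by
    intro w hw; simpa [dist_eq_norm] using hw
  have hgd : DifferentiableOn ℂ (fun w => f (c + w)) (ball 0 r) :=
    hf.comp (by fun_prop) hmem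
  obtain ⟨h, h00, hh, hexp⟩ := exists_log_of_ne_zero hr hgd (fun w hw => h0 _ (hmem w hw))
  have hzb : z - c ∈ ball (0 : ℂ) r := by
    rw [mem_ball_zero_iff]; linarith
  have h1 := norm_log_le (g := fun w => f (c + w)) hM hr h00
    (fun w hw => (hh w hw).differentiableAt.differentiableWithinAt) hexp
    (by simpa using h0 c (mem_ball_self hr)) (fun w hw => by simpa using hb _ (hmem w hw)) hzb
  have h2 : ‖h (z - c)‖ ≤ 6 * M := by
    refine h1.trans ?_
    rw [div_le_iff₀ (by linarith)]
    nlinarith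
  have h3 := hexp _ hzb
  simp only [add_sub_cancel, add_zero] at h3
  rw [h3, norm_mul, Complex.norm_exp]
  gcongr
  have := Complex.abs_re_le_norm (h (z - c))
  have := neg_abs_le (h (z - c)).re
  linarith

open Metric in
lemma norm_logDeriv_zero_le {g : ℂ → ℂ} {r M : ℝ} (hM : 0 < M) (hr : 0 < r)
    (hg : DifferentiableOn ℂ g (ball 0 r)) (h0 : ∀ z ∈ ball (0 : ℂ) r, g z ≠ 0)
    (hb : ∀ z ∈ ball (0 : ℂ) r, ‖g z‖ ≤ Real.exp M * ‖g 0‖) :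
    ‖deriv g 0 / g 0‖ ≤ 4 * M / r := by
  obtain ⟨h, h00, hh, hexp⟩ := exists_log_of_ne_zero hr hg h0
  have hd : DifferentiableOn ℂ h (ball 0 r) :=
    fun w hw => (hh w hw).differentiableAt.differentiableWithinAt
  have hsub : closedBall (0 : ℂ) (r / 2) ⊆ ball 0 r := closedBall_subset_ball (by linarith)
  have hdc : DiffContOnCl ℂ h (ball 0 (r / 2)) := by
    refine DifferentiableOn.diffContOnCl (hd.mono ?_)
    rw [closure_ball _ (by positivity)]; exact hsub
  have h1 := Complex.norm_deriv_le_of_forall_mem_sphere_norm_le (C := 2 * M) (half_pos hr) hdc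
    (fun z hz => by
      have hz' := mem_sphere_zero_iff_norm.1 hz
      refine (norm_log_le hM hr h00 hd hexp (h0 0 (mem_ball_self hr)) hb
        (hsub (sphere_subset_closedBall hz))).trans ?_
      rw [hz']
      apply le_of_eq; field_simp; ring)
  rw [(hh 0 (mem_ball_self hr)).deriv] at h1
  refine h1.trans (le_of_eq ?_)
  field_simp; ring

open Metric in
/-- Factoring out the zeros of a bounded holomorphic function in a smaller disc. -/
lemma exists_factor {f : ℂ → ℂ} {R M : ℝ} (hR : 0 < R)
    (hf : DifferentiableOn ℂ f (ball 0 R)) (hf0 : f 0 ≠ 0)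
    (hb : ∀ z ∈ ball (0 : ℂ) R, ‖f z‖ ≤ Real.exp M * ‖f 0‖) :
    ∃ (S : Multiset ℂ) (g : ℂ → ℂ), (∀ ρ ∈ S, ρ ∈ closedBall (0 : ℂ) (R / 4)) ∧
      DifferentiableOn ℂ g (ball 0 R) ∧
      (∀ z ∈ ball (0 : ℂ) R, f z = (S.map (fun ρ => z - ρ)).prod * g z) ∧
      (∀ z ∈ closedBall (0 : ℂ) (R / 4), g z ≠ 0) ∧
      ∀ z ∈ ball (0 : ℂ) (3 / 4 * R), ‖g z‖ ≤ Real.exp M * ‖g 0‖ := by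
  classical
  let P : Multiset ℂ → (ℂ → ℂ) → Prop := fun S g => (∀ ρ ∈ S, ρ ∈ closedBall (0 : ℂ) (R / 4)) ∧
      DifferentiableOn ℂ g (ball 0 R) ∧
      (∀ z ∈ ball (0 : ℂ) R, f z = (S.map (fun ρ => z - ρ)).prod * g z)
  have h0mem : (0 : ℂ) ∈ ball (0 : ℂ) R := mem_ball_self hR
  have key : ∀ S g, P S g → ∀ z ∈ ball (0 : ℂ) (3 / 4 * R),
      ‖g z‖ ≤ Real.exp M * ((1 / 2) ^ Multiset.card S * ‖g 0‖) := by
    rintro S g ⟨hS, hgd, hfac⟩ z hz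
    have hsub : closedBall (0 : ℂ) (3 / 4 * R) ⊆ ball 0 R := closedBall_subset_ball (by linarith)
    refine Complex.norm_le_of_forall_mem_frontier_norm_le (U := ball (0 : ℂ) (3 / 4 * R))
      isBounded_ball ?_ (fun w hw => ?_) (subset_closure hz)
    · refine DifferentiableOn.diffContOnCl (hgd.mono ?_)
      rw [closure_ball _ (by positivity)]; exact hsub
    · rw [frontier_ball _ (by positivity)] at hw
      have hwn := mem_sphere_zero_iff_norm.1 hw
      have h1 := hb w (hsub (sphere_subset_closedBall hw))
      rw [hfac w (hsub (sphere_subset_closedBall hw)), hfac 0 h0mem, norm_mul, norm_mul] at h1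
      have h2 : ∀ T : Multiset ℂ, (∀ ρ ∈ T, ρ ∈ closedBall (0 : ℂ) (R / 4)) →
          0 < ‖(T.map (fun ρ => w - ρ)).prod‖ ∧ ‖(T.map (fun ρ => 0 - ρ)).prod‖ ≤
            (1 / 2) ^ Multiset.card T * ‖(T.map (fun ρ => w - ρ)).prod‖ := by
        intro T
        induction T using Multiset.induction_on with
        | empty => intro _; simp
        | cons a T ih =>
          intro hT
          obtain ⟨i1, i2⟩ := ih (fun ρ h => hT ρ (Multiset.mem_cons_of_mem h))
          have ha : ‖a‖ ≤ R / 4 := by simpa using hT a (Multiset.mem_cons_self a T)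
          have hwa : R / 2 ≤ ‖w - a‖ := by
            have := norm_sub_norm_le w a
            linarith
          simp only [Multiset.map_cons, Multiset.prod_cons, norm_mul, Multiset.card_cons, zero_sub,
            norm_neg] at i2 ⊢
          refine ⟨mul_pos (by linarith) i1, ?_⟩
          calc ‖a‖ * _ ≤ (1 / 2 * ‖w - a‖) * ((1 / 2) ^ Multiset.card T * 
                ‖(T.map (fun ρ => w - ρ)).prod‖) := by
                refine mul_le_mul (by linarith) i2 (norm_nonneg _) (by positivity)
            _ = _ := by ring
      obtain ⟨i1, i2⟩ := h2 S hS
      have h3 : ‖(S.map (fun ρ => w - ρ)).prod‖ * ‖g w‖ ≤ ‖(S.map (fun ρ => w - ρ)).prod‖ *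
          (Real.exp M * ((1 / 2) ^ Multiset.card S * ‖g 0‖)) := by
        refine h1.trans ?_
        calc _ ≤ Real.exp M * (((1 / 2) ^ Multiset.card S * ‖(S.map (fun ρ => w - ρ)).prod‖) *
              ‖g 0‖) := by gcongr
          _ = _ := by ring
      exact le_of_mul_le_mul_left h3 i1
  have hbd : ∃ N : ℕ, ∀ S g, P S g → Multiset.card S ≤ N := by
    obtain ⟨N, hN⟩ := exists_pow_lt_of_lt_one (Real.exp_pos (-M)) (by norm_num : (1 / 2 : ℝ) < 1)
    refine ⟨N, fun S g hP => ?_⟩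
    by_contra! hlt
    have h1 := key S g hP 0 (mem_ball_self (by positivity))
    have hg0 : 0 < ‖g 0‖ := by
      rw [norm_pos_iff]; intro h
      exact hf0 (by rw [hP.2.2 0 h0mem, h, mul_zero])
    have h2 : Real.exp M * (1 / 2) ^ Multiset.card S < 1 := by
      have : ((1 : ℝ) / 2) ^ Multiset.card S ≤ (1 / 2) ^ N :=
        pow_le_pow_of_le_one (by norm_num) (by norm_num) hlt.le
      calc _ < Real.exp M * Real.exp (-M) := by gcongr; linarith
        _ = 1 := by rw [← Real.exp_add]; simp
    nlinarith
  have hex : ∃ S g, P S g := ⟨0, f, by simp, hf, by simp⟩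
  obtain ⟨N, hN⟩ := hbd
  obtain ⟨n, ⟨S, g, hP, hn⟩, hmax⟩ : ∃ n, (∃ S g, P S g ∧ Multiset.card S = n) ∧
      ∀ S g, P S g → Multiset.card S ≤ n := by
    obtain ⟨S0, g0, h0⟩ := hex
    let Q : ℕ → Prop := fun n => ∃ S g, P S g ∧ Multiset.card S = n
    have hQ : Q (Nat.findGreatest Q N) :=
      Nat.findGreatest_spec (m := Multiset.card S0) (hN _ _ h0) ⟨S0, g0, h0, rfl⟩
    exact ⟨_, hQ, fun S g h => Nat.le_findGreatest (hN _ _ h) ⟨S, g, h, rfl⟩⟩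
  refine ⟨S, g, hP.1, hP.2.1, hP.2.2, fun ρ hρ h => ?_, fun z hz => (key S g hP z hz).trans ?_⟩
  · have hρR : ρ ∈ ball (0 : ℂ) R := closedBall_subset_ball (by linarith) hρ
    have hP' : P (ρ ::ₘ S) (dslope g ρ) := by
      refine ⟨fun a ha => ?_, ?_, fun z hz => ?_⟩
      · rcases Multiset.mem_cons.1 ha with rfl | ha
        exacts [hρ, hP.1 a ha]
      · exact (Complex.differentiableOn_dslope (isOpen_ball.mem_nhds hρR)).2 hP.2.1
      · have := sub_smul_dslope g ρ z
        rw [h, sub_zero, smul_eq_mul] at this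
        rw [hP.2.2 z hz, ← this]
        simp only [Multiset.map_cons, Multiset.prod_cons]; ring
    have := hmax _ _ hP'
    rw [Multiset.card_cons, hn] at this
    omega
  · gcongr
    exact mul_le_of_le_one_left (norm_nonneg _) (pow_le_one₀ (by norm_num) (by norm_num))

lemma logDeriv_multiset_prod (S : Multiset ℂ) (hS : (S.map (fun ρ => (0 : ℂ) - ρ)).prod ≠ 0) :
    ∃ d, HasDerivAt (fun z : ℂ => (S.map (fun ρ => z - ρ)).prod) d 0 ∧
      d / (S.map (fun ρ => (0 : ℂ) - ρ)).prod = (S.map (fun ρ => 1 / (0 - ρ))).sum := by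
  induction S using Multiset.induction_on with
  | empty => exact ⟨0, by simpa using hasDerivAt_const (0 : ℂ) (1 : ℂ), by simp⟩
  | cons a T ih =>
    simp only [Multiset.map_cons, Multiset.prod_cons, Multiset.sum_cons] at hS ⊢
    obtain ⟨h1, h2⟩ := mul_ne_zero_iff.1 hS
    obtain ⟨d, hd, hd2⟩ := ih h2
    refine ⟨_, ((hasDerivAt_id (0 : ℂ)).sub_const a).mul hd, ?_⟩
    rw [← hd2]
    simp only [id]
    field_simp

open Metric in
lemma landau_zero {f : ℂ → ℂ} {R M : ℝ} (hR : 0 < R) (hM : 0 < M)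
    (hf : DifferentiableOn ℂ f (ball 0 R)) (hf0 : f 0 ≠ 0)
    (hb : ∀ z ∈ ball (0 : ℂ) R, ‖f z‖ ≤ Real.exp M * ‖f 0‖)
    (hz : ∀ z ∈ ball (0 : ℂ) R, f z = 0 → z.re < 0) :
    -(deriv f 0 / f 0).re ≤ 16 * M / R ∧ ∀ ρ ∈ closedBall (0 : ℂ) (R / 4), f ρ = 0 →
      -(deriv f 0 / f 0).re ≤ 16 * M / R - (1 / (0 - ρ)).re := by
  obtain ⟨S, g, hS, hgd, hfac, hg0, hgb⟩ := exists_factor hR hf hf0 hb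
  have h0mem : (0 : ℂ) ∈ ball (0 : ℂ) R := mem_ball_self hR
  have hf0' := hf0
  rw [hfac 0 h0mem] at hf0'
  obtain ⟨hp0, hgz⟩ := mul_ne_zero_iff.1 hf0'
  obtain ⟨d, hd, hd2⟩ := logDeriv_multiset_prod S hp0
  have hgder : HasDerivAt g (deriv g 0) 0 :=
    (hgd.differentiableAt (isOpen_ball.mem_nhds h0mem)).hasDerivAt
  have hfder : HasDerivAt f _ 0 := (hd.mul hgder).congr_of_eventuallyEq
    (Filter.eventually_of_mem (isOpen_ball.mem_nhds h0mem) hfac)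
  have e1 : deriv f 0 / f 0 = (S.map (fun ρ => 1 / (0 - ρ))).sum + deriv g 0 / g 0 := by
    rw [hfder.deriv, hfac 0 h0mem, ← hd2]
    field_simp
  have h1 : ‖deriv g 0 / g 0‖ ≤ 4 * M / (R / 4) := by
    refine norm_logDeriv_zero_le hM (by positivity) (hgd.mono (ball_subset_ball (by linarith)))
      (fun z hz => hg0 z (ball_subset_closedBall hz)) (fun z hz => hgb z ?_)
    exact ball_subset_ball (by linarith) hz
  have h2 := (neg_le_abs _).trans ((Complex.abs_re_le_norm _).trans h1)
  have e3 : 4 * M / (R / 4) = 16 * M / R := by field_simp; ring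
  have hroot : ∀ ρ ∈ S, ρ.re < 0 := by
    intro ρ hρ
    have hρb : ρ ∈ ball (0 : ℂ) R := closedBall_subset_ball (by linarith) (hS ρ hρ)
    refine hz ρ hρb ?_
    rw [hfac ρ hρb, Multiset.prod_eq_zero, zero_mul]
    exact Multiset.mem_map.2 ⟨ρ, hρ, sub_self ρ⟩
  have hpos : ∀ ρ : ℂ, ρ.re < 0 → 0 ≤ (1 / (0 - ρ)).re := by
    intro ρ h
    rw [one_div, Complex.inv_re]
    apply div_nonneg _ (Complex.normSq_nonneg _)
    simp; linarith
  have hsum : ∀ T : Multiset ℂ, (∀ ρ ∈ T, ρ.re < 0) →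
      0 ≤ ((T.map (fun ρ => 1 / (0 - ρ))).sum).re := by
    intro T
    induction T using Multiset.induction_on with
    | empty => simp
    | cons a T ih =>
      intro hT
      rw [Multiset.map_cons, Multiset.sum_cons, Complex.add_re]
      exact add_nonneg (hpos a (hT a (Multiset.mem_cons_self _ _)))
        (ih fun ρ h => hT ρ (Multiset.mem_cons_of_mem h))
  rw [e1, Complex.add_re]
  refine ⟨by linarith [hsum S hroot], fun ρ hρ hfρ => ?_⟩
  have hρS : ρ ∈ S := by
    rw [hfac ρ (closedBall_subset_ball (by linarith) hρ)] at hfρ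
    have := (mul_eq_zero.1 hfρ).resolve_right (hg0 ρ hρ)
    rw [Multiset.prod_eq_zero_iff, Multiset.mem_map] at this
    obtain ⟨a, ha, h⟩ := this
    rwa [sub_eq_zero.1 h]
  obtain ⟨T, rfl⟩ := Multiset.exists_cons_of_mem hρS
  rw [Multiset.map_cons, Multiset.sum_cons, Complex.add_re]
  linarith [hsum T fun ρ h => hroot ρ (Multiset.mem_cons_of_mem h)]

open Metric in
lemma landau {f : ℂ → ℂ} {c : ℂ} {R M : ℝ} (hR : 0 < R) (hM : 0 < M)
    (hf : DifferentiableOn ℂ f (ball c R)) (hf0 : f c ≠ 0)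
    (hb : ∀ z ∈ ball c R, ‖f z‖ ≤ Real.exp M * ‖f c‖)
    (hz : ∀ z ∈ ball c R, f z = 0 → z.re < c.re) :
    -(deriv f c / f c).re ≤ 16 * M / R ∧ ∀ ρ ∈ closedBall c (R / 4), f ρ = 0 →
      -(deriv f c / f c).re ≤ 16 * M / R - (1 / (c - ρ)).re := by
  have hmem : ∀ w ∈ ball (0 : ℂ) R, c + w ∈ ball c R := by
    intro w hw; simpa [dist_eq_norm] using hw
  have h := landau_zero (f := fun w => f (c + w)) hR hM (hf.comp (by fun_prop) hmem)
    (by simpa using hf0) (fun w hw => by simpa using hb _ (hmem w hw))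
    (fun w hw h => by simpa using hz _ (hmem w hw) h)
  have e : deriv (fun w => f (c + w)) 0 = deriv f c := by
    simpa using deriv_comp_const_add (f := f) c 0
  rw [e] at h
  simp only [add_zero] at h
  refine ⟨h.1, fun ρ hρ hfρ => ?_⟩
  have := h.2 (ρ - c) (by simpa [dist_eq_norm] using hρ) (by simpa using hfρ)
  simpa using this

lemma riemannZeta₁_eq {s : ℂ} (hs : s ≠ 1) : riemannZeta₁ s = (s - 1) * riemannZeta s := by
  rw [riemannZeta_eq_inv_sub_mul hs, mul_inv_cancel_left₀ (sub_ne_zero.2 hs)]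

lemma riemannZeta₁_ne_zero {s : ℂ} (hs : 1 ≤ s.re) : riemannZeta₁ s ≠ 0 := by
  by_cases h : s = 1
  · simp [h, riemannZeta₁_one]
  · rw [riemannZeta₁_eq h]
    exact mul_ne_zero (sub_ne_zero.2 h) (riemannZeta_ne_zero_of_one_le_re hs)

lemma logDeriv_riemannZeta₁ {s : ℂ} (hs : s ≠ 1) (hz : riemannZeta s ≠ 0) :
    deriv riemannZeta₁ s / riemannZeta₁ s = deriv riemannZeta s / riemannZeta s + 1 / (s - 1) := by
  have h1 : riemannZeta₁ =ᶠ[nhds s] fun z => (z - 1) * riemannZeta z := by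
    filter_upwards [isOpen_ne.mem_nhds hs] with z hz using riemannZeta₁_eq hz
  have h2 := (differentiableAt_riemannZeta hs).hasDerivAt
  have h3 : HasDerivAt (fun z => (z - 1) * riemannZeta z) _ s :=
    ((hasDerivAt_id s).sub_const 1).mul h2
  rw [h1.deriv_eq, h3.deriv, riemannZeta₁_eq hs]
  have := sub_ne_zero.2 hs
  simp only [id]
  field_simp
  ring

open ArithmeticFunction in
lemma re_term_vonMangoldt (σ t : ℝ) (n : ℕ) :
    (LSeries.term (fun n => (vonMangoldt n : ℂ)) ((σ : ℂ) + t * Complex.I) n).re =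
      vonMangoldt n * (n : ℝ) ^ (-σ) * Real.cos (t * Real.log n) := by
  rcases Nat.eq_zero_or_pos n with rfl | hn
  · simp
  · have hn' : (0 : ℝ) < n := by exact_mod_cast hn
    rw [LSeries.term_of_ne_zero hn.ne', div_eq_mul_inv, ← Complex.cpow_neg,
      natCast_cpow_neg hn, Complex.re_ofReal_mul, Complex.re_ofReal_mul, ex,
      Complex.exp_ofReal_mul_I_re, neg_mul, Real.cos_neg, mul_assoc]

open ArithmeticFunction in
lemma three_four_one {σ : ℝ} (hσ : 1 < σ) (t : ℝ) :
    3 * (deriv riemannZeta σ / riemannZeta σ).re +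
      4 * (deriv riemannZeta (σ + t * Complex.I) / riemannZeta (σ + t * Complex.I)).re +
      (deriv riemannZeta (σ + (2 * t : ℝ) * Complex.I) /
        riemannZeta (σ + (2 * t : ℝ) * Complex.I)).re ≤ 0 := by
  have key : ∀ t : ℝ, HasSum (fun n : ℕ => vonMangoldt n * (n : ℝ) ^ (-σ) *
      Real.cos (t * Real.log n)) (-(deriv riemannZeta (σ + t * Complex.I) /
        riemannZeta (σ + t * Complex.I)).re) := by
    intro t
    have hs : 1 < ((σ : ℂ) + t * Complex.I).re := by simpa using hσ
    have h1 := (LSeriesSummable_vonMangoldt hs).LSeriesHasSum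
    rw [LSeries_vonMangoldt_eq_deriv_riemannZeta_div hs] at h1
    have h2 := Complex.hasSum_re h1
    simp only [re_term_vonMangoldt] at h2
    rwa [neg_div, Complex.neg_re] at h2
  have k0 := key 0
  simp only [Complex.ofReal_zero, zero_mul, add_zero] at k0
  have h := ((k0.mul_left 3).add ((key t).mul_left 4)).add (key (2 * t))
  have h2 := h.nonneg (fun n => ?_)
  · linarith
  · have : Real.cos (2 * t * Real.log n) = 2 * Real.cos (t * Real.log n) ^ 2 - 1 := by
      rw [mul_assoc, Real.cos_two_mul]
    rw [this]
    have e : 3 * (vonMangoldt n * (n : ℝ) ^ (-σ) * Real.cos 0) +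
        4 * (vonMangoldt n * (n : ℝ) ^ (-σ) * Real.cos (t * Real.log n)) +
        vonMangoldt n * (n : ℝ) ^ (-σ) * (2 * Real.cos (t * Real.log n) ^ 2 - 1) =
        vonMangoldt n * (n : ℝ) ^ (-σ) * (2 * (1 + Real.cos (t * Real.log n)) ^ 2) := by
      rw [Real.cos_zero]; ring
    have hv : 0 ≤ vonMangoldt n := vonMangoldt_nonneg
    rw [e]; positivity

lemma exists_neg_logDeriv_le : ∃ C : ℝ, 0 < C ∧ ∀ σ : ℝ, 1 < σ → σ ≤ 2 →
    -(deriv riemannZeta σ / riemannZeta σ).re ≤ 1 / (σ - 1) + C := by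
  have hc : ContinuousOn (fun x : ℝ => deriv riemannZeta₁ x / riemannZeta₁ x) (Set.Icc 1 2) := by
    refine ContinuousOn.div ?_ ?_ fun x hx => riemannZeta₁_ne_zero (by simpa using hx.1)
    · exact ((differentiable_riemannZeta₁.contDiff (n := 1)).continuous_deriv le_rfl).comp
        Complex.continuous_ofReal |>.continuousOn
    · exact (differentiable_riemannZeta₁.continuous.comp Complex.continuous_ofReal).continuousOn
  obtain ⟨C, hC⟩ := isCompact_Icc.exists_bound_of_continuousOn hc
  refine ⟨|C| + 1, by positivity, fun σ h1 h2 => ?_⟩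
  have hne : (σ : ℂ) ≠ 1 := by
    intro h; have := congrArg Complex.re h; simp at this; linarith
  have h3 := hC σ ⟨h1.le, h2⟩
  rw [logDeriv_riemannZeta₁ hne (riemannZeta_ne_zero_of_one_le_re (by simpa using h1.le))] at h3
  have h4 := (neg_le_abs _).trans ((Complex.abs_re_le_norm _).trans h3)
  rw [Complex.add_re] at h4
  have e : (1 / ((σ : ℂ) - 1)).re = 1 / (σ - 1) := by
    rw [show (1 / ((σ : ℂ) - 1)) = ((1 / (σ - 1) : ℝ) : ℂ) by push_cast; rfl, Complex.ofReal_re]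
  rw [e] at h4
  linarith [le_abs_self C]

lemma tsum_rpow_le {σ : ℝ} (h1 : 1 < σ) (h2 : σ ≤ 3) : ∑' n : ℕ, (n : ℝ) ^ (-σ) ≤ 30 / (σ - 1) := by
  have hs : (1 : ℝ) < (σ : ℂ).re := by simpa using h1
  have hne : (σ : ℂ) ≠ 1 := by
    intro h; have := congrArg Complex.re h; simp at this; linarith
  have e : riemannZeta σ = ((∑' n : ℕ, (n : ℝ) ^ (-σ) : ℝ) : ℂ) := by
    rw [zeta_eq_tsum_one_div_nat_cpow hs, Complex.ofReal_tsum]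
    congr 1; ext n
    rw [one_div, ← Complex.cpow_neg, Complex.ofReal_cpow (by positivity)]
    push_cast; rfl
  have hz := norm_zeta_le (N := 1) (s := σ) (by simp; linarith) hne le_rfl
  have hpos : 0 ≤ ∑' n : ℕ, (n : ℝ) ^ (-σ) := tsum_nonneg fun n => by positivity
  rw [e, Complex.norm_real, Real.norm_of_nonneg hpos] at hz
  have e2 : ‖(σ : ℂ) - 1‖ = σ - 1 := by
    rw [← Complex.ofReal_one, ← Complex.ofReal_sub, Complex.norm_real, Real.norm_of_nonneg (by linarith)]
  rw [e2] at hz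
  simp at hz
  rw [abs_of_pos (by linarith)] at hz
  refine hz.trans ?_
  rw [le_div_iff₀ (by linarith), add_mul, add_mul, inv_mul_cancel₀ (by linarith)]
  nlinarith

open ArithmeticFunction ArithmeticFunction.Moebius in
lemma LSeries_moebius_eq {s : ℂ} (hs : 1 < s.re) :
    LSeries (fun n => ((μ n : ℤ) : ℂ)) s = (riemannZeta s)⁻¹ := by
  have h := LSeries_zeta_mul_Lseries_moebius hs
  rw [LSeries_zeta_eq_riemannZeta hs] at h
  exact eq_inv_of_mul_eq_one_right h

lemma norm_inv_zeta_le {s : ℂ} (h1 : 1 < s.re) (h2 : s.re ≤ 3) :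
    ‖(riemannZeta s)⁻¹‖ ≤ 30 / (s.re - 1) := by
  rw [← LSeries_moebius_eq h1]
  have hsum : Summable fun n : ℕ => (n : ℝ) ^ (-s.re) := Real.summable_nat_rpow.2 (by linarith)
  refine (tsum_of_norm_bounded hsum.hasSum fun n => ?_).trans (tsum_rpow_le h1 h2)
  rw [LSeries.norm_term_eq]
  split
  · positivity
  · rw [Real.rpow_neg (by positivity), div_eq_mul_inv]
    refine mul_le_of_le_one_left (by positivity) ?_
    rw [Complex.norm_intCast]
    exact_mod_cast ArithmeticFunction.abs_moebius_le_one

/-- A bound for `ζ` slightly to the left of the line `Re s = 1`. -/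
def ZetaBound (A r T : ℝ) : Prop :=
  1 ≤ A ∧ 0 < r ∧ r ≤ 1 / 4 ∧ 1 / r ≤ Real.exp A ∧ ∀ σ t : ℝ, 1 - r ≤ σ → σ ≤ 3 →
    10 ^ 60 ≤ t → t ≤ 2 * T + 1 → ‖riemannZeta (σ + t * Complex.I)‖ ≤ Real.exp A

lemma ZetaBound.apply {A r T : ℝ} (h : ZetaBound A r T) {z : ℂ} (h1 : 1 - r ≤ z.re)
    (h2 : z.re ≤ 3) (h3 : 10 ^ 60 ≤ z.im) (h4 : z.im ≤ 2 * T + 1) :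
    ‖riemannZeta z‖ ≤ Real.exp A := by
  simpa using h.2.2.2.2 z.re z.im h1 h2 h3 h4

/-- Ball estimates near the point `1 + x + i t`. -/
lemma ZetaBound.ball {A r T : ℝ} (h : ZetaBound A r T) {x t K R : ℝ} (hK : 1 ≤ K)
    (hx : r / (K * A) ≤ x) (hx1 : x ≤ 1) (hR : R ≤ r) (ht : 10 ^ 60 + 1 ≤ t) (htT : t ≤ 2 * T) :
    (∀ z ∈ Metric.ball ((1 + x : ℝ) + t * Complex.I) R, 1 + x - R ≤ z.re ∧ z.re ≤ 3 ∧
        t - R ≤ z.im ∧ z.im ≤ t + R) ∧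
      Real.exp (-(2 * A + Real.log (30 * K))) ≤ ‖riemannZeta ((1 + x : ℝ) + t * Complex.I)‖ ∧
      DifferentiableOn ℂ riemannZeta (Metric.ball ((1 + x : ℝ) + t * Complex.I) R) ∧
      ∀ z ∈ Metric.ball ((1 + x : ℝ) + t * Complex.I) R, ‖riemannZeta z‖ ≤
        Real.exp (3 * A + Real.log (30 * K)) * ‖riemannZeta ((1 + x : ℝ) + t * Complex.I)‖ := by
  obtain ⟨hA, hr, hr4, hrA, -⟩ := id h
  have hKA : 0 < K * A := by positivity
  have hx0 : 0 < x := lt_of_lt_of_le (by positivity) hx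
  set c : ℂ := (1 + x : ℝ) + t * Complex.I with hc
  have hcre : c.re = 1 + x := by simp [hc]
  have hcim : c.im = t := by simp [hc]
  have hmem : ∀ z ∈ Metric.ball c R, 1 + x - R ≤ z.re ∧ z.re ≤ 3 ∧
        t - R ≤ z.im ∧ z.im ≤ t + R := by
    intro z hz
    rw [Metric.mem_ball, dist_eq_norm] at hz
    have h1 := (abs_le.1 ((Complex.abs_re_le_norm (z - c)).trans hz.le))
    have h2 := (abs_le.1 ((Complex.abs_im_le_norm (z - c)).trans hz.le))
    rw [Complex.sub_re, hcre] at h1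
    rw [Complex.sub_im, hcim] at h2
    refine ⟨by linarith, by linarith, by linarith, by linarith⟩
  have hlow : Real.exp (-(2 * A + Real.log (30 * K))) ≤ ‖riemannZeta c‖ := by
    have h1 := norm_inv_zeta_le (s := c) (by rw [hcre]; linarith) (by rw [hcre]; linarith)
    rw [hcre, add_sub_cancel_left, norm_inv] at h1
    have hpos : 0 < ‖riemannZeta c‖ :=
      norm_pos_iff.2 (riemannZeta_ne_zero_of_one_le_re (by rw [hcre]; linarith))
    rw [Real.exp_neg]
    refine inv_le_of_inv_le₀ hpos (h1.trans ?_)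
    rw [Real.exp_add, Real.exp_log (by positivity), two_mul, Real.exp_add]
    have h2 : A ≤ Real.exp A := by linarith [Real.add_one_le_exp A]
    calc 30 / x ≤ 30 / (r / (K * A)) := by gcongr
      _ = A * (1 / r) * (30 * K) := by field_simp
      _ ≤ _ := by gcongr
  refine ⟨hmem, hlow, fun z hz => ?_, fun z hz => ?_⟩
  · refine (differentiableAt_riemannZeta fun h1 => ?_).differentiableWithinAt
    have := (hmem z hz).2.2.1
    rw [h1, Complex.one_im] at this
    linarith
  · obtain ⟨h1, h2, h3, h4⟩ := hmem z hz
    refine (h.apply (by linarith) h2 (by linarith) (by linarith)).trans ?_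
    calc Real.exp A = Real.exp (3 * A + Real.log (30 * K)) *
          Real.exp (-(2 * A + Real.log (30 * K))) := by rw [← Real.exp_add]; ring_nf
      _ ≤ _ := by gcongr

lemma zero_free_aux : ∃ K : ℝ, 1 ≤ K ∧ ∀ A r T : ℝ, ZetaBound A r T → ∀ β γ : ℝ,
    10 ^ 60 + 1 ≤ γ → γ ≤ T → riemannZeta (β + γ * Complex.I) = 0 → β ≤ 1 - r / (K * A) := by
  obtain ⟨C, hC, hlog⟩ := exists_neg_logDeriv_le
  set K : ℝ := 20000 + 60 * C with hKdef
  refine ⟨K, by linarith, fun A r T h β γ h1 h2 hz => ?_⟩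
  by_contra! hβ
  obtain ⟨hA, hr, hr4, hrA, -⟩ := id h
  have hK0 : 20000 ≤ K := by linarith
  have hKA : 20000 ≤ K * A := by nlinarith
  set η := r / (K * A) with hη
  have hη0 : 0 < η := by positivity
  have hηr : η * 20000 ≤ r := by
    rw [hη, div_mul_eq_mul_div, div_le_iff₀ (by positivity)]; gcongr
  have hβ1 : β < 1 := by
    by_contra! hb
    exact riemannZeta_ne_zero_of_one_le_re (by simpa using hb) hz
  set M := 3 * A + Real.log (30 * K) with hM
  have hlogK : Real.log (30 * K) ≤ 30 * K / 160000 + 11 := by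
    have e1 : Real.log (30 * K) = Real.log (30 * K / Real.exp 12) + 12 := by
      rw [Real.log_div (by positivity) (by positivity), Real.log_exp]; ring
    have e2 := Real.log_le_sub_one_of_pos (show 0 < 30 * K / Real.exp 12 by positivity)
    have e3 : (160000 : ℝ) ≤ Real.exp 12 := by
      have : Real.exp 12 = Real.exp 1 ^ 12 := by rw [← Real.exp_nat_mul]; norm_num
      rw [this]
      calc (160000 : ℝ) ≤ 2.718 ^ 12 := by norm_num
        _ ≤ _ := by gcongr; linarith [Real.exp_one_gt_d9]
    have e4 : 30 * K / Real.exp 12 ≤ 30 * K / 160000 := by gcongr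
    linarith
  have hlogK0 : 0 ≤ Real.log (30 * K) := Real.log_nonneg (by linarith)
  have hM0 : 0 < M := by linarith
  have hnz : ∀ (t : ℝ) (z : ℂ), riemannZeta z = 0 → z.re < ((1 + 6 * η : ℝ) + t * Complex.I).re := by
    intro t z hz
    by_contra! hb
    refine riemannZeta_ne_zero_of_one_le_re (le_trans ?_ hb) hz
    simp; linarith
  have hne : ∀ t : ℝ, riemannZeta ((1 + 6 * η : ℝ) + t * Complex.I) ≠ 0 := by
    intro t
    refine riemannZeta_ne_zero_of_one_le_re ?_
    simp; linarith
  obtain ⟨-, -, d1, b1⟩ := h.ball (x := 6 * η) (t := γ) (K := K) (R := r) (by linarith)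
    (by linarith) (by linarith) le_rfl h1 (by linarith)
  obtain ⟨-, -, d2, b2⟩ := h.ball (x := 6 * η) (t := 2 * γ) (K := K) (R := r) (by linarith)
    (by linarith) (by linarith) le_rfl (by linarith) (by linarith)
  have L1 := (landau hr hM0 d1 (hne γ) b1 (fun z _ => hnz γ z)).2 (β + γ * Complex.I) (by
    rw [Metric.mem_closedBall, dist_eq_norm]
    have : (β : ℂ) + γ * Complex.I - ((1 + 6 * η : ℝ) + γ * Complex.I) =
      ((β - (1 + 6 * η) : ℝ) : ℂ) := by push_cast; ring
    rw [this, Complex.norm_real, Real.norm_eq_abs, abs_le]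
    constructor <;> linarith) hz
  have L2 := (landau hr hM0 d2 (hne (2 * γ)) b2 (fun z _ => hnz (2 * γ) z)).1
  have L0 := hlog (1 + 6 * η) (by linarith) (by linarith)
  have hT := three_four_one (show 1 < 1 + 6 * η by linarith) γ
  have e1 : (1 / ((1 + 6 * η : ℝ) + γ * Complex.I - (β + γ * Complex.I))).re =
      1 / (1 + 6 * η - β) := by
    rw [show (((1 + 6 * η : ℝ) : ℂ) + γ * Complex.I - (β + γ * Complex.I)) =
      ((1 + 6 * η - β : ℝ) : ℂ) by push_cast; ring, ← Complex.ofReal_one, ← Complex.ofReal_div,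
      Complex.ofReal_re]
  have e2 : 1 / (7 * η) ≤ 1 / (1 + 6 * η - β) := by
    apply one_div_le_one_div_of_le <;> linarith
  have e3 : 1 + 6 * η - 1 = 6 * η := by ring
  rw [e1] at L1
  rw [e3] at L0
  have hfin : 4 * (1 / (7 * η)) ≤ 3 * (1 / (6 * η)) + 3 * C + 5 * (16 * M / r) := by linarith
  have hrη : r = η * (K * A) := by rw [hη]; field_simp
  have e5 : 5 * (16 * M / r) * η = 80 * M / (K * A) := by
    rw [hrη]; field_simp; ring
  have h6 := mul_le_mul_of_nonneg_right hfin hη0.le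
  have e6 : 4 * (1 / (7 * η)) * η = 4 / 7 := by field_simp
  have e7 : (3 * (1 / (6 * η)) + 3 * C + 5 * (16 * M / r)) * η =
      1 / 2 + 3 * C * η + 80 * M / (K * A) := by
    rw [add_mul, e5, add_mul]; congr 2; field_simp; norm_num
  rw [e6, e7] at h6
  have h7 : 3 * C * η ≤ 3 * C / (K * A) := by
    rw [hη, mul_div_assoc']
    exact div_le_div_of_nonneg_right (by nlinarith) (by positivity)
  have h8 : (3 * C + 80 * M) / (K * A) < 1 / 14 := by
    rw [div_lt_iff₀ (by positivity)]
    have : 80 * M ≤ (240 + 80 * (30 * K / 160000 + 11)) * A := by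
      rw [hM]; nlinarith
    nlinarith
  rw [add_div] at h8
  linarith

lemma inv_zeta_aux : ∃ K : ℝ, 1 ≤ K ∧ ∀ A r T : ℝ, ZetaBound A r T → ∀ s : ℂ,
    10 ^ 60 + 2 ≤ s.im → s.im ≤ T - 1 → 1 - r / (K * A) ≤ s.re → s.re ≤ 3 →
    riemannZeta s ≠ 0 ∧ ‖(riemannZeta s)⁻¹‖ ≤ Real.exp (K * A) := by
  obtain ⟨K, hK, hfree⟩ := zero_free_aux
  set Q := Real.log (30 * (4 * K)) with hQ
  have hQ0 : 0 ≤ Q := Real.log_nonneg (by linarith)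
  refine ⟨2 * K + (26 + 8 * Q), by linarith, fun A r T h s h1 h2 h3 h4 => ?_⟩
  obtain ⟨hA, hr, hr4, hrA, -⟩ := id h
  set η := r / (K * A) with hη
  have hη0 : 0 < η := by positivity
  have hηr : η ≤ r := div_le_self hr.le (by nlinarith)
  have h3' : 1 - η / 2 ≤ s.re := by
    refine le_trans ?_ h3
    rw [hη, div_div]
    exact sub_le_sub_left (div_le_div_of_nonneg_left hr.le (by positivity) (by nlinarith)) _
  have hx : r / (4 * K * A) = η / 4 := by rw [hη]; field_simp
  have hbig : 7 * (3 * A + Q) + (2 * A + Q) ≤ (2 * K + (26 + 8 * Q)) * A := by nlinarith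
  suffices hs : Real.exp (-(7 * (3 * A + Q) + (2 * A + Q))) ≤ ‖riemannZeta s‖ by
    have hpos := (Real.exp_pos _).trans_le hs
    refine ⟨norm_pos_iff.1 hpos, ?_⟩
    rw [norm_inv]
    refine inv_le_of_inv_le₀ (Real.exp_pos _) (le_trans ?_ hs)
    rw [← Real.exp_neg]
    exact Real.exp_le_exp.2 (by linarith)
  rcases le_total (1 + η / 4) s.re with h5 | h5
  · have hmain : Real.exp (-(2 * A + Q)) ≤ ‖riemannZeta s‖ := by
      by_cases h6 : s.re ≤ 2
      · have h7 := (h.ball (x := s.re - 1) (t := s.im) (K := 4 * K) (R := r) (by linarith)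
          (by rw [hx]; linarith) (by linarith) le_rfl (by linarith) (by linarith)).2.1
        simpa using h7
      · have h7 := norm_inv_zeta_le (s := s) (by linarith) h4
        rw [norm_inv] at h7
        have hpos : 0 < ‖riemannZeta s‖ :=
          norm_pos_iff.2 (riemannZeta_ne_zero_of_one_le_re (by linarith))
        rw [Real.exp_neg]
        refine inv_le_of_inv_le₀ hpos (h7.trans ?_)
        rw [Real.exp_add, hQ, Real.exp_log (by positivity)]
        calc 30 / (s.re - 1) ≤ 30 := div_le_self (by norm_num) (by linarith)
          _ ≤ 1 * (30 * (4 * K)) := by linarith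
          _ ≤ _ := by gcongr; exact Real.one_le_exp (by linarith)
    refine le_trans (Real.exp_le_exp.2 ?_) hmain
    linarith
  · obtain ⟨hm, hl, hd, hb⟩ := h.ball (x := η / 4) (t := s.im) (K := 4 * K) (R := η) (by linarith)
      (by rw [hx]) (by linarith) hηr (by linarith) (by linarith)
    have h6 := norm_ge_of_ball (M := 3 * A + Q) (by linarith) hη0 hd (fun z hz h0 => ?_) hb
      (z := s) ?_
    · refine le_trans ?_ h6
      calc Real.exp (-(7 * (3 * A + Q) + (2 * A + Q))) ≤
            Real.exp (-(2 * A + Q)) * Real.exp (-(6 * (3 * A + Q))) := by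
            rw [← Real.exp_add]; exact Real.exp_le_exp.2 (by linarith)
        _ ≤ _ := by gcongr
    · obtain ⟨m1, m2, m3, m4⟩ := hm z hz
      have := hfree A r T h z.re z.im (by linarith) (by linarith) (by simpa using h0)
      rw [← hη] at this
      linarith
    · have : s - ((1 + η / 4 : ℝ) + s.im * Complex.I) = ((s.re - (1 + η / 4) : ℝ) : ℂ) := by
        apply Complex.ext <;> simp
      rw [this, Complex.norm_real, Real.norm_eq_abs, abs_le]
      constructor <;> linarith

/-- The reciprocal of `ζ`, with the removable singularity at `1` filled in. -/
noncomputable def invZeta (s : ℂ) : ℂ := (s - 1) / riemannZeta₁ s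

lemma invZeta_eq {s : ℂ} (hs : s ≠ 1) : invZeta s = (riemannZeta s)⁻¹ := by
  rw [invZeta, riemannZeta₁_eq hs, div_mul_eq_div_div, div_self (sub_ne_zero.2 hs), one_div]

lemma zetaBound_of_large {U : ℝ} (hU : 10 ^ 60 ≤ U) :
    ZetaBound (10000 * Real.log (Real.log U))
      ((Real.log (Real.log U) / Real.log U) ^ (2 / 3 : ℝ) / 4) ((U - 1) / 2) := by
  set L := Real.log U with hL
  set l := Real.log L with hl
  have hL10 : 10 ≤ L := log_pos_of_large hU
  have he3 : Real.exp 1 ≤ 3 := by linarith [Real.exp_one_lt_d9]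
  have hl1 : 1 ≤ l := by
    rw [hl, Real.le_log_iff_exp_le (by linarith)]; linarith
  have hlL : l ≤ L := (Real.log_le_sub_one_of_pos (by linarith)).trans (by linarith)
  set q := l / L with hq
  have hq0 : 0 < q := by positivity
  have hq1 : q ≤ 1 := (div_le_one (by linarith)).2 hlL
  have hA : Real.exp (10000 * l) = L ^ (10000 : ℝ) := by
    rw [Real.rpow_def_of_pos (by linarith), hl, mul_comm]
  have hp1 : q ^ (2 / 3 : ℝ) ≤ 1 := Real.rpow_le_one hq0.le hq1 (by norm_num)
  refine ⟨by linarith, by positivity, by linarith, ?_, fun σ t h1 h2 h3 h4 => ?_⟩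
  · rw [hA]
    have e1 : q ≤ q ^ (2 / 3 : ℝ) := by
      conv_lhs => rw [← Real.rpow_one q]
      exact Real.rpow_le_rpow_of_exponent_ge hq0 hq1 (by norm_num)
    have e2 : 1 / L ≤ q := by rw [hq]; gcongr
    calc 1 / (q ^ (2 / 3 : ℝ) / 4) ≤ 1 / (1 / L / 4) := by gcongr; linarith
      _ = 4 * L := by field_simp
      _ ≤ L ^ (2 : ℝ) := by rw [Real.rpow_two]; nlinarith
      _ ≤ _ := Real.rpow_le_rpow_of_exponent_le (by linarith) (by norm_num)
  · rw [hA]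
    have ht10 := log_pos_of_large h3
    have htU : Real.log t ≤ L := Real.log_le_log (by linarith [show (0:ℝ) < 10 ^ 60 by positivity]) (by linarith)
    have hcube : ((q ^ (2 / 3 : ℝ)) / 4) ^ 3 = q ^ 2 / 64 := by
      rw [div_pow, ← Real.rpow_natCast (q ^ (2 / 3 : ℝ)) 3, ← Real.rpow_mul hq0.le]
      norm_num
    have hanti : q ≤ Real.log (Real.log t) / Real.log t :=
      Real.log_div_self_antitoneOn (Set.mem_ofPred_eq.symm ▸ (by linarith)) (Set.mem_ofPred_eq.symm ▸ (by linarith)) htU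
    have hqt : q * Real.log t ≤ Real.log (Real.log t) := (le_div_iff₀ (by linarith)).1 hanti
    refine (norm_zeta_le_log_pow h3 (del := q ^ (2 / 3 : ℝ) / 4) (by linarith)
      ?_ h1 h2).trans (Real.rpow_le_rpow (by linarith) htU (by norm_num))
    rw [hcube]
    have h0 : 0 ≤ q * Real.log t := by positivity
    have := pow_le_pow_left₀ h0 hqt 2
    nlinarith [sq_nonneg (q * Real.log t)]

lemma exists_compact_zero_free (t₀ : ℝ) : ∃ ε B : ℝ, 0 < ε ∧ 0 < B ∧ ∀ s : ℂ, 1 - ε ≤ s.re → s.re ≤ 2 →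
    |s.im| ≤ t₀ → riemannZeta₁ s ≠ 0 ∧ ‖invZeta s‖ ≤ B := by
  set K0 : Set ℂ := Set.Icc 1 2 ×ℂ Set.Icc (-t₀) t₀ with hK0
  have hc : IsCompact K0 := isCompact_Icc.reProdIm isCompact_Icc
  have hopen : IsOpen {s : ℂ | riemannZeta₁ s ≠ 0} :=
    isOpen_ne_fun differentiable_riemannZeta₁.continuous continuous_const
  have hsub : K0 ⊆ {s : ℂ | riemannZeta₁ s ≠ 0} := fun s hs =>
    riemannZeta₁_ne_zero (Complex.mem_reProdIm.1 hs).1.1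
  obtain ⟨ε, hε, hεs⟩ := hc.exists_cthickening_subset_open hopen hsub
  have hcont : ContinuousOn invZeta (Metric.cthickening ε K0) := by
    refine ContinuousOn.div (by fun_prop) differentiable_riemannZeta₁.continuous.continuousOn ?_
    exact fun s hs => hεs hs
  obtain ⟨B, hB⟩ := hc.cthickening.exists_bound_of_continuousOn hcont
  refine ⟨ε, |B| + 1, hε, by positivity, fun s h1 h2 h3 => ?_⟩
  have hmem : s ∈ Metric.cthickening ε K0 := by
    refine Metric.mem_cthickening_of_dist_le s (max s.re 1 + s.im * Complex.I) ε _ ?_ ?_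
    · rw [hK0, Complex.mem_reProdIm]
      have := abs_le.1 h3
      simp only [Complex.add_re, Complex.ofReal_re, Complex.mul_re, Complex.I_re, mul_zero,
        Complex.ofReal_im, Complex.I_im, mul_one, sub_self, add_zero, Complex.add_im,
        Complex.mul_im, zero_add, Set.mem_Icc]
      exact ⟨⟨le_max_right _ _, max_le h2 (by norm_num)⟩, this.1, this.2⟩
    · rw [dist_eq_norm]
      have : s - ((max s.re 1 : ℝ) + s.im * Complex.I) = ((s.re - max s.re 1 : ℝ) : ℂ) := by
        apply Complex.ext <;> simp
      rw [this, Complex.norm_real, Real.norm_eq_abs, abs_le]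
      rcases max_cases s.re 1 with h | h <;> constructor <;> linarith
  exact ⟨hεs hmem, (hB s hmem).trans (by linarith [le_abs_self B])⟩

lemma exists_zero_free_upper : ∃ c K : ℝ, 0 < c ∧ 1 ≤ K ∧ ∀ T : ℝ, 10 ^ 61 ≤ T → ∀ s : ℂ,
    1 - c / (Real.log T ^ (2 / 3 : ℝ) * Real.log (Real.log T) ^ (1 / 3 : ℝ)) ≤ s.re → s.re ≤ 2 →
    10 ^ 60 + 2 ≤ s.im → s.im ≤ T → riemannZeta₁ s ≠ 0 ∧ ‖invZeta s‖ ≤ Real.log T ^ K := by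
  obtain ⟨K, hK, H⟩ := inv_zeta_aux
  refine ⟨1 / (80000 * K), 20000 * K, by positivity, by linarith, fun T hT s h1 h2 h3 h4 => ?_⟩
  have hT60 : (10 : ℝ) ^ 60 ≤ T := le_trans (by norm_num) hT
  have hU : (10 : ℝ) ^ 60 ≤ 2 * T + 3 := by linarith [show (0:ℝ) < 10 ^ 60 by positivity]
  have hT0 : 0 < T := lt_of_lt_of_le (by positivity) hT60
  have hb := zetaBound_of_large hU
  set L := Real.log (2 * T + 3) with hL
  set x := Real.log T with hx
  have hx10 : 10 ≤ x := log_pos_of_large hT60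
  have hL10 : 10 ≤ L := log_pos_of_large hU
  have hLx : L ≤ 2 * x := by
    rw [hL, hx, ← Real.log_rpow hT0]
    refine Real.log_le_log (by linarith) ?_
    rw [Real.rpow_two]
    nlinarith [show (10:ℝ) ≤ 10 ^ 60 by norm_num]
  have hlx : 1 ≤ Real.log x := by
    rw [Real.le_log_iff_exp_le (by linarith)]; linarith [Real.exp_one_lt_d9]
  have hlL1 : 1 ≤ Real.log L := by
    rw [Real.le_log_iff_exp_le (by linarith)]; linarith [Real.exp_one_lt_d9]
  have hll : Real.log L ≤ 2 * Real.log x := by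
    rw [← Real.log_rpow (by linarith)]
    refine Real.log_le_log (by linarith) (hLx.trans ?_)
    rw [Real.rpow_two]; nlinarith
  set l := Real.log L with hl
  have key : (l / L) ^ (2 / 3 : ℝ) / 4 / (K * (10000 * l)) =
      1 / (40000 * K) / (L ^ (2 / 3 : ℝ) * l ^ (1 / 3 : ℝ)) := by
    rw [Real.div_rpow (by linarith) (by linarith)]
    have e : l = l ^ (2 / 3 : ℝ) * l ^ (1 / 3 : ℝ) := by
      rw [← Real.rpow_add (by linarith)]; norm_num
    have e1 : 0 < l ^ (2 / 3 : ℝ) := by positivity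
    have e2 : 0 < l ^ (1 / 3 : ℝ) := by positivity
    have e3 : 0 < L ^ (2 / 3 : ℝ) := by positivity
    have e4 : K * (10000 * l) = K * (10000 * (l ^ (2 / 3 : ℝ) * l ^ (1 / 3 : ℝ))) := by rw [← e]
    rw [e4]
    field_simp
    norm_num
  have key2 : L ^ (2 / 3 : ℝ) * l ^ (1 / 3 : ℝ) ≤
      2 * (x ^ (2 / 3 : ℝ) * Real.log x ^ (1 / 3 : ℝ)) := by
    calc L ^ (2 / 3 : ℝ) * l ^ (1 / 3 : ℝ) ≤ (2 * x) ^ (2 / 3 : ℝ) * (2 * Real.log x) ^ (1 / 3 : ℝ) := by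
          gcongr
      _ = (2 ^ (2 / 3 : ℝ) * 2 ^ (1 / 3 : ℝ)) * (x ^ (2 / 3 : ℝ) * Real.log x ^ (1 / 3 : ℝ)) := by
          rw [Real.mul_rpow (by norm_num) (by linarith), Real.mul_rpow (by norm_num) (by linarith)]
          ring
      _ = _ := by rw [← Real.rpow_add (by norm_num)]; norm_num
  have hs1 : s ≠ 1 := by
    intro h; rw [h, Complex.one_im] at h3; norm_num at h3
  have hwid : 1 - (l / L) ^ (2 / 3 : ℝ) / 4 / (K * (10000 * l)) ≤
      1 - 1 / (80000 * K) / (x ^ (2 / 3 : ℝ) * Real.log x ^ (1 / 3 : ℝ)) := by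
    rw [key]
    refine sub_le_sub_left ?_ _
    calc 1 / (80000 * K) / (x ^ (2 / 3 : ℝ) * Real.log x ^ (1 / 3 : ℝ))
        = 1 / (40000 * K) / (2 * (x ^ (2 / 3 : ℝ) * Real.log x ^ (1 / 3 : ℝ))) := by
          field_simp; norm_num
      _ ≤ _ := by gcongr
  obtain ⟨hz, hbd⟩ := H _ _ _ hb s h3 (by linarith) (hwid.trans h1) (by linarith)
  · refine ⟨?_, ?_⟩
    · rw [riemannZeta₁_eq hs1]; exact mul_ne_zero (sub_ne_zero.2 hs1) hz
    · rw [invZeta_eq hs1]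
      refine hbd.trans ?_
      rw [Real.rpow_def_of_pos (by linarith)]
      refine Real.exp_le_exp.2 ?_
      nlinarith

lemma riemannZeta₁_conj (s : ℂ) : riemannZeta₁ (starRingEnd ℂ s) = starRingEnd ℂ (riemannZeta₁ s) := by
  by_cases h : s = 1
  · simp [h, riemannZeta₁_one]
  · rw [riemannZeta₁_eq h, riemannZeta₁_eq, riemannZeta_conj]
    · simp
    · intro heq; apply h; simpa using congrArg (starRingEnd ℂ) heq

/-- The Vinogradov--Korobov zero-free region, with a bound for `1 / ζ`. -/
lemma exists_zero_free : ∃ c K : ℝ, 0 < c ∧ 1 ≤ K ∧ ∀ T : ℝ, 10 ^ 61 ≤ T → ∀ s : ℂ,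
    1 - c / (Real.log T ^ (2 / 3 : ℝ) * Real.log (Real.log T) ^ (1 / 3 : ℝ)) ≤ s.re → s.re ≤ 2 →
    |s.im| ≤ T → riemannZeta₁ s ≠ 0 ∧ ‖invZeta s‖ ≤ Real.log T ^ K := by
  obtain ⟨ε, B, hε, hB, H1⟩ := exists_compact_zero_free (10 ^ 60 + 2)
  obtain ⟨c, K, hc, hK, H2⟩ := exists_zero_free_upper
  refine ⟨min c ε, max K B, lt_min hc hε, le_max_of_le_left hK, fun T hT s h1 h2 h3 => ?_⟩
  have hx10 : 10 ≤ Real.log T := log_pos_of_large (le_trans (by norm_num) hT)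
  have hlx : 1 ≤ Real.log (Real.log T) := by
    rw [Real.le_log_iff_exp_le (by linarith)]; linarith [Real.exp_one_lt_d9]
  set D := Real.log T ^ (2 / 3 : ℝ) * Real.log (Real.log T) ^ (1 / 3 : ℝ) with hD
  have hD1 : 1 ≤ D := by
    refine one_le_mul_of_one_le_of_one_le ?_ ?_ <;> exact Real.one_le_rpow (by linarith) (by norm_num)
  by_cases h4 : |s.im| ≤ 10 ^ 60 + 2
  · have h5 : min c ε / D ≤ ε := (div_le_self (lt_min hc hε).le hD1).trans (min_le_right _ _)
    obtain ⟨h6, h7⟩ := H1 s (by linarith) h2 h4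
    refine ⟨h6, h7.trans ?_⟩
    calc B ≤ 10 ^ B := by
          rw [Real.rpow_def_of_pos (by norm_num)]
          have e1 := Real.add_one_le_exp (Real.log 10 * B)
          have e2 : 1 ≤ Real.log 10 := by
            rw [Real.le_log_iff_exp_le (by norm_num)]; linarith [Real.exp_one_lt_d9]
          nlinarith
      _ ≤ Real.log T ^ B := Real.rpow_le_rpow (by norm_num) hx10 hB.le
      _ ≤ _ := Real.rpow_le_rpow_of_exponent_le (by linarith) (le_max_right _ _)
  · push Not at h4
    have h5 : min c ε / D ≤ c / D := by gcongr; exact min_le_left _ _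
    have h6 : Real.log T ^ K ≤ Real.log T ^ max K B :=
      Real.rpow_le_rpow_of_exponent_le (by linarith) (le_max_left _ _)
    rcases le_total 0 s.im with h7 | h7
    · rw [abs_of_nonneg h7] at h3 h4
      obtain ⟨h8, h9⟩ := H2 T hT s (by linarith) h2 h4.le h3
      exact ⟨h8, h9.trans h6⟩
    · rw [abs_of_nonpos h7] at h3 h4
      obtain ⟨h8, h9⟩ := H2 T hT (starRingEnd ℂ s) (by rw [Complex.conj_re]; linarith)
        (by rwa [Complex.conj_re]) (by rw [Complex.conj_im]; exact h4.le) (by rwa [Complex.conj_im])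
      have e : invZeta (starRingEnd ℂ s) = starRingEnd ℂ (invZeta s) := by
        simp [invZeta, riemannZeta₁_conj]
      rw [e, RCLike.norm_conj] at h9
      rw [riemannZeta₁_conj] at h8
      exact ⟨fun h => h8 (by rw [h, map_zero]), h9.trans h6⟩

lemma norm_inv_mul_succ_le {s : ℂ} (hs : 1 / 2 ≤ s.re) :
    ‖1 / (s * (s + 1))‖ ≤ 2 * (1 + s.im ^ 2)⁻¹ := by
  have h1 : 0 < 1 + s.im ^ 2 := by positivity
  have ha : (1 + s.im ^ 2) / 4 ≤ ‖s‖ ^ 2 := by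
    rw [← Complex.normSq_eq_norm_sq, Complex.normSq_apply]; nlinarith
  have hb : 1 + s.im ^ 2 ≤ ‖s + 1‖ ^ 2 := by
    rw [← Complex.normSq_eq_norm_sq, Complex.normSq_apply]
    simp only [Complex.add_re, Complex.one_re, Complex.add_im, Complex.one_im]; nlinarith
  have hc : (1 + s.im ^ 2) / 2 ≤ ‖s‖ * ‖s + 1‖ := by
    apply le_of_sq_le_sq _ (by positivity)
    calc ((1 + s.im ^ 2) / 2) ^ 2 = (1 + s.im ^ 2) / 4 * (1 + s.im ^ 2) := by ring
      _ ≤ ‖s‖ ^ 2 * ‖s + 1‖ ^ 2 := mul_le_mul ha hb h1.le (by positivity)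
      _ = _ := by ring
  rw [norm_div, norm_one, norm_mul]
  calc 1 / (‖s‖ * ‖s + 1‖) ≤ 1 / ((1 + s.im ^ 2) / 2) :=
        one_div_le_one_div_of_le (by positivity) hc
    _ = _ := by field_simp

lemma hasMellin_one_sub {s : ℂ} (hs : 0 < s.re) :
    HasMellin (fun t : ℝ => Set.indicator (Set.Ioc 0 1) (fun _ => 1 : ℝ → ℂ) t
      - Set.indicator (Set.Ioc 0 1) (fun t => (t : ℂ) ^ (1 : ℂ) : ℝ → ℂ) t) s
      (1 / (s * (s + 1))) := by
  have h1 := hasMellin_one_Ioc hs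
  have h2 := hasMellin_cpow_Ioc 1 (s := s) (by simp; linarith)
  have h := hasMellin_sub h1.1 h2.1
  rw [h1.2, h2.2] at h
  have e1 : s ≠ 0 := by rintro rfl; simp at hs
  have e2 : s + 1 ≠ 0 := by
    intro h0
    have := congrArg Complex.re h0
    simp at this; linarith
  have : 1 / (s * (s + 1)) = 1 / s - 1 / (s + 1) := by field_simp; ring
  rw [this]; exact h

lemma one_sub_kernel_eq {u : ℝ} (hu : 0 < u) :
    Set.indicator (Set.Ioc 0 1) (fun _ => 1 : ℝ → ℂ) u
      - Set.indicator (Set.Ioc 0 1) (fun t => (t : ℂ) ^ (1 : ℂ) : ℝ → ℂ) u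
      = ((max (1 - u) 0 : ℝ) : ℂ) := by
  by_cases h : u ≤ 1
  · have hm : u ∈ Set.Ioc (0 : ℝ) 1 := ⟨hu, h⟩
    rw [Set.indicator_of_mem hm, Set.indicator_of_mem hm, max_eq_left (by linarith)]
    push_cast; simp
  · have : u ∉ Set.Ioc (0 : ℝ) 1 := fun h' => h h'.2
    rw [Set.indicator_of_notMem this, Set.indicator_of_notMem this, max_eq_right (by linarith)]
    simp

lemma re_vert (σ y : ℝ) : ((σ : ℂ) + y * Complex.I).re = σ := by simp
lemma im_vert (σ y : ℝ) : ((σ : ℂ) + y * Complex.I).im = y := by simp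

lemma continuous_inv_mul_succ {σ : ℝ} (hσ : 0 < σ) :
    Continuous fun y : ℝ => 1 / (((σ : ℂ) + y * Complex.I) * ((σ : ℂ) + y * Complex.I + 1)) := by
  refine Continuous.div (by fun_prop) (by fun_prop) fun y => mul_ne_zero ?_ ?_
  · intro h
    have := congrArg Complex.re h
    simp at this; linarith
  · intro h
    have := congrArg Complex.re h
    simp at this; linarith

lemma integrable_inv_mul_succ {σ : ℝ} (hσ : 1 / 2 ≤ σ) :
    MeasureTheory.Integrable fun y : ℝ =>
      1 / (((σ : ℂ) + y * Complex.I) * ((σ : ℂ) + y * Complex.I + 1)) := by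
  refine (integrable_inv_one_add_sq.const_mul 2).mono'
    (continuous_inv_mul_succ (by linarith)).aestronglyMeasurable (.of_forall fun y => ?_)
  have := norm_inv_mul_succ_le (s := (σ : ℂ) + y * Complex.I) (by rw [re_vert]; exact hσ)
  rwa [im_vert] at this

lemma perron_kernel {σ u : ℝ} (hσ : 1 / 2 ≤ σ) (hu : 0 < u) :
    ∫ y : ℝ, (u : ℂ) ^ (-((σ : ℂ) + y * Complex.I)) *
      (1 / (((σ : ℂ) + y * Complex.I) * ((σ : ℂ) + y * Complex.I + 1)))
      = 2 * π * ((max (1 - u) 0 : ℝ) : ℂ) := by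
  set f : ℝ → ℂ := fun t : ℝ => Set.indicator (Set.Ioc 0 1) (fun _ => 1 : ℝ → ℂ) t
      - Set.indicator (Set.Ioc 0 1) (fun t => (t : ℂ) ^ (1 : ℂ) : ℝ → ℂ) t with hf
  have hm : ∀ y : ℝ, mellin f (σ + y * Complex.I) =
      1 / (((σ : ℂ) + y * Complex.I) * ((σ : ℂ) + y * Complex.I + 1)) := fun y =>
    (hasMellin_one_sub (s := σ + y * Complex.I) (by rw [re_vert]; linarith)).2
  have hinv := mellinInv_mellin_eq σ f hu
    (hasMellin_one_sub (s := (σ : ℂ)) (by simp; linarith)).1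
    (by
      unfold Complex.VerticalIntegrable
      simp_rw [hm]; exact integrable_inv_mul_succ hσ)
    (by
      have : f =ᶠ[nhds u] fun u => ((max (1 - u) 0 : ℝ) : ℂ) := by
        filter_upwards [lt_mem_nhds hu] with v hv using one_sub_kernel_eq hv
      refine ContinuousAt.congr ?_ this.symm
      fun_prop)
  have h3 : f u = _ := one_sub_kernel_eq hu
  rw [h3, mellinInv] at hinv
  simp_rw [hm] at hinv
  rw [← hinv]
  simp only [smul_eq_mul, Complex.real_smul]
  rw [← mul_assoc]
  push_cast
  rw [show (2 * (π : ℂ)) * (1 / (2 * π)) = 1 by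
    have : (π : ℂ) ≠ 0 := by exact_mod_cast Real.pi_ne_zero
    field_simp, one_mul]

lemma norm_perron_term {σ x : ℝ} (hx : 0 < x) (n : ℕ) (hn : n ≠ 0) (y : ℝ) :
    ‖(((n / x : ℝ)) : ℂ) ^ (-((σ : ℂ) + y * Complex.I))‖ = x ^ σ * (n : ℝ) ^ (-σ) := by
  have hn' : (0 : ℝ) < n := by exact_mod_cast Nat.pos_of_ne_zero hn
  rw [Complex.norm_cpow_eq_rpow_re_of_pos (by positivity), Complex.neg_re, re_vert,
    Real.div_rpow hn'.le hx.le, Real.rpow_neg hx.le, div_inv_eq_mul, mul_comm]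

/-- The smoothed Mertens sum as a vertical line integral. -/
lemma smooth_mertens_eq {σ x : ℝ} (hσ : 1 < σ) (hx : 0 < x) :
    ∫ y : ℝ, (x : ℂ) ^ ((σ : ℂ) + y * Complex.I) * invZeta (σ + y * Complex.I) *
      (1 / (((σ : ℂ) + y * Complex.I) * ((σ : ℂ) + y * Complex.I + 1)))
      = 2 * π * ((∑ n ∈ Icc 1 ⌊x⌋₊, (ArithmeticFunction.moebius n : ℝ) * (1 - n / x) : ℝ) : ℂ) := by
  set g : ℝ → ℂ := fun y => 1 / (((σ : ℂ) + y * Complex.I) * ((σ : ℂ) + y * Complex.I + 1)) with hg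
  have hgi : MeasureTheory.Integrable g := integrable_inv_mul_succ (by linarith)
  set F : ℕ → ℝ → ℂ := fun n y => ((ArithmeticFunction.moebius n : ℤ) : ℂ) *
    ((((n / x : ℝ)) : ℂ) ^ (-((σ : ℂ) + y * Complex.I)) * g y) with hF
  have hF0 : F 0 = fun _ => 0 := by funext y; simp [hF]
  have hnorm : ∀ n y, ‖F n y‖ ≤ x ^ σ * (n : ℝ) ^ (-σ) * ‖g y‖ := by
    intro n y
    by_cases hn : n = 0
    · subst hn; rw [hF0]; simp only [norm_zero]; positivity
    rw [hF]; simp only [norm_mul]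
    rw [norm_perron_term hx n hn]
    have : ‖((ArithmeticFunction.moebius n : ℤ) : ℂ)‖ ≤ 1 := by
      rw [Complex.norm_intCast]
      exact_mod_cast ArithmeticFunction.abs_moebius_le_one
    exact mul_le_of_le_one_left (by positivity) this
  have hInt : ∀ n, MeasureTheory.Integrable (F n) := by
    intro n
    by_cases hn : n = 0
    · subst hn; rw [hF0]; exact MeasureTheory.integrable_zero _ _ _
    have hn' : (0 : ℝ) < n / x := by
      have : (0 : ℝ) < n := by exact_mod_cast Nat.pos_of_ne_zero hn
      positivity
    refine (hgi.norm.const_mul (x ^ σ * (n : ℝ) ^ (-σ))).mono' ?_ (.of_forall (hnorm n))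
    apply Continuous.aestronglyMeasurable
    refine continuous_const.mul (Continuous.mul ?_ (continuous_inv_mul_succ (by linarith)))
    refine Continuous.const_cpow (by fun_prop) (Or.inl ?_)
    exact_mod_cast hn'.ne'
  have hsum : Summable fun n => ∫ y, ‖F n y‖ := by
    have hs : Summable fun n : ℕ => (n : ℝ) ^ (-σ) := Real.summable_nat_rpow.2 (by linarith)
    refine Summable.of_nonneg_of_le (fun n => MeasureTheory.integral_nonneg fun y => norm_nonneg _)
      (fun n => ?_) ((hs.mul_left (x ^ σ)).mul_right (∫ y, ‖g y‖))
    rw [← MeasureTheory.integral_const_mul]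
    exact MeasureTheory.integral_mono (hInt n).norm (hgi.norm.const_mul _) (hnorm n)
  have hmain := MeasureTheory.hasSum_integral_of_summable_integral_norm hInt hsum
  have hpt : ∀ y, ∑' n, F n y = (x : ℂ) ^ ((σ : ℂ) + y * Complex.I) *
      invZeta (σ + y * Complex.I) * g y := by
    intro y
    set s : ℂ := (σ : ℂ) + y * Complex.I with hs
    have hre : s.re = σ := re_vert σ y
    have hs1 : s ≠ 1 := by
      intro h
      rw [h, Complex.one_re] at hre; linarith
    rw [invZeta_eq hs1, ← LSeries_moebius_eq (by rw [hre]; exact hσ), LSeries, mul_assoc,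
      ← tsum_mul_right, ← tsum_mul_left]
    refine tsum_congr fun n => ?_
    by_cases hn : n = 0
    · subst hn; simp [hF]
    rw [LSeries.term_of_ne_zero hn]
    simp only [hF]
    rw [← hs]
    have hn' : (0 : ℝ) < n := by exact_mod_cast Nat.pos_of_ne_zero hn
    have hx' : (x : ℂ) ≠ 0 := by exact_mod_cast hx.ne'
    have : (((n / x : ℝ)) : ℂ) ^ (-s) = (x : ℂ) ^ s * ((n : ℂ) ^ s)⁻¹ := by
      rw [div_eq_mul_inv, Complex.ofReal_mul, Complex.mul_cpow_ofReal_nonneg hn'.le (by positivity),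
        Complex.ofReal_inv, Complex.inv_cpow _ _ (by
          rw [Complex.arg_ofReal_of_nonneg hx.le]; exact Real.pi_ne_zero.symm),
        Complex.cpow_neg, Complex.cpow_neg, inv_inv, mul_comm, Complex.ofReal_natCast]
    rw [this]; ring
  have hval : ∀ n, ∫ y, F n y = 2 * π *
      (((ArithmeticFunction.moebius n : ℝ) * max (1 - n / x) 0 : ℝ) : ℂ) := by
    intro n
    by_cases hn : n = 0
    · subst hn; simp [hF0]
    have hn' : (0 : ℝ) < n / x := by
      have : (0 : ℝ) < n := by exact_mod_cast Nat.pos_of_ne_zero hn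
      positivity
    rw [hF, MeasureTheory.integral_const_mul, perron_kernel (by linarith) hn']
    push_cast; ring
  simp_rw [hpt, hval] at hmain
  have hfin := hasSum_sum_of_ne_finset_zero (L := SummationFilter.unconditional ℕ) (s := Icc 1 ⌊x⌋₊)
    (f := fun n : ℕ => (2 * π * (((ArithmeticFunction.moebius n : ℝ) * max (1 - n / x) 0 : ℝ) : ℂ) : ℂ)) (by
      intro n hn
      by_cases h0 : n = 0
      · subst h0; simp
      have : x < n := by
        by_contra h
        push Not at h
        exact hn (mem_Icc.2 ⟨Nat.pos_of_ne_zero h0, Nat.le_floor h⟩)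
      have : (1 : ℝ) ≤ n / x := by rw [le_div_iff₀ hx]; linarith
      rw [max_eq_right (by linarith)]; simp)
  rw [hmain.unique hfin]
  push_cast
  rw [mul_sum]
  refine sum_congr rfl fun n hn => ?_
  have hnx : (n : ℝ) ≤ x := (Nat.le_floor_iff hx.le).1 (mem_Icc.1 hn).2
  have : n / x ≤ 1 := by rw [div_le_one hx]; exact hnx
  rw [max_eq_left (by linarith)]; push_cast; ring

lemma integral_diff_interval_le {T : ℝ} (hT : 1 ≤ T) :
    π - ∫ y in (-T)..T, (1 + y ^ 2)⁻¹ ≤ 2 / T := by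
  rw [integral_inv_one_add_sq, Real.arctan_neg]
  have h := Real.arctan_inv_of_pos (by linarith : 0 < T)
  have h2 : Real.arctan T⁻¹ ≤ T⁻¹ := by
    have hp : 0 ≤ Real.arctan T⁻¹ := Real.arctan_nonneg.2 (by positivity)
    have := Real.le_tan hp (Real.arctan_lt_pi_div_two _)
    rwa [Real.tan_arctan] at this
  rw [show 2 / T = 2 * T⁻¹ by ring]; linarith

/-- Truncating an integral against an `O((1+y²)⁻¹)` integrand. -/
lemma norm_integral_sub_interval_le {g : ℝ → ℂ} {K T : ℝ} (hT : 1 ≤ T)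
    (hg : MeasureTheory.Integrable g) (hK : ∀ y, ‖g y‖ ≤ K * (1 + y ^ 2)⁻¹) (hK0 : 0 ≤ K) :
    ‖(∫ y, g y) - ∫ y in (-T)..T, g y‖ ≤ K * (2 / T) := by
  have hTT : -T ≤ T := by linarith
  rw [intervalIntegral.integral_of_le hTT,
    ← MeasureTheory.integral_add_compl (measurableSet_Ioc (a := -T) (b := T)) hg, add_sub_cancel_left]
  have hi := integrable_inv_one_add_sq.const_mul K
  refine (MeasureTheory.norm_integral_le_of_norm_le hi.integrableOn
    (.of_forall hK)).trans ?_
  rw [MeasureTheory.integral_const_mul]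
  refine mul_le_mul_of_nonneg_left ?_ hK0
  have h1 := MeasureTheory.integral_add_compl (measurableSet_Ioc (a := -T) (b := T))
    integrable_inv_one_add_sq
  rw [integral_univ_inv_one_add_sq, ← intervalIntegral.integral_of_le hTT] at h1
  linarith [integral_diff_interval_le hT]

lemma smooth_mertens_le {x T w B : ℝ} (hx : 3 ≤ x) (hT : 1 ≤ T) (hw0 : 0 < w) (hw : w ≤ 1 / 2)
    (hB : 1 ≤ B)
    (H : ∀ s : ℂ, 1 - w ≤ s.re → s.re ≤ 2 → |s.im| ≤ T → riemannZeta₁ s ≠ 0 ∧ ‖invZeta s‖ ≤ B) :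
    |∑ n ∈ Icc 1 ⌊x⌋₊, (ArithmeticFunction.moebius n : ℝ) * (1 - n / x)| ≤
      63 * B * (x * Real.log x / T + x ^ (1 - w)) := by
  have hx0 : 0 < x := by linarith
  have hlog : 1 ≤ Real.log x := by
    rw [Real.le_log_iff_exp_le hx0]; linarith [Real.exp_one_lt_d9]
  set σ : ℝ := 1 + 1 / Real.log x with hσd
  have hσ1 : 1 < σ := by rw [hσd]; linarith [show 0 < 1 / Real.log x by positivity]
  have hσ2 : σ ≤ 2 := by
    have : 1 / Real.log x ≤ 1 := by rw [div_le_one (by linarith)]; exact hlog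
    rw [hσd]; linarith
  have hxσ : x ^ σ ≤ 3 * x := by
    rw [hσd, Real.rpow_add hx0, Real.rpow_one, Real.rpow_def_of_pos hx0 (1 / Real.log x),
      mul_one_div_cancel (by linarith)]
    nlinarith [Real.exp_one_lt_d9]
  set G : ℂ → ℂ := fun s => (x : ℂ) ^ s * invZeta s * (1 / (s * (s + 1))) with hG
  have hxs : ∀ s : ℂ, ‖(x : ℂ) ^ s‖ = x ^ s.re := Complex.norm_cpow_eq_rpow_re_of_pos hx0
  have hGn : ∀ s : ℂ, 1 / 2 ≤ s.re → ‖G s‖ ≤ x ^ s.re * ‖invZeta s‖ * (2 * (1 + s.im ^ 2)⁻¹) := by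
    intro s hs
    rw [hG]; simp only [norm_mul, hxs]
    have := norm_inv_mul_succ_le hs
    exact mul_le_mul_of_nonneg_left this (by positivity)
  have hdiff : ∀ s : ℂ, 1 / 2 ≤ s.re → riemannZeta₁ s ≠ 0 → DifferentiableAt ℂ G s := by
    intro s hs hz
    have e1 : s ≠ 0 := by rintro rfl; norm_num at hs
    have e2 : s + 1 ≠ 0 := by
      intro h0
      have := congrArg Complex.re h0
      simp at this; linarith
    have hxne : (x : ℂ) ≠ 0 := by exact_mod_cast hx0.ne'
    have d1 : DifferentiableAt ℂ riemannZeta₁ s := differentiable_riemannZeta₁ s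
    have d2 : DifferentiableAt ℂ (fun s : ℂ => (x : ℂ) ^ s) s :=
      differentiableAt_id.const_cpow (Or.inl hxne)
    have d3 : DifferentiableAt ℂ invZeta s := by
      unfold invZeta
      exact DifferentiableAt.div (by fun_prop) d1 hz
    exact (d2.mul d3).mul (DifferentiableAt.div (by fun_prop) (by fun_prop) (mul_ne_zero e1 e2))
  -- the vertical line `Re s = σ`
  set g : ℝ → ℂ := fun y => G (σ + y * Complex.I) with hg
  have hgK : ∀ y, ‖g y‖ ≤ (180 * (x * Real.log x)) * (1 + y ^ 2)⁻¹ := by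
    intro y
    have h := hGn (σ + y * Complex.I) (by rw [re_vert]; linarith)
    rw [re_vert, im_vert] at h
    refine h.trans ?_
    have hne : (σ : ℂ) + y * Complex.I ≠ 1 := by
      intro h; have := congrArg Complex.re h
      rw [re_vert, Complex.one_re] at this; linarith
    have hi := norm_inv_zeta_le (s := σ + y * Complex.I) (by rw [re_vert]; exact hσ1)
      (by rw [re_vert]; linarith)
    rw [re_vert, ← invZeta_eq hne] at hi
    have hi' : ‖invZeta (σ + y * Complex.I)‖ ≤ 30 * Real.log x := by
      refine hi.trans (le_of_eq ?_)
      rw [hσd]; field_simp; ring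
    have hp : 0 < (1 + y ^ 2)⁻¹ := by positivity
    calc _ ≤ (3 * x) * (30 * Real.log x) * (2 * (1 + y ^ 2)⁻¹) := by
          refine mul_le_mul_of_nonneg_right ?_ (by positivity)
          exact mul_le_mul hxσ hi' (norm_nonneg _) (by positivity)
      _ = _ := by ring
  have hgc : Continuous g := by
    rw [continuous_iff_continuousAt]
    intro y
    have h1 : ContinuousAt G (σ + y * Complex.I) :=
      (hdiff _ (by rw [re_vert]; linarith)
        (riemannZeta₁_ne_zero (by rw [re_vert]; linarith))).continuousAt
    exact ContinuousAt.comp (f := fun y : ℝ => (σ : ℂ) + y * Complex.I) h1 (by fun_prop)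
  have hgi : MeasureTheory.Integrable g :=
    (integrable_inv_one_add_sq.const_mul _).mono' hgc.aestronglyMeasurable (.of_forall hgK)
  have htail := norm_integral_sub_interval_le hT hgi hgK (by positivity)
  -- the rectangle
  set z : ℂ := ((1 - w : ℝ) : ℂ) + ((-T : ℝ) : ℂ) * Complex.I with hz
  set z' : ℂ := (σ : ℂ) + (T : ℂ) * Complex.I with hz'
  have hrect := Complex.integral_boundary_rect_eq_zero_of_differentiableOn G z z' (by
    intro s hs
    rw [Complex.mem_reProdIm, hz, hz', re_vert, re_vert, im_vert, im_vert,
      Set.uIcc_of_le (by linarith), Set.uIcc_of_le (by linarith)] at hs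
    obtain ⟨⟨a1, a2⟩, b1, b2⟩ := hs
    exact (hdiff s (by linarith)
      (H s a1 (by linarith) (abs_le.2 ⟨b1, b2⟩)).1).differentiableWithinAt)
  rw [hz, hz', re_vert, re_vert, im_vert, im_vert] at hrect
  have hhor : ∀ t : ℝ, |t| = T →
      ‖∫ u : ℝ in (1 - w)..σ, G (u + t * Complex.I)‖ ≤ 9 * B * x / T := by
    intro t ht
    have hb : ∀ u ∈ Set.uIoc (1 - w) σ, ‖G (u + t * Complex.I)‖ ≤ 6 * B * x / T := by
      intro u hu
      rw [Set.uIoc_of_le (by linarith)] at hu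
      have h := hGn (u + t * Complex.I) (by rw [re_vert]; linarith [hu.1])
      rw [re_vert, im_vert] at h
      refine h.trans ?_
      have h2 := (H (u + t * Complex.I) (by rw [re_vert]; linarith [hu.1])
        (by rw [re_vert]; linarith [hu.2]) (by rw [im_vert, ht])).2
      have h3 : x ^ u ≤ 3 * x :=
        (Real.rpow_le_rpow_of_exponent_le (by linarith) hu.2).trans hxσ
      have h4 : (1 + t ^ 2)⁻¹ ≤ T⁻¹ := by
        apply inv_anti₀ (by linarith)
        rw [← sq_abs, ht]; nlinarith
      calc _ ≤ (3 * x) * B * (2 * T⁻¹) := by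
            refine mul_le_mul ?_ (by linarith) (by positivity) (by positivity)
            exact mul_le_mul h3 h2 (norm_nonneg _) (by positivity)
        _ = _ := by ring
    refine (intervalIntegral.norm_integral_le_of_norm_le_const hb).trans ?_
    rw [abs_of_pos (by linarith)]
    have : 0 ≤ 6 * B * x / T := by positivity
    calc _ ≤ 6 * B * x / T * (3 / 2) := mul_le_mul_of_nonneg_left (by linarith) this
      _ = _ := by ring
  have hleft : ‖∫ y : ℝ in (-T)..T, G (((1 - w : ℝ) : ℂ) + y * Complex.I)‖ ≤
      8 * B * x ^ (1 - w) := by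
    have hb : ∀ y ∈ Set.Ioc (-T) T, ‖G (((1 - w : ℝ) : ℂ) + y * Complex.I)‖ ≤
        2 * B * x ^ (1 - w) * (1 + y ^ 2)⁻¹ := by
      intro y hy
      have h := hGn (((1 - w : ℝ) : ℂ) + y * Complex.I) (by rw [re_vert]; linarith)
      rw [re_vert, im_vert] at h
      refine h.trans ?_
      have h2 := (H (((1 - w : ℝ) : ℂ) + y * Complex.I) (by rw [re_vert])
        (by rw [re_vert]; linarith) (by rw [im_vert]; exact abs_le.2 ⟨hy.1.le, hy.2⟩)).2
      calc _ ≤ x ^ (1 - w) * B * (2 * (1 + y ^ 2)⁻¹) := by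
            refine mul_le_mul_of_nonneg_right ?_ (by positivity)
            exact mul_le_mul_of_nonneg_left h2 (by positivity)
        _ = _ := by ring
    refine (intervalIntegral.norm_integral_le_of_norm_le (by linarith)
      (.of_forall hb) (integrable_inv_one_add_sq.const_mul _).intervalIntegrable).trans ?_
    rw [intervalIntegral.integral_const_mul, integral_inv_one_add_sq]
    have h1 := Real.arctan_lt_pi_div_two T
    have h2 := Real.neg_pi_div_two_lt_arctan (-T)
    have h3 := Real.pi_lt_four
    have : 0 ≤ 2 * B * x ^ (1 - w) := by positivity
    calc _ ≤ 2 * B * x ^ (1 - w) * 4 := mul_le_mul_of_nonneg_left (by linarith) this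
      _ = _ := by ring
  have hmain := smooth_mertens_eq hσ1 hx0
  change ∫ y, g y = _ at hmain
  set S : ℝ := ∑ n ∈ Icc 1 ⌊x⌋₊, (ArithmeticFunction.moebius n : ℝ) * (1 - n / x) with hS
  have hI : ‖∫ y in (-T)..T, g y‖ ≤ 18 * B * x / T + 8 * B * x ^ (1 - w) := by
    set J1 := ∫ u : ℝ in (1 - w)..σ, G (u + ((-T : ℝ) : ℂ) * Complex.I)
    set J2 := ∫ u : ℝ in (1 - w)..σ, G (u + (T : ℂ) * Complex.I)
    set J3 := ∫ y : ℝ in (-T)..T, G (((1 - w : ℝ) : ℂ) + y * Complex.I)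
    have h1 : ‖J1‖ ≤ 9 * B * x / T := hhor (-T) (by rw [abs_neg, abs_of_pos (by linarith)])
    have h2 : ‖J2‖ ≤ 9 * B * x / T := hhor T (by rw [abs_of_pos (by linarith)])
    have e : Complex.I * (∫ y in (-T)..T, g y) = J2 - J1 + Complex.I * J3 := by
      simp only [smul_eq_mul] at hrect
      linear_combination hrect
    calc ‖∫ y in (-T)..T, g y‖ = ‖Complex.I * (∫ y in (-T)..T, g y)‖ := by
          rw [norm_mul, Complex.norm_I, one_mul]
      _ ≤ ‖J2‖ + ‖J1‖ + ‖J3‖ := by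
          rw [e]
          refine (norm_add_le _ _).trans ?_
          rw [norm_mul, Complex.norm_I, one_mul]
          exact add_le_add (norm_sub_le _ _) le_rfl
      _ ≤ 9 * B * x / T + 9 * B * x / T + 8 * B * x ^ (1 - w) := by
          exact add_le_add (add_le_add h2 h1) hleft
      _ = _ := by ring
  have htot : ‖∫ y, g y‖ ≤ 378 * (B * (x * Real.log x / T + x ^ (1 - w))) := by
    have h0 : ‖∫ y, g y‖ ≤ ‖(∫ y, g y) - ∫ y in (-T)..T, g y‖ + ‖∫ y in (-T)..T, g y‖ := by
      simpa using norm_add_le ((∫ y, g y) - ∫ y in (-T)..T, g y) (∫ y in (-T)..T, g y)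
    have e1 : B * (x * 1 / T) ≤ B * (x * Real.log x / T) :=
      mul_le_mul_of_nonneg_left (div_le_div_of_nonneg_right
        (mul_le_mul_of_nonneg_left hlog hx0.le) (by linarith)) (by linarith)
    have e2 : 1 * (x * Real.log x / T) ≤ B * (x * Real.log x / T) :=
      mul_le_mul_of_nonneg_right hB (by positivity)
    have e3 : 0 ≤ B * x ^ (1 - w) := by positivity
    have e4 : 180 * (x * Real.log x) * (2 / T) = 360 * (1 * (x * Real.log x / T)) := by ring
    have e5 : 18 * B * x / T = 18 * (B * (x * 1 / T)) := by ring
    rw [e4] at htail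
    rw [e5] at hI
    rw [mul_add]
    linarith
  rw [hmain, norm_mul, Complex.norm_real, Real.norm_eq_abs] at htot
  have hn : ‖(2 * π : ℂ)‖ = 2 * π := by
    rw [show (2 * π : ℂ) = ((2 * π : ℝ) : ℂ) by push_cast; ring, Complex.norm_real,
      Real.norm_of_nonneg (by positivity)]
  rw [hn] at htot
  nlinarith [Real.pi_gt_three, abs_nonneg S]

/-- The Vinogradov–Korobov exponent `u^{3/5} (log u)^{-1/5}`. -/
noncomputable def vkExp (u : ℝ) : ℝ := u ^ (3 / 5 : ℝ) * Real.log u ^ (-(1 / 5) : ℝ)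

lemma one_le_log_of_three_le {u : ℝ} (hu : 3 ≤ u) : 1 ≤ Real.log u := by
  rw [Real.le_log_iff_exp_le (by linarith)]; linarith [Real.exp_one_lt_d9]

lemma vkExp_pos {u : ℝ} (hu : 3 ≤ u) : 0 < vkExp u := by
  have := one_le_log_of_three_le hu
  unfold vkExp; positivity

lemma vkExp_eq {u : ℝ} (hu : 3 ≤ u) :
    vkExp u = u * (u ^ (-(2 / 5) : ℝ) * Real.log u ^ (-(1 / 5) : ℝ)) := by
  rw [vkExp, ← mul_assoc]
  congr 1
  nth_rewrite 2 [← Real.rpow_one u]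
  rw [← Real.rpow_add (by linarith)]; norm_num

lemma vkExp_sub_le {u v : ℝ} (hv : 3 ≤ v) (h : v ≤ u) : vkExp u - vkExp v ≤ u - v := by
  have l1 := one_le_log_of_three_le hv
  have l2 : Real.log v ≤ Real.log u := Real.log_le_log (by linarith) h
  have p1 : 0 < Real.log u := by linarith
  have p2 : 0 < u := by linarith
  have p3 : 0 < v := by linarith
  have e1 : u ^ (-(2 / 5) : ℝ) * Real.log u ^ (-(1 / 5) : ℝ) ≤
      v ^ (-(2 / 5) : ℝ) * Real.log v ^ (-(1 / 5) : ℝ) := by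
    refine mul_le_mul (Real.rpow_le_rpow_of_nonpos (by linarith) h (by norm_num))
      (Real.rpow_le_rpow_of_nonpos (by linarith) l2 (by norm_num)) ?_ ?_ <;> positivity
  have e2 : v ^ (-(2 / 5) : ℝ) * Real.log v ^ (-(1 / 5) : ℝ) ≤ 1 :=
    mul_le_one₀ (Real.rpow_le_one_of_one_le_of_nonpos (by linarith) (by norm_num))
      (Real.rpow_nonneg (by linarith) _)
      (Real.rpow_le_one_of_one_le_of_nonpos l1 (by norm_num))
  rw [vkExp_eq hv, vkExp_eq (hv.trans h)]
  nlinarith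

lemma vkExp_le_self {u : ℝ} (hu : 3 ≤ u) : vkExp u ≤ u := by
  have l1 := one_le_log_of_three_le hu
  rw [vkExp_eq hu]
  refine mul_le_of_le_one_right (by linarith) (mul_le_one₀
    (Real.rpow_le_one_of_one_le_of_nonpos (by linarith) (by norm_num))
    (Real.rpow_nonneg (by linarith) _)
    (Real.rpow_le_one_of_one_le_of_nonpos l1 (by norm_num)))

lemma vkExp_pow_five {u : ℝ} (hu : 3 ≤ u) : vkExp u ^ 5 = u ^ 3 / Real.log u := by
  have l1 := one_le_log_of_three_le hu
  rw [vkExp, mul_pow, ← Real.rpow_natCast (u ^ _), ← Real.rpow_natCast (Real.log u ^ _),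
    ← Real.rpow_mul (by linarith), ← Real.rpow_mul (by linarith)]
  norm_num
  rw [Real.rpow_neg_one]; rfl

lemma vkExp_mono {u v : ℝ} (hv : 3 ≤ v) (h : v ≤ u) : vkExp v ≤ vkExp u := by
  have hu := hv.trans h
  refine le_of_pow_le_pow_left₀ (by norm_num : 5 ≠ 0) (vkExp_pos hu).le ?_
  rw [vkExp_pow_five hu, vkExp_pow_five hv]
  have l1 := one_le_log_of_three_le hv
  have l2 := one_le_log_of_three_le hu
  have he := Real.exp_one_lt_d9
  have h1 := Real.log_div_self_antitoneOn (a := v) (b := u)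
    (show Real.exp 1 ≤ v by linarith) (show Real.exp 1 ≤ u by linarith) h
  simp only at h1
  rw [div_le_div_iff₀ (by linarith) (by linarith)] at h1 ⊢
  have h2 : v ^ 2 ≤ u ^ 2 := by nlinarith
  calc v ^ 3 * Real.log u = v ^ 2 * (Real.log u * v) := by ring
    _ ≤ u ^ 2 * (Real.log v * u) := mul_le_mul h2 h1 (by nlinarith) (by positivity)
    _ = _ := by ring

lemma le_vkExp_pow_five {u : ℝ} (hu : 3 ≤ u) : u ≤ vkExp u ^ 5 := by
  have l1 := one_le_log_of_three_le hu
  rw [vkExp_pow_five hu, le_div_iff₀ (by linarith)]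
  have := Real.log_le_self (by linarith : 0 ≤ u)
  nlinarith [mul_nonneg (by linarith : 0 ≤ u) (sub_nonneg.2 this), sq_nonneg u]

lemma vkExp_rpow {u : ℝ} (hu : 3 ≤ u) :
    vkExp u ^ (5 / 3 : ℝ) * Real.log u ^ (1 / 3 : ℝ) = u := by
  have l1 := one_le_log_of_three_le hu
  rw [vkExp, Real.mul_rpow (by positivity) (by positivity), ← Real.rpow_mul (by linarith),
    ← Real.rpow_mul (by linarith), mul_assoc, ← Real.rpow_add (by linarith)]
  norm_num

lemma vkExp_mul_denom_le {u : ℝ} (hu : 3 ≤ u) (hL : 3 ≤ vkExp u) :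
    vkExp u * (vkExp u ^ (2 / 3 : ℝ) * Real.log (vkExp u) ^ (1 / 3 : ℝ)) ≤ u := by
  have hp := vkExp_pos hu
  have h1 : Real.log (vkExp u) ≤ Real.log u := Real.log_le_log hp (vkExp_le_self hu)
  have l1 := one_le_log_of_three_le hL
  calc _ = vkExp u ^ (5 / 3 : ℝ) * Real.log (vkExp u) ^ (1 / 3 : ℝ) := by
        rw [← mul_assoc]
        congr 1
        nth_rewrite 1 [← Real.rpow_one (vkExp u)]
        rw [← Real.rpow_add hp]; norm_num
    _ ≤ vkExp u ^ (5 / 3 : ℝ) * Real.log u ^ (1 / 3 : ℝ) :=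
        mul_le_mul_of_nonneg_left (Real.rpow_le_rpow (by linarith) h1 (by norm_num)) (by positivity)
    _ = u := vkExp_rpow hu

lemma rpow_le_mul_exp {m ε L : ℝ} (hm : 0 < m) (hε : 0 < ε) (hL : 0 ≤ L) :
    L ^ m ≤ (m / ε) ^ m * Real.exp (ε * L) := by
  have h : L ≤ (m / ε) * Real.exp (ε * L / m) := by
    have := Real.add_one_le_exp (ε * L / m)
    calc L = (m / ε) * (ε * L / m) := by field_simp
      _ ≤ _ := mul_le_mul_of_nonneg_left (by linarith) (by positivity)
  calc L ^ m ≤ ((m / ε) * Real.exp (ε * L / m)) ^ m := Real.rpow_le_rpow hL h hm.le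
    _ = _ := by
      rw [Real.mul_rpow (by positivity) (by positivity), ← Real.exp_mul]
      congr 2; field_simp

lemma mertens_smooth_trivial {x : ℝ} (hx : 1 ≤ x) :
    |∑ n ∈ Icc 1 ⌊x⌋₊, (ArithmeticFunction.moebius n : ℝ) * (x - n)| ≤ x ^ 2 := by
  have h : ∀ n ∈ Icc 1 ⌊x⌋₊, |(ArithmeticFunction.moebius n : ℝ) * (x - n)| ≤ x := by
    intro n hn
    have hnx : (n : ℝ) ≤ x := (Nat.le_floor_iff (by linarith)).1 (mem_Icc.1 hn).2
    have h1 : |(ArithmeticFunction.moebius n : ℝ)| ≤ 1 := by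
      exact_mod_cast ArithmeticFunction.abs_moebius_le_one
    rw [abs_mul, abs_of_nonneg (by linarith : 0 ≤ x - n)]
    have : (0 : ℝ) ≤ n := Nat.cast_nonneg n
    nlinarith [abs_nonneg (ArithmeticFunction.moebius n : ℝ)]
  refine (abs_sum_le_sum_abs _ _).trans ((sum_le_sum h).trans ?_)
  rw [sum_const, Nat.card_Icc, nsmul_eq_mul, Nat.add_sub_cancel]
  nlinarith [Nat.floor_le (by linarith : 0 ≤ x)]

lemma exists_smooth_mertens_bound : ∃ c C : ℝ, 0 < c ∧ c ≤ 1 ∧ 1 ≤ C ∧ ∀ x : ℝ, 1 ≤ x →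
    |∑ n ∈ Icc 1 ⌊x⌋₊, (ArithmeticFunction.moebius n : ℝ) * (x - n)| ≤
      C * x ^ 2 * Real.exp (-(c * vkExp (Real.log x + 3))) := by
  obtain ⟨c₀, K, hc₀, hK, H⟩ := exists_zero_free
  set c : ℝ := min c₀ (1 / 2) with hc
  have hc0 : 0 < c := lt_min hc₀ (by norm_num)
  have hcle : c ≤ 1 / 2 := min_le_right _ _
  set D : ℝ := ((K + 6) / (c / 4)) ^ (K + 6) with hD
  have hD0 : 0 < D := by positivity
  refine ⟨c / 4, Real.exp 142 + 126 * D, by linarith, by linarith,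
    by linarith [Real.add_one_le_exp (142 : ℝ)], fun x hx => ?_⟩
  set u := Real.log x + 3 with hu
  have hlx : 0 ≤ Real.log x := Real.log_nonneg hx
  have hu3 : 3 ≤ u := by linarith
  set L := vkExp u with hL
  have hL0 : 0 < L := vkExp_pos hu3
  by_cases hbig : L < 142
  · refine (mertens_smooth_trivial hx).trans ?_
    have h1 : 1 ≤ Real.exp 142 * Real.exp (-(c / 4 * L)) := by
      rw [← Real.exp_add]; apply Real.one_le_exp; nlinarith
    have h2 : 0 < D * Real.exp (-(c / 4 * L)) := by positivity
    have h3 : 0 ≤ x ^ 2 := sq_nonneg x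
    calc x ^ 2 ≤ x ^ 2 * (Real.exp 142 * Real.exp (-(c / 4 * L))
          + 126 * (D * Real.exp (-(c / 4 * L)))) := le_mul_of_one_le_right h3 (by linarith)
      _ = _ := by ring
  push Not at hbig
  have hu142 : 142 ≤ u := hbig.trans (vkExp_le_self hu3)
  have hx3 : 3 ≤ x := by
    by_contra h
    push Not at h
    have := Real.log_le_sub_one_of_pos (by linarith : 0 < x)
    linarith
  have hT : (10 : ℝ) ^ 61 ≤ Real.exp L := by
    have h1 : (10 : ℝ) ^ 61 ≤ Real.exp 1 ^ 142 := by
      calc (10 : ℝ) ^ 61 ≤ (2.7182818283 : ℝ) ^ 142 := by norm_num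
        _ ≤ _ := pow_le_pow_left₀ (by norm_num) Real.exp_one_gt_d9.le 142
    rw [← Real.exp_nat_mul] at h1
    refine h1.trans (Real.exp_le_exp.2 ?_)
    push_cast; linarith
  set den := L ^ (2 / 3 : ℝ) * Real.log L ^ (1 / 3 : ℝ) with hden
  have hden1 : 1 ≤ den := by
    have := one_le_log_of_three_le (show 3 ≤ L by linarith)
    exact one_le_mul_of_one_le_of_one_le (Real.one_le_rpow (by linarith) (by norm_num))
      (Real.one_le_rpow this (by norm_num))
  have hLden : L * den ≤ u := vkExp_mul_denom_le hu3 (by rw [← hL]; linarith)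
  have hw0 : 0 < c / den := by positivity
  have hw : c / den ≤ 1 / 2 := (div_le_self hc0.le hden1).trans hcle
  have hB : 1 ≤ L ^ K := Real.one_le_rpow (by linarith) (by linarith)
  have hS := smooth_mertens_le hx3 (le_trans (by norm_num) hT) hw0 hw hB (by
    intro s h1 h2 h3
    have := H (Real.exp L) hT s (by
      rw [Real.log_exp]
      refine le_trans ?_ h1
      rw [← hden]
      have : c / den ≤ c₀ / den := div_le_div_of_nonneg_right (min_le_left _ _) (by linarith)
      linarith) h2 h3
    rwa [Real.log_exp] at this)
  have hx0 : 0 < x := by linarith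
  have hconv : ∑ n ∈ Icc 1 ⌊x⌋₊, (ArithmeticFunction.moebius n : ℝ) * (x - n) =
      x * ∑ n ∈ Icc 1 ⌊x⌋₊, (ArithmeticFunction.moebius n : ℝ) * (1 - n / x) := by
    rw [mul_sum]
    refine sum_congr rfl fun n _ => ?_
    field_simp
  rw [hconv, abs_mul, abs_of_pos hx0]
  have hwl : c / 2 * L ≤ c / den * Real.log x := by
    have h1 : u ≤ 2 * Real.log x := by linarith
    rw [div_mul_eq_mul_div c den, le_div_iff₀ (by linarith)]
    calc c / 2 * L * den = c / 2 * (L * den) := by ring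
      _ ≤ c / 2 * (2 * Real.log x) := mul_le_mul_of_nonneg_left (hLden.trans h1) (by linarith)
      _ = _ := by ring
  have e1 : x ^ (1 - c / den) ≤ x * Real.exp (-(c / 2 * L)) := by
    rw [Real.rpow_sub hx0, Real.rpow_one, Real.rpow_def_of_pos hx0, div_eq_mul_inv, ← Real.exp_neg]
    refine mul_le_mul_of_nonneg_left (Real.exp_le_exp.2 ?_) hx0.le
    linarith
  have hL5 : Real.log x ≤ L ^ 5 := by linarith [le_vkExp_pow_five hu3]
  have e2 : x * Real.log x / Real.exp L ≤ x * L ^ 5 * Real.exp (-(c / 2 * L)) := by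
    rw [div_eq_mul_inv, ← Real.exp_neg]
    refine mul_le_mul (mul_le_mul_of_nonneg_left hL5 hx0.le) (Real.exp_le_exp.2 ?_)
      (Real.exp_pos _).le (by positivity)
    nlinarith
  have hpow : L ^ K * (L ^ 5 + 1) ≤ 2 * (D * Real.exp (c / 4 * L)) := by
    have h1 := rpow_le_mul_exp (m := K + 6) (ε := c / 4) (by linarith) (by linarith) hL0.le
    have h2 : L ^ K * L ^ 5 ≤ L ^ (K + 6) := by
      rw [← Real.rpow_natCast L 5, ← Real.rpow_add hL0]
      exact Real.rpow_le_rpow_of_exponent_le (by linarith) (by norm_num)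
    have h3 : 1 ≤ L ^ 5 := one_le_pow₀ (by linarith)
    have h4 : L ^ K * 1 ≤ L ^ K * L ^ 5 := mul_le_mul_of_nonneg_left h3 (by linarith)
    rw [← hD] at h1
    rw [mul_add]
    linarith
  have e3 : 63 * L ^ K * (x * Real.log x / Real.exp L + x ^ (1 - c / den)) ≤
      126 * D * x * Real.exp (-(c / 4 * L)) := by
    calc _ ≤ 63 * L ^ K * (x * L ^ 5 * Real.exp (-(c / 2 * L)) + x * Real.exp (-(c / 2 * L))) :=
          mul_le_mul_of_nonneg_left (add_le_add e2 e1) (by positivity)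
      _ = (L ^ K * (L ^ 5 + 1)) * (63 * (x * Real.exp (-(c / 2 * L)))) := by ring
      _ ≤ (2 * (D * Real.exp (c / 4 * L))) * (63 * (x * Real.exp (-(c / 2 * L)))) :=
          mul_le_mul_of_nonneg_right hpow (by positivity)
      _ = 126 * D * x * (Real.exp (c / 4 * L) * Real.exp (-(c / 2 * L))) := by ring
      _ = _ := by rw [← Real.exp_add]; congr 2; ring
  have e4 := hS.trans e3
  have e5 : 0 ≤ Real.exp 142 * x ^ 2 * Real.exp (-(c / 4 * L)) := by positivity
  calc _ ≤ x * (126 * D * x * Real.exp (-(c / 4 * L))) := mul_le_mul_of_nonneg_left e4 hx0.le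
    _ ≤ _ := by
      have e6 : (Real.exp 142 + 126 * D) * x ^ 2 * Real.exp (-(c / 4 * L)) =
        Real.exp 142 * x ^ 2 * Real.exp (-(c / 4 * L)) +
          x * (126 * D * x * Real.exp (-(c / 4 * L))) := by ring
      linarith

/-- The Mertens function. -/
noncomputable def mertens (x : ℝ) : ℝ := ∑ n ∈ Icc 1 ⌊x⌋₊, (ArithmeticFunction.moebius n : ℝ)

lemma abs_moebius_le (n : ℕ) : |(ArithmeticFunction.moebius n : ℝ)| ≤ 1 := by
  exact_mod_cast ArithmeticFunction.abs_moebius_le_one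

lemma mul_mertens_le {x h : ℝ} (hx : 1 ≤ x) (hh : 0 ≤ h) :
    |h * mertens x| ≤
      |∑ n ∈ Icc 1 ⌊x + h⌋₊, (ArithmeticFunction.moebius n : ℝ) * (x + h - n)| +
      |∑ n ∈ Icc 1 ⌊x⌋₊, (ArithmeticFunction.moebius n : ℝ) * (x - n)| + h * (h + 1) := by
  have hfl : ⌊x⌋₊ ≤ ⌊x + h⌋₊ := Nat.floor_le_floor (by linarith)
  have hsplit : ∑ n ∈ Icc 1 ⌊x + h⌋₊, (ArithmeticFunction.moebius n : ℝ) * (x + h - n) =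
      ∑ n ∈ Icc 1 ⌊x⌋₊, (ArithmeticFunction.moebius n : ℝ) * (x + h - n) +
      ∑ n ∈ Ioc ⌊x⌋₊ ⌊x + h⌋₊, (ArithmeticFunction.moebius n : ℝ) * (x + h - n) := by
    have e : ∀ N : ℕ, Icc 1 N = Ioc 0 N := fun N => by ext; simp [Nat.one_le_iff_ne_zero, Nat.pos_iff_ne_zero]
    rw [e, e, ← sum_union (Finset.disjoint_left.2 fun n h1 h2 => by
      simp only [mem_Ioc] at h1 h2; omega), Ioc_union_Ioc_eq_Ioc (Nat.zero_le _) hfl]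
  have hrest : |∑ n ∈ Ioc ⌊x⌋₊ ⌊x + h⌋₊, (ArithmeticFunction.moebius n : ℝ) * (x + h - n)| ≤
      h * (h + 1) := by
    have hb : ∀ n ∈ Ioc ⌊x⌋₊ ⌊x + h⌋₊, |(ArithmeticFunction.moebius n : ℝ) * (x + h - n)| ≤ h := by
      intro n hn
      rw [mem_Ioc] at hn
      have h1 : x < n := (Nat.floor_lt (by linarith)).1 hn.1
      have h2 : (n : ℝ) ≤ x + h := (Nat.le_floor_iff (by linarith)).1 hn.2
      rw [abs_mul, abs_of_nonneg (by linarith : 0 ≤ x + h - n)]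
      nlinarith [abs_moebius_le n, abs_nonneg (ArithmeticFunction.moebius n : ℝ)]
    refine (abs_sum_le_sum_abs _ _).trans ((sum_le_sum hb).trans ?_)
    rw [sum_const, Nat.card_Ioc, nsmul_eq_mul, Nat.cast_sub hfl, mul_comm]
    refine mul_le_mul_of_nonneg_left ?_ hh
    linarith [Nat.floor_le (by linarith : 0 ≤ x + h), Nat.lt_floor_add_one x]
  have hM : ∑ n ∈ Icc 1 ⌊x⌋₊, (ArithmeticFunction.moebius n : ℝ) * (x + h - n) =
      ∑ n ∈ Icc 1 ⌊x⌋₊, (ArithmeticFunction.moebius n : ℝ) * (x - n) + h * mertens x := by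
    rw [mertens, mul_sum, ← sum_add_distrib]
    exact sum_congr rfl fun n _ => by ring
  rw [hM] at hsplit
  set A := ∑ n ∈ Icc 1 ⌊x + h⌋₊, (ArithmeticFunction.moebius n : ℝ) * (x + h - n)
  set B := ∑ n ∈ Icc 1 ⌊x⌋₊, (ArithmeticFunction.moebius n : ℝ) * (x - n)
  set D := ∑ n ∈ Ioc ⌊x⌋₊ ⌊x + h⌋₊, (ArithmeticFunction.moebius n : ℝ) * (x + h - n)
  have : h * mertens x = A - B - D := by linarith
  rw [this]
  linarith [abs_sub (A - B) D, abs_sub A B]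

/-- The Vinogradov–Korobov bound for the Mertens function. -/
theorem exists_mertens_bound : ∃ c C : ℝ, 0 < c ∧ c ≤ 1 / 2 ∧ 1 ≤ C ∧ ∀ x : ℝ, 1 ≤ x →
    |mertens x| ≤ C * x * Real.exp (-(c * vkExp (Real.log x + 3))) := by
  obtain ⟨c, C, hc, hc1, hC, H⟩ := exists_smooth_mertens_bound
  refine ⟨c / 2, 6 * C + Real.exp 3, by linarith, by linarith,
    by linarith [Real.add_one_le_exp (3 : ℝ)], fun x hx => ?_⟩
  have hlx : 0 ≤ Real.log x := Real.log_nonneg hx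
  set E := vkExp (Real.log x + 3) with hE
  have hE0 : 0 < E := vkExp_pos (by linarith)
  set δ := Real.exp (-(c / 2 * E)) with hδ
  have hδ0 : 0 < δ := Real.exp_pos _
  have hδ1 : δ ≤ 1 := by rw [hδ, Real.exp_le_one_iff]; nlinarith
  have hδ2 : δ * δ = Real.exp (-(c * E)) := by rw [hδ, ← Real.exp_add]; congr 1; ring
  have hx0 : 0 < x := by linarith
  have h1 := H x hx
  have h2 := H (x + δ * x) (by nlinarith)
  have h3 : Real.exp (-(c * vkExp (Real.log (x + δ * x) + 3))) ≤ δ * δ := by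
    rw [hδ2]
    apply Real.exp_le_exp.2
    have : Real.log x ≤ Real.log (x + δ * x) := Real.log_le_log hx0 (by nlinarith)
    have := vkExp_mono (v := Real.log x + 3) (u := Real.log (x + δ * x) + 3) (by linarith)
      (by linarith)
    nlinarith
  have h4 : (x + δ * x) ^ 2 ≤ 4 * x ^ 2 := by
    have : x + δ * x ≤ 2 * x := by nlinarith
    calc (x + δ * x) ^ 2 ≤ (2 * x) ^ 2 := pow_le_pow_left₀ (by positivity) this 2
      _ = _ := by ring
  have h5 := mul_mertens_le hx (h := δ * x) (by positivity)
  rw [← hδ2] at h1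
  have h6 : C * (x + δ * x) ^ 2 * Real.exp (-(c * vkExp (Real.log (x + δ * x) + 3))) ≤
      C * (4 * x ^ 2) * (δ * δ) := by
    refine mul_le_mul (mul_le_mul_of_nonneg_left h4 (by linarith)) h3 (Real.exp_pos _).le
      (by positivity)
  rw [abs_mul, abs_of_pos (by positivity : 0 < δ * x)] at h5
  have h7 : 1 ≤ Real.exp 3 * (x * δ) := by
    have : x * δ = Real.exp (Real.log x + -(c / 2 * E)) := by
      rw [Real.exp_add, Real.exp_log hx0]
    rw [this, ← Real.exp_add]
    apply Real.one_le_exp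
    have := vkExp_le_self (u := Real.log x + 3) (by linarith)
    rw [← hE] at this
    nlinarith
  have h8 : (δ * x) * |mertens x| ≤ (δ * x) * (5 * C * x * δ + δ * x + 1) := by
    calc _ ≤ _ := h5
      _ ≤ C * (4 * x ^ 2) * (δ * δ) + C * x ^ 2 * (δ * δ) + δ * x * (δ * x + 1) := by
        linarith
      _ = _ := by ring
  have h9 := le_of_mul_le_mul_left h8 (by positivity)
  have h10 : 1 * (δ * x) ≤ C * (δ * x) := mul_le_mul_of_nonneg_right hC (by positivity)
  refine h9.trans ?_
  calc 5 * C * x * δ + δ * x + 1 ≤ 5 * C * x * δ + C * (δ * x) + Real.exp 3 * (x * δ) := by linarith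
    _ = _ := by ring

lemma mertens_natCast (n : ℕ) :
    mertens n = ∑ d ∈ Icc 1 n, (ArithmeticFunction.moebius d : ℝ) := by
  rw [mertens, Nat.floor_natCast]

lemma mertens_succ (n : ℕ) :
    mertens ((n + 1 : ℕ) : ℝ) = mertens n + (ArithmeticFunction.moebius (n + 1) : ℝ) := by
  rw [mertens_natCast, mertens_natCast, sum_Icc_succ_top (by omega)]

lemma mertens_floor (x : ℝ) : mertens (⌊x⌋₊ : ℝ) = mertens x := by
  rw [mertens_natCast, mertens]

lemma summable_ite_moebius {α : ℕ} (hα : 2 ≤ α) (P : ℕ → Prop) [DecidablePred P] :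
    Summable fun d : ℕ => if P d then (ArithmeticFunction.moebius d : ℝ) / (d : ℝ) ^ α else 0 := by
  refine Summable.of_norm_bounded (Real.summable_one_div_nat_pow.2 (by omega : 1 < α)) fun d => ?_
  split_ifs
  · rw [norm_div, norm_pow, Real.norm_natCast]
    exact div_le_div_of_nonneg_right (abs_moebius_le d) (by positivity)
  · rw [norm_zero]; positivity

lemma abel_weight_le {α : ℕ} (hα : 2 ≤ α) {d : ℕ} (hd : 1 ≤ d) :
    (d : ℝ) * (1 / (d : ℝ) ^ α - 1 / ((d + 1 : ℕ) : ℝ) ^ α) ≤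
      2 * (1 / (d : ℝ) ^ (α - 1) - 1 / ((d + 1 : ℕ) : ℝ) ^ (α - 1)) := by
  obtain ⟨j, rfl⟩ := Nat.exists_eq_add_of_le hα
  have hd' : (1 : ℝ) ≤ d := by exact_mod_cast hd
  have key : ((d : ℝ) + 2) * (d : ℝ) ^ (j + 1) ≤ ((d : ℝ) + 1) ^ (j + 2) := by
    calc ((d : ℝ) + 2) * (d : ℝ) ^ (j + 1) = (d : ℝ) ^ j * ((d + 2) * d) := by ring
      _ ≤ ((d : ℝ) + 1) ^ j * ((d : ℝ) + 1) ^ 2 :=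
        mul_le_mul (pow_le_pow_left₀ (by linarith) (by linarith) j) (by nlinarith)
          (by positivity) (by positivity)
      _ = _ := by ring
  rw [show 2 + j - 1 = j + 1 by omega, show 2 + j = j + 2 by omega]
  push_cast
  have h1 : ((d : ℝ) + 2) / ((d : ℝ) + 1) ^ (j + 2) ≤ 1 / (d : ℝ) ^ (j + 1) := by
    rw [div_le_div_iff₀ (by positivity) (by positivity)]; linarith
  have e1 : (d : ℝ) * (1 / (d : ℝ) ^ (j + 2)) = 1 / (d : ℝ) ^ (j + 1) := by
    field_simp; ring
  have e2 : 1 / ((d : ℝ) + 1) ^ (j + 1) = ((d : ℝ) + 1) / ((d : ℝ) + 1) ^ (j + 2) := by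
    field_simp; ring
  rw [mul_sub, e1, e2]
  have e3 : ((d : ℝ) + 2) / ((d : ℝ) + 1) ^ (j + 2) =
      2 * (((d : ℝ) + 1) / ((d : ℝ) + 1) ^ (j + 2)) - d * (1 / ((d : ℝ) + 1) ^ (j + 2)) := by ring
  linarith

/-- Partial summation for tails of `∑ μ(d)/d^α`. -/
lemma tail_moebius_le {α : ℕ} (hα : 2 ≤ α) {K z : ℝ} (hK : 0 ≤ K) (hz : 1 ≤ z)
    (H : ∀ x, z ≤ x → |mertens x| ≤ K * x) :
    |∑' d : ℕ, if z < d then (ArithmeticFunction.moebius d : ℝ) / (d : ℝ) ^ α else 0| ≤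
      4 * K / z ^ (α - 1) := by
  set n := ⌊z⌋₊ with hn
  have hn1 : 1 ≤ n := Nat.le_floor (by simpa using hz)
  have hzn : z < (n + 1 : ℕ) := by push_cast; exact Nat.lt_floor_add_one z
  set w : ℕ → ℝ := fun d => 1 / (d : ℝ) ^ α with hw
  set v : ℕ → ℝ := fun d => 1 / (d : ℝ) ^ (α - 1) with hv
  have hlt : ∀ d : ℕ, z < d ↔ n < d := fun d => (Nat.floor_lt (by linarith)).symm
  have hM : ∀ d : ℕ, n < d → |mertens d| ≤ K * d := fun d hd => H d ((hlt d).2 hd).le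
  have hMn : |mertens n| ≤ K * (n + 1 : ℕ) := by
    rw [hn, mertens_floor]
    refine (H z le_rfl).trans (mul_le_mul_of_nonneg_left hzn.le hK)
  have hwv : ∀ d : ℕ, 1 ≤ d → d * w d = v d := by
    intro d hd
    have : (d : ℝ) ≠ 0 := by exact_mod_cast (by omega : d ≠ 0)
    obtain ⟨j, rfl⟩ := Nat.exists_eq_add_of_le hα
    simp only [hw, hv]
    rw [show 2 + j - 1 = j + 1 by omega, show 2 + j = j + 2 by omega]
    field_simp; ring
  have hwanti : ∀ d : ℕ, 1 ≤ d → w (d + 1) ≤ w d := by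
    intro d hd
    have : (1 : ℝ) ≤ d := by exact_mod_cast hd
    simp only [hw]
    exact one_div_le_one_div_of_le (by positivity)
      (pow_le_pow_left₀ (by positivity) (by push_cast; linarith) _)
  have hw0 : ∀ d, 0 ≤ w d := fun d => by simp only [hw]; positivity
  have hpart : ∀ m : ℕ, |∑ d ∈ range (n + 1 + m), (if z < d then
      (ArithmeticFunction.moebius d : ℝ) / (d : ℝ) ^ α else 0) - mertens ((n + m : ℕ) : ℝ) *
        w (n + m + 1)| ≤ K * v (n + 1) + 2 * K * (v (n + 1) - v (n + m + 1)) := by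
    intro m
    induction m with
    | zero =>
      have : ∑ d ∈ range (n + 1 + 0), (if z < d then
          (ArithmeticFunction.moebius d : ℝ) / (d : ℝ) ^ α else 0) = 0 := by
        refine sum_eq_zero fun d hd => if_neg ?_
        rw [hlt]; rw [mem_range] at hd; omega
      rw [this, zero_sub, abs_neg, abs_mul, abs_of_nonneg (hw0 _), Nat.add_zero]
      rw [sub_self, mul_zero, add_zero, ← hwv (n + 1) (by omega), ← mul_assoc]
      exact mul_le_mul_of_nonneg_right hMn (hw0 _)
    | succ m ih =>
      rw [← Nat.add_assoc, sum_range_succ, if_pos ((hlt _).2 (by omega))]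
      have e : n + 1 + m = n + m + 1 := by omega
      rw [e] at ih ⊢
      rw [show n + (m + 1) = n + m + 1 by omega] at *
      have h1 := mertens_succ (n + m)
      have h2 := hM (n + m + 1) (by omega)
      have h3 := abel_weight_le hα (d := n + m + 1) (by omega)
      have h4 := hwanti (n + m + 1) (by omega)
      set S := ∑ d ∈ range (n + m + 1), (if z < d then
          (ArithmeticFunction.moebius d : ℝ) / (d : ℝ) ^ α else 0)
      have e2 : S + (ArithmeticFunction.moebius (n + m + 1) : ℝ) / ((n + m + 1 : ℕ) : ℝ) ^ α -
          mertens ((n + m + 1 : ℕ) : ℝ) * w (n + m + 1 + 1) =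
          (S - mertens ((n + m : ℕ) : ℝ) * w (n + m + 1)) +
          mertens ((n + m + 1 : ℕ) : ℝ) * (w (n + m + 1) - w (n + m + 1 + 1)) := by
        rw [h1]; simp only [hw]; ring
      rw [e2]
      refine (abs_add_le _ _).trans ?_
      rw [abs_mul, abs_of_nonneg (sub_nonneg.2 h4)]
      have h5 : |mertens ((n + m + 1 : ℕ) : ℝ)| * (w (n + m + 1) - w (n + m + 1 + 1)) ≤
          K * (2 * (v (n + m + 1) - v (n + m + 1 + 1))) := by
        refine (mul_le_mul_of_nonneg_right h2 (sub_nonneg.2 h4)).trans ?_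
        rw [mul_assoc]
        exact mul_le_mul_of_nonneg_left h3 hK
      linarith
  have hv1 : v (n + 1) ≤ 1 / z ^ (α - 1) :=
    one_div_le_one_div_of_le (by positivity) (pow_le_pow_left₀ (by linarith) hzn.le _)
  have hfin : ∀ m : ℕ, |∑ d ∈ range (n + 1 + m), (if z < d then
      (ArithmeticFunction.moebius d : ℝ) / (d : ℝ) ^ α else 0)| ≤ 4 * K / z ^ (α - 1) := by
    intro m
    have h1 := hpart m
    have hMm : |mertens ((n + m : ℕ) : ℝ)| ≤ K * ((n + m + 1 : ℕ) : ℝ) := by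
      rcases Nat.eq_zero_or_pos m with rfl | hm
      · exact hMn
      · refine (hM _ (by omega)).trans (mul_le_mul_of_nonneg_left ?_ hK)
        push_cast; linarith
    have h2 : |mertens ((n + m : ℕ) : ℝ) * w (n + m + 1)| ≤ K * v (n + m + 1) := by
      rw [abs_mul, abs_of_nonneg (hw0 _), ← hwv _ (by omega), ← mul_assoc]
      exact mul_le_mul_of_nonneg_right hMm (hw0 _)
    have h3 : 0 ≤ v (n + m + 1) := by simp only [hv]; positivity
    have h4 : v (n + m + 1) ≤ v (n + 1) := by
      simp only [hv]
      refine one_div_le_one_div_of_le (by positivity) (pow_le_pow_left₀ (by positivity) ?_ _)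
      push_cast; linarith [(Nat.cast_nonneg m : (0 : ℝ) ≤ m)]
    set S := ∑ d ∈ range (n + 1 + m), (if z < d then
      (ArithmeticFunction.moebius d : ℝ) / (d : ℝ) ^ α else 0)
    have h5 : |S| ≤ |S - mertens ((n + m : ℕ) : ℝ) * w (n + m + 1)| +
        |mertens ((n + m : ℕ) : ℝ) * w (n + m + 1)| := by
      simpa using abs_add_le (S - mertens ((n + m : ℕ) : ℝ) * w (n + m + 1))
        (mertens ((n + m : ℕ) : ℝ) * w (n + m + 1))
    have h6 : 0 ≤ K * v (n + m + 1) := by positivity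
    calc |S| ≤ 3 * (K * v (n + 1)) := by linarith
      _ ≤ 4 * (K * v (n + 1)) := by nlinarith [mul_nonneg hK (h3.trans h4)]
      _ ≤ 4 * (K * (1 / z ^ (α - 1))) := by
        have := mul_le_mul_of_nonneg_left hv1 hK; linarith
      _ = _ := by ring
  have hlim := (summable_ite_moebius hα (fun d : ℕ => z < d)).hasSum.tendsto_sum_nat
  have hlim2 := hlim.comp (Filter.tendsto_add_atTop_nat (n + 1))
  refine le_of_tendsto hlim2.abs (.of_forall fun m => ?_)
  have := hfin m
  simp only [Function.comp]
  rwa [Nat.add_comm m (n + 1)]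

/-- `∑_{m > y} μ(m)²/m²`. -/
noncomputable def sqfreeTail (y : ℝ) : ℝ :=
  ∑' m : ℕ, if y < m then (ArithmeticFunction.moebius m : ℝ) ^ 2 / (m : ℝ) ^ 2 else 0

/-- `∑_{e > z} 1/e²`. -/
noncomputable def sqTail (z : ℝ) : ℝ := ∑' e : ℕ, if z < e then 1 / (e : ℝ) ^ 2 else 0

lemma summable_ite_sq (P : ℕ → Prop) [DecidablePred P] :
    Summable fun e : ℕ => if P e then 1 / (e : ℝ) ^ 2 else 0 := by
  refine Summable.of_nonneg_of_le (fun e => ?_) (fun e => ?_)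
    (Real.summable_one_div_nat_pow.2 (by norm_num : 1 < 2))
  · split_ifs <;> positivity
  · split_ifs
    · exact le_rfl
    · positivity

lemma sqTail_approx {z : ℝ} (hz : 0 < z) : |sqTail z - 1 / z| ≤ 1 / z ^ 2 := by
  set n := ⌊z⌋₊ with hn
  have hzn : z < (n + 1 : ℕ) := by push_cast; exact Nat.lt_floor_add_one z
  have hnz : (n : ℝ) ≤ z := Nat.floor_le hz.le
  have hlt : ∀ d : ℕ, z < d ↔ n < d := fun d => (Nat.floor_lt hz.le).symm
  set N : ℝ := n + 1 with hN
  have hN0 : 0 < N := by positivity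
  have hpart : ∀ m : ℕ, 1 / N - 1 / (N + m) ≤
      ∑ e ∈ range (n + 1 + m), (if z < e then 1 / (e : ℝ) ^ 2 else 0) ∧
      ∑ e ∈ range (n + 1 + m), (if z < e then 1 / (e : ℝ) ^ 2 else 0) ≤ 1 / N + 1 / N ^ 2 ∧
      ∑ e ∈ range (n + 1 + (m + 1)), (if z < e then 1 / (e : ℝ) ^ 2 else 0) ≤
        1 / N + 1 / N ^ 2 - 1 / (N + m) := by
    intro m
    induction m with
    | zero =>
      have h0 : ∑ e ∈ range (n + 1 + 0), (if z < e then 1 / (e : ℝ) ^ 2 else 0) = 0 := by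
        refine sum_eq_zero fun d hd => if_neg ?_
        rw [hlt]; rw [mem_range] at hd; omega
      refine ⟨by rw [h0]; simp, by rw [h0]; positivity, ?_⟩
      rw [← Nat.add_assoc, sum_range_succ, h0, if_pos ((hlt _).2 (by omega))]
      push_cast
      rw [← hN, add_zero]; simp
    | succ m ih =>
      obtain ⟨h1, h2, h3⟩ := ih
      have hk : 0 < N + m := by positivity
      have t1 : ∀ k : ℝ, 0 < k → 1 / (k + 1) ^ 2 + 1 / (k + 1) ≤ 1 / k ∧
          1 / k - 1 / (k + 1) ≤ 1 / k ^ 2 := by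
        intro k hk
        constructor
        · rw [div_add_div _ _ (by positivity) (by positivity), div_le_div_iff₀ (by positivity) hk]
          nlinarith [sq_nonneg k]
        · rw [div_sub_div _ _ (by positivity) (by positivity),
            div_le_div_iff₀ (by positivity) (by positivity)]
          nlinarith [sq_nonneg k]
      have e1 : ∑ e ∈ range (n + 1 + (m + 1)), (if z < e then 1 / (e : ℝ) ^ 2 else 0) =
          ∑ e ∈ range (n + 1 + m), (if z < e then 1 / (e : ℝ) ^ 2 else 0) + 1 / (N + m) ^ 2 := by
        rw [← Nat.add_assoc, sum_range_succ, if_pos ((hlt _).2 (by omega))]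
        push_cast; rfl
      have e2 : ∑ e ∈ range (n + 1 + (m + 1 + 1)), (if z < e then 1 / (e : ℝ) ^ 2 else 0) =
          ∑ e ∈ range (n + 1 + (m + 1)), (if z < e then 1 / (e : ℝ) ^ 2 else 0)
            + 1 / (N + m + 1) ^ 2 := by
        rw [← Nat.add_assoc, sum_range_succ, if_pos ((hlt _).2 (by omega))]
        push_cast; rw [hN]; ring
      obtain ⟨a1, a2⟩ := t1 (N + m) hk
      have a3 : 0 < 1 / (N + m) := by positivity
      push_cast
      rw [← add_assoc]
      refine ⟨by linarith, by linarith, by linarith⟩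
  have hsum := (summable_ite_sq (fun e : ℕ => z < e)).hasSum
  have hlim := hsum.tendsto_sum_nat.comp (Filter.tendsto_add_atTop_nat (n + 1))
  have hU : sqTail z ≤ 1 / N + 1 / N ^ 2 := by
    refine le_of_tendsto hlim (.of_forall fun m => ?_)
    have := (hpart m).2.1
    simp only [Function.comp]; rwa [Nat.add_comm m (n + 1)]
  have hL : 1 / N ≤ sqTail z := by
    have hl : Filter.Tendsto (fun m : ℕ => 1 / N - 1 / (N + m)) Filter.atTop (nhds (1 / N - 0)) := by
      refine Filter.Tendsto.const_sub _ ?_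
      refine Filter.Tendsto.div_atTop tendsto_const_nhds ?_
      exact Filter.tendsto_atTop_add_const_left _ _ tendsto_natCast_atTop_atTop
    rw [sub_zero] at hl
    refine le_of_tendsto_of_tendsto hl hlim (.of_forall fun m => ?_)
    have := (hpart m).1
    simp only [Function.comp]; rwa [Nat.add_comm m (n + 1)]
  have hzN : z < N := by rw [hN]; exact_mod_cast hzn
  have i1 : 1 / N ≤ 1 / z := one_div_le_one_div_of_le hz hzN.le
  have i2 : 1 / N ^ 2 ≤ 1 / z ^ 2 :=
    one_div_le_one_div_of_le (by positivity) (pow_le_pow_left₀ hz.le hzN.le 2)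
  have i3 : 1 / z - 1 / N ≤ 1 / z ^ 2 := by
    rw [div_sub_div _ _ hz.ne' hN0.ne', div_le_div_iff₀ (by positivity) (by positivity)]
    have : 1 * N - z * 1 ≤ 1 := by linarith
    nlinarith [mul_pos hz hz, mul_pos hz hN0]
  rw [abs_le]
  constructor <;> linarith

lemma sum_moebius_divisors (b : ℕ) :
    ∑ d ∈ b.divisors, (ArithmeticFunction.moebius d : ℝ) = if b = 1 then 1 else 0 := by
  have h := ArithmeticFunction.coe_mul_zeta_apply (R := ℤ) (f := ArithmeticFunction.moebius) (x := b)
  rw [ArithmeticFunction.moebius_mul_coe_zeta, ArithmeticFunction.one_apply] at h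
  have h' := congrArg (fun t : ℤ => (t : ℝ)) h
  push_cast at h'
  rw [← h']

lemma dvd_of_sq_dvd_sq_mul {d b s : ℕ} (hb : b ≠ 0) (hs : Squarefree s) (h : d ^ 2 ∣ b ^ 2 * s) :
    d ∣ b := by
  have hg : 0 < Nat.gcd d b := Nat.gcd_pos_of_pos_right _ (Nat.pos_of_ne_zero hb)
  obtain ⟨d', e, hco, hd, hbe⟩ := Nat.exists_coprime d b
  set g := Nat.gcd d b
  rw [hd, hbe, mul_pow, mul_pow, mul_right_comm] at h
  have h1 : d' ^ 2 ∣ e ^ 2 * s := Nat.dvd_of_mul_dvd_mul_right (by positivity) h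
  have h2 : d' ^ 2 ∣ s := Nat.Coprime.dvd_of_dvd_mul_left (Nat.Coprime.pow 2 2 hco) h1
  have h3 : d' = 1 := by
    have := hs d' (by rwa [← sq])
    exact Nat.isUnit_iff.1 this
  rw [hd, hbe, h3, one_mul]
  exact Dvd.intro_left e rfl

/-- `μ(n)²` as the divisor sum of `μ` over square divisors, with an arbitrary weight. -/
lemma tsum_fiber_sq (W : ℕ → ℝ) {n : ℕ} (hn : n ≠ 0) :
    ∑' p : (fun p : ℕ × ℕ => p.1 ^ 2 * p.2) ⁻¹' {n},
      (ArithmeticFunction.moebius p.1.1 : ℝ) * W (p.1.1 ^ 2 * p.1.2) =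
    (ArithmeticFunction.moebius n : ℝ) ^ 2 * W n := by
  obtain ⟨s, b, hs0, hb0, hsb, hsf⟩ := Nat.sq_mul_squarefree_of_pos (Nat.pos_of_ne_zero hn)
  have hset : (fun p : ℕ × ℕ => p.1 ^ 2 * p.2) ⁻¹' {n} =
      ((b.divisors.image fun d => (d, n / d ^ 2) : Finset (ℕ × ℕ)) : Set (ℕ × ℕ)) := by
    ext ⟨d, e⟩
    simp only [Set.mem_preimage, Set.mem_singleton_iff, coe_image, Set.mem_image, mem_coe,
      Nat.mem_divisors, Prod.mk.injEq]
    constructor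
    · intro h
      have hd0 : 0 < d ^ 2 := by
        rcases Nat.eq_zero_or_pos (d ^ 2) with h0 | h0
        · rw [h0, zero_mul] at h; exact absurd h.symm hn
        · exact h0
      refine ⟨d, ⟨dvd_of_sq_dvd_sq_mul hb0.ne' hsf ?_, hb0.ne'⟩, rfl, ?_⟩
      · rw [hsb, ← h]; exact Dvd.intro _ rfl
      · rw [← h, Nat.mul_div_cancel_left _ hd0]
    · rintro ⟨d', ⟨hd, -⟩, rfl, rfl⟩
      refine Nat.mul_div_cancel' ?_
      rw [← hsb]; exact Dvd.dvd.mul_right (pow_dvd_pow_of_dvd hd 2) s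
  rw [tsum_congr_set_coe (fun p : ℕ × ℕ => (ArithmeticFunction.moebius p.1 : ℝ) *
    W (p.1 ^ 2 * p.2)) hset,
    Finset.tsum_subtype' _ (fun p : ℕ × ℕ => (ArithmeticFunction.moebius p.1 : ℝ) *
    W (p.1 ^ 2 * p.2)), sum_image (fun x _ y _ h => (Prod.mk.inj h).1)]
  have : ∀ d ∈ b.divisors, (ArithmeticFunction.moebius d : ℝ) * W (d ^ 2 * (n / d ^ 2)) =
      (ArithmeticFunction.moebius d : ℝ) * W n := by
    intro d hd
    rw [Nat.mul_div_cancel']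
    rw [← hsb]; exact Dvd.dvd.mul_right (pow_dvd_pow_of_dvd (Nat.mem_divisors.1 hd).1 2) s
  rw [sum_congr rfl this, ← sum_mul, sum_moebius_divisors]
  congr 1
  have hsq := ArithmeticFunction.moebius_sq (n := n)
  have hiff : Squarefree n ↔ b = 1 := by
    constructor
    · intro h
      have := h b (by rw [← sq, ← hsb]; exact Dvd.intro _ rfl)
      exact Nat.isUnit_iff.1 this
    · rintro rfl
      rw [← hsb]; simpa using hsf
  have hsq' := congrArg (fun t : ℤ => (t : ℝ)) hsq
  push_cast at hsq'
  rw [hsq']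
  simp only [hiff]

lemma sum_moebius_div_sq : HasSum (fun d : ℕ => (ArithmeticFunction.moebius d : ℝ) / (d : ℝ) ^ 2)
    (6 / π ^ 2) := by
  have hs : Summable fun d : ℕ => (ArithmeticFunction.moebius d : ℝ) / (d : ℝ) ^ 2 := by
    simpa using summable_ite_moebius le_rfl (fun _ : ℕ => True)
  have h := LSeries_moebius_eq (s := 2) (by norm_num)
  rw [riemannZeta_two, LSeries] at h
  have h2 : ∀ n : ℕ, LSeries.term (fun n => ((ArithmeticFunction.moebius n : ℤ) : ℂ)) 2 n =
      (((ArithmeticFunction.moebius n : ℝ) / (n : ℝ) ^ 2 : ℝ) : ℂ) := by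
    intro n
    by_cases hn : n = 0
    · subst hn; simp
    · rw [LSeries.term_of_ne_zero hn]
      push_cast
      congr 1
      exact_mod_cast Complex.cpow_natCast (n : ℂ) 2
  simp_rw [h2] at h
  rw [← Complex.ofReal_tsum] at h
  have h3 : ∑' n : ℕ, (ArithmeticFunction.moebius n : ℝ) / (n : ℝ) ^ 2 = 6 / π ^ 2 := by
    have : ((π : ℂ) ^ 2 / 6)⁻¹ = ((6 / π ^ 2 : ℝ) : ℂ) := by push_cast; rw [inv_div]
    rw [this] at h
    exact_mod_cast h
  rw [← h3]; exact hs.hasSum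

lemma tsum_one_div_sq_le : ∑' e : ℕ, 1 / (e : ℝ) ^ 2 ≤ 2 := by
  rw [hasSum_zeta_two.tsum_eq]
  nlinarith [Real.pi_lt_d2, Real.pi_pos]

/-- The summand of the double series for `sqfreeTail`. -/
noncomputable def sqPair (y : ℝ) (p : ℕ × ℕ) : ℝ :=
  (ArithmeticFunction.moebius p.1 : ℝ) / (p.1 : ℝ) ^ 4 *
    if y < ((p.1 ^ 2 * p.2 : ℕ) : ℝ) then 1 / (p.2 : ℝ) ^ 2 else 0

lemma abs_sqPair_le (y : ℝ) (p : ℕ × ℕ) :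
    |sqPair y p| ≤ 1 / (p.1 : ℝ) ^ 4 * (1 / (p.2 : ℝ) ^ 2) := by
  rw [sqPair, abs_mul, abs_div]
  refine mul_le_mul ?_ ?_ (abs_nonneg _) (by positivity)
  · rw [abs_of_nonneg (by positivity : 0 ≤ (p.1 : ℝ) ^ 4)]
    exact div_le_div_of_nonneg_right (abs_moebius_le _) (by positivity)
  · split_ifs
    · rw [abs_of_nonneg (by positivity)]
    · rw [abs_zero]; positivity

lemma summable_sq_pair_bound :
    Summable fun p : ℕ × ℕ => 1 / (p.1 : ℝ) ^ 4 * (1 / (p.2 : ℝ) ^ 2) :=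
  (Real.summable_one_div_nat_pow.2 (by norm_num : 1 < 4)).mul_of_nonneg
    (Real.summable_one_div_nat_pow.2 (by norm_num : 1 < 2))
    (fun _ => by positivity) (fun _ => by positivity)

lemma summable_sqPair (y : ℝ) : Summable (sqPair y) :=
  Summable.of_norm_bounded summable_sq_pair_bound (abs_sqPair_le y)

lemma sqfreeTail_eq (y : ℝ) : sqfreeTail y = ∑' p : ℕ × ℕ, sqPair y p := by
  have h := (summable_sqPair y).hasSum.tsum_fiberwise (fun p : ℕ × ℕ => p.1 ^ 2 * p.2)
  rw [← h.tsum_eq, sqfreeTail]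
  refine tsum_congr fun n => ?_
  set W : ℕ → ℝ := fun m => if y < m then 1 / (m : ℝ) ^ 2 else 0 with hW
  have hterm : ∀ p : ℕ × ℕ, sqPair y p = (ArithmeticFunction.moebius p.1 : ℝ) * W (p.1 ^ 2 * p.2) := by
    intro p
    simp only [sqPair, hW]
    by_cases hp : p.1 = 0
    · rw [hp]; simp
    · split_ifs
      · have : (p.1 : ℝ) ≠ 0 := by exact_mod_cast hp
        push_cast
        rw [mul_pow, ← pow_mul, div_mul_div_comm, mul_one_div]
        norm_num
      · simp
  simp_rw [hterm]
  by_cases hn : n = 0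
  · subst hn
    have : ∀ p : (fun p : ℕ × ℕ => p.1 ^ 2 * p.2) ⁻¹' {0},
        (ArithmeticFunction.moebius p.1.1 : ℝ) * W (p.1.1 ^ 2 * p.1.2) = 0 := by
      rintro ⟨p, hp⟩
      simp only [Set.mem_preimage, Set.mem_singleton_iff] at hp
      simp [hp, hW]
    rw [tsum_congr this]
    simp
  · rw [tsum_fiber_sq W hn]
    simp only [hW]
    split_ifs <;> ring

lemma sqfreeTail_approx {y D K : ℝ} (hy : 0 < y) (hD : 1 ≤ D) (hK : 0 ≤ K)
    (H : ∀ x, D ≤ x → |mertens x| ≤ K * x) :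
    |sqfreeTail y - 6 / π ^ 2 / y| ≤ 4 * K / D / y + D / y ^ 2 + 8 * K / D ^ 3 := by
  classical
  set F1 : ℕ × ℕ → ℝ := fun p => if D < p.1 then 0 else sqPair y p with hF1
  set F2 : ℕ × ℕ → ℝ := fun p => if D < p.1 then sqPair y p else 0 with hF2
  have hb1 : ∀ p, ‖F1 p‖ ≤ 1 / (p.1 : ℝ) ^ 4 * (1 / (p.2 : ℝ) ^ 2) := by
    intro p
    simp only [hF1]
    split_ifs
    · rw [norm_zero]; positivity
    · exact abs_sqPair_le y p
  have hb2 : ∀ p, ‖F2 p‖ ≤ 1 / (p.1 : ℝ) ^ 4 * (1 / (p.2 : ℝ) ^ 2) := by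
    intro p
    simp only [hF2]
    split_ifs
    · exact abs_sqPair_le y p
    · rw [norm_zero]; positivity
  have hs1 : Summable F1 := Summable.of_norm_bounded summable_sq_pair_bound hb1
  have hs2 : Summable F2 := Summable.of_norm_bounded summable_sq_pair_bound hb2
  have hsplit : sqfreeTail y = (∑' p, F1 p) + ∑' p, F2 p := by
    rw [sqfreeTail_eq, ← hs1.tsum_add hs2]
    refine tsum_congr fun p => ?_
    simp only [hF1, hF2]
    split_ifs <;> simp
  -- small `d`
  have hsm : Summable fun d : ℕ => if ¬ D < d then
      (ArithmeticFunction.moebius d : ℝ) / (d : ℝ) ^ 2 else 0 :=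
    summable_ite_moebius le_rfl _
  have hbig : Summable fun d : ℕ => if D < d then
      (ArithmeticFunction.moebius d : ℝ) / (d : ℝ) ^ 2 else 0 :=
    summable_ite_moebius le_rfl _
  have hZ : ∑' d : ℕ, (if ¬ D < d then (ArithmeticFunction.moebius d : ℝ) / (d : ℝ) ^ 2 else 0) =
      6 / π ^ 2 - ∑' d : ℕ, (if D < d then (ArithmeticFunction.moebius d : ℝ) / (d : ℝ) ^ 2 else 0) := by
    rw [eq_sub_iff_add_eq, ← hsm.tsum_add hbig, ← sum_moebius_div_sq.tsum_eq]
    refine tsum_congr fun d => ?_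
    split_ifs <;> simp
  have hV2 := tail_moebius_le le_rfl hK hD H
  have hP1 : |(∑' p, F1 p) - 1 / y * ∑' d : ℕ, (if ¬ D < d then
      (ArithmeticFunction.moebius d : ℝ) / (d : ℝ) ^ 2 else 0)| ≤ D / y ^ 2 := by
    rw [hs1.tsum_prod, ← tsum_mul_left, ← (hs1.prod).tsum_sub (hsm.mul_left _)]
    have hterm : ∀ d : ℕ, ‖(∑' e, F1 (d, e)) - 1 / y * (if ¬ D < d then
        (ArithmeticFunction.moebius d : ℝ) / (d : ℝ) ^ 2 else 0)‖ ≤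
        if d ∈ Icc 1 ⌊D⌋₊ then 1 / y ^ 2 else 0 := by
      intro d
      rw [Real.norm_eq_abs]
      by_cases hd0 : d = 0
      · subst hd0
        simp [hF1, sqPair]
      by_cases hd : D < d
      · have : ∀ e, F1 (d, e) = 0 := fun e => by simp only [hF1]; rw [if_pos hd]
        rw [tsum_congr this, tsum_zero, if_neg (not_not.2 hd)]
        simp only [mul_zero, sub_zero, abs_zero]
        split_ifs <;> positivity
      have hdm : d ∈ Icc 1 ⌊D⌋₊ := by
        rw [mem_Icc]; push Not at hd; exact ⟨Nat.pos_of_ne_zero hd0, Nat.le_floor hd⟩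
      rw [if_pos hdm, if_pos hd]
      have hd' : (0 : ℝ) < d := by exact_mod_cast Nat.pos_of_ne_zero hd0
      have hin : ∑' e, F1 (d, e) = (ArithmeticFunction.moebius d : ℝ) / (d : ℝ) ^ 4 *
          sqTail (y / d ^ 2) := by
        rw [sqTail, ← tsum_mul_left]
        refine tsum_congr fun e => ?_
        simp only [hF1, sqPair]
        rw [if_neg hd]
        congr 1
        have : y < ((d ^ 2 * e : ℕ) : ℝ) ↔ y / (d : ℝ) ^ 2 < e := by
          rw [div_lt_iff₀ (by positivity)]; push_cast; rw [mul_comm]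
        simp only [this]
      rw [hin]
      have hap := sqTail_approx (z := y / d ^ 2) (by positivity)
      have e1 : (ArithmeticFunction.moebius d : ℝ) / (d : ℝ) ^ 4 * sqTail (y / d ^ 2) -
          1 / y * ((ArithmeticFunction.moebius d : ℝ) / (d : ℝ) ^ 2) =
          (ArithmeticFunction.moebius d : ℝ) * (1 / (d : ℝ) ^ 4 *
            (sqTail (y / d ^ 2) - 1 / (y / d ^ 2))) := by
        field_simp
      rw [e1, abs_mul, abs_mul, abs_of_nonneg (by positivity : 0 ≤ 1 / (d : ℝ) ^ 4)]
      calc _ ≤ 1 * (1 / (d : ℝ) ^ 4 * (1 / (y / d ^ 2) ^ 2)) :=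
            mul_le_mul (abs_moebius_le d) (mul_le_mul_of_nonneg_left hap (by positivity))
              (by positivity) (by norm_num)
        _ = 1 / y ^ 2 := by field_simp
    have hfs : HasSum (fun d : ℕ => if d ∈ Icc 1 ⌊D⌋₊ then 1 / y ^ 2 else 0)
        (∑ d ∈ Icc 1 ⌊D⌋₊, if d ∈ Icc 1 ⌊D⌋₊ then 1 / y ^ 2 else 0) :=
      hasSum_sum_of_ne_finset_zero (fun d hd => if_neg hd)
    refine (tsum_of_norm_bounded hfs hterm).trans ?_
    rw [sum_ite_mem, inter_self, sum_const, Nat.card_Icc, nsmul_eq_mul, Nat.add_sub_cancel, mul_one_div]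
    exact div_le_div_of_nonneg_right (Nat.floor_le (by linarith)) (by positivity)
  -- large `d`
  have hP2 : |∑' p, F2 p| ≤ 8 * K / D ^ 3 := by
    have hs2' : Summable (fun p : ℕ × ℕ => F2 (p.2, p.1)) :=
      hs2.comp_injective (Equiv.prodComm ℕ ℕ).injective
    have hsw : ∑' p, F2 p = ∑' p : ℕ × ℕ, F2 (p.2, p.1) :=
      ((Equiv.prodComm ℕ ℕ).tsum_eq F2).symm
    rw [hsw, hs2'.tsum_prod]
    have hterm : ∀ e : ℕ, ‖∑' d, F2 (d, e)‖ ≤ 4 * K / D ^ 3 * (1 / (e : ℝ) ^ 2) := by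
      intro e
      by_cases he : e = 0
      · subst he
        have : ∀ d, F2 (d, 0) = 0 := fun d => by simp [hF2, sqPair]
        rw [tsum_congr this, tsum_zero, norm_zero]; positivity
      have he' : (0 : ℝ) < e := by exact_mod_cast Nat.pos_of_ne_zero he
      set z := max D (Real.sqrt (y / e)) with hz
      have hzD : D ≤ z := le_max_left _ _
      have hval : ∀ d, F2 (d, e) = 1 / (e : ℝ) ^ 2 * (if z < d then
          (ArithmeticFunction.moebius d : ℝ) / (d : ℝ) ^ 4 else 0) := by
        intro d
        simp only [hF2, sqPair]
        by_cases h1 : D < d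
        · rw [if_pos h1]
          have : y < ((d ^ 2 * e : ℕ) : ℝ) ↔ z < d := by
            rw [hz, max_lt_iff, Real.sqrt_lt' (by linarith), div_lt_iff₀ he']
            push_cast
            exact ⟨fun h => ⟨h1, h⟩, fun h => h.2⟩
          simp only [this]
          split_ifs <;> ring
        · rw [if_neg h1, if_neg (fun h => h1 (lt_of_le_of_lt hzD h)), mul_zero]
      rw [tsum_congr hval, tsum_mul_left, norm_mul, Real.norm_of_nonneg (by positivity), mul_comm]
      refine mul_le_mul_of_nonneg_right ?_ (by positivity)
      refine (tail_moebius_le (α := 4) (by norm_num) hK (hD.trans hzD)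
        (fun x hx => H x (hzD.trans hx))).trans ?_
      exact div_le_div_of_nonneg_left (by positivity) (by positivity)
        (pow_le_pow_left₀ (by linarith) hzD 3)
    have hsq := (hasSum_zeta_two.summable.mul_left (4 * K / D ^ 3)).hasSum
    refine (tsum_of_norm_bounded hsq hterm).trans ?_
    rw [tsum_mul_left]
    calc _ ≤ 4 * K / D ^ 3 * 2 := mul_le_mul_of_nonneg_left tsum_one_div_sq_le (by positivity)
      _ = _ := by ring
  rw [hZ] at hP1
  set V := ∑' d : ℕ, (if D < d then (ArithmeticFunction.moebius d : ℝ) / (d : ℝ) ^ 2 else 0)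
  have hV : |1 / y * V| ≤ 4 * K / D / y := by
    rw [abs_mul, abs_of_pos (by positivity)]
    rw [show 2 - 1 = 1 from rfl, pow_one] at hV2
    calc _ ≤ 1 / y * (4 * K / D) := mul_le_mul_of_nonneg_left hV2 (by positivity)
      _ = _ := by ring
  have e : sqfreeTail y - 6 / π ^ 2 / y =
      ((∑' p, F1 p) - 1 / y * (6 / π ^ 2 - V)) + (∑' p, F2 p) - 1 / y * V := by
    rw [hsplit]; ring
  rw [e]
  refine (abs_sub _ _).trans ?_
  have := abs_add_le ((∑' p, F1 p) - 1 / y * (6 / π ^ 2 - V)) (∑' p, F2 p)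
  linarith

lemma vkExp_le_four_mul {u v : ℝ} (hv : 3 ≤ v) (hu : 3 ≤ u) (h : u ≤ 4 * v) :
    vkExp u ≤ 4 * vkExp v := by
  rcases le_total u v with huv | huv
  · have := vkExp_mono hu huv
    have := vkExp_pos hv
    linarith
  · have h1 : u ^ (3 / 5 : ℝ) ≤ 4 * v ^ (3 / 5 : ℝ) := by
      calc u ^ (3 / 5 : ℝ) ≤ (4 * v) ^ (3 / 5 : ℝ) :=
            Real.rpow_le_rpow (by linarith) h (by norm_num)
        _ = 4 ^ (3 / 5 : ℝ) * v ^ (3 / 5 : ℝ) := Real.mul_rpow (by norm_num) (by linarith)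
        _ ≤ 4 ^ (1 : ℝ) * v ^ (3 / 5 : ℝ) :=
            mul_le_mul_of_nonneg_right
              (Real.rpow_le_rpow_of_exponent_le (by norm_num) (by norm_num))
              (Real.rpow_nonneg (by linarith) _)
        _ = _ := by rw [Real.rpow_one]
    have hlv := one_le_log_of_three_le hv
    have h2 : Real.log u ^ (-(1 / 5) : ℝ) ≤ Real.log v ^ (-(1 / 5) : ℝ) :=
      Real.rpow_le_rpow_of_nonpos (by linarith) (Real.log_le_log (by linarith) huv) (by norm_num)
    have hlu := one_le_log_of_three_le hu
    unfold vkExp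
    rw [← mul_assoc]
    exact mul_le_mul h1 h2 (Real.rpow_nonneg (by linarith) _)
      (mul_nonneg (by norm_num) (Real.rpow_nonneg (by linarith) _))

/-- The Vinogradov–Korobov saving. -/
noncomputable def vkEps (c y : ℝ) : ℝ := Real.exp (-(c * vkExp (max (Real.log y) 0 + 3)))

lemma vkEps_pos (c y : ℝ) : 0 < vkEps c y := Real.exp_pos _

lemma vkEps_div_le {c y d : ℝ} (hc : 0 ≤ c) (hy : 0 < y) (hd : 1 ≤ d) :
    vkEps c (y / d) ≤ d ^ c * vkEps c y := by
  have hld := Real.log_nonneg hd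
  unfold vkEps
  rw [Real.rpow_def_of_pos (by linarith), ← Real.exp_add, Real.exp_le_exp,
    Real.log_div hy.ne' (by linarith)]
  have h1 : max (Real.log y - Real.log d) 0 ≤ max (Real.log y) 0 :=
    max_le_max (by linarith) le_rfl
  have h2 : max (Real.log y) 0 ≤ max (Real.log y - Real.log d) 0 + Real.log d := by
    refine max_le ?_ ?_
    · linarith [le_max_left (Real.log y - Real.log d) 0]
    · linarith [le_max_right (Real.log y - Real.log d) 0]
  have h3 := vkExp_sub_le (v := max (Real.log y - Real.log d) 0 + 3)
    (u := max (Real.log y) 0 + 3)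
    (by linarith [le_max_right (Real.log y - Real.log d) 0]) (by linarith)
  nlinarith [mul_le_mul_of_nonneg_left h3 hc]

lemma vkEps_anti {c x y : ℝ} (hc : 0 ≤ c) (hx : 0 < x) (h : x ≤ y) : vkEps c y ≤ vkEps c x := by
  unfold vkEps
  rw [Real.exp_le_exp, neg_le_neg_iff]
  refine mul_le_mul_of_nonneg_left (vkExp_mono ?_ ?_) hc
  · linarith [le_max_right (Real.log x) 0]
  · linarith [max_le_max_right 0 (Real.log_le_log hx h)]

lemma sqfreeTail_nonneg (y : ℝ) : 0 ≤ sqfreeTail y :=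
  tsum_nonneg fun m => by split_ifs <;> positivity

lemma sqfreeTail_le_two (y : ℝ) : sqfreeTail y ≤ 2 := by
  have hs : Summable fun m : ℕ => 1 / (m : ℝ) ^ 2 := hasSum_zeta_two.summable
  have hle : ∀ m : ℕ, (if y < m then (ArithmeticFunction.moebius m : ℝ) ^ 2 / (m : ℝ) ^ 2 else 0) ≤
      1 / (m : ℝ) ^ 2 := by
    intro m
    split_ifs
    · refine div_le_div_of_nonneg_right ?_ (by positivity)
      have := abs_moebius_le m
      rw [← sq_abs]
      exact pow_le_one₀ (abs_nonneg _) this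
    · positivity
  have h0 : ∀ m : ℕ,
      0 ≤ (if y < m then (ArithmeticFunction.moebius m : ℝ) ^ 2 / (m : ℝ) ^ 2 else 0) := by
    intro m; split_ifs <;> positivity
  exact ((Summable.of_nonneg_of_le h0 hle hs).tsum_le_tsum hle hs).trans tsum_one_div_sq_le

theorem exists_sqfreeTail_bound : ∃ c C : ℝ, 0 < c ∧ c ≤ 1 / 20 ∧ 1 ≤ C ∧ ∀ y : ℝ, 0 < y →
    |sqfreeTail y - 6 / π ^ 2 / y| ≤ C * y ^ (-(3 / 2) : ℝ) * vkEps c y := by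
  obtain ⟨c, C, hc, hc2, hC, hM⟩ := exists_mertens_bound
  refine ⟨c / 16, 14 * C, by positivity, by linarith, by linarith, fun y hy => ?_⟩
  set κ := c / 16 with hκ
  have hκ0 : 0 < κ := by positivity
  have hκ1 : κ ≤ 1 / 32 := by rw [hκ]; linarith
  rcases lt_or_ge y 1 with hy1 | hy1
  · have h1 := sqfreeTail_nonneg y
    have h2 := sqfreeTail_le_two y
    have h3 : 0 ≤ 6 / π ^ 2 / y := by positivity
    have hz : 1 ≤ y ^ (-(3 / 2) : ℝ) :=
      Real.one_le_rpow_of_pos_of_le_one_of_nonpos hy hy1.le (by norm_num)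
    have h4 : 6 / π ^ 2 / y ≤ y ^ (-(3 / 2) : ℝ) := by
      have : 6 / π ^ 2 ≤ 1 := by
        rw [div_le_one (by positivity)]; nlinarith [Real.pi_gt_three]
      calc 6 / π ^ 2 / y ≤ 1 / y := div_le_div_of_nonneg_right this hy.le
        _ = y ^ (-1 : ℝ) := by rw [Real.rpow_neg_one, one_div]
        _ ≤ _ := Real.rpow_le_rpow_of_exponent_ge hy hy1.le (by norm_num)
    have he : 1 / 2 ≤ vkEps κ y := by
      unfold vkEps
      rw [max_eq_right (Real.log_nonpos hy.le hy1.le), zero_add]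
      have := vkExp_le_self (le_refl (3 : ℝ))
      have h5 := Real.add_one_le_exp (-(κ * vkExp 3))
      nlinarith
    have h6 : |sqfreeTail y - 6 / π ^ 2 / y| ≤ 2 * y ^ (-(3 / 2) : ℝ) := by
      rw [abs_le]; constructor <;> linarith
    refine h6.trans ?_
    have h7 : 14 * y ^ (-(3 / 2) : ℝ) ≤ 14 * C * y ^ (-(3 / 2) : ℝ) := by nlinarith
    calc 2 * y ^ (-(3 / 2) : ℝ) ≤ 14 * y ^ (-(3 / 2) : ℝ) * (1 / 2) := by linarith
      _ ≤ _ := mul_le_mul h7 he (by norm_num) (by positivity)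
  have hL := Real.log_nonneg hy1
  set L := Real.log y with hLdef
  set E := vkExp (L + 3) with hE
  have hE0 : 0 < E := vkExp_pos (by linarith)
  have hEle : E ≤ L + 3 := vkExp_le_self (by linarith)
  have hκE : κ * E ≤ κ * (L + 3) := mul_le_mul_of_nonneg_left hEle hκ0.le
  have hκL : κ * L ≤ 1 / 32 * L := mul_le_mul_of_nonneg_right hκ1 hL
  set lD := 3 * κ + L / 2 - κ * E with hlD
  clear_value lD
  have hlD4 : L / 4 ≤ lD := by rw [hlD]; nlinarith
  have hD1 : 1 ≤ Real.exp lD := Real.one_le_exp (by linarith)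
  have hvk : E ≤ 4 * vkExp (lD + 3) :=
    vkExp_le_four_mul (by linarith) (by linarith) (by linarith)
  have hmain := sqfreeTail_approx (y := y) (D := Real.exp lD) (K := C * Real.exp (-(4 * κ * E)))
    hy hD1 (by positivity) (by
      intro x hx
      have hx1 : 1 ≤ x := hD1.trans hx
      refine (hM x hx1).trans ?_
      have hlx : lD ≤ Real.log x := by
        rw [Real.le_log_iff_exp_le (by linarith)]; exact hx
      have hvx : vkExp (lD + 3) ≤ vkExp (Real.log x + 3) :=
        vkExp_mono (by linarith) (by linarith)
      have : Real.exp (-(c * vkExp (Real.log x + 3))) ≤ Real.exp (-(4 * κ * E)) := by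
        rw [Real.exp_le_exp, hκ, neg_le_neg_iff]
        have := mul_le_mul_of_nonneg_left (hvk.trans (mul_le_mul_of_nonneg_left hvx (by norm_num)))
          hc.le
        linarith
      calc _ ≤ C * x * Real.exp (-(4 * κ * E)) := mul_le_mul_of_nonneg_left this (by positivity)
        _ = _ := by ring)
  refine hmain.trans ?_
  have hyL : y = Real.exp L := (Real.exp_log hy).symm
  have hyr : y ^ (-(3 / 2) : ℝ) = Real.exp (-(3 / 2) * L) := by
    rw [Real.rpow_def_of_pos hy, mul_comm]
  have heps : vkEps κ y = Real.exp (-(κ * E)) := by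
    unfold vkEps; rw [max_eq_left hL]
  rw [hyr, heps]
  have hκE0 : 0 < κ * E := by positivity
  have t1 : 4 * (C * Real.exp (-(4 * κ * E))) / Real.exp lD / y ≤
      4 * C * (Real.exp (-(3 / 2) * L) * Real.exp (-(κ * E))) := by
    have : 4 * (C * Real.exp (-(4 * κ * E))) / Real.exp lD / y =
        4 * C * Real.exp (-(4 * κ * E) - lD - L) := by
      rw [Real.exp_sub, Real.exp_sub, ← hyL]; ring
    rw [this, ← Real.exp_add]
    refine mul_le_mul_of_nonneg_left (Real.exp_le_exp.2 ?_) (by positivity)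
    rw [hlD]; nlinarith
  have t2 : Real.exp lD / y ^ 2 ≤ 2 * (Real.exp (-(3 / 2) * L) * Real.exp (-(κ * E))) := by
    have h3 : Real.exp (3 * κ) ≤ 2 := by
      have h1 : Real.exp (3 * κ) ≤ Real.exp (Real.log 2) := by
        rw [Real.exp_le_exp]; linarith [Real.log_two_gt_d9]
      rwa [Real.exp_log (by norm_num)] at h1
    have : Real.exp lD / y ^ 2 =
        Real.exp (3 * κ) * (Real.exp (-(3 / 2) * L) * Real.exp (-(κ * E))) := by
      rw [hyL, ← Real.exp_nat_mul, ← Real.exp_sub, ← Real.exp_add, ← Real.exp_add, hlD]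
      congr 1; push_cast; ring
    rw [this]
    exact mul_le_mul_of_nonneg_right h3 (by positivity)
  have t3 : 8 * (C * Real.exp (-(4 * κ * E))) / Real.exp lD ^ 3 ≤
      8 * C * (Real.exp (-(3 / 2) * L) * Real.exp (-(κ * E))) := by
    have : 8 * (C * Real.exp (-(4 * κ * E))) / Real.exp lD ^ 3 =
        8 * C * Real.exp (-(4 * κ * E) - 3 * lD) := by
      rw [Real.exp_sub, ← Real.exp_nat_mul]; push_cast; ring
    rw [this, ← Real.exp_add]
    refine mul_le_mul_of_nonneg_left (Real.exp_le_exp.2 ?_) (by positivity)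
    rw [hlD]; nlinarith
  have hX : 0 < Real.exp (-(3 / 2) * L) * Real.exp (-(κ * E)) := by positivity
  nlinarith

/-- The squarefree indicator as a real arithmetic function. -/
noncomputable def sqfreeAF : ArithmeticFunction ℝ :=
  ⟨fun n => (ArithmeticFunction.moebius n : ℝ) ^ 2, by simp⟩

lemma sqfreeAF_apply (n : ℕ) : sqfreeAF n = (ArithmeticFunction.moebius n : ℝ) ^ 2 := rfl

lemma isMultiplicative_sqfreeAF : sqfreeAF.IsMultiplicative := by
  refine ⟨by simp [sqfreeAF_apply], fun {m n} h => ?_⟩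
  rw [sqfreeAF_apply, sqfreeAF_apply, sqfreeAF_apply,
    ArithmeticFunction.isMultiplicative_moebius.map_mul_of_coprime h]
  push_cast; ring

lemma sqfreeAF_prime_pow {p n : ℕ} (hp : p.Prime) :
    sqfreeAF (p ^ n) = if n ≤ 1 then 1 else 0 := by
  rcases n with _ | n
  · simp [sqfreeAF_apply]
  · rw [sqfreeAF_apply, ArithmeticFunction.moebius_apply_prime_pow hp n.succ_ne_zero]
    rcases n with _ | n <;> simp

/-- `μ²(r) r / φ(r)` restricted to `r` coprime to `a`. -/
noncomputable def coprimeWeight (a : ℕ) : ArithmeticFunction ℝ :=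
  ⟨fun r => if r.Coprime a then (ArithmeticFunction.moebius r : ℝ) ^ 2 * r / r.totient else 0,
    by simp⟩

lemma coprimeWeight_apply (a r : ℕ) : coprimeWeight a r =
    if r.Coprime a then (ArithmeticFunction.moebius r : ℝ) ^ 2 * r / r.totient else 0 := rfl

lemma isMultiplicative_coprimeWeight (a : ℕ) : (coprimeWeight a).IsMultiplicative := by
  refine ⟨by simp [coprimeWeight_apply], fun {m n} h => ?_⟩
  simp only [coprimeWeight_apply]
  rw [ArithmeticFunction.isMultiplicative_moebius.map_mul_of_coprime h, Nat.totient_mul h]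
  simp only [Nat.coprime_mul_iff_left]
  by_cases hm : m.Coprime a
  · by_cases hn : n.Coprime a
    · rw [if_pos ⟨hm, hn⟩, if_pos hm, if_pos hn, div_mul_div_comm]
      push_cast
      ring
    · rw [if_neg (fun h => hn h.2), if_neg hn, mul_zero]
  · rw [if_neg (fun h => hm h.1), if_neg hm, zero_mul]

lemma coprimeWeight_prime_pow (a : ℕ) {p n : ℕ} (hp : p.Prime) :
    coprimeWeight a (p ^ n) = if n = 0 then 1 else
      if n = 1 then (if p ∣ a then 0 else (p : ℝ) / (p - 1)) else 0 := by
  rcases n with _ | n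
  · simp [coprimeWeight_apply]
  · rw [coprimeWeight_apply, ArithmeticFunction.moebius_apply_prime_pow hp n.succ_ne_zero]
    simp only [Nat.coprime_pow_left_iff n.succ_pos, hp.coprime_iff_not_dvd]
    rcases n with _ | n
    · simp only [zero_add, pow_one, if_true, one_ne_zero, if_false, Nat.totient_prime hp,
        Nat.cast_sub hp.one_le, Nat.cast_one]
      by_cases h : p ∣ a <;> simp [h]
    · simp

/-- The multiplicative function with values `h p n` at the prime powers `p ^ n`, `n ≥ 1`. -/
noncomputable def ofPrimePow (h : ℕ → ℕ → ℝ) : ArithmeticFunction ℝ :=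
  ⟨fun d => if d = 0 then 0 else d.factorization.prod fun p n => if n = 0 then 1 else h p n,
    by simp⟩

lemma ofPrimePow_apply (h : ℕ → ℕ → ℝ) (d : ℕ) : ofPrimePow h d =
    if d = 0 then 0 else d.factorization.prod fun p n => if n = 0 then 1 else h p n := rfl

lemma isMultiplicative_ofPrimePow (h : ℕ → ℕ → ℝ) : (ofPrimePow h).IsMultiplicative := by
  rw [ArithmeticFunction.IsMultiplicative.iff_ne_zero]
  refine ⟨by simp [ofPrimePow_apply], fun {m n} hm hn hmn => ?_⟩
  simp only [ofPrimePow_apply]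
  rw [if_neg (mul_ne_zero hm hn), if_neg hm, if_neg hn, Nat.factorization_mul hm hn]
  exact Finsupp.prod_add_index_of_disjoint (by simpa using hmn.disjoint_primeFactors) _

lemma ofPrimePow_prime_pow (h : ℕ → ℕ → ℝ) {p n : ℕ} (hp : p.Prime) :
    ofPrimePow h (p ^ n) = if n = 0 then 1 else h p n := by
  rw [ofPrimePow_apply, if_neg (pow_ne_zero _ hp.ne_zero), hp.factorization_pow,
    Finsupp.prod_single_index (by simp)]

/-- The local weights of the Dirichlet quotient of `coprimeWeight a` by the squarefree indicator. -/
noncomputable def kernelWeight (a p : ℕ) : ℝ := if p ∣ a then 1 else -(1 / ((p : ℝ) - 1))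

/-- The Dirichlet quotient of `coprimeWeight a` by the squarefree indicator. -/
noncomputable def kernel (a : ℕ) : ArithmeticFunction ℝ :=
  ofPrimePow fun p n => (-1) ^ n * kernelWeight a p

lemma isMultiplicative_kernel (a : ℕ) : (kernel a).IsMultiplicative :=
  isMultiplicative_ofPrimePow _

lemma kernel_prime_pow (a : ℕ) {p n : ℕ} (hp : p.Prime) :
    kernel a (p ^ n) = if n = 0 then 1 else (-1) ^ n * kernelWeight a p :=
  ofPrimePow_prime_pow _ hp

lemma coprimeWeight_eq (a : ℕ) : coprimeWeight a = kernel a * sqfreeAF := by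
  rw [ArithmeticFunction.IsMultiplicative.eq_iff_eq_on_prime_powers _
    (isMultiplicative_coprimeWeight a) _ ((isMultiplicative_kernel a).mul isMultiplicative_sqfreeAF)]
  intro p n hp
  have hp1 : (1 : ℝ) < p := by exact_mod_cast hp.one_lt
  have hp0 : (p : ℝ) - 1 ≠ 0 := by linarith
  rw [coprimeWeight_prime_pow a hp, ArithmeticFunction.mul_apply,
    Nat.sum_divisorsAntidiagonal' (f := fun x y => kernel a x * sqfreeAF y),
    Nat.sum_divisors_prime_pow hp]
  rcases n with _ | n
  · simp [(isMultiplicative_kernel a).map_one, isMultiplicative_sqfreeAF.map_one]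
  rw [sum_range_succ', sum_range_succ', sum_eq_zero, zero_add]
  · have h1 : p ^ (n + 1) / p ^ (0 + 1) = p ^ n := by
      rw [Nat.pow_div (by omega) hp.pos]; simp
    rw [h1, pow_zero, Nat.div_one, kernel_prime_pow a hp, kernel_prime_pow a hp,
      sqfreeAF_prime_pow hp, isMultiplicative_sqfreeAF.map_one, kernelWeight]
    rcases n with _ | n
    · by_cases h : p ∣ a
      · simp [h]
      · simp only [h, if_false]
        norm_num
        field_simp
        ring
    · by_cases h : p ∣ a <;> simp [h, pow_succ]
  · intro i hi
    rw [sqfreeAF_prime_pow hp, if_neg (by omega), mul_zero]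

lemma abs_kernelWeight_le {a p : ℕ} (hp : p.Prime) :
    |kernelWeight a p| ≤ if p ∣ a then 1 else 2 / (p : ℝ) := by
  have hp2 : (2 : ℝ) ≤ p := by exact_mod_cast hp.two_le
  unfold kernelWeight
  split_ifs
  · simp
  · rw [abs_neg, abs_of_nonneg (div_nonneg zero_le_one (by linarith)),
      div_le_div_iff₀ (by linarith) (by linarith)]
    linarith

/-- The factor `∏_{p ∣ a} (1 + p^{-1/3})` in the error terms. -/
noncomputable def primeFactor (a : ℕ) : ℝ := ∏ p ∈ a.primeFactors, (1 + (p : ℝ) ^ (-(1 : ℝ) / 3))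

lemma one_le_primeFactor (a : ℕ) : 1 ≤ primeFactor a :=
  Finset.one_le_prod fun p _ => le_add_of_nonneg_right (by positivity)

lemma rpow_prime_le {p : ℕ} (hp : p.Prime) : (p : ℝ) ^ (-(9 / 20) : ℝ) ≤ 3 / 4 := by
  have hp2 : (2 : ℝ) ≤ p := by exact_mod_cast hp.two_le
  have h1 : (p : ℝ) ^ (-(9 / 20) : ℝ) ≤ (2 : ℝ) ^ (-(9 / 20) : ℝ) :=
    Real.rpow_le_rpow_of_nonpos (by norm_num) hp2 (by norm_num)
  refine h1.trans ?_
  rw [← pow_le_pow_iff_left₀ (by positivity) (by norm_num) (n := 20) (by norm_num),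
    ← Real.rpow_mul_natCast (by norm_num),
    show (-(9 / 20) : ℝ) * (20 : ℕ) = ((-9 : ℤ) : ℝ) by norm_num, Real.rpow_intCast]
  norm_num

lemma kernel_local_le {a p : ℕ} (hp : p.Prime) :
    1 + 4 * |kernelWeight a p| * (p : ℝ) ^ (-(9 / 20) : ℝ) ≤
      (if p ∣ a then 1 + (p : ℝ) ^ (-(1 : ℝ) / 3) else 1) *
        (1 + 4 ^ 10 * (p : ℝ) ^ (-(29 / 20) : ℝ)) := by
  have hp0 : (0 : ℝ) < p := by exact_mod_cast hp.pos
  have hx : (p : ℝ) ^ (-(9 / 20) : ℝ) = p * (p : ℝ) ^ (-(29 / 20) : ℝ) := by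
    rw [← Real.rpow_one_add' hp0.le (by norm_num)]; norm_num
  have hy : 0 < (p : ℝ) ^ (-(29 / 20) : ℝ) := by positivity
  have hw := abs_kernelWeight_le (a := a) hp
  by_cases h : p ∣ a
  · rw [if_pos h] at hw ⊢
    have hz : 0 < (p : ℝ) ^ (-(1 : ℝ) / 3) := by positivity
    have key : 4 * (p : ℝ) ^ (-(9 / 20) : ℝ) ≤
        (p : ℝ) ^ (-(1 : ℝ) / 3) + 4 ^ 10 * (p : ℝ) ^ (-(29 / 20) : ℝ) := by
      rcases le_total (p : ℝ) (4 ^ 9) with hp9 | hp9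
      · rw [hx]; nlinarith
      · have h4 : (4 : ℝ) ≤ (p : ℝ) ^ (7 / 60 : ℝ) := by
          calc (4 : ℝ) = 4 ^ (1 : ℝ) := (Real.rpow_one _).symm
            _ ≤ 4 ^ ((9 : ℕ) * (7 / 60) : ℝ) :=
                Real.rpow_le_rpow_of_exponent_le (by norm_num) (by norm_num)
            _ = ((4 : ℝ) ^ 9) ^ (7 / 60 : ℝ) := by
                rw [Real.rpow_natCast_mul (by norm_num)]
            _ ≤ _ := Real.rpow_le_rpow (by norm_num) hp9 (by norm_num)
        have e : (p : ℝ) ^ (-(1 : ℝ) / 3) =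
            (p : ℝ) ^ (7 / 60 : ℝ) * (p : ℝ) ^ (-(9 / 20) : ℝ) := by
          rw [← Real.rpow_add hp0]; norm_num
        have hx0 : 0 < (p : ℝ) ^ (-(9 / 20) : ℝ) := by positivity
        rw [e]; nlinarith
    have h1 : |kernelWeight a p| * (p : ℝ) ^ (-(9 / 20) : ℝ) ≤ 1 * (p : ℝ) ^ (-(9 / 20) : ℝ) :=
      mul_le_mul_of_nonneg_right hw (by positivity)
    nlinarith [mul_pos hz hy]
  · rw [if_neg h] at hw ⊢
    rw [one_mul, hx]
    have h1 : |kernelWeight a p| * p ≤ 2 := by rwa [le_div_iff₀ hp0] at hw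
    nlinarith

/-- `|kernel a d| d^{-9/20}`. -/
noncomputable def kernelAbs (a d : ℕ) : ℝ := |kernel a d| * (d : ℝ) ^ (-(9 / 20) : ℝ)

lemma kernelAbs_prime_pow (a : ℕ) {p n : ℕ} (hp : p.Prime) : kernelAbs a (p ^ n) =
    if n = 0 then 1 else |kernelWeight a p| * ((p : ℝ) ^ (-(9 / 20) : ℝ)) ^ n := by
  have hp0 : (0 : ℝ) < p := by exact_mod_cast hp.pos
  rw [kernelAbs, kernel_prime_pow a hp]
  split_ifs with h
  · simp [h]
  · rw [abs_mul, abs_pow, abs_neg, abs_one, one_pow, one_mul, Nat.cast_pow, ← Real.rpow_natCast,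
      ← Real.rpow_natCast, ← Real.rpow_mul hp0.le, ← Real.rpow_mul hp0.le, mul_comm (n : ℝ)]

lemma hasSum_prime_pow {x w : ℝ} (hx : |x| < 1) {f : ℕ → ℝ}
    (hf : ∀ n, f n = if n = 0 then 1 else w * x ^ n) : HasSum f (1 + w * (x / (1 - x))) := by
  rw [← hasSum_nat_add_iff' 1, sum_range_one, hf 0, if_pos rfl, add_sub_cancel_left, div_eq_mul_inv,
    ← mul_assoc]
  refine ((hasSum_geometric_of_abs_lt_one hx).mul_left (w * x)).congr_fun fun n => ?_
  rw [hf, if_neg n.succ_ne_zero, pow_succ]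
  ring

lemma hasSum_kernelAbs_prime_pow (a : ℕ) {p : ℕ} (hp : p.Prime) :
    HasSum (fun n => kernelAbs a (p ^ n)) (1 + |kernelWeight a p| *
      ((p : ℝ) ^ (-(9 / 20) : ℝ) / (1 - (p : ℝ) ^ (-(9 / 20) : ℝ)))) := by
  refine hasSum_prime_pow ?_ fun n => kernelAbs_prime_pow a hp
  rw [abs_of_nonneg (by positivity)]
  linarith [rpow_prime_le hp]

lemma kernelAbs_nonneg (a d : ℕ) : 0 ≤ kernelAbs a d := by unfold kernelAbs; positivity

lemma exists_sum_kernelAbs_le : ∃ B : ℝ, 0 < B ∧ ∀ a : ℕ, a ≠ 0 →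
    Summable (kernelAbs a) ∧ ∑' d, kernelAbs a d ≤ B * primeFactor a := by
  have hs : Summable fun n : ℕ => (4 : ℝ) ^ 10 * (n : ℝ) ^ (-(29 / 20) : ℝ) :=
    (Real.summable_nat_rpow.2 (by norm_num)).mul_left _
  refine ⟨Real.exp (∑' n : ℕ, (4 : ℝ) ^ 10 * (n : ℝ) ^ (-(29 / 20) : ℝ)), Real.exp_pos _,
    fun a ha => ?_⟩
  set S := ∑' n : ℕ, (4 : ℝ) ^ 10 * (n : ℝ) ^ (-(29 / 20) : ℝ) with hS
  have hprod : ∀ N : ℕ, ∏ p ∈ N.primesBelow, ∑' n, kernelAbs a (p ^ n) ≤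
      Real.exp S * primeFactor a := by
    intro N
    have h1 : ∏ p ∈ N.primesBelow, ∑' n, kernelAbs a (p ^ n) ≤
        ∏ p ∈ N.primesBelow, ((if p ∣ a then 1 + (p : ℝ) ^ (-(1 : ℝ) / 3) else 1) *
        Real.exp (4 ^ 10 * (p : ℝ) ^ (-(29 / 20) : ℝ))) := by
      refine prod_le_prod (fun p _ => tsum_nonneg fun n => kernelAbs_nonneg _ _) fun p hp => ?_
      have hpp := Nat.prime_of_mem_primesBelow hp
      rw [(hasSum_kernelAbs_prime_pow a hpp).tsum_eq]
      have hx := rpow_prime_le hpp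
      have hx0 : 0 ≤ (p : ℝ) ^ (-(9 / 20) : ℝ) := by positivity
      have h2 : (p : ℝ) ^ (-(9 / 20) : ℝ) / (1 - (p : ℝ) ^ (-(9 / 20) : ℝ)) ≤
          4 * (p : ℝ) ^ (-(9 / 20) : ℝ) := by
        rw [div_le_iff₀ (by linarith)]; nlinarith
      have h3 := mul_le_mul_of_nonneg_left h2 (abs_nonneg (kernelWeight a p))
      have h4 := kernel_local_le (a := a) hpp
      have h5 : 1 + 4 ^ 10 * (p : ℝ) ^ (-(29 / 20) : ℝ) ≤
          Real.exp (4 ^ 10 * (p : ℝ) ^ (-(29 / 20) : ℝ)) := by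
        rw [add_comm]; exact Real.add_one_le_exp _
      have h6 : (0 : ℝ) ≤ if p ∣ a then 1 + (p : ℝ) ^ (-(1 : ℝ) / 3) else 1 := by
        split_ifs <;> positivity
      have h7 := mul_le_mul_of_nonneg_left h5 h6
      linarith
    rw [prod_mul_distrib, ← Real.exp_sum, mul_comm] at h1
    refine h1.trans (mul_le_mul (Real.exp_le_exp.2 (hs.sum_le_tsum _ fun n _ => by positivity)) ?_
      (prod_nonneg fun p _ => by split_ifs <;> positivity) (Real.exp_pos _).le)
    rw [← prod_filter]
    refine prod_le_prod_of_subset_of_one_le (fun p hp => ?_) (fun p _ => by positivity) fun p _ _ => ?_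
    · rw [mem_filter] at hp
      exact Nat.mem_primeFactors.2 ⟨Nat.prime_of_mem_primesBelow hp.1, hp.2, ha⟩
    · have : (0 : ℝ) ≤ (p : ℝ) ^ (-(1 : ℝ) / 3) := by positivity
      linarith
  have hfin : ∀ u : Finset ℕ, ∑ d ∈ u, kernelAbs a d ≤ Real.exp S * primeFactor a := by
    intro u
    refine le_trans ?_ (hprod (u.sup id + 1))
    obtain ⟨hs1, hs2⟩ := EulerProduct.summable_and_hasSum_smoothNumbers_prod_primesBelow_tsum
      (f := kernelAbs a) (by simp [kernelAbs, (isMultiplicative_kernel a).map_one])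
      (fun {m n} h => by
        rw [kernelAbs, (isMultiplicative_kernel a).map_mul_of_coprime h, abs_mul, Nat.cast_mul,
          Real.mul_rpow (by positivity) (by positivity), kernelAbs, kernelAbs]; ring)
      (fun {p} hp => (hasSum_kernelAbs_prime_pow a hp).summable.norm) (u.sup id + 1)
    have hz : kernelAbs a 0 = 0 := by simp [kernelAbs]
    rw [← hs2.tsum_eq, ← sum_erase u hz]
    have hmem : ∀ d ∈ u.erase 0, d ∈ (u.sup id + 1).smoothNumbers := fun d hd => by
      rw [mem_erase] at hd
      exact Nat.mem_smoothNumbers_of_lt (Nat.pos_of_ne_zero hd.1)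
        (Nat.lt_succ_of_le (le_sup (f := id) hd.2))
    rw [← sum_attach]
    have := hs2.summable.sum_le_tsum ((u.erase 0).attach.map
      ⟨fun d => (⟨d.1, hmem d.1 d.2⟩ : (u.sup id + 1).smoothNumbers),
        fun x y h => Subtype.ext (by simpa using h)⟩)
      (fun d _ => kernelAbs_nonneg a d)
    rwa [sum_map] at this
  have hsum := summable_of_sum_le (fun d => kernelAbs_nonneg a d) hfin
  exact ⟨hsum, hsum.tsum_le_of_sum_le hfin⟩

@[to_additive]
lemma hasProd_primes_dvd {M : Type*} [CommMonoid M] [TopologicalSpace M] (x : ℕ → M) {a : ℕ}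
    (ha : a ≠ 0) :
    HasProd (fun p : Nat.Primes => if (p : ℕ) ∣ a then x p else 1) (∏ p ∈ a.primeFactors, x p) := by
  have h : HasProd (fun p : Nat.Primes => if (p : ℕ) ∣ a then x p else 1)
      (∏ p ∈ (a.primeFactors.subtype Nat.Prime : Finset Nat.Primes),
        if (p : ℕ) ∣ a then x p else 1) :=
    hasProd_prod_of_ne_finset_one fun p hp => if_neg fun hd => hp <| by
      exact Finset.mem_subtype.2 (Nat.mem_primeFactors.2 ⟨p.2, hd, ha⟩)
  convert h using 1
  rw [← Finset.prod_subtype_of_mem x (p := Nat.Prime) fun p hp => Nat.prime_of_mem_primeFactors hp]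
  refine prod_congr rfl fun p hp => ?_
  rw [if_pos (Nat.dvd_of_mem_primeFactors (Finset.mem_subtype.1 hp))]

/-- `∑ n^{-s}` for an integer `s`. -/
noncomputable def zetaSum (s : ℕ) : ℝ := ∑' n : ℕ, 1 / (n : ℝ) ^ s

lemma zetaSum_pos {s : ℕ} (hs : 2 ≤ s) : 0 < zetaSum s :=
  (Real.summable_one_div_nat_pow.2 hs).tsum_pos (fun n => by positivity) 1 (by norm_num)

lemma riemannZeta_eq_zetaSum {s : ℕ} (hs : 2 ≤ s) : riemannZeta s = (zetaSum s : ℂ) := by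
  rw [zeta_nat_eq_tsum_of_gt_one hs, zetaSum, Complex.ofReal_tsum]
  push_cast; rfl

lemma hasProd_zetaSum {s : ℕ} (hs : 2 ≤ s) :
    HasProd (fun p : Nat.Primes => (1 - 1 / ((p : ℕ) : ℝ) ^ s)⁻¹) (zetaSum s) := by
  let f : ℕ →*₀ ℝ :=
    { toFun := fun n => 1 / (n : ℝ) ^ s
      map_zero' := by rw [Nat.cast_zero, zero_pow (by omega), div_zero]
      map_one' := by simp
      map_mul' := fun m n => by push_cast; rw [mul_pow, div_mul_div_comm, one_mul] }
  exact EulerProduct.eulerProduct_completely_multiplicative_hasProd (f := f)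
    (Real.summable_one_div_nat_pow.2 hs).norm

lemma summable_abs_kernel_div {a : ℕ} (ha : a ≠ 0) : Summable fun d : ℕ => |kernel a d| / (d : ℝ) := by
  obtain ⟨B, -, hB⟩ := exists_sum_kernelAbs_le
  refine Summable.of_nonneg_of_le (fun d => by positivity) (fun d => ?_) (hB a ha).1
  rcases Nat.eq_zero_or_pos d with rfl | hd
  · simp [kernelAbs]
  · rw [kernelAbs, div_eq_mul_inv, ← Real.rpow_neg_one]
    exact mul_le_mul_of_nonneg_left
      (Real.rpow_le_rpow_of_exponent_le (by exact_mod_cast hd) (by norm_num)) (abs_nonneg _)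

lemma totient_div_eq (a : ℕ) (ha : a ≠ 0) :
    (a.totient : ℝ) / a = ∏ p ∈ a.primeFactors, (1 - (p : ℝ)⁻¹) := by
  have h := congrArg (fun q : ℚ => (q : ℝ)) (Nat.totient_eq_mul_prod_factors a)
  push_cast at h
  have : (a : ℝ) ≠ 0 := by exact_mod_cast ha
  rw [h, mul_div_cancel_left₀ _ this]

lemma hasSum_kernel_div {a : ℕ} (ha : a ≠ 0) :
    HasSum (fun d : ℕ => kernel a d / (d : ℝ)) (π ^ 2 / 6 * ((a.totient : ℝ) / a)) := by
  have hs : Summable fun d : ℕ => kernel a d / (d : ℝ) := by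
    refine Summable.of_norm ((summable_abs_kernel_div ha).congr fun d => ?_)
    rw [Real.norm_eq_abs, abs_div, Nat.abs_cast]
  have h := EulerProduct.eulerProduct_hasProd (f := fun d : ℕ => kernel a d / (d : ℝ))
    (by simp [(isMultiplicative_kernel a).map_one])
    (fun {m n} h => by
      rw [(isMultiplicative_kernel a).map_mul_of_coprime h, Nat.cast_mul, mul_div_mul_comm])
    hs.norm (by simp)
  have h2 := (hasProd_zetaSum le_rfl).mul (hasProd_primes_dvd (fun p => 1 - (p : ℝ)⁻¹) ha)
  have hz : zetaSum 2 = π ^ 2 / 6 := hasSum_zeta_two.tsum_eq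
  rw [← totient_div_eq a ha, hz] at h2
  have e : ∑' d : ℕ, kernel a d / (d : ℝ) = π ^ 2 / 6 * ((a.totient : ℝ) / a) := by
    refine (h.congr_fun fun p => ?_).unique h2
    have hp := p.2
    have hp1 : (1 : ℝ) < (p : ℕ) := by exact_mod_cast hp.one_lt
    generalize (p : ℕ) = q at *
    have hq0 : (q : ℝ) ≠ 0 := by linarith
    have hq1 : (q : ℝ) - 1 ≠ 0 := by linarith
    have hq2 : (q : ℝ) + 1 ≠ 0 := by linarith
    have hq3 : (q : ℝ) ^ 2 - 1 ≠ 0 := by nlinarith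
    have hx : |-(1 / (q : ℝ))| < 1 := by
      rw [abs_neg, abs_of_pos (by positivity), div_lt_one (by linarith)]; exact hp1
    rw [(hasSum_prime_pow (w := kernelWeight a q) hx fun n => ?_).tsum_eq, kernelWeight]
    · have e1 : -(1 / (q : ℝ)) / (1 - -(1 / (q : ℝ))) = -(1 / (q + 1)) := by
        field_simp
        ring
      have e2 : (1 - 1 / (q : ℝ) ^ 2)⁻¹ = (q : ℝ) ^ 2 / ((q - 1) * (q + 1)) := by
        rw [show 1 - 1 / (q : ℝ) ^ 2 = ((q - 1) * (q + 1)) / q ^ 2 by field_simp; ring, inv_div]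
      rw [e1, e2]
      split_ifs
      · field_simp
        ring
      · field_simp
        ring
    · rw [kernel_prime_pow a hp]
      split_ifs with hn
      · simp [hn]
      · rw [neg_pow (1 / (q : ℝ)), Nat.cast_pow, one_div, inv_pow]; ring
  rw [← e]
  exact hs.hasSum

/-- `μ²(r)/(r φ(r))` restricted to `r` coprime to `a`. -/
noncomputable def coprimeTerm (a r : ℕ) : ℝ :=
  if r.Coprime a then (ArithmeticFunction.moebius r : ℝ) ^ 2 / (r * r.totient) else 0

lemma coprimeTerm_eq (a r : ℕ) : coprimeTerm a r = coprimeWeight a r / (r : ℝ) ^ 2 := by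
  rw [coprimeTerm, coprimeWeight_apply]
  rcases Nat.eq_zero_or_pos r with rfl | hr
  · simp
  · have : (r : ℝ) ≠ 0 := by exact_mod_cast hr.ne'
    split_ifs
    · field_simp
    · simp

lemma coprimeTerm_nonneg (a r : ℕ) : 0 ≤ coprimeTerm a r := by
  unfold coprimeTerm; split_ifs <;> positivity

/-- `∑_{r > R} μ²(r)/(r φ(r))` over `r` coprime to `a`. -/
noncomputable def coprimeTail (a : ℕ) (R : ℝ) : ℝ := ∑' r : ℕ, if R < r then coprimeTerm a r else 0

lemma hasSum_fiber_mul {f : ℕ × ℕ → ℝ} (hf : Summable f) (h0 : ∀ p : ℕ × ℕ, p.1 * p.2 = 0 → f p = 0) :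
    HasSum (fun n : ℕ => ∑ p ∈ n.divisorsAntidiagonal, f p) (∑' p, f p) := by
  have h := hf.hasSum.tsum_fiberwise (fun p : ℕ × ℕ => p.1 * p.2)
  refine h.congr_fun fun n => ?_
  by_cases hn : n = 0
  · subst hn
    rw [Nat.divisorsAntidiagonal_zero, sum_empty]
    exact ((tsum_congr fun p : (fun p : ℕ × ℕ => p.1 * p.2) ⁻¹' {0} => h0 p.1 p.2).trans tsum_zero).symm
  · have : (fun p : ℕ × ℕ => p.1 * p.2) ⁻¹' {n} = (n.divisorsAntidiagonal : Set (ℕ × ℕ)) := by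
      ext p; simp [Nat.mem_divisorsAntidiagonal, hn]
    rw [this]
    exact (Finset.tsum_subtype n.divisorsAntidiagonal f).symm

lemma hasSum_coprimeTail {a : ℕ} (ha : a ≠ 0) {R : ℝ} :
    HasSum (fun d : ℕ => kernel a d / (d : ℝ) ^ 2 * sqfreeTail (R / d)) (coprimeTail a R) ∧
    Summable (coprimeTerm a) := by
  have hk : Summable fun d : ℕ => |kernel a d| / (d : ℝ) ^ 2 := by
    refine Summable.of_nonneg_of_le (fun d => by positivity) (fun d => ?_)
      (summable_abs_kernel_div ha)
    rcases Nat.eq_zero_or_pos d with rfl | hd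
    · simp
    · have : (1 : ℝ) ≤ d := by exact_mod_cast hd
      exact div_le_div_of_nonneg_left (abs_nonneg _) (by linarith) (by nlinarith)
  have hz : Summable fun e : ℕ => 1 / (e : ℝ) ^ 2 := hasSum_zeta_two.summable
  have hbd := hk.mul_of_nonneg hz (fun d => by positivity) (fun d => by positivity)
  have key : ∀ P : ℕ → Prop, [DecidablePred P] → Summable fun p : ℕ × ℕ =>
      (kernel a p.1 / (p.1 : ℝ) ^ 2 * (if P (p.1 * p.2) then
        (ArithmeticFunction.moebius p.2 : ℝ) ^ 2 / (p.2 : ℝ) ^ 2 else 0)) := by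
    intro P _
    refine Summable.of_norm_bounded hbd fun p => ?_
    rw [norm_mul, norm_div, Real.norm_eq_abs, Real.norm_of_nonneg (by positivity : 0 ≤ (p.1 : ℝ) ^ 2)]
    refine mul_le_mul_of_nonneg_left ?_ (by positivity)
    split_ifs
    · rw [Real.norm_of_nonneg (by positivity)]
      refine div_le_div_of_nonneg_right ?_ (by positivity)
      rw [← sq_abs]
      exact pow_le_one₀ (abs_nonneg _) (abs_moebius_le _)
    · rw [norm_zero]; positivity
  have conv : ∀ P : ℕ → Prop, [DecidablePred P] → HasSum
      (fun r : ℕ => if P r then coprimeTerm a r else 0) (∑' p : ℕ × ℕ,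
      (kernel a p.1 / (p.1 : ℝ) ^ 2 * (if P (p.1 * p.2) then
        (ArithmeticFunction.moebius p.2 : ℝ) ^ 2 / (p.2 : ℝ) ^ 2 else 0))) := by
    intro P _
    refine (hasSum_fiber_mul (key P) fun p hp => ?_).congr_fun fun n => ?_
    · rcases mul_eq_zero.1 hp with h | h <;> simp [h]
    · rw [coprimeTerm_eq, coprimeWeight_eq, ArithmeticFunction.mul_apply]
      have : ∀ p ∈ n.divisorsAntidiagonal, (kernel a p.1 / (p.1 : ℝ) ^ 2 * (if P (p.1 * p.2) then
          (ArithmeticFunction.moebius p.2 : ℝ) ^ 2 / (p.2 : ℝ) ^ 2 else 0)) =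
          if P n then kernel a p.1 * sqfreeAF p.2 / (n : ℝ) ^ 2 else 0 := by
        intro p hp
        rw [(Nat.mem_divisorsAntidiagonal.1 hp).1, ← (Nat.mem_divisorsAntidiagonal.1 hp).1,
          Nat.cast_mul, mul_pow, sqfreeAF_apply]
        split_ifs
        · rw [div_mul_div_comm]
        · rw [mul_zero]
      rw [sum_congr rfl this]
      split_ifs
      · rw [sum_div]
      · simp
  constructor
  · have h1 := conv (fun n => R < n)
    rw [coprimeTail, h1.tsum_eq]
    refine ((key fun n => R < n).hasSum.prod_fiberwise fun d => ((key fun n => R < n).prod_factor d).hasSum).congr_fun fun d => ?_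
    dsimp only
    rw [tsum_mul_left, sqfreeTail]
    rcases Nat.eq_zero_or_pos d with rfl | hd
    · simp
    · have hd' : (0 : ℝ) < d := by exact_mod_cast hd
      congr 1
      refine tsum_congr fun e => ?_
      have : R < ((d * e : ℕ) : ℝ) ↔ R / d < e := by
        rw [div_lt_iff₀ hd']; push_cast; rw [mul_comm]
      simp only [this]
  · simpa using (conv (fun _ => True)).summable

theorem exists_coprimeTail_bound : ∃ c C : ℝ, 0 < c ∧ 0 < C ∧ ∀ a : ℕ, a ≠ 0 → ∀ R : ℝ, 0 < R →
    |coprimeTail a R - (a.totient : ℝ) / a / R| ≤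
      C * primeFactor a * (R ^ (-(3 / 2) : ℝ) * vkEps c R) := by
  obtain ⟨c, C, hc, hc2, hC, H⟩ := exists_sqfreeTail_bound
  obtain ⟨B, hB0, hB⟩ := exists_sum_kernelAbs_le
  refine ⟨c, C * B, hc, by positivity, fun a ha R hR => ?_⟩
  obtain ⟨hs, hle⟩ := hB a ha
  set M := C * (R ^ (-(3 / 2) : ℝ) * vkEps c R) with hM
  have hM0 : 0 ≤ M := by have := vkEps_pos c R; positivity
  have h1 := (hasSum_kernel_div ha).mul_left (6 / π ^ 2 / R)
  have h2 := (hasSum_coprimeTail ha (R := R)).1.sub h1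
  have e : 6 / π ^ 2 / R * (π ^ 2 / 6 * ((a.totient : ℝ) / a)) = (a.totient : ℝ) / a / R := by
    have := Real.pi_pos.ne'
    have ha' : (a : ℝ) ≠ 0 := by exact_mod_cast ha
    field_simp
  rw [e] at h2
  rw [← h2.tsum_eq, ← Real.norm_eq_abs]
  refine (tsum_of_norm_bounded (hs.mul_left M).hasSum fun d => ?_).trans ?_
  · rcases Nat.eq_zero_or_pos d with rfl | hd
    · simp [kernelAbs]
    have hd1 : (1 : ℝ) ≤ d := by exact_mod_cast hd
    have hd0 : (0 : ℝ) < d := by linarith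
    have e1 : kernel a d / (d : ℝ) ^ 2 * sqfreeTail (R / d) - 6 / π ^ 2 / R * (kernel a d / d) =
        kernel a d / (d : ℝ) ^ 2 * (sqfreeTail (R / d) - 6 / π ^ 2 / (R / d)) := by
      have := Real.pi_pos.ne'
      field_simp
    rw [e1, Real.norm_eq_abs, abs_mul, abs_div,
      abs_of_nonneg (by positivity : 0 ≤ (d : ℝ) ^ 2), kernelAbs]
    have h3 := H (R / d) (by positivity)
    have h4 : vkEps c (R / d) ≤ (d : ℝ) ^ (1 / 20 : ℝ) * vkEps c R :=
      (vkEps_div_le hc.le hR hd1).trans (mul_le_mul_of_nonneg_right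
        (Real.rpow_le_rpow_of_exponent_le hd1 (by linarith)) (vkEps_pos _ _).le)
    have h5 : (R / d) ^ (-(3 / 2) : ℝ) = R ^ (-(3 / 2) : ℝ) * (d : ℝ) ^ (3 / 2 : ℝ) := by
      rw [Real.div_rpow hR.le hd0.le, Real.rpow_neg hd0.le, div_inv_eq_mul]
    have h6 : |sqfreeTail (R / d) - 6 / π ^ 2 / (R / d)| ≤
        M * ((d : ℝ) ^ (3 / 2 : ℝ) * (d : ℝ) ^ (1 / 20 : ℝ)) := by
      calc _ ≤ C * (R / d) ^ (-(3 / 2) : ℝ) * ((d : ℝ) ^ (1 / 20 : ℝ) * vkEps c R) :=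
            h3.trans (mul_le_mul_of_nonneg_left h4 (by positivity))
        _ = _ := by rw [h5, hM]; ring
    calc _ ≤ |kernel a d| / (d : ℝ) ^ 2 * (M * ((d : ℝ) ^ (3 / 2 : ℝ) * (d : ℝ) ^ (1 / 20 : ℝ))) :=
          mul_le_mul_of_nonneg_left h6 (by positivity)
      _ = M * (|kernel a d| * ((d : ℝ) ^ (3 / 2 : ℝ) * (d : ℝ) ^ (1 / 20 : ℝ) / (d : ℝ) ^ (2 : ℝ))) := by
          rw [Real.rpow_two]; ring
      _ = _ := by
          rw [← Real.rpow_add hd0, ← Real.rpow_sub hd0]; norm_num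
  · rw [tsum_mul_left]
    calc _ ≤ M * (B * primeFactor a) := mul_le_mul_of_nonneg_left hle hM0
      _ = _ := by rw [hM]; ring

/-- `∑ μ²(r)/(r φ(r))` over `r` coprime to `a`. -/
noncomputable def coprimeSum (a : ℕ) : ℝ := ∑' r, coprimeTerm a r

lemma summable_coprimeTerm {a : ℕ} (ha : a ≠ 0) : Summable (coprimeTerm a) :=
  (hasSum_coprimeTail ha (R := 0)).2

lemma tsum_coprimeTerm_prime_pow (a : ℕ) {p : ℕ} (hp : p.Prime) :
    ∑' n, coprimeTerm a (p ^ n) = 1 + if p ∣ a then 0 else 1 / ((p : ℝ) * (p - 1)) := by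
  have hp1 : (1 : ℝ) < p := by exact_mod_cast hp.one_lt
  have hp0 : (p : ℝ) - 1 ≠ 0 := by linarith
  rw [tsum_eq_sum (s := range 2)]
  · rw [sum_range_succ, sum_range_one, coprimeTerm_eq, coprimeTerm_eq,
      coprimeWeight_prime_pow a hp, coprimeWeight_prime_pow a hp]
    simp only [if_true, one_ne_zero, if_false, pow_zero, pow_one, Nat.cast_one, one_pow, div_one]
    split_ifs
    · simp
    · field_simp
  · intro n hn
    rw [mem_range] at hn
    rw [coprimeTerm_eq, coprimeWeight_prime_pow a hp, if_neg (by omega), if_neg (by omega), zero_div]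

lemma coprimeSum_mul_zetaSum {a : ℕ} (ha : a ≠ 0) : coprimeSum a * zetaSum 6 =
    zetaSum 2 * zetaSum 3 * ∏ p ∈ a.primeFactors, (1 - 1 / ((p : ℝ) ^ 2 - p + 1)) := by
  have h := EulerProduct.eulerProduct_hasProd (f := coprimeTerm a)
    (by rw [coprimeTerm_eq]; simp [(isMultiplicative_coprimeWeight a).map_one])
    (fun {m n} h => by
      rw [coprimeTerm_eq, coprimeTerm_eq, coprimeTerm_eq,
        (isMultiplicative_coprimeWeight a).map_mul_of_coprime h, Nat.cast_mul, mul_pow,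
        mul_div_mul_comm])
    (summable_coprimeTerm ha).norm (by rw [coprimeTerm_eq]; simp)
  have h6 := h.mul (hasProd_zetaSum (s := 6) (by norm_num))
  have h23 := ((hasProd_zetaSum le_rfl).mul (hasProd_zetaSum (s := 3) (by norm_num))).mul
    (hasProd_primes_dvd (fun p => 1 - 1 / ((p : ℝ) ^ 2 - p + 1)) ha)
  refine (h6.congr_fun fun p => ?_).unique h23
  have hp := p.2
  have hp1 : (1 : ℝ) < (p : ℕ) := by exact_mod_cast hp.one_lt
  rw [tsum_coprimeTerm_prime_pow a hp]
  generalize (p : ℕ) = q at *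
  have h0 : (q : ℝ) ≠ 0 := by linarith
  have h1 : (q : ℝ) - 1 ≠ 0 := by linarith
  have h2 : (q : ℝ) + 1 ≠ 0 := by linarith
  have h3 : (q : ℝ) ^ 2 - q + 1 ≠ 0 := by nlinarith
  have h4 : (q : ℝ) ^ 2 + q + 1 ≠ 0 := by nlinarith
  have h5 : (q : ℝ) * (q - 1) + 1 ≠ 0 := by nlinarith
  have e2 : (1 - 1 / (q : ℝ) ^ 2)⁻¹ = (q : ℝ) ^ 2 / ((q - 1) * (q + 1)) := by
    rw [show 1 - 1 / (q : ℝ) ^ 2 = ((q - 1) * (q + 1)) / q ^ 2 by field_simp; ring, inv_div]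
  have e3 : (1 - 1 / (q : ℝ) ^ 3)⁻¹ = (q : ℝ) ^ 3 / ((q - 1) * (q ^ 2 + q + 1)) := by
    rw [show 1 - 1 / (q : ℝ) ^ 3 = ((q - 1) * (q ^ 2 + q + 1)) / q ^ 3 by field_simp; ring, inv_div]
  have e6 : (1 - 1 / (q : ℝ) ^ 6)⁻¹ =
      (q : ℝ) ^ 6 / ((q - 1) * (q + 1) * (q ^ 2 + q + 1) * (q ^ 2 - q + 1)) := by
    rw [show 1 - 1 / (q : ℝ) ^ 6 = ((q - 1) * (q + 1) * (q ^ 2 + q + 1) * (q ^ 2 - q + 1)) / q ^ 6 by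
      field_simp; ring, inv_div]
  rw [e2, e3, e6]
  split_ifs
  · field_simp
    ring
  · field_simp

lemma coprimeSum_mul_prime {a p : ℕ} (ha : a ≠ 0) (hp : p.Prime) : coprimeSum (a * p) =
    if p ∣ a then coprimeSum a else coprimeSum a * (1 - 1 / ((p : ℝ) ^ 2 - p + 1)) := by
  have h1 := coprimeSum_mul_zetaSum ha
  have h2 := coprimeSum_mul_zetaSum (mul_ne_zero ha hp.ne_zero)
  have hz : zetaSum 6 ≠ 0 := (zetaSum_pos (by norm_num)).ne'
  rw [← mul_left_inj' hz]
  rw [Nat.primeFactors_mul ha hp.ne_zero, hp.primeFactors] at h2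
  split_ifs with h
  · have : a.primeFactors ∪ {p} = a.primeFactors := by
      rw [union_eq_left, singleton_subset_iff]
      exact Nat.mem_primeFactors.2 ⟨hp, h, ha⟩
    rw [h2, h1, this]
  · rw [prod_union (disjoint_singleton_right.2 fun hm => h (Nat.dvd_of_mem_primeFactors hm)),
      prod_singleton] at h2
    rw [h2]
    linear_combination (-(1 - 1 / ((p : ℝ) ^ 2 - p + 1))) * h1

lemma hasSum_dvd_coprimeTerm {a p : ℕ} (ha : a ≠ 0) (hp : p.Prime) :
    HasSum (fun r => if p ∣ r then Real.log p * coprimeTerm a r else 0)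
      (if p ∣ a then 0 else coprimeSum a * (Real.log p / ((p : ℝ) ^ 2 - p + 1))) := by
  have h := ((summable_coprimeTerm ha).hasSum.sub
    (summable_coprimeTerm (mul_ne_zero ha hp.ne_zero)).hasSum).mul_left (Real.log p)
  have e1 : ∀ r, (if p ∣ r then Real.log p * coprimeTerm a r else 0) =
      Real.log p * (coprimeTerm a r - coprimeTerm (a * p) r) := by
    intro r
    have h0 : r.Coprime p ↔ ¬ p ∣ r := Nat.coprime_comm.trans hp.coprime_iff_not_dvd
    simp only [coprimeTerm, Nat.coprime_mul_iff_right, h0]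
    by_cases h1 : p ∣ r <;> by_cases h2 : r.Coprime a <;> simp [h1, h2]
  have e2 : (if p ∣ a then 0 else coprimeSum a * (Real.log p / ((p : ℝ) ^ 2 - p + 1))) =
      Real.log p * (coprimeSum a - coprimeSum (a * p)) := by
    rw [coprimeSum_mul_prime ha hp]
    split_ifs <;> ring
  rw [funext e1, e2]
  exact h

lemma summable_log_div : Summable fun n : ℕ => Real.log n / ((n : ℝ) ^ 2 - n + 1) := by
  have hs : Summable fun n : ℕ => 4 * (n : ℝ) ^ (-(3 / 2) : ℝ) :=
    (Real.summable_nat_rpow.2 (by norm_num)).mul_left _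
  refine Summable.of_nonneg_of_le (fun n => ?_) (fun n => ?_) hs
  · exact div_nonneg (Real.log_natCast_nonneg n) (by nlinarith [sq_nonneg ((n : ℝ) - 1 / 2)])
  · rcases Nat.eq_zero_or_pos n with rfl | hn
    · simp
    have hn0 : (0 : ℝ) < n := by exact_mod_cast hn
    have h1 := Real.log_le_rpow_div hn0.le (ε := 1 / 2) (by norm_num)
    have h2 : (n : ℝ) ^ (1 / 2 : ℝ) = n ^ 2 * (n : ℝ) ^ (-(3 / 2) : ℝ) := by
      rw [← Real.rpow_two, ← Real.rpow_add hn0]; norm_num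
    have h3 : 0 < (n : ℝ) ^ (-(3 / 2) : ℝ) := by positivity
    rw [div_le_iff₀ (by nlinarith [sq_nonneg ((n : ℝ) - 1 / 2)])]
    rw [h2] at h1
    have h4 : 0 ≤ (n : ℝ) ^ 2 - 2 * n + 2 := by nlinarith [sq_nonneg ((n : ℝ) - 1)]
    nlinarith [mul_nonneg h3.le h4]

lemma hasSum_ite_not {ι : Type*} {f : ι → ℝ} (hf : Summable f) (P : ι → Prop) [DecidablePred P] :
    HasSum (fun x => if P x then 0 else f x) (∑' x : {x // ¬ P x}, f x) := by
  have h : HasSum (Set.indicator {x | ¬ P x} f) (∑' x : {x // ¬ P x}, f x) :=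
    hasSum_subtype_iff_indicator.1 (hf.subtype {x | ¬ P x}).hasSum
  refine h.congr_fun fun x => ?_
  by_cases hx : P x
  · rw [if_pos hx, Set.indicator_of_notMem (by simpa using hx)]
  · rw [if_neg hx, Set.indicator_of_mem (by simpa using hx)]

lemma hasSum_coprimeTerm_log {a : ℕ} (ha : a ≠ 0) :
    HasSum (fun r : ℕ => coprimeTerm a r * Real.log r)
      (coprimeSum a * ∑' p : {p : Nat.Primes // ¬ ((p : ℕ) : ℕ) ∣ a},
        Real.log ((p.1 : ℕ) : ℝ) / (((p.1 : ℕ) : ℝ) ^ 2 - ((p.1 : ℕ) : ℝ) + 1)) := by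
  obtain ⟨H, hH⟩ : ∃ H : Nat.Primes × ℕ → ℝ, ∀ p r, H (p, r) =
      if (p : ℕ) ∣ r then Real.log (p : ℕ) * coprimeTerm a r else 0 :=
    ⟨fun x => if (x.1 : ℕ) ∣ x.2 then Real.log (x.1 : ℕ) * coprimeTerm a x.2 else 0,
      fun _ _ => rfl⟩
  have hH0 : 0 ≤ H := fun ⟨p, r⟩ => by
    rw [hH, Pi.zero_apply]
    split_ifs
    · exact mul_nonneg (Real.log_natCast_nonneg _) (coprimeTerm_nonneg _ _)
    · exact le_rfl
  have hrow : ∀ p : Nat.Primes, HasSum (fun r => H (p, r)) (if (p : ℕ) ∣ a then 0 else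
      coprimeSum a * (Real.log (p : ℕ) / (((p : ℕ) : ℝ) ^ 2 - (p : ℕ) + 1))) := fun p => by
    simp only [hH]
    exact hasSum_dvd_coprimeTerm ha p.2
  have hlp : Summable fun p : Nat.Primes =>
      Real.log (p : ℕ) / (((p : ℕ) : ℝ) ^ 2 - (p : ℕ) + 1) :=
    summable_log_div.comp_injective Nat.Primes.coe_nat_injective
  have hrs : HasSum (fun p : Nat.Primes => if (p : ℕ) ∣ a then 0 else
      coprimeSum a * (Real.log (p : ℕ) / (((p : ℕ) : ℝ) ^ 2 - (p : ℕ) + 1)))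
      (coprimeSum a * ∑' p : {p : Nat.Primes // ¬ ((p : ℕ) : ℕ) ∣ a},
        Real.log ((p.1 : ℕ) : ℝ) / (((p.1 : ℕ) : ℝ) ^ 2 - ((p.1 : ℕ) : ℝ) + 1)) := by
    refine ((hasSum_ite_not hlp fun p => (p : ℕ) ∣ a).mul_left (coprimeSum a)).congr_fun fun p => ?_
    rw [mul_ite, mul_zero]
  have hsum : Summable H := by
    rw [summable_prod_of_nonneg hH0]
    refine ⟨fun p => (hrow p).summable, hrs.summable.congr fun p => ((hrow p).tsum_eq).symm⟩
  have htot := hsum.hasSum.prod_fiberwise hrow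
  rw [hrs.unique htot]
  have hsw : HasSum (fun x : ℕ × Nat.Primes => H (x.2, x.1)) (∑' x, H x) :=
    (Equiv.prodComm ℕ Nat.Primes).hasSum_iff.2 hsum.hasSum
  refine hsw.prod_fiberwise fun r => ?_
  simp only [hH]
  rcases Nat.eq_zero_or_pos r with rfl | hr
  · have : coprimeTerm a 0 = 0 := by simp [coprimeTerm]
    simp [this]
  have h1 := hasSum_primes_dvd (fun p => Real.log p * coprimeTerm a r) hr.ne'
  rw [← sum_mul] at h1
  have h2 : coprimeTerm a r * Real.log r =
      (∑ p ∈ r.primeFactors, Real.log p) * coprimeTerm a r := by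
    by_cases hsq : Squarefree r
    · rw [← Real.log_prod (fun p hp => by
        exact_mod_cast (Nat.prime_of_mem_primeFactors hp).ne_zero), ← Nat.cast_prod,
        Nat.prod_primeFactors_of_squarefree hsq, mul_comm]
    · have : coprimeTerm a r = 0 := by
        simp [coprimeTerm, ArithmeticFunction.moebius_eq_zero_of_not_squarefree hsq]
      rw [this, mul_zero, zero_mul]
  rw [h2]
  exact h1

/-- `∑_{r > R} μ²(r) log r/(r φ(r))` over `r` coprime to `a`. -/
noncomputable def coprimeLogTail (a : ℕ) (R : ℝ) : ℝ :=
  ∑' r : ℕ, if R < r then coprimeTerm a r * Real.log r else 0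

lemma summable_ite_coprimeTerm {a : ℕ} (ha : a ≠ 0) (R : ℝ) :
    Summable fun r : ℕ => if R < r then coprimeTerm a r else 0 :=
  Summable.of_nonneg_of_le (fun r => by split_ifs <;> simp [coprimeTerm_nonneg])
    (fun r => by split_ifs <;> simp [coprimeTerm_nonneg]) (summable_coprimeTerm ha)

lemma summable_ite_coprimeTerm_log {a : ℕ} (ha : a ≠ 0) (R : ℝ) :
    Summable fun r : ℕ => if R < r then coprimeTerm a r * Real.log r else 0 := by
  have h : ∀ r : ℕ, 0 ≤ coprimeTerm a r * Real.log r := fun r =>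
    mul_nonneg (coprimeTerm_nonneg _ _) (Real.log_natCast_nonneg _)
  exact Summable.of_nonneg_of_le (fun r => by split_ifs <;> simp [h])
    (fun r => by split_ifs <;> simp [h]) (hasSum_coprimeTerm_log ha).summable

lemma coprimeTail_antitone {a : ℕ} (ha : a ≠ 0) : Antitone (coprimeTail a) := by
  intro x y hxy
  refine (summable_ite_coprimeTerm ha y).tsum_le_tsum (fun r => ?_) (summable_ite_coprimeTerm ha x)
  by_cases h : y < r
  · rw [if_pos h, if_pos (lt_of_le_of_lt hxy h)]
  · rw [if_neg h]; split_ifs <;> simp [coprimeTerm_nonneg]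

lemma integral_ite_div {R g : ℝ} (hR : 0 < R) (s : ℝ) :
    MeasureTheory.IntegrableOn (fun u : ℝ => if u < s then g / u else 0) (Set.Ioi R) ∧
    ∫ u in Set.Ioi R, (if u < s then g / u else 0) =
      if R < s then g * (Real.log s - Real.log R) else 0 := by
  have e : (fun u : ℝ => if u < s then g / u else 0) = Set.indicator (Set.Iio s) fun u => g / u := by
    ext u; simp [Set.indicator_apply]
  rw [e, MeasureTheory.integrableOn_indicator_iff measurableSet_Iio,
    MeasureTheory.setIntegral_indicator measurableSet_Iio, Set.inter_comm, Set.Ioi_inter_Iio]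
  constructor
  · refine MeasureTheory.IntegrableOn.mono_set (t := Set.Icc R s) ?_ Set.Ioo_subset_Icc_self
    refine ContinuousOn.integrableOn_Icc (continuousOn_const.div continuousOn_id fun x hx => ?_)
    exact (lt_of_lt_of_le hR hx.1).ne'
  · split_ifs with h
    · rw [← MeasureTheory.integral_Ioc_eq_integral_Ioo, ← intervalIntegral.integral_of_le h.le]
      simp only [div_eq_mul_inv]
      rw [intervalIntegral.integral_const_mul, integral_inv_of_pos hR (hR.trans h),
        Real.log_div (hR.trans h).ne' hR.ne']
    · rw [Set.Ioo_eq_empty h, MeasureTheory.setIntegral_empty]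

lemma coprimeLogTail_eq {a : ℕ} (ha : a ≠ 0) {R : ℝ} (hR : 1 ≤ R) :
    coprimeLogTail a R = Real.log R * coprimeTail a R + ∫ u in Set.Ioi R, coprimeTail a u / u := by
  have hR0 : 0 < R := by linarith
  have hlR := Real.log_nonneg hR
  have hval : ∀ r : ℕ, (if R < r then coprimeTerm a r * (Real.log r - Real.log R) else 0) =
      (if R < r then coprimeTerm a r * Real.log r else 0) -
        Real.log R * (if R < r then coprimeTerm a r else 0) := by
    intro r; split_ifs <;> ring
  have hs := (summable_ite_coprimeTerm_log ha R).sub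
    ((summable_ite_coprimeTerm ha R).mul_left (Real.log R))
  have h := MeasureTheory.hasSum_integral_of_summable_integral_norm
    (μ := MeasureTheory.volume.restrict (Set.Ioi R))
    (F := fun (r : ℕ) (u : ℝ) => if u < (r : ℝ) then coprimeTerm a r / u else 0)
    (fun r => (integral_ite_div hR0 _).1) (by
      refine hs.congr fun r => ?_
      rw [← hval, ← (integral_ite_div (g := coprimeTerm a r) hR0 (r : ℝ)).2]
      refine MeasureTheory.setIntegral_congr_fun measurableSet_Ioi fun u hu => ?_
      have hu0 : (0 : ℝ) < u := hR0.trans hu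
      rw [Real.norm_of_nonneg]
      have := coprimeTerm_nonneg a r
      split_ifs <;> positivity)
  have e1 : (fun r : ℕ => ∫ u in Set.Ioi R, (if u < (r : ℝ) then coprimeTerm a r / u else 0)) =
      fun r : ℕ => (if R < r then coprimeTerm a r * Real.log r else 0) -
        Real.log R * (if R < r then coprimeTerm a r else 0) := by
    ext r
    rw [(integral_ite_div hR0 _).2, hval]
  have e2 : ∀ u : ℝ, ∑' r : ℕ, (if u < (r : ℝ) then coprimeTerm a r / u else 0) =
      coprimeTail a u / u := by
    intro u
    rw [coprimeTail, ← tsum_div_const]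
    exact tsum_congr fun r => by split_ifs <;> simp
  rw [e1] at h
  simp only [e2] at h
  rw [← h.tsum_eq, (summable_ite_coprimeTerm_log ha R).tsum_sub
    ((summable_ite_coprimeTerm ha R).mul_left _), tsum_mul_left, coprimeLogTail, coprimeTail]
  ring

lemma coprimeLogTail_bound {a : ℕ} (ha : a ≠ 0) {A M c R : ℝ} (hc : 0 ≤ c) (hM : 0 ≤ M) (hR : 1 ≤ R)
    (H : ∀ u, 0 < u → |coprimeTail a u - A / u| ≤ M * (u ^ (-(3 / 2) : ℝ) * vkEps c u)) :
    |coprimeLogTail a R - A * ((Real.log R + 1) / R)| ≤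
      M * (Real.log R + 1) * (R ^ (-(3 / 2) : ℝ) * vkEps c R) := by
  have hR0 : 0 < R := by linarith
  have hlR := Real.log_nonneg hR
  have hi2 := integrableOn_Ioi_rpow_of_lt (show (-2 : ℝ) < -1 by norm_num) hR0
  have hi5 := integrableOn_Ioi_rpow_of_lt (show (-(5 / 2) : ℝ) < -1 by norm_num) hR0
  have hI2 : ∫ u in Set.Ioi R, A * u ^ (-2 : ℝ) = A / R := by
    rw [MeasureTheory.integral_const_mul, integral_Ioi_rpow_of_lt (by norm_num) hR0]
    norm_num
    rw [Real.rpow_neg_one, div_eq_mul_inv]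
  have hI5 : ∫ u in Set.Ioi R, M * vkEps c R * u ^ (-(5 / 2) : ℝ) ≤
      M * (R ^ (-(3 / 2) : ℝ) * vkEps c R) := by
    rw [MeasureTheory.integral_const_mul, integral_Ioi_rpow_of_lt (by norm_num) hR0]
    have h1 : -R ^ (-(5 / 2) + 1 : ℝ) / (-(5 / 2) + 1) = 2 / 3 * R ^ (-(3 / 2) : ℝ) := by
      norm_num; ring
    have h2 : 0 ≤ M * (R ^ (-(3 / 2) : ℝ) * vkEps c R) := by have := vkEps_pos c R; positivity
    rw [h1]
    linarith
  have hpt : ∀ u ∈ Set.Ioi R, ‖coprimeTail a u / u - A * u ^ (-2 : ℝ)‖ ≤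
      M * vkEps c R * u ^ (-(5 / 2) : ℝ) := by
    intro u hu
    have hu' : R < u := hu
    have hu0 : 0 < u := hR0.trans hu
    have e1 : coprimeTail a u / u - A * u ^ (-2 : ℝ) = (coprimeTail a u - A / u) / u := by
      rw [Real.rpow_neg hu0.le, Real.rpow_two]; field_simp
    have e2 : u ^ (-(5 / 2) : ℝ) = u ^ (-(3 / 2) : ℝ) / u := by
      rw [← Real.rpow_sub_one hu0.ne']; norm_num
    rw [e1, norm_div, Real.norm_eq_abs, Real.norm_of_nonneg hu0.le, e2, ← mul_div_assoc]
    refine div_le_div_of_nonneg_right ((H u hu0).trans ?_) hu0.le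
    calc _ ≤ M * (u ^ (-(3 / 2) : ℝ) * vkEps c R) :=
          mul_le_mul_of_nonneg_left (mul_le_mul_of_nonneg_left (vkEps_anti hc hR0 hu'.le)
            (by positivity)) hM
      _ = _ := by ring
  have hmeas : MeasureTheory.AEStronglyMeasurable
      (fun u : ℝ => coprimeTail a u / u - A * u ^ (-2 : ℝ))
      (MeasureTheory.volume.restrict (Set.Ioi R)) := by
    refine Measurable.aestronglyMeasurable ?_
    exact ((coprimeTail_antitone ha).measurable.div measurable_id).sub
      ((measurable_id.pow_const _).const_mul _)
  have hInt : MeasureTheory.IntegrableOn (fun u : ℝ => coprimeTail a u / u - A * u ^ (-2 : ℝ))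
      (Set.Ioi R) :=
    MeasureTheory.Integrable.mono' (hi5.const_mul (M * vkEps c R)) hmeas
      ((MeasureTheory.ae_restrict_iff' measurableSet_Ioi).2 (Filter.Eventually.of_forall hpt))
  have hV : |(∫ u in Set.Ioi R, coprimeTail a u / u) - A / R| ≤
      M * (R ^ (-(3 / 2) : ℝ) * vkEps c R) := by
    have e : (∫ u in Set.Ioi R, coprimeTail a u / u) - A / R =
        ∫ u in Set.Ioi R, (coprimeTail a u / u - A * u ^ (-2 : ℝ)) := by
      have h3 : ∫ u in Set.Ioi R, coprimeTail a u / u =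
          ∫ u in Set.Ioi R, ((coprimeTail a u / u - A * u ^ (-2 : ℝ)) + A * u ^ (-2 : ℝ)) := by
        simp only [sub_add_cancel]
      rw [h3, MeasureTheory.integral_add hInt (hi2.const_mul A), hI2, add_sub_cancel_right]
    rw [e, ← Real.norm_eq_abs]
    exact (MeasureTheory.norm_integral_le_of_norm_le (hi5.const_mul (M * vkEps c R))
      ((MeasureTheory.ae_restrict_iff' measurableSet_Ioi).2
        (Filter.Eventually.of_forall hpt))).trans hI5
  rw [coprimeLogTail_eq ha hR]
  have e : Real.log R * coprimeTail a R + (∫ u in Set.Ioi R, coprimeTail a u / u) -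
      A * ((Real.log R + 1) / R) = Real.log R * (coprimeTail a R - A / R) +
        ((∫ u in Set.Ioi R, coprimeTail a u / u) - A / R) := by
    field_simp; ring
  rw [e]
  refine (abs_add_le _ _).trans ?_
  rw [abs_mul, abs_of_nonneg hlR]
  have := mul_le_mul_of_nonneg_left (H R hR0) hlR
  linarith

lemma sum_filter_add_tsum_ite {a : ℤ} {f : ℕ → ℝ} (g : ℕ → ℝ)
    (hf : ∀ r, f r = if r.Coprime a.natAbs then g r else 0) (hg : g 0 = 0) {R : ℝ} (hR : 0 ≤ R)
    (hs : Summable f) (hs' : Summable fun r : ℕ => if R < r then f r else 0) :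
    (∑ r ∈ (Finset.Icc 1 ⌊R⌋₊).filter (fun r : ℕ => Int.gcd (r : ℤ) a = 1), g r) =
      (∑' r, f r) - ∑' r : ℕ, if R < r then f r else 0 := by
  rw [← hs.tsum_sub hs', Finset.sum_filter, tsum_eq_sum (s := Finset.Icc 1 ⌊R⌋₊)]
  · refine Finset.sum_congr rfl fun r hr => ?_
    have h : ¬ R < r := not_lt.2 ((Nat.le_floor_iff hR).1 (Finset.mem_Icc.1 hr).2)
    rw [if_neg h, sub_zero, hf]
    rfl
  · intro r hr
    rcases Nat.eq_zero_or_pos r with rfl | h0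
    · simp [hf, hg]
    · have h : R < r := by
        by_contra h
        exact hr (Finset.mem_Icc.2 ⟨h0, (Nat.le_floor_iff hR).2 (not_lt.1 h)⟩)
      rw [if_pos h, sub_self]

lemma div_totient_mul_C1 {a : ℤ} (ha : a ≠ 0) :
    ((a.natAbs : ℝ) / (Nat.totient a.natAbs : ℝ)) * C1 a = coprimeSum a.natAbs := by
  have hn : a.natAbs ≠ 0 := Int.natAbs_ne_zero.2 ha
  have h1 : (0 : ℝ) < a.natAbs := by exact_mod_cast Nat.pos_of_ne_zero hn
  have h2 : (0 : ℝ) < a.natAbs.totient := by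
    exact_mod_cast Nat.totient_pos.2 (Nat.pos_of_ne_zero hn)
  have h6 := zetaSum_pos (show 2 ≤ 6 by norm_num)
  have e2 := riemannZeta_eq_zetaSum (show 2 ≤ 2 by norm_num)
  have e3 := riemannZeta_eq_zetaSum (show 2 ≤ 3 by norm_num)
  have e6 := riemannZeta_eq_zetaSum (show 2 ≤ 6 by norm_num)
  push_cast at e2 e3 e6
  have e : (riemannZeta 2 * riemannZeta 3 / riemannZeta 6).re =
      zetaSum 2 * zetaSum 3 / zetaSum 6 := by
    rw [e2, e3, e6, ← Complex.ofReal_mul, ← Complex.ofReal_div, Complex.ofReal_re]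
  rw [C1, e, eq_div_of_mul_eq h6.ne' (coprimeSum_mul_zetaSum hn)]
  field_simp

lemma vkExp_log_add_three_ge {R : ℝ} (hR : 3 ≤ R) :
    (20 : ℝ) ^ (-(1 : ℝ) / 5) *
      (Real.log R ^ ((3 : ℝ) / 5) * Real.log (Real.log R) ^ (-(1 : ℝ) / 5)) ≤
      vkExp (Real.log R + 3) := by
  set t := Real.log R with ht
  have ht1 : 12 / 11 ≤ t := by
    have h := Real.exp_one_lt_d9
    rw [ht, Real.le_log_iff_exp_le (by linarith)]
    have h1 : Real.exp (12 / 11) ^ 11 ≤ 3 ^ 11 := by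
      rw [← Real.exp_nat_mul]
      have : ((11 : ℕ) : ℝ) * (12 / 11) = ((12 : ℕ) : ℝ) * 1 := by norm_num
      rw [this, Real.exp_nat_mul]
      calc Real.exp 1 ^ 12 ≤ 2.7182818286 ^ 12 := pow_le_pow_left₀ (Real.exp_pos 1).le h.le 12
        _ ≤ 3 ^ 11 := by norm_num
    exact (le_of_pow_le_pow_left₀ (by norm_num) (by norm_num) h1).trans hR
  have ht0 : 0 < t := by linarith
  have hlog : 1 / 12 ≤ Real.log t := by
    have h := Real.one_sub_inv_le_log_of_pos ht0
    have : t⁻¹ ≤ 11 / 12 := by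
      rw [inv_le_comm₀ ht0 (by norm_num)]; norm_num; linarith
    linarith
  have hl4 : Real.log 4 ≤ 1.4 := by
    have h := Real.log_two_lt_d9
    have : Real.log 4 = 2 * Real.log 2 := by
      rw [show (4 : ℝ) = 2 ^ 2 by norm_num, Real.log_pow]; norm_num
    rw [this]; linarith
  have hle : Real.log (t + 3) ≤ 20 * Real.log t := by
    have h : Real.log (t + 3) ≤ Real.log (4 * t) := Real.log_le_log (by linarith) (by linarith)
    rw [Real.log_mul (by norm_num) ht0.ne'] at h
    linarith
  have hpos : 0 < Real.log (t + 3) := Real.log_pos (by linarith)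
  have hE : (20 : ℝ) ^ (-(1 : ℝ) / 5) * Real.log t ^ (-(1 : ℝ) / 5) ≤
      Real.log (t + 3) ^ (-(1 : ℝ) / 5) := by
    rw [← Real.mul_rpow (by norm_num) (by linarith)]
    exact Real.rpow_le_rpow_of_nonpos hpos hle (by norm_num)
  have hF : t ^ ((3 : ℝ) / 5) ≤ (t + 3) ^ ((3 : ℝ) / 5) :=
    Real.rpow_le_rpow ht0.le (by linarith) (by norm_num)
  have h := mul_le_mul hF hE (by positivity) (by positivity)
  rw [vkExp, show (-(1 / 5) : ℝ) = -(1 : ℝ) / 5 by norm_num]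
  linarith

lemma log_mul_vkEps_le {c R : ℝ} (hc : 0 < c) (hR : 3 ≤ R) :
    (Real.log R + 1) * vkEps c R ≤ (10 / c) ^ 5 *
      Real.exp (-(c / 2 * (20 : ℝ) ^ (-(1 : ℝ) / 5) * Real.log R ^ ((3 : ℝ) / 5) *
        Real.log (Real.log R) ^ (-(1 : ℝ) / 5))) := by
  have hlR : 0 ≤ Real.log R := Real.log_nonneg (by linarith)
  have hv := vkExp_log_add_three_ge hR
  have hu : 3 ≤ Real.log R + 3 := by linarith
  have h5 := le_vkExp_pow_five hu
  have h0 := (vkExp_pos hu).le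
  rw [vkEps, max_eq_left hlR]
  generalize vkExp (Real.log R + 3) = v at *
  have h := rpow_le_mul_exp (m := 5) (ε := c / 2) (by norm_num) (by linarith) h0
  have e5 : (5 : ℝ) = ((5 : ℕ) : ℝ) := by norm_num
  rw [e5, Real.rpow_natCast, Real.rpow_natCast, ← e5, show (5 : ℝ) / (c / 2) = 10 / c by
    field_simp; norm_num] at h
  calc (Real.log R + 1) * Real.exp (-(c * v)) ≤
        ((10 / c) ^ 5 * Real.exp (c / 2 * v)) * Real.exp (-(c * v)) :=
        mul_le_mul_of_nonneg_right (by linarith) (Real.exp_pos _).le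
    _ = (10 / c) ^ 5 * Real.exp (-(c / 2 * v)) := by
        rw [mul_assoc, ← Real.exp_add]; congr 2; ring
    _ ≤ _ := by
        refine mul_le_mul_of_nonneg_left (Real.exp_le_exp.2 (neg_le_neg ?_)) (by positivity)
        have := mul_le_mul_of_nonneg_left hv (by linarith : 0 ≤ c / 2)
        linarith

end VK

/-- sums of `μ²(r)/(rφ(r))` over `r ≤ R` coprime to `a`. -/
theorem sums_over_r_coprime :
    ∃ c C : ℝ, 0 < c ∧ 0 < C ∧ ∀ a : ℤ, a ≠ 0 → ∀ R : ℝ, 3 ≤ R →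
      (|(∑ r ∈ (Finset.Icc 1 ⌊R⌋₊).filter (fun r : ℕ => Int.gcd (r : ℤ) a = 1),
            (ArithmeticFunction.moebius r : ℝ) ^ 2 / ((r : ℝ) * (Nat.totient r : ℝ)))
          - ((a.natAbs : ℝ) / (Nat.totient a.natAbs : ℝ)) * C1 a
          + ((Nat.totient a.natAbs : ℝ) / (a.natAbs : ℝ)) * (1 / R)|
        ≤ C * (∏ p ∈ a.natAbs.primeFactors, (1 + (p : ℝ) ^ (-(1 : ℝ) / 3)))
            / (R ^ ((3 : ℝ) / 2) *
              Real.exp (c * Real.log R ^ ((3 : ℝ) / 5) *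
                Real.log (Real.log R) ^ (-(1 : ℝ) / 5))))
      ∧
      (|(∑ r ∈ (Finset.Icc 1 ⌊R⌋₊).filter (fun r : ℕ => Int.gcd (r : ℤ) a = 1),
            (ArithmeticFunction.moebius r : ℝ) ^ 2 * Real.log r
              / ((r : ℝ) * (Nat.totient r : ℝ)))
          - ((a.natAbs : ℝ) / (Nat.totient a.natAbs : ℝ)) * C1 a *
              (∑' p : {p : Nat.Primes // ¬ ((p : ℕ) : ℕ) ∣ a.natAbs},
                Real.log ((p.1 : ℕ) : ℝ)
                  / (((p.1 : ℕ) : ℝ) ^ 2 - ((p.1 : ℕ) : ℝ) + 1))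
          + ((Nat.totient a.natAbs : ℝ) / (a.natAbs : ℝ)) * ((Real.log R + 1) / R)|
        ≤ C * (∏ p ∈ a.natAbs.primeFactors, (1 + (p : ℝ) ^ (-(1 : ℝ) / 3)))
            / (R ^ ((3 : ℝ) / 2) *
              Real.exp (c * Real.log R ^ ((3 : ℝ) / 5) *
                Real.log (Real.log R) ^ (-(1 : ℝ) / 5)))) := by
  obtain ⟨c, C, hc, hC, H⟩ := VK.exists_coprimeTail_bound
  refine ⟨c / 2 * (20 : ℝ) ^ (-(1 : ℝ) / 5), C * (10 / c) ^ 5, by positivity, by positivity,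
    fun a ha R hR => ?_⟩
  have hn : a.natAbs ≠ 0 := Int.natAbs_ne_zero.2 ha
  have hR0 : 0 < R := by linarith
  have hlR : 0 ≤ Real.log R := Real.log_nonneg (by linarith)
  have hM : 0 ≤ C * VK.primeFactor a.natAbs :=
    mul_nonneg hC.le (zero_le_one.trans (VK.one_le_primeFactor _))
  have hbound : ∀ x : ℝ, x ≤ C * VK.primeFactor a.natAbs * (Real.log R + 1) *
      (R ^ (-(3 / 2) : ℝ) * VK.vkEps c R) →
      x ≤ C * (10 / c) ^ 5 * (∏ p ∈ a.natAbs.primeFactors, (1 + (p : ℝ) ^ (-(1 : ℝ) / 3)))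
            / (R ^ ((3 : ℝ) / 2) *
              Real.exp (c / 2 * (20 : ℝ) ^ (-(1 : ℝ) / 5) * Real.log R ^ ((3 : ℝ) / 5) *
                Real.log (Real.log R) ^ (-(1 : ℝ) / 5))) := by
    intro x hx
    have h := mul_le_mul_of_nonneg_left (VK.log_mul_vkEps_le hc hR)
      (mul_nonneg hM (Real.rpow_nonneg hR0.le (-(3 / 2))))
    rw [Real.exp_neg] at h
    rw [← VK.primeFactor]
    refine hx.trans (le_trans (le_of_eq (by ring)) (h.trans (le_of_eq ?_)))
    rw [Real.rpow_neg hR0.le]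
    field_simp
  rw [VK.div_totient_mul_C1 ha]
  have hlog := VK.hasSum_coprimeTerm_log hn
  have hT := H _ hn R hR0
  have hL := VK.coprimeLogTail_bound hn hc.le hM (by linarith : 1 ≤ R) (H _ hn)
  constructor
  · refine hbound _ ?_
    rw [VK.sum_filter_add_tsum_ite (f := VK.coprimeTerm a.natAbs) _ (fun r => rfl) (by simp)
      hR0.le (VK.summable_coprimeTerm hn) (VK.summable_ite_coprimeTerm hn R), ← VK.coprimeSum,
      ← VK.coprimeTail, ← abs_neg]
    refine le_trans (le_of_eq (by congr 1; ring)) (hT.trans ?_)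
    have h0 : 0 ≤ R ^ (-(3 / 2) : ℝ) * VK.vkEps c R :=
      mul_nonneg (Real.rpow_nonneg hR0.le _) (VK.vkEps_pos _ _).le
    exact mul_le_mul_of_nonneg_right (le_mul_of_one_le_right hM (by linarith)) h0
  · refine hbound _ ?_
    rw [VK.sum_filter_add_tsum_ite (f := fun r => VK.coprimeTerm a.natAbs r * Real.log r) _
      (fun r => by rw [VK.coprimeTerm, ite_mul, zero_mul, div_mul_eq_mul_div]) (by simp) hR0.le
      hlog.summable (VK.summable_ite_coprimeTerm_log hn R), hlog.tsum_eq, ← VK.coprimeLogTail,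
      ← abs_neg]
    exact le_trans (le_of_eq (by congr 1; ring)) hL
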